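/- Let K be an algebraically closed field and let B₁, …, B₈ be the two-point symmetric special biserial algebras from Ariki–Iijima–Park's classification. Then B₁, B₄, B₅, B₆, B₇ are τ-tilting finite (for all admissible parameter values) with number of isomorphism classes of basic support τ-tilting modules equal to 6, 6, 8, 6, 8 respectively, and Hasse quiver of type H_{2,2}, H_{2,2}, H_{3,3}, H_{2,2}, H_{3,3} respectively; whereas B₂, B₃ and B₈ are τ-tilting infinite. -/

import Mathlib

/-!
Core definitions for τ-tilting theory of finite dimensional algebras.

Throughout, for an algebra `Λ`, *right* `Λ`-modules are formalized as left modules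
over the opposite ring `Λᵐᵒᵖ` (the category `RMod Λ := ModuleCat Λᵐᵒᵖ`).

τ-rigidity is formalized via the standard projective-presentation criterion of
Auslander–Smalø/Adachi–Iyama–Reiten: a finitely generated module `M` is τ-rigid iff it admits
a (finite) projective presentation `P₁ → P₀ → M → 0` such that
`Hom(P₀, M) → Hom(P₁, M)` is surjective.
-/

noncomputable section

namespace TwoPoint

/-- A module is indecomposable if it is nonzero and admits no nontrivial direct sum
decomposition. -/
def IsIndecModule (R : Type) [Ring R] (M : Type) [AddCommGroup M] [Module R M] : Prop :=
  Nontrivial M ∧ ∀ N₁ N₂ : Submodule R M, IsCompl N₁ N₂ → N₁ = ⊥ ∨ N₂ = ⊥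

/-- `M` decomposes as a finite direct sum of indecomposable submodules having exactly `n`
isomorphism classes. -/
def HasIndecClassCount (R : Type) [Ring R] (M : ModuleCat.{0} R) (n : ℕ) : Prop :=
  ∃ (k : ℕ) (N : Fin k → Submodule R M),
    DirectSum.IsInternal N ∧ (∀ i, IsIndecModule R (N i)) ∧
    ∃ c : Fin k → Fin n, Function.Surjective c ∧
      ∀ i j, (c i = c j ↔ Nonempty ((N i) ≃ₗ[R] (N j)))

/-- `M` is basic: it decomposes as a finite direct sum of pairwise nonisomorphic
indecomposable submodules. -/
def IsBasicModuleCat (R : Type) [Ring R] (M : ModuleCat.{0} R) : Prop :=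
  ∃ (k : ℕ) (N : Fin k → Submodule R M),
    DirectSum.IsInternal N ∧ (∀ i, IsIndecModule R (N i)) ∧
    ∀ i j, i ≠ j → IsEmpty ((N i) ≃ₗ[R] (N j))

/-- τ-rigidity, via the projective presentation criterion: there is a finite projective
presentation `P₁ —f→ P₀ —g→ M → 0` such that `Hom(—, M)` applied to `f` is surjective,
i.e. `Hom_Λ(M, τM) = 0`. -/
def IsTauRigidCat (R : Type) [Ring R] (M : ModuleCat.{0} R) : Prop :=
  Module.Finite R M ∧
  ∃ (P₁ P₀ : ModuleCat.{0} R) (f : P₁ →ₗ[R] P₀) (g : P₀ →ₗ[R] M),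
    Module.Finite R P₁ ∧ Module.Projective R P₁ ∧
    Module.Finite R P₀ ∧ Module.Projective R P₀ ∧
    Function.Surjective g ∧ LinearMap.range f = LinearMap.ker g ∧
    ∀ h : P₁ →ₗ[R] M, ∃ h' : P₀ →ₗ[R] M, h = h'.comp f

/-- Support τ-tilting module, via support τ-tilting pairs `(M, P)` (Adachi–Iyama–Reiten):
`M` is τ-rigid, `P` is finitely generated projective with `Hom(P, M) = 0`, and
`|M| + |P| = |R|` where `|X|` is the number of isomorphism classes of indecomposable
direct summands. -/
def IsSupportTauTiltingCat (R : Type) [Ring R] (M : ModuleCat.{0} R) : Prop :=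
  IsTauRigidCat R M ∧
  ∃ (P : ModuleCat.{0} R) (p q r : ℕ),
    Module.Finite R P ∧ Module.Projective R P ∧
    (∀ f : P →ₗ[R] M, f = 0) ∧
    HasIndecClassCount R M p ∧ HasIndecClassCount R P q ∧
    HasIndecClassCount R (ModuleCat.of R R) r ∧ p + q = r

/-- The category of (finitely generated) right `Λ`-modules, as left `Λᵐᵒᵖ`-modules. -/
abbrev RMod (Λ : Type) [Ring Λ] := ModuleCat.{0} Λᵐᵒᵖ

/-- Basic support τ-tilting right `Λ`-module. -/
def IsBasicSupportTauTilting (Λ : Type) [Ring Λ] (M : RMod Λ) : Prop :=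
  IsSupportTauTiltingCat Λᵐᵒᵖ M ∧ IsBasicModuleCat Λᵐᵒᵖ M

/-- `Λ` is τ-tilting finite: there are only finitely many isomorphism classes of basic
support τ-tilting right `Λ`-modules. -/
def IsTauTiltingFinite (Λ : Type) [Ring Λ] : Prop :=
  ∃ (n : ℕ) (L : Fin n → RMod Λ),
    ∀ M : RMod Λ, IsBasicSupportTauTilting Λ M → ∃ i, Nonempty (M ≃ₗ[Λᵐᵒᵖ] L i)

/-- `Λ` has exactly `n` isomorphism classes of basic support τ-tilting modules. -/
def SupportTauTiltingCount (Λ : Type) [Ring Λ] (n : ℕ) : Prop :=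
  ∃ L : Fin n → RMod Λ,
    (∀ i, IsBasicSupportTauTilting Λ (L i)) ∧
    (∀ i j, Nonempty ((L i) ≃ₗ[Λᵐᵒᵖ] (L j)) → i = j) ∧
    ∀ M : RMod Λ, IsBasicSupportTauTilting Λ M → ∃ i, Nonempty (M ≃ₗ[Λᵐᵒᵖ] L i)

/-- `Fac M ⊆ Fac N`: every factor module of a finite direct sum of copies of `M` is also a
factor module of a finite direct sum of copies of `N`.  This is the partial order on
support τ-tilting modules. -/
def FacLE (Λ : Type) [Ring Λ] (M N : RMod Λ) : Prop :=
  ∀ X : RMod Λ,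
    (∃ (k : ℕ) (f : (Fin k → M) →ₗ[Λᵐᵒᵖ] X), Function.Surjective f) →
    (∃ (k : ℕ) (f : (Fin k → N) →ₗ[Λᵐᵒᵖ] X), Function.Surjective f)

/-- The Hasse quiver of the poset `sτ-tilt Λ` is of type `H_{m,n}`: the poset of
isomorphism classes of basic support τ-tilting modules is isomorphic to the poset
consisting of a greatest element, a least element, and two incomparable chains with `m`
resp. `n` elements in between (hence two directed paths from `Λ` to `0` with `m` resp. `n`
intermediate vertices). -/
def HasseType (Λ : Type) [Ring Λ] (m n : ℕ) : Prop :=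
  ∃ T : WithTop (WithBot (Fin m ⊕ Fin n)) → RMod Λ,
    (∀ x, IsBasicSupportTauTilting Λ (T x)) ∧
    (∀ x y, Nonempty ((T x) ≃ₗ[Λᵐᵒᵖ] (T y)) → x = y) ∧
    (∀ M : RMod Λ, IsBasicSupportTauTilting Λ M → ∃ x, Nonempty (M ≃ₗ[Λᵐᵒᵖ] T x)) ∧
    ∀ x y, x ≤ y ↔ FacLE Λ (T x) (T y)

/-- `Λ` is τ-tilting finite with exactly `N` basic support τ-tilting modules and Hasse
quiver of type `H_{m,n}`. -/
def TauTiltingData (Λ : Type) [Ring Λ] (N m n : ℕ) : Prop :=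
  IsTauTiltingFinite Λ ∧ SupportTauTiltingCount Λ N ∧ HasseType Λ m n

/-- `B` is a factor algebra of `Λ`: there is a surjective `K`-algebra homomorphism
`Λ → B`. -/
def IsFactorAlgebra (K : Type) [CommRing K] (B Λ : Type) [Ring B] [Ring Λ]
    [Algebra K B] [Algebra K Λ] : Prop :=
  ∃ φ : Λ →ₐ[K] B, Function.Surjective φ

/-- `Λ` is a basic algebra: the regular right module decomposes into pairwise
nonisomorphic indecomposables. -/
def IsBasicAlgebra (Λ : Type) [Ring Λ] : Prop :=
  IsBasicModuleCat Λᵐᵒᵖ (ModuleCat.of Λᵐᵒᵖ Λᵐᵒᵖ)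

/-- `Λ` is representation-finite: finitely many isomorphism classes of indecomposable
finitely generated right modules. -/
def IsRepFinite (Λ : Type) [Ring Λ] : Prop :=
  ∃ (n : ℕ) (L : Fin n → RMod Λ), ∀ M : RMod Λ,
    Module.Finite Λᵐᵒᵖ M → IsIndecModule Λᵐᵒᵖ M → ∃ i, Nonempty (M ≃ₗ[Λᵐᵒᵖ] L i)

end TwoPoint

namespace TwoPoint

/-! ### Bound quiver algebras on two-point quivers

A two-point quiver is given by an arrow type `σ` together with source and target functions
`s t : σ → Fin 2`.  The corresponding bound quiver algebra `KQ/I` is presented as the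
quotient of the free algebra on the two vertex idempotents and the arrows, by the path
algebra relations together with the defining relations of `I` (paths are composed from
left to right, so a relation like `αμβ` is the product `α * μ * β`). -/

/-- Generators for the path algebra of a two-point quiver: two vertex idempotents and the
arrows. -/
inductive TPGen (σ : Type) : Type
  | v : Fin 2 → TPGen σ
  | ar : σ → TPGen σ

/-- The vertex idempotent generator. -/
def vtx (K : Type) [Field K] {σ : Type} (i : Fin 2) : FreeAlgebra K (TPGen σ) :=
  FreeAlgebra.ι K (TPGen.v i)

/-- The arrow generator. -/
def arr (K : Type) [Field K] {σ : Type} (a : σ) : FreeAlgebra K (TPGen σ) :=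
  FreeAlgebra.ι K (TPGen.ar a)

/-- The defining relations of a bound quiver algebra on a two-point quiver:
`e_i e_j = δ_{ij} e_i`, `e_1 + e_2 = 1`, `e_{s(a)} a = a = a e_{t(a)}`, together with the
prescribed relations `rels` (each pair `(x, y) ∈ rels` imposes `x = y`). -/
inductive QuivRel (K : Type) [Field K] (σ : Type) (s t : σ → Fin 2)
    (rels : Set (FreeAlgebra K (TPGen σ) × FreeAlgebra K (TPGen σ))) :
    FreeAlgebra K (TPGen σ) → FreeAlgebra K (TPGen σ) → Prop
  | idem (i : Fin 2) : QuivRel K σ s t rels (vtx K i * vtx K i) (vtx K i)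
  | orth (i j : Fin 2) : i ≠ j → QuivRel K σ s t rels (vtx K i * vtx K j) 0
  | vsum : QuivRel K σ s t rels (vtx K 0 + vtx K 1) 1
  | src (a : σ) : QuivRel K σ s t rels (vtx K (s a) * arr K a) (arr K a)
  | tgt (a : σ) : QuivRel K σ s t rels (arr K a * vtx K (t a)) (arr K a)
  | rel (p : FreeAlgebra K (TPGen σ) × FreeAlgebra K (TPGen σ)) :
      p ∈ rels → QuivRel K σ s t rels p.1 p.2

/-- The bound quiver algebra of a two-point quiver with relations `rels`. -/
abbrev BoundQuiverAlgebra (K : Type) [Field K] (σ : Type) (s t : σ → Fin 2)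
    (rels : Set (FreeAlgebra K (TPGen σ) × FreeAlgebra K (TPGen σ))) : Type :=
  RingQuot (QuivRel K σ s t rels)

/-! Concrete two-point quivers used below.  Vertices are `0` ("1") and `1` ("2"). -/

/- Quiver `μ : 1 → 2`, loop `β` at `2`. -/
namespace QA
def s : Fin 2 → Fin 2 := ![0, 1]
def t : Fin 2 → Fin 2 := ![1, 1]
def mu (K : Type) [Field K] : FreeAlgebra K (TPGen (Fin 2)) := arr K (0 : Fin 2)
def be (K : Type) [Field K] : FreeAlgebra K (TPGen (Fin 2)) := arr K (1 : Fin 2)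
end QA

/- Quiver: loop `α` at `1`, `μ : 1 → 2`, loop `β` at `2`. -/
namespace QB
def s : Fin 3 → Fin 2 := ![0, 0, 1]
def t : Fin 3 → Fin 2 := ![0, 1, 1]
def al (K : Type) [Field K] : FreeAlgebra K (TPGen (Fin 3)) := arr K (0 : Fin 3)
def mu (K : Type) [Field K] : FreeAlgebra K (TPGen (Fin 3)) := arr K (1 : Fin 3)
def be (K : Type) [Field K] : FreeAlgebra K (TPGen (Fin 3)) := arr K (2 : Fin 3)
end QB

/- Quiver: `μ : 1 → 2`, loops `β₁, β₂` at `2`. -/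
namespace QC
def s : Fin 3 → Fin 2 := ![0, 1, 1]
def t : Fin 3 → Fin 2 := ![1, 1, 1]
def mu (K : Type) [Field K] : FreeAlgebra K (TPGen (Fin 3)) := arr K (0 : Fin 3)
def b1 (K : Type) [Field K] : FreeAlgebra K (TPGen (Fin 3)) := arr K (1 : Fin 3)
def b2 (K : Type) [Field K] : FreeAlgebra K (TPGen (Fin 3)) := arr K (2 : Fin 3)
end QC

/- Quiver: loop `α` at `1`, `μ : 1 → 2`, `ν : 2 → 1`. -/
namespace QD
def s : Fin 3 → Fin 2 := ![0, 0, 1]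
def t : Fin 3 → Fin 2 := ![0, 1, 0]
def al (K : Type) [Field K] : FreeAlgebra K (TPGen (Fin 3)) := arr K (0 : Fin 3)
def mu (K : Type) [Field K] : FreeAlgebra K (TPGen (Fin 3)) := arr K (1 : Fin 3)
def nu (K : Type) [Field K] : FreeAlgebra K (TPGen (Fin 3)) := arr K (2 : Fin 3)
end QD

/- Quiver: loops `α` at `1` and `β` at `2`, `μ : 1 → 2`, `ν : 2 → 1`. -/
namespace QE
def s : Fin 4 → Fin 2 := ![0, 1, 0, 1]
def t : Fin 4 → Fin 2 := ![0, 1, 1, 0]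
def al (K : Type) [Field K] : FreeAlgebra K (TPGen (Fin 4)) := arr K (0 : Fin 4)
def be (K : Type) [Field K] : FreeAlgebra K (TPGen (Fin 4)) := arr K (1 : Fin 4)
def mu (K : Type) [Field K] : FreeAlgebra K (TPGen (Fin 4)) := arr K (2 : Fin 4)
def nu (K : Type) [Field K] : FreeAlgebra K (TPGen (Fin 4)) := arr K (3 : Fin 4)
end QE

/- Quiver: `μ : 1 → 2`, `ν : 2 → 1`. -/
namespace QF
def s : Fin 2 → Fin 2 := ![0, 1]
def t : Fin 2 → Fin 2 := ![1, 0]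
def mu (K : Type) [Field K] : FreeAlgebra K (TPGen (Fin 2)) := arr K (0 : Fin 2)
def nu (K : Type) [Field K] : FreeAlgebra K (TPGen (Fin 2)) := arr K (1 : Fin 2)
end QF

/- The Kronecker quiver: `μ₁, μ₂ : 1 → 2`. -/
namespace QG
def s : Fin 2 → Fin 2 := ![0, 0]
def t : Fin 2 → Fin 2 := ![1, 1]
end QG

/- Quiver: `μ₁, μ₂ : 1 → 2`, `ν₁, ν₂ : 2 → 1`. -/
namespace QH
def s : Fin 4 → Fin 2 := ![0, 0, 1, 1]
def t : Fin 4 → Fin 2 := ![1, 1, 0, 0]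
def mu1 (K : Type) [Field K] : FreeAlgebra K (TPGen (Fin 4)) := arr K (0 : Fin 4)
def mu2 (K : Type) [Field K] : FreeAlgebra K (TPGen (Fin 4)) := arr K (1 : Fin 4)
def nu1 (K : Type) [Field K] : FreeAlgebra K (TPGen (Fin 4)) := arr K (2 : Fin 4)
def nu2 (K : Type) [Field K] : FreeAlgebra K (TPGen (Fin 4)) := arr K (3 : Fin 4)
end QH

/- Quiver: loop `α` at `1`, `μ : 1 → 2`. -/
namespace QI
def s : Fin 2 → Fin 2 := ![0, 0]
def t : Fin 2 → Fin 2 := ![0, 1]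
def al (K : Type) [Field K] : FreeAlgebra K (TPGen (Fin 2)) := arr K (0 : Fin 2)
def mu (K : Type) [Field K] : FreeAlgebra K (TPGen (Fin 2)) := arr K (1 : Fin 2)
end QI

/- Quiver: loops `α₁, α₂` at `1`, `μ : 1 → 2`. -/
namespace QJ
def s : Fin 3 → Fin 2 := ![0, 0, 0]
def t : Fin 3 → Fin 2 := ![0, 0, 1]
def a1 (K : Type) [Field K] : FreeAlgebra K (TPGen (Fin 3)) := arr K (0 : Fin 3)
def a2 (K : Type) [Field K] : FreeAlgebra K (TPGen (Fin 3)) := arr K (1 : Fin 3)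
def mu (K : Type) [Field K] : FreeAlgebra K (TPGen (Fin 3)) := arr K (2 : Fin 3)
end QJ

/- Quiver: `μ₁, μ₂ : 1 → 2`, `ν : 2 → 1`. -/
namespace QK
def s : Fin 3 → Fin 2 := ![0, 0, 1]
def t : Fin 3 → Fin 2 := ![1, 1, 0]
def mu1 (K : Type) [Field K] : FreeAlgebra K (TPGen (Fin 3)) := arr K (0 : Fin 3)
def mu2 (K : Type) [Field K] : FreeAlgebra K (TPGen (Fin 3)) := arr K (1 : Fin 3)
def nu (K : Type) [Field K] : FreeAlgebra K (TPGen (Fin 3)) := arr K (2 : Fin 3)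
end QK

/- Quiver: `μ₁, μ₂, μ₃ : 1 → 2`. -/
namespace QL
def s : Fin 3 → Fin 2 := ![0, 0, 0]
def t : Fin 3 → Fin 2 := ![1, 1, 1]
end QL

/- Quiver: loop `α` at `1`, `μ₁, μ₂ : 1 → 2`. -/
namespace QM
def s : Fin 3 → Fin 2 := ![0, 0, 0]
def t : Fin 3 → Fin 2 := ![0, 1, 1]
def al (K : Type) [Field K] : FreeAlgebra K (TPGen (Fin 3)) := arr K (0 : Fin 3)
def mu1 (K : Type) [Field K] : FreeAlgebra K (TPGen (Fin 3)) := arr K (1 : Fin 3)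
def mu2 (K : Type) [Field K] : FreeAlgebra K (TPGen (Fin 3)) := arr K (2 : Fin 3)
end QM

end TwoPoint

namespace TwoPoint

/-! ### The two-point symmetric special biserial algebras of Ariki–Iijima–Park -/

/-- `B₁` (`n ≥ 1`): `(μν)ⁿμ = (νμ)ⁿν = 0`. -/
abbrev BisB1 (K : Type) [Field K] (n : ℕ) : Type :=
  BoundQuiverAlgebra K (Fin 2) QF.s QF.t
    {((QF.mu K * QF.nu K) ^ n * QF.mu K, 0), ((QF.nu K * QF.mu K) ^ n * QF.nu K, 0)}

/-- `B₂` (`m, n ≥ 1`): `μ₁ν₂ = ν₂μ₁ = μ₂ν₁ = ν₁μ₂ = 0`, `(μ₁ν₁)ᵐ = (μ₂ν₂)ⁿ`,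
`(ν₁μ₁)ᵐ = (ν₂μ₂)ⁿ`. -/
abbrev BisB2 (K : Type) [Field K] (m n : ℕ) : Type :=
  BoundQuiverAlgebra K (Fin 4) QH.s QH.t
    {(QH.mu1 K * QH.nu2 K, 0), (QH.nu2 K * QH.mu1 K, 0), (QH.mu2 K * QH.nu1 K, 0),
     (QH.nu1 K * QH.mu2 K, 0),
     ((QH.mu1 K * QH.nu1 K) ^ m, (QH.mu2 K * QH.nu2 K) ^ n),
     ((QH.nu1 K * QH.mu1 K) ^ m, (QH.nu2 K * QH.mu2 K) ^ n)}

/-- `B₃` (`n ≥ 1`): `μ₁ν₂ = ν₁μ₁ = μ₂ν₁ = ν₂μ₂ = 0`,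
`(μ₁ν₁μ₂ν₂)ⁿ = (μ₂ν₂μ₁ν₁)ⁿ`, `(ν₁μ₂ν₂μ₁)ⁿ = (ν₂μ₁ν₁μ₂)ⁿ`. -/
abbrev BisB3 (K : Type) [Field K] (n : ℕ) : Type :=
  BoundQuiverAlgebra K (Fin 4) QH.s QH.t
    {(QH.mu1 K * QH.nu2 K, 0), (QH.nu1 K * QH.mu1 K, 0), (QH.mu2 K * QH.nu1 K, 0),
     (QH.nu2 K * QH.mu2 K, 0),
     ((QH.mu1 K * QH.nu1 K * QH.mu2 K * QH.nu2 K) ^ n,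
      (QH.mu2 K * QH.nu2 K * QH.mu1 K * QH.nu1 K) ^ n),
     ((QH.nu1 K * QH.mu2 K * QH.nu2 K * QH.mu1 K) ^ n,
      (QH.nu2 K * QH.mu1 K * QH.nu1 K * QH.mu2 K) ^ n)}

/-- `B₄` (`m ≥ 2`, `n ≥ 1`): `αμ = να = 0`, `αᵐ = (μν)ⁿ`. -/
abbrev BisB4 (K : Type) [Field K] (m n : ℕ) : Type :=
  BoundQuiverAlgebra K (Fin 3) QD.s QD.t
    {(QD.al K * QD.mu K, 0), (QD.nu K * QD.al K, 0),
     (QD.al K ^ m, (QD.mu K * QD.nu K) ^ n)}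

/-- `B₅` (`n ≥ 1`): `α² = νμ = 0`, `(αμν)ⁿ = (μνα)ⁿ`. -/
abbrev BisB5 (K : Type) [Field K] (n : ℕ) : Type :=
  BoundQuiverAlgebra K (Fin 3) QD.s QD.t
    {(QD.al K ^ 2, 0), (QD.nu K * QD.mu K, 0),
     ((QD.al K * QD.mu K * QD.nu K) ^ n, (QD.mu K * QD.nu K * QD.al K) ^ n)}

/-- `B₆` (`m, r ≥ 2`, `n ≥ 1`): `αμ = μβ = βν = να = 0`, `αᵐ = (μν)ⁿ`, `βʳ = (νμ)ⁿ`. -/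
abbrev BisB6 (K : Type) [Field K] (m r n : ℕ) : Type :=
  BoundQuiverAlgebra K (Fin 4) QE.s QE.t
    {(QE.al K * QE.mu K, 0), (QE.mu K * QE.be K, 0), (QE.be K * QE.nu K, 0),
     (QE.nu K * QE.al K, 0), (QE.al K ^ m, (QE.mu K * QE.nu K) ^ n),
     (QE.be K ^ r, (QE.nu K * QE.mu K) ^ n)}

/-- `B₇` (`m ≥ 2`, `n ≥ 1`): `α² = νμ = μβ = βν = 0`, `(αμν)ⁿ = (μνα)ⁿ`,
`βᵐ = (ναμ)ⁿ`. -/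
abbrev BisB7 (K : Type) [Field K] (m n : ℕ) : Type :=
  BoundQuiverAlgebra K (Fin 4) QE.s QE.t
    {(QE.al K ^ 2, 0), (QE.nu K * QE.mu K, 0), (QE.mu K * QE.be K, 0),
     (QE.be K * QE.nu K, 0),
     ((QE.al K * QE.mu K * QE.nu K) ^ n, (QE.mu K * QE.nu K * QE.al K) ^ n),
     (QE.be K ^ m, (QE.nu K * QE.al K * QE.mu K) ^ n)}

/-- `B₈` (`n ≥ 1`): `α² = β² = μν = νμ = 0`, `(ναμβ)ⁿ = (βναμ)ⁿ`, `(αμβν)ⁿ = (μβνα)ⁿ`. -/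
abbrev BisB8 (K : Type) [Field K] (n : ℕ) : Type :=
  BoundQuiverAlgebra K (Fin 4) QE.s QE.t
    {(QE.al K ^ 2, 0), (QE.be K ^ 2, 0), (QE.mu K * QE.nu K, 0), (QE.nu K * QE.mu K, 0),
     ((QE.nu K * QE.al K * QE.mu K * QE.be K) ^ n,
      (QE.be K * QE.nu K * QE.al K * QE.mu K) ^ n),
     ((QE.al K * QE.mu K * QE.be K * QE.nu K) ^ n,
      (QE.mu K * QE.be K * QE.nu K * QE.al K) ^ n)}

end TwoPoint

namespace TwoPoint

/-- A finite dimensional basic algebra with two primitive idempotents, together with its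
projection to the semisimple quotient `K × K`. -/
structure Pointed (K R : Type) [Field K] [Ring R] [Algebra K R] where
  e : Fin 2 → R
  idem : ∀ i, e i * e i = e i
  orth : ∀ i j, i ≠ j → e i * e j = 0
  sum : e 0 + e 1 = 1
  top : R →ₐ[K] (Fin 2 → K)
  top_e : ∀ i, top (e i) = Pi.single i 1
  nil : ∃ N : ℕ, RingHom.ker top ^ N = ⊥
  fin : Module.Finite K R

namespace Pointed

variable {K R : Type} [Field K] [Ring R] [Algebra K R] (D : Pointed K R)

/-- The radical. -/
def J : Ideal R := RingHom.ker D.top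

theorem mem_J {r : R} : r ∈ D.J ↔ D.top r = 0 := RingHom.mem_ker

theorem J_mul_mem {r : R} (h : r ∈ D.J) (s : R) : r * s ∈ D.J := by
  rw [mem_J] at *; rw [map_mul, h, zero_mul]

theorem isArtinian (D : Pointed K R) : IsArtinianRing R := by
  have := D.fin
  exact IsArtinianRing.of_finite K R

theorem isNoetherian (D : Pointed K R) : IsNoetherianRing R := by
  have := D.fin
  exact isNoetherian_of_tower K (inferInstance : IsNoetherian K R)

theorem e_decomp {M : Type} [AddCommGroup M] [Module R M] (x : M) :
    D.e 0 • x + D.e 1 • x = x := by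
  rw [← add_smul, D.sum, one_smul]

theorem ee_smul {M : Type} [AddCommGroup M] [Module R M] (i : Fin 2) (x : M) :
    D.e i • D.e i • x = D.e i • x := by
  rw [← mul_smul, D.idem]

theorem top_e_apply (i j : Fin 2) : D.top (D.e i) j = if j = i then 1 else 0 := by
  rw [D.top_e, Pi.single_apply]

theorem sub_top_mem (r : R) :
    r - (algebraMap K R (D.top r 0) * D.e 0 + algebraMap K R (D.top r 1) * D.e 1) ∈ D.J := by
  rw [mem_J, map_sub, map_add, map_mul, map_mul, AlgHom.commutes, AlgHom.commutes, D.top_e,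
    D.top_e]
  ext i
  fin_cases i <;> simp

/-- An element of `J` between any idempotents, or an invertible multiple of `e i`. -/
theorem corner_sub_mem {i : Fin 2} {r : R} (h : r * D.e i = r) :
    r - algebraMap K R (D.top r i) * D.e i ∈ D.J := by
  have h2 := D.J_mul_mem (D.sub_top_mem r) (D.e i)
  convert h2 using 1
  rw [sub_mul, h, add_mul, mul_assoc, mul_assoc]
  fin_cases i
  · simp [D.idem, D.orth 1 0 (by decide)]
  · simp [D.idem, D.orth 0 1 (by decide)]

theorem mem_J_of_ne {i j : Fin 2} (hij : i ≠ j) {r : R} (h1 : D.e i * r = r)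
    (h2 : r * D.e j = r) : r ∈ D.J := by
  rw [mem_J, ← h1, ← h2, map_mul, map_mul, D.top_e, D.top_e]
  ext k
  by_cases hk : k = i
  · subst hk; simp [hij]
  · simp [hk]

section Nakayama

variable {M : Type} [AddCommGroup M] [Module R M]

theorem nakayama (C : Submodule R M) (h : C ≤ D.J • C) : C = ⊥ := by
  have h2 : ∀ n : ℕ, C ≤ (D.J ^ n) • C := by
    intro n
    induction n with
    | zero =>
      rw [Submodule.pow_zero, Ideal.one_eq_top]
      exact fun x hx => by simpa using Submodule.smul_mem_smul (Submodule.mem_top (x := (1 : R))) hx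
    | succ n ih =>
      calc C ≤ D.J ^ n • C := ih
        _ ≤ D.J ^ n • D.J • C := Submodule.smul_mono le_rfl h
        _ = D.J ^ (n + 1) • C := by rw [Submodule.pow_succ, Submodule.mul_smul]
  obtain ⟨N, hN⟩ := D.nil
  have h3 := h2 N
  rw [show D.J ^ N = ⊥ from hN] at h3
  simpa using h3

theorem nakayama_sup (C : Submodule R M) (h : ⊤ ≤ C ⊔ D.J • (⊤ : Submodule R M)) : C = ⊤ := by
  have h1 : (⊤ : Submodule R (M ⧸ C)) = ⊥ := by
    apply D.nakayama
    have : (⊤ : Submodule R (M ⧸ C)) = Submodule.map C.mkQ ⊤ := by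
      rw [Submodule.map_top, Submodule.range_mkQ]
    rw [this]
    refine (Submodule.map_mono h).trans ?_
    rw [Submodule.map_sup, Submodule.map_smul'']
    simp
  rw [eq_top_iff]
  intro x _
  have : C.mkQ x ∈ (⊤ : Submodule R (M ⧸ C)) := trivial
  rw [h1] at this
  simpa using this

theorem nakayama_span {κ : Type} (m m' : κ → M) (h : Submodule.span R (Set.range m) = ⊤)
    (h' : ∀ k, m k - m' k ∈ D.J • (⊤ : Submodule R M)) :
    Submodule.span R (Set.range m') = ⊤ := by
  apply D.nakayama_sup
  rw [← h, Submodule.span_le]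
  rintro _ ⟨k, rfl⟩
  have : m k = m' k + (m k - m' k) := by abel
  rw [this]
  exact Submodule.add_mem_sup (Submodule.subset_span ⟨k, rfl⟩) (by rw [h]; exact h' k)

end Nakayama

/-- The action of a matrix with entries in `R` on tuples of elements of a module. -/
def act {ι κ M : Type} [Fintype κ] [AddCommGroup M] [Module R M] (F : Matrix ι κ R)
    (m : κ → M) : ι → M := fun r => ∑ k, F r k • m k

section act
variable {ι κ lam M N : Type} [Fintype κ] [AddCommGroup M] [Module R M]
  [AddCommGroup N] [Module R N]

theorem act_apply (F : Matrix ι κ R) (m : κ → M) (r : ι) : act F m r = ∑ k, F r k • m k := rfl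

theorem act_mul [Fintype ι] (G : Matrix lam ι R) (F : Matrix ι κ R) (m : κ → M) :
    act (G * F) m = act G (act F m) := by
  ext r
  simp only [act, Matrix.mul_apply, Finset.sum_smul, Finset.smul_sum, mul_smul]
  rw [Finset.sum_comm]

theorem act_one [DecidableEq κ] (m : κ → M) : act (1 : Matrix κ κ R) m = m := by
  ext r
  simp [act, Matrix.one_apply]

theorem act_add (G F : Matrix ι κ R) (m : κ → M) : act (G + F) m = act G m + act F m := by
  ext r; simp [act, add_smul, Finset.sum_add_distrib]

theorem act_zero_right (F : Matrix ι κ R) : act F (0 : κ → M) = 0 := by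
  ext r; simp [act]

theorem map_act (φ : M →ₗ[R] N) (F : Matrix ι κ R) (m : κ → M) (r : ι) :
    φ (act F m r) = act F (fun k => φ (m k)) r := by
  simp [act]
end act

end Pointed

namespace Pointed

variable {K R : Type} [Field K] [Ring R] [Algebra K R] (D : Pointed K R)

/-- A presentation of a module by homogeneous generators `m` and homogeneous relations `F`. -/
structure Pres {κ ι M : Type} [Fintype κ] [Fintype ι] [AddCommGroup M] [Module R M]
    (v : κ → Fin 2) (u : ι → Fin 2) (m : κ → M) (F : Matrix ι κ R) : Prop where
  left : ∀ r k, D.e (u r) * F r k = F r k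
  right : ∀ r k, F r k * D.e (v k) = F r k
  gen : ∀ k, D.e (v k) • m k = m k
  span : Submodule.span R (Set.range m) = ⊤
  rel : act F m = 0
  exact : ∀ y : κ → R, ∑ k, y k • m k = 0 → ∃ b : ι → R, ∀ k, y k * D.e (v k) = ∑ r, b r * F r k

/-- Every homogeneous tuple of elements of `N` indexed by rows is in the image of `F`. -/
def Crit {κ ι : Type} [Fintype κ] (u : ι → Fin 2) (F : Matrix ι κ R)
    (N : Type) [AddCommGroup N] [Module R N] : Prop :=
  ∀ h : ι → N, (∀ r, D.e (u r) • h r = h r) → ∃ h' : κ → N, act F h' = h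

section
variable {κ ι M N : Type} [Fintype κ] [Fintype ι] [AddCommGroup M] [Module R M]
  [AddCommGroup N] [Module R N]
variable {v : κ → Fin 2} {u : ι → Fin 2} {m : κ → M} {F : Matrix ι κ R}

theorem hom_ext_of_span {m : κ → M} (h : Submodule.span R (Set.range m) = ⊤)
    {f g : M →ₗ[R] N} (hfg : ∀ k, f (m k) = g (m k)) : f = g :=
  LinearMap.ext_on_range h hfg

theorem exists_sum_of_span {m : κ → M} (h : Submodule.span R (Set.range m) = ⊤) (x : M) :
    ∃ y : κ → R, ∑ k, y k • m k = x := by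
  have : x ∈ Submodule.span R (Set.range m) := by rw [h]; trivial
  exact (Submodule.mem_span_range_iff_exists_fun R).1 this

variable {D}

theorem Pres.lift (h : D.Pres v u m F) (n : κ → N) (hn : ∀ k, D.e (v k) • n k = n k)
    (hF : act F n = 0) : ∃ φ : M →ₗ[R] N, ∀ k, φ (m k) = n k := by
  classical
  let f := Fintype.linearCombination R m
  let g := Fintype.linearCombination R n
  have hf : Function.Surjective f := fun x => by
    obtain ⟨y, hy⟩ := exists_sum_of_span h.span x
    exact ⟨y, by simpa [f, Fintype.linearCombination_apply] using hy⟩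
  have hker : LinearMap.ker f ≤ LinearMap.ker g := by
    intro y hy
    rw [LinearMap.mem_ker] at *
    simp only [f, g, Fintype.linearCombination_apply] at *
    obtain ⟨b, hb⟩ := h.exact y hy
    calc ∑ k, y k • n k = ∑ k, (y k * D.e (v k)) • n k := by
          refine Finset.sum_congr rfl fun k _ => ?_
          rw [mul_smul, hn]
      _ = ∑ r, b r • act F n r := by
          simp only [hb, act, Finset.sum_smul, Finset.smul_sum, mul_smul]
          rw [Finset.sum_comm]
      _ = 0 := by simp [hF]
  refine ⟨((LinearMap.ker f).liftQ g hker).comp (f.quotKerEquivOfSurjective hf).symm.toLinearMap,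
    fun k => ?_⟩
  have : (f.quotKerEquivOfSurjective hf).symm (m k) = Submodule.Quotient.mk (Pi.single k 1) := by
    rw [LinearEquiv.symm_apply_eq]
    simp [f, LinearMap.quotKerEquivOfSurjective, Fintype.linearCombination_apply_single]
  simp [this, g, Fintype.linearCombination_apply_single]

theorem Pres.finite (h : D.Pres v u m F) : Module.Finite R M :=
  ⟨h.span ▸ Submodule.fg_span (Set.finite_range m)⟩

end

section PMod
variable {κ ι : Type} [Fintype κ] [Fintype ι] [DecidableEq κ]

/-- The submodule of relations generated by the rows of `F`. -/
def relSub (v : κ → Fin 2) (F : Matrix ι κ R) : Submodule R (κ → R) :=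
  Submodule.span R (Set.range fun r k => F r k) ⊔
    Submodule.span R (Set.range fun k => (Pi.single k (1 - D.e (v k)) : κ → R))

/-- The module with presentation matrix `F`. -/
abbrev PMod (v : κ → Fin 2) (F : Matrix ι κ R) : Type := (κ → R) ⧸ D.relSub v F

/-- The canonical generators of `PMod`. -/
def pgen (v : κ → Fin 2) (F : Matrix ι κ R) (k : κ) : D.PMod v F :=
  Submodule.Quotient.mk (Pi.single k (D.e (v k)))

theorem sum_pgen (v : κ → Fin 2) (F : Matrix ι κ R) (y : κ → R) :
    ∑ k, y k • D.pgen v F k = Submodule.Quotient.mk fun k => y k * D.e (v k) := by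
  simp only [pgen, ← Submodule.mkQ_apply, ← map_smul, ← map_sum]
  congr 1
  ext k
  simp [Finset.sum_apply, Pi.single_apply]

theorem pgen_one (v : κ → Fin 2) (F : Matrix ι κ R) (y : κ → R) :
    (Submodule.Quotient.mk y : D.PMod v F) = Submodule.Quotient.mk fun k => y k * D.e (v k) := by
  rw [Submodule.Quotient.eq]
  refine Submodule.mem_sup_right ?_
  rw [Submodule.mem_span_range_iff_exists_fun]
  refine ⟨y, ?_⟩
  ext k
  simp [Finset.sum_apply, Pi.single_apply, mul_sub]

theorem pmod_pres (v : κ → Fin 2) (u : ι → Fin 2) (F : Matrix ι κ R)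
    (hl : ∀ r k, D.e (u r) * F r k = F r k) (hr : ∀ r k, F r k * D.e (v k) = F r k) :
    D.Pres v u (D.pgen v F) F where
  left := hl
  right := hr
  gen k := by
    rw [pgen, ← Submodule.Quotient.mk_smul]
    congr 1
    ext l
    by_cases h : l = k
    · subst h; simp [D.idem]
    · simp [h]
  span := by
    rw [eq_top_iff]
    intro x _
    obtain ⟨y, rfl⟩ := Submodule.Quotient.mk_surjective _ x
    rw [Submodule.mem_span_range_iff_exists_fun]
    exact ⟨y, by rw [sum_pgen, ← pgen_one]⟩
  rel := by
    ext r
    rw [act, sum_pgen, Pi.zero_apply, Submodule.Quotient.mk_eq_zero]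
    refine Submodule.mem_sup_left (Submodule.subset_span ⟨r, ?_⟩)
    ext k
    rw [hr]
  exact y hy := by
    rw [sum_pgen, Submodule.Quotient.mk_eq_zero, relSub, Submodule.mem_sup] at hy
    obtain ⟨a, ha, c, hc, hac⟩ := hy
    rw [Submodule.mem_span_range_iff_exists_fun] at ha hc
    obtain ⟨b, rfl⟩ := ha
    obtain ⟨d, rfl⟩ := hc
    refine ⟨b, fun k => ?_⟩
    have := congrFun hac k
    have h2 := congrArg (· * D.e (v k)) this
    simp only [Pi.add_apply, Finset.sum_apply, Pi.smul_apply, smul_eq_mul, add_mul,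
      Finset.sum_mul, mul_assoc, hr, D.idem] at h2
    rw [← h2, add_eq_left]
    refine Finset.sum_eq_zero fun l _ => ?_
    by_cases h : k = l
    · subst h; simp [sub_mul, D.idem]
    · simp [h]

end PMod

section
variable {κ ι M N : Type} [Fintype κ] [Fintype ι] [AddCommGroup M] [Module R M]
  [AddCommGroup N] [Module R N]
variable {v : κ → Fin 2} {u : ι → Fin 2} {m : κ → M} {F : Matrix ι κ R}
variable {D}

theorem Pres.projective [IsEmpty ι] (h : D.Pres v u m F) : Module.Projective R M := by
  classical
  obtain ⟨φ, hφ⟩ := h.lift (N := κ → R) (fun k => Pi.single k (D.e (v k)))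
    (fun k => by
      ext l
      by_cases hl : l = k
      · subst hl; simp [D.idem]
      · simp [hl]) (by ext r; exact isEmptyElim r)
  refine Module.Projective.of_split φ (Fintype.linearCombination R m) ?_
  apply LinearMap.ext_on_range h.span
  intro k
  simp [hφ, Fintype.linearCombination_apply_single, h.gen]

/-- Two presented modules whose generators satisfy each other's relations are isomorphic. -/
theorem Pres.iso {ι' : Type} [Fintype ι'] {u' : ι' → Fin 2} {n : κ → N} {F' : Matrix ι' κ R}
    (h : D.Pres v u m F) (h' : D.Pres v u' n F') (h1 : act F n = 0) (h2 : act F' m = 0) :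
    ∃ f : M ≃ₗ[R] N, ∀ k, f (m k) = n k := by
  obtain ⟨φ, hφ⟩ := h.lift n h'.gen h1
  obtain ⟨ψ, hψ⟩ := h'.lift m h.gen h2
  refine ⟨LinearEquiv.ofLinearMap φ ψ ?_ ?_, hφ⟩
  · apply LinearMap.ext_on_range h'.span; intro k; simp [hφ, hψ]
  · apply LinearMap.ext_on_range h.span; intro k; simp [hφ, hψ]

theorem Pres.reindex {κ' ι' : Type} [Fintype κ'] [Fintype ι'] (h : D.Pres v u m F)
    (a : κ' ≃ κ) (b : ι' ≃ ι) :
    D.Pres (v ∘ a) (u ∘ b) (m ∘ a) (F.submatrix b a) where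
  left r k := h.left _ _
  right r k := h.right _ _
  gen k := h.gen _
  span := by rw [← h.span, Set.range_comp, a.surjective.range_eq, Set.image_univ]
  rel := by
    ext r
    have h1 := congrFun h.rel (b r)
    rw [act_apply, Pi.zero_apply] at h1
    rw [act_apply, Pi.zero_apply, ← h1]
    exact a.sum_comp (fun k => F (b r) k • m k)
  exact y hy := by
    obtain ⟨c, hc⟩ := h.exact (y ∘ a.symm) (by
      rw [← a.sum_comp]; simpa using hy)
    refine ⟨c ∘ b, fun k => ?_⟩
    have := hc (a k)
    simp only [Function.comp, Equiv.symm_apply_apply, Matrix.submatrix_apply] at *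
    rw [this]
    exact (b.sum_comp (fun r => c r * F r (a k))).symm

/-- Change of generators by an invertible matrix `Q` and of relations by row operations. -/
theorem Pres.baseChange {κ' ι' : Type} [Fintype κ'] [Fintype ι'] [DecidableEq κ]
    [DecidableEq κ'] {j i : Fin 2} (h : D.Pres (fun _ => j) (fun _ => i) m F)
    (Q : Matrix κ' κ R) (Q' : Matrix κ κ' R) (P : Matrix ι' ι R) (P' : Matrix ι ι' R)
    [DecidableEq ι]
    (hQ : ∀ a b, D.e j * Q a b = Q a b * D.e j) (hQ' : ∀ a b, D.e j * Q' a b = Q' a b * D.e j)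
    (hP : ∀ a b, D.e i * P a b = P a b * D.e i)
    (hQQ : Q' * Q = 1) (hQQ' : Q * Q' = 1) (hPP : P' * P = 1) :
    D.Pres (fun _ => j) (fun _ => i) (act Q m) (P * F * Q') where
  left r k := by
    simp only [Matrix.mul_apply, Finset.sum_mul, Finset.mul_sum]
    refine Finset.sum_congr rfl fun a _ => Finset.sum_congr rfl fun b _ => ?_
    rw [← mul_assoc, ← mul_assoc, hP, mul_assoc (P r b), h.left]
  right r k := by
    simp only [Matrix.mul_apply, Finset.sum_mul]
    refine Finset.sum_congr rfl fun a _ => Finset.sum_congr rfl fun b _ => ?_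
    rw [mul_assoc, ← hQ', ← mul_assoc, mul_assoc (P r b), h.right]
  gen k := by
    simp only [act, Finset.smul_sum]
    refine Finset.sum_congr rfl fun a _ => ?_
    rw [← mul_smul, hQ, mul_smul, h.gen]
  span := by
    rw [eq_top_iff, ← h.span, Submodule.span_le]
    rintro _ ⟨k, rfl⟩
    have : m k = act Q' (act Q m) k := by rw [← act_mul, hQQ, act_one]
    rw [this]
    exact Submodule.sum_mem _ fun l _ => Submodule.smul_mem _ _ (Submodule.subset_span ⟨l, rfl⟩)
  rel := by
    rw [act_mul, ← act_mul, act_mul, ← act_mul Q', hQQ, act_one, act_mul, h.rel, act_zero_right]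
  exact y hy := by
    have h1 : ∑ k, (∑ l, y l * Q l k) • m k = 0 := by
      rw [← hy]
      simp only [act, Finset.sum_smul, Finset.smul_sum, mul_smul]
      rw [Finset.sum_comm]
    obtain ⟨b, hb⟩ := h.exact _ h1
    refine ⟨fun r' => ∑ r, b r * P' r r', fun k => ?_⟩
    let Y : Matrix Unit κ' R := Matrix.of fun _ => y
    let B : Matrix Unit ι R := Matrix.of fun _ => b
    have h2 : Y * Q * Matrix.scalar κ (D.e j) = B * F := by
      ext a k
      rw [Matrix.scalar_apply, Matrix.mul_diagonal, Matrix.mul_apply, Matrix.mul_apply]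
      exact hb k
    have h3 : Matrix.scalar κ (D.e j) * Q' = Q' * Matrix.scalar κ' (D.e j) := by
      ext a k
      simp [hQ']
    have h4 : Y * Matrix.scalar κ' (D.e j) = B * P' * (P * F * Q') := by
      calc Y * Matrix.scalar κ' (D.e j) = Y * (Q * Q') * Matrix.scalar κ' (D.e j) := by
            rw [hQQ', Matrix.mul_one]
        _ = Y * Q * (Q' * Matrix.scalar κ' (D.e j)) := by simp only [Matrix.mul_assoc]
        _ = (Y * Q * Matrix.scalar κ (D.e j)) * Q' := by rw [← h3]; simp only [Matrix.mul_assoc]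
        _ = B * (P' * P) * F * Q' := by rw [h2, hPP, Matrix.mul_one]
        _ = _ := by simp only [Matrix.mul_assoc]
    have h5 := congrFun (congrFun h4 ()) k
    rw [Matrix.scalar_apply, Matrix.mul_diagonal, Matrix.mul_apply] at h5
    simp only [Matrix.mul_apply (M := B)] at h5
    exact h5

end

section Pi
variable {ξ : Type} [Fintype ξ] [DecidableEq ξ] {κ ι : ξ → Type} [∀ x, Fintype (κ x)]
  [∀ x, Fintype (ι x)]
  {G : ξ → Type} [∀ x, AddCommGroup (G x)] [∀ x, Module R (G x)]
  {v : ∀ x, κ x → Fin 2} {u : ∀ x, ι x → Fin 2} {m : ∀ x, κ x → G x}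
  {F : ∀ x, Matrix (ι x) (κ x) R}
variable {D}

/-- The generators of a finite product of presented modules. -/
def piGen (m : ∀ x, κ x → G x) : (Σ x, κ x) → (∀ x, G x) := fun p => Pi.single p.1 (m p.1 p.2)

theorem sum_piGen (m : ∀ x, κ x → G x) (y : (Σ x, κ x) → R) (x : ξ) :
    (∑ p, y p • piGen m p) x = ∑ k, y ⟨x, k⟩ • m x k := by
  rw [Fintype.sum_sigma, Finset.sum_apply, Finset.sum_eq_single x]
  · simp [piGen, Finset.sum_apply]
  · intro b _ hb
    simp [piGen, Finset.sum_apply, hb.symm]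
  · simp

theorem Pres.pi (h : ∀ x, D.Pres (v x) (u x) (m x) (F x)) :
    D.Pres (fun p : Σ x, κ x => v p.1 p.2) (fun p : Σ x, ι x => u p.1 p.2) (piGen m)
      (Matrix.blockDiagonal' F) where
  left := by
    rintro ⟨x, r⟩ ⟨y, k⟩
    by_cases hxy : x = y
    · subst hxy; simp [(h x).left]
    · simp [Matrix.blockDiagonal'_apply_ne, hxy]
  right := by
    rintro ⟨x, r⟩ ⟨y, k⟩
    by_cases hxy : x = y
    · subst hxy; simp [(h x).right]
    · simp [Matrix.blockDiagonal'_apply_ne, hxy]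
  gen := by
    rintro ⟨x, k⟩
    rw [piGen, ← Pi.single_smul, (h x).gen]
  span := by
    rw [eq_top_iff]
    intro n _
    rw [Submodule.mem_span_range_iff_exists_fun]
    choose y hy using fun x => exists_sum_of_span (h x).span (n x)
    refine ⟨fun p => y p.1 p.2, ?_⟩
    ext x
    rw [sum_piGen, hy]
  rel := by
    ext ⟨x, r⟩ y
    rw [act, sum_piGen]
    by_cases hxy : x = y
    · subst hxy
      simpa [act] using congrFun (h x).rel r
    · simp [Matrix.blockDiagonal'_apply_ne, hxy]
  exact y hy := by
    choose b hb using fun x => (h x).exact (fun k => y ⟨x, k⟩) (by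
      rw [← sum_piGen, hy]; rfl)
    refine ⟨fun p => b p.1 p.2, ?_⟩
    rintro ⟨x, k⟩
    rw [hb, Fintype.sum_sigma, Finset.sum_eq_single x]
    · simp
    · intro c _ hc
      simp [Matrix.blockDiagonal'_apply_ne, hc]
    · simp

theorem Crit.pi (h : ∀ x y, D.Crit (u x) (F x) (G y)) :
    D.Crit (fun p : Σ x, ι x => u p.1 p.2) (Matrix.blockDiagonal' F) (∀ x, G x) := by
  intro n hn
  choose h' hh' using fun x y => h x y (fun r => n ⟨x, r⟩ y) (fun r => congrFun (hn ⟨x, r⟩) y)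
  refine ⟨fun p y => h' p.1 y p.2, ?_⟩
  ext ⟨x, r⟩ y
  rw [act, Fintype.sum_sigma, Finset.sum_apply, Finset.sum_eq_single x]
  · have := congrFun (hh' x y) r
    simpa [act, Finset.sum_apply] using this
  · intro c _ hc
    simp [Matrix.blockDiagonal'_apply_ne, hc.symm]
  · simp

end Pi

/-- The matrix without rows. -/
def noRel (R κ : Type) : Matrix Empty κ R := Matrix.of fun r _ => r.elim

theorem noRel_pres {κ : Type} [Fintype κ] [DecidableEq κ] (v : κ → Fin 2) :
    D.Pres v (fun x : Empty => x.elim) (D.pgen v (noRel R κ)) (noRel R κ) :=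
  D.pmod_pres v _ _ (fun r => r.elim) (fun r => r.elim)

theorem tauRigid_of_crit {κ ι : Type} [Fintype κ] [Fintype ι] {M : Type} [AddCommGroup M]
    [Module R M] {v : κ → Fin 2} {u : ι → Fin 2} {m : κ → M} {F : Matrix ι κ R}
    (h : D.Pres v u m F) (hc : D.Crit u F M) : IsTauRigidCat R (ModuleCat.of R M) := by
  classical
  have h0 := D.noRel_pres v
  have h1 := D.noRel_pres u
  obtain ⟨g, hg⟩ := h0.lift m h.gen (by ext r; exact r.elim)
  obtain ⟨f, hf⟩ := h1.lift (act F (D.pgen v (noRel R κ))) (by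
    intro r; simp [act, Finset.smul_sum, ← mul_smul, h.left]) (by ext r; exact r.elim)
  refine ⟨h.finite, ModuleCat.of R _, ModuleCat.of R _, f, g, h1.finite, h1.projective,
    h0.finite, h0.projective, ?_, ?_, ?_⟩
  · intro x
    obtain ⟨y, rfl⟩ := exists_sum_of_span h.span x
    exact ⟨∑ k, y k • D.pgen v (noRel R κ) k, by simp [hg]⟩
  · apply le_antisymm
    · rw [LinearMap.range_le_ker_iff]
      apply LinearMap.ext_on_range h1.span
      intro r
      have := congrFun h.rel r
      rw [LinearMap.comp_apply, hf, map_act]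
      simpa [hg] using this
    · intro x hx
      obtain ⟨y, rfl⟩ := exists_sum_of_span h0.span x
      have : ∑ k, y k • m k = 0 := by simpa [hg] using hx
      obtain ⟨b, hb⟩ := h.exact y this
      refine ⟨∑ r, b r • D.pgen u (noRel R ι) r, ?_⟩
      rw [map_sum]
      calc _ = ∑ k, (∑ r, b r * F r k) • D.pgen v (noRel R κ) k := by
            simp only [map_smul, hf, act, Finset.smul_sum, Finset.sum_smul, mul_smul]
            rw [Finset.sum_comm]
        _ = _ := by
            refine Finset.sum_congr rfl fun k _ => ?_
            rw [← hb, mul_smul, h0.gen]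
  · intro φ
    obtain ⟨n, hn⟩ := hc (fun r => φ (D.pgen u (noRel R ι) r)) (fun r => by
      rw [← map_smul, h1.gen])
    obtain ⟨ψ, hψ⟩ := h0.lift (fun k => D.e (v k) • n k) (fun k => D.ee_smul _ _)
      (by ext r; exact r.elim)
    refine ⟨ψ, ?_⟩
    apply LinearMap.ext_on_range h1.span
    intro r
    rw [LinearMap.comp_apply, hf, map_act]
    simp only [hψ]
    rw [← congrFun hn r]
    simp only [act, ← mul_smul, h.right]

end Pointed

section KrullSchmidt

variable {R : Type} [Ring R]

theorem IsIndecModule.isLocalRing {N : Type} [AddCommGroup N] [Module R N] [IsArtinian R N]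
    [IsNoetherian R N] (h : IsIndecModule R N) : IsLocalRing (Module.End R N) := by
  have := h.1
  refine IsLocalRing.of_isUnit_or_isUnit_one_sub_self fun f => ?_
  obtain ⟨n, hn⟩ := (f.eventually_isCompl_ker_pow_range_pow).exists
  obtain ⟨n, hn, h1⟩ :=
    (f.eventually_isCompl_ker_pow_range_pow.and (Filter.eventually_ge_atTop 1)).exists
  rcases h.2 _ _ hn with hk | hr
  · left
    have h2 : IsUnit (f ^ n) := by
      rw [Module.End.isUnit_iff]
      refine ⟨LinearMap.ker_eq_bot.1 hk, LinearMap.range_eq_top.1 ?_⟩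
      have := hn.sup_eq_top
      rwa [hk, bot_sup_eq] at this
    exact (isUnit_pow_iff (by omega)).1 h2
  · right
    have : f ^ n = 0 := LinearMap.range_eq_bot.1 hr
    exact IsNilpotent.isUnit_one_sub ⟨n, this⟩

theorem isIndecModule_of_isLocalRing {N : Type} [AddCommGroup N] [Module R N]
    [IsLocalRing (Module.End R N)] : IsIndecModule R N := by
  have hne : Nontrivial N := by
    by_contra hN
    rw [not_nontrivial_iff_subsingleton] at hN
    exact one_ne_zero (α := Module.End R N) (LinearMap.ext fun x => Subsingleton.elim _ _)
  refine ⟨hne, fun N₁ N₂ h => ?_⟩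
  let p := N₁.subtype.comp (N₁.projectionOnto N₂ h)
  have hp1 : ∀ x ∈ N₁, p x = x := fun x hx => by
    have := Submodule.projectionOnto_apply_left h ⟨x, hx⟩
    simp [p, this]
  have hp2 : ∀ x ∈ N₂, p x = 0 := fun x hx => by
    have := (Submodule.projectionOnto_apply_eq_zero_iff h (x := x)).2 hx
    simp [p, this]
  rcases IsLocalRing.isUnit_or_isUnit_of_add_one (a := p) (b := 1 - p) (by abel) with hu | hu
  · right
    rw [Module.End.isUnit_iff] at hu
    rw [eq_bot_iff]
    intro x hx
    exact hu.1 (by rw [hp2 x hx, map_zero])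
  · left
    rw [Module.End.isUnit_iff] at hu
    rw [eq_bot_iff]
    intro x hx
    exact hu.1 (by simp [hp1 x hx])

theorem exists_isUnit_of_sum {A ι : Type} [Ring A] [IsLocalRing A] (s : Finset ι) (f : ι → A)
    (h : IsUnit (∑ i ∈ s, f i)) : ∃ i ∈ s, IsUnit (f i) := by
  classical
  induction s using Finset.induction_on with
  | empty => simp at h
  | insert a s ha ih =>
    rw [Finset.sum_insert ha] at h
    obtain ⟨w, hw⟩ := h
    have h1 : (↑w⁻¹ : A) * f a + (↑w⁻¹ : A) * ∑ i ∈ s, f i = 1 := by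
      rw [← mul_add, ← hw, Units.inv_mul]
    rcases IsLocalRing.isUnit_or_isUnit_of_add_one h1 with h2 | h2
    · exact ⟨a, by simp, (Units.isUnit_units_mul _ _).1 h2⟩
    · obtain ⟨i, hi, hu⟩ := ih ((Units.isUnit_units_mul _ _).1 h2)
      exact ⟨i, by simp [hi], hu⟩

theorem equiv_of_retract {L N : Type} [AddCommGroup L] [Module R L] [AddCommGroup N] [Module R N]
    [Nontrivial L] (hN : IsIndecModule R N) (i : L →ₗ[R] N) (p : N →ₗ[R] L)
    (h : p.comp i = LinearMap.id) : Nonempty (L ≃ₗ[R] N) := by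
  have hi : Function.Injective i := fun x y hxy => by
    have := congrArg p hxy
    simpa [← LinearMap.comp_apply, h] using this
  have hc : IsCompl (LinearMap.range i) (LinearMap.ker p) := by
    constructor
    · rw [Submodule.disjoint_def]
      rintro _ ⟨x, rfl⟩ hx
      rw [LinearMap.mem_ker, ← LinearMap.comp_apply, h] at hx
      simp only [LinearMap.id_apply] at hx
      simp [hx]
    · rw [codisjoint_iff, eq_top_iff]
      intro x _
      rw [show x = i (p x) + (x - i (p x)) by abel]
      refine Submodule.add_mem_sup ⟨_, rfl⟩ ?_
      rw [LinearMap.mem_ker, map_sub, ← LinearMap.comp_apply p i, h]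
      simp
  rcases hN.2 _ _ hc with h1 | h1
  · exfalso
    obtain ⟨x, hx⟩ := exists_ne (0 : L)
    apply hx
    apply hi
    rw [LinearMap.range_eq_bot.1 h1]
    simp
  · refine ⟨LinearEquiv.ofBijective i ⟨hi, LinearMap.range_eq_top.1 ?_⟩⟩
    have := hc.sup_eq_top
    rwa [h1, sup_bot_eq] at this

theorem exists_retract_of_retract_pi {ξ : Type} [Fintype ξ] {L : Type} {N : ξ → Type}
    [AddCommGroup L] [Module R L] [∀ x, AddCommGroup (N x)] [∀ x, Module R (N x)]
    [IsLocalRing (Module.End R L)]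
    (i : L →ₗ[R] ∀ x, N x) (p : (∀ x, N x) →ₗ[R] L) (h : p.comp i = LinearMap.id) :
    ∃ (x : ξ) (i' : L →ₗ[R] N x) (p' : N x →ₗ[R] L), p'.comp i' = LinearMap.id := by
  classical
  let q : ∀ x, N x →ₗ[R] L := fun x => p.comp (LinearMap.single R N x)
  let j : ∀ x, L →ₗ[R] N x := fun x => (LinearMap.proj x).comp i
  have hs : ∑ x, ((q x).comp (j x) : Module.End R L) = 1 := by
    rw [Module.End.one_eq_id, ← h]
    ext y
    simp only [q, j, LinearMap.sum_apply, LinearMap.comp_apply, LinearMap.single_apply,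
      LinearMap.proj_apply]
    rw [← map_sum]
    congr 1
    exact Finset.univ_sum_single (i y)
  obtain ⟨x, -, hx⟩ := exists_isUnit_of_sum Finset.univ
    (fun x => ((q x).comp (j x) : Module.End R L)) (by rw [hs]; exact isUnit_one)
  obtain ⟨w, hw⟩ := hx
  refine ⟨x, j x, (w⁻¹.1 : Module.End R L).comp (q x), ?_⟩
  rw [LinearMap.comp_assoc, ← hw]
  exact w.inv_mul

theorem exists_equiv_of_retract_pi {ξ : Type} [Fintype ξ] {L : Type} {N : ξ → Type}
    [AddCommGroup L] [Module R L] [∀ x, AddCommGroup (N x)] [∀ x, Module R (N x)]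
    [IsLocalRing (Module.End R L)] (hN : ∀ x, IsIndecModule R (N x))
    (i : L →ₗ[R] ∀ x, N x) (p : (∀ x, N x) →ₗ[R] L) (h : p.comp i = LinearMap.id) :
    ∃ x, Nonempty (L ≃ₗ[R] N x) := by
  have := (isIndecModule_of_isLocalRing (R := R) (N := L)).1
  obtain ⟨x, i', p', h'⟩ := exists_retract_of_retract_pi i p h
  exact ⟨x, equiv_of_retract (hN x) i' p' h'⟩

/-- The decomposition of a module as an internal direct sum yields a product decomposition. -/
def internalEquiv {M : Type} [AddCommGroup M] [Module R M] {k : ℕ} (N : Fin k → Submodule R M)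
    (h : DirectSum.IsInternal N) : M ≃ₗ[R] ∀ x, N x :=
  (LinearEquiv.ofBijective (DirectSum.coeLinearMap N) h).symm.trans
    (DirectSum.linearEquivFunOnFintype R (Fin k) fun x => N x)

/-- The summands of a module isomorphic to a finite product. -/
def piSummand {M : Type} [AddCommGroup M] [Module R M] {k : ℕ} {G : Fin k → Type}
    [∀ x, AddCommGroup (G x)] [∀ x, Module R (G x)] (E : M ≃ₗ[R] ∀ x, G x) (x : Fin k) :
    Submodule R M := LinearMap.range (E.symm.toLinearMap.comp (LinearMap.single R G x))

variable {M : Type} [AddCommGroup M] [Module R M] {k : ℕ} {G : Fin k → Type}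
    [∀ x, AddCommGroup (G x)] [∀ x, Module R (G x)]

/-- Each summand is isomorphic to the corresponding factor. -/
def piSummandEquiv (E : M ≃ₗ[R] ∀ x, G x) (x : Fin k) : G x ≃ₗ[R] piSummand E x :=
  LinearEquiv.ofInjective (E.symm.toLinearMap.comp (LinearMap.single R G x)) (by
    rw [LinearMap.coe_comp]
    exact E.symm.injective.comp (Pi.single_injective (M := G) x))

theorem piSummand_isInternal (E : M ≃ₗ[R] ∀ x, G x) : DirectSum.IsInternal (piSummand E) := by
  classical
  have key : ∀ d : DirectSum (Fin k) fun x => G x,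
      DirectSum.coeLinearMap (piSummand E)
        (DFinsupp.mapRange.linearEquiv (fun x => piSummandEquiv E x) d) =
      E.symm (DirectSum.linearEquivFunOnFintype R (Fin k) (fun x => G x) d) := by
    intro d
    induction d using DirectSum.induction_on with
    | zero => simp
    | of i x =>
      have : (DFinsupp.mapRange.linearEquiv (fun x => piSummandEquiv E x))
        (DirectSum.of (fun x => G x) i x) = DirectSum.lof R _ (fun x => piSummand E x) i
          (piSummandEquiv E i x) := by
        exact DFinsupp.mapRange_single (hf := fun i => map_zero _)
      rw [this, DirectSum.coeLinearMap_lof]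
      have h2 : DirectSum.linearEquivFunOnFintype R (Fin k) (fun x => G x)
        (DirectSum.of (fun x => G x) i x) = Pi.single i x :=
          DirectSum.linearEquivFunOnFintype_lof R i x
      rw [h2]
      rfl
    | add x y hx hy => simp only [map_add, hx, hy]
  have hb : Function.Bijective (fun d => DirectSum.coeLinearMap (piSummand E)
        (DFinsupp.mapRange.linearEquiv (fun x => piSummandEquiv E x) d)) := by
    rw [show (fun d => DirectSum.coeLinearMap (piSummand E)
        (DFinsupp.mapRange.linearEquiv (fun x => piSummandEquiv E x) d)) =
        E.symm ∘ (DirectSum.linearEquivFunOnFintype R (Fin k) (fun x => G x)) from funext key]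
    exact E.symm.bijective.comp (LinearEquiv.bijective _)
  exact (Function.Bijective.of_comp_iff _ (LinearEquiv.bijective
    (DFinsupp.mapRange.linearEquiv fun x => piSummandEquiv E x))).1 hb

theorem IsIndecModule.congr {L N : Type} [AddCommGroup L] [Module R L] [AddCommGroup N]
    [Module R N] (f : L ≃ₗ[R] N) (h : IsIndecModule R L) : IsIndecModule R N := by
  refine ⟨f.symm.toEquiv.nontrivial_congr.2 h.1, fun N₁ N₂ hc => ?_⟩
  have h2 := h.2 (N₁.map f.symm.toLinearMap) (N₂.map f.symm.toLinearMap)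
    (hc.map (Submodule.orderIsoMapComap f.symm))
  simpa [Submodule.map_eq_bot_iff] using h2

end KrullSchmidt

section Matching

variable {R : Type} [Ring R] {Γ : Type} [DecidableEq Γ] {G : Γ → Type}
  [∀ γ, AddCommGroup (G γ)] [∀ γ, Module R (G γ)]
  [∀ γ, IsLocalRing (Module.End R (G γ))]
  (hG : ∀ γ γ', Nonempty (G γ ≃ₗ[R] G γ') → γ = γ')
  {M : Type} [AddCommGroup M] [Module R M]
  {ξ : Type} [Fintype ξ] {c : ξ → Γ} (E : M ≃ₗ[R] ∀ x, G (c x))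

include E in
theorem exists_equiv_summand {k : ℕ} {N : Fin k → Submodule R M} (hN : DirectSum.IsInternal N)
    (hi : ∀ x, IsIndecModule R (N x)) (x : ξ) : ∃ a, Nonempty (N a ≃ₗ[R] G (c x)) := by
  classical
  let F := E.symm.trans (internalEquiv N hN)
  obtain ⟨a, ⟨f⟩⟩ := exists_equiv_of_retract_pi (L := G (c x)) hi
    (F.toLinearMap.comp (LinearMap.single R (fun x => G (c x)) x))
    ((LinearMap.proj x).comp F.symm.toLinearMap) (by ext y; simp)
  exact ⟨a, ⟨f.symm⟩⟩

include E in
theorem exists_equiv_factor [IsArtinian R M] [IsNoetherian R M] {k : ℕ}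
    {N : Fin k → Submodule R M} (hN : DirectSum.IsInternal N)
    (hi : ∀ x, IsIndecModule R (N x)) (a : Fin k) : ∃ x, Nonempty (N a ≃ₗ[R] G (c x)) := by
  classical
  have := (hi a).isLocalRing
  let F := E.symm.trans (internalEquiv N hN)
  exact exists_equiv_of_retract_pi (L := N a)
    (fun x => isIndecModule_of_isLocalRing)
    (F.symm.toLinearMap.comp (LinearMap.single R (fun x => N x) a))
    ((LinearMap.proj a).comp F.toLinearMap) (by ext y; simp)

include hG E in
theorem exists_labels [IsArtinian R M] [IsNoetherian R M] {k : ℕ}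
    {N : Fin k → Submodule R M} (hN : DirectSum.IsInternal N)
    (hi : ∀ x, IsIndecModule R (N x)) :
    ∃ d : Fin k → Γ, (∀ a, Nonempty (N a ≃ₗ[R] G (d a))) ∧
      (∀ a b, d a = d b ↔ Nonempty (N a ≃ₗ[R] N b)) ∧
      ∀ γ, (∃ a, d a = γ) ↔ γ ∈ Finset.univ.image c := by
  choose x hx using exists_equiv_factor E hN hi
  refine ⟨fun a => c (x a), hx, fun a b => ⟨fun h => ?_, fun ⟨f⟩ => ?_⟩, fun γ =>
    ⟨fun ⟨a, ha⟩ => ?_, fun h => ?_⟩⟩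
  · obtain ⟨f⟩ := hx a
    obtain ⟨g⟩ := hx b
    have h' : c (x a) = c (x b) := h
    rw [← h'] at g
    exact ⟨f.trans g.symm⟩
  · obtain ⟨f₁⟩ := hx a
    obtain ⟨g⟩ := hx b
    exact hG _ _ ⟨f₁.symm.trans (f.trans g)⟩
  · rw [← ha]; simp
  · obtain ⟨y, -, rfl⟩ := Finset.mem_image.1 h
    obtain ⟨a, ⟨f⟩⟩ := exists_equiv_summand E hN hi y
    obtain ⟨g⟩ := hx a
    exact ⟨a, hG _ _ ⟨g.symm.trans f⟩⟩

include hG E in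
theorem classCount_eq [IsArtinian R M] [IsNoetherian R M] {p : ℕ}
    (h : HasIndecClassCount R (ModuleCat.of R M) p) : p = (Finset.univ.image c).card := by
  obtain ⟨k, N, hN, hi, q, hq, hqe⟩ := h
  obtain ⟨d, hd, hd2, hd3⟩ := exists_labels hG E hN hi
  obtain ⟨s, hs⟩ := hq.hasRightInverse
  have hinj : Function.Injective (d ∘ s) := fun y y' hy => by
    have := (hqe _ _).2 ((hd2 _ _).1 hy)
    rwa [hs, hs] at this
  have : Finset.univ.image (d ∘ s) = Finset.univ.image c := by
    ext γ
    rw [← hd3]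
    constructor
    · intro h
      obtain ⟨y, -, rfl⟩ := Finset.mem_image.1 h
      exact ⟨_, rfl⟩
    · rintro ⟨a, rfl⟩
      refine Finset.mem_image.2 ⟨q a, Finset.mem_univ _, ?_⟩
      exact (hd2 _ _).2 ((hqe _ _).1 (hs (q a)))
  rw [← this, Finset.card_image_of_injective _ hinj]
  simp

include hG E in
theorem basic_equiv [IsArtinian R M] [IsNoetherian R M]
    (h : IsBasicModuleCat R (ModuleCat.of R M)) :
    Nonempty (M ≃ₗ[R] ∀ γ : Finset.univ.image c, G γ) := by
  obtain ⟨k, N, hN, hi, hb⟩ := h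
  obtain ⟨d, hd, hd2, hd3⟩ := exists_labels hG E hN hi
  have hinj : Function.Injective d := fun a b hab => by
    by_contra hne
    exact (hb a b hne).false ((hd2 a b).1 hab).some
  let w : Fin k ≃ Finset.univ.image c := Equiv.ofBijective
    (fun a => ⟨d a, (hd3 _).1 ⟨a, rfl⟩⟩) ⟨fun a b hab => hinj (congrArg Subtype.val hab),
      fun ⟨γ, hγ⟩ => by
        obtain ⟨a, rfl⟩ := (hd3 γ).2 hγ
        exact ⟨a, rfl⟩⟩
  exact ⟨(internalEquiv N hN).trans ((LinearEquiv.piCongrRight fun a => (hd a).some).trans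
    (LinearEquiv.piCongrLeft R (fun γ : Finset.univ.image c => G γ) w))⟩

include hG in
theorem basic_and_count (S : Finset Γ) (E' : M ≃ₗ[R] ∀ γ : S, G γ) :
    IsBasicModuleCat R (ModuleCat.of R M) ∧ HasIndecClassCount R (ModuleCat.of R M) S.card := by
  let F : M ≃ₗ[R] ∀ a : Fin S.card, G (S.equivFin.symm a) :=
    E'.trans (LinearEquiv.piCongrLeft R (fun γ : S => G γ) S.equivFin.symm).symm
  have hN := piSummand_isInternal F
  have hi : ∀ a, IsIndecModule R (piSummand F a) := fun a =>
    (isIndecModule_of_isLocalRing (N := G (S.equivFin.symm a))).congr (piSummandEquiv F a)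
  have hne : ∀ a b, Nonempty (piSummand F a ≃ₗ[R] piSummand F b) → a = b := fun a b ⟨f⟩ => by
    have := hG _ _ ⟨(piSummandEquiv F a).trans (f.trans (piSummandEquiv F b).symm)⟩
    exact S.equivFin.symm.injective (Subtype.ext this)
  refine ⟨⟨_, _, hN, hi, fun a b hab => ⟨fun f => hab (hne a b ⟨f⟩)⟩⟩,
    ⟨_, _, hN, hi, id, Function.surjective_id, fun a b => ⟨?_, hne a b⟩⟩⟩
  rintro rfl
  exact ⟨LinearEquiv.refl _ _⟩

end Matching

section Extension

variable {R : Type} [Ring R] {P₁ P₀ M Q : Type} [AddCommGroup P₁] [AddCommGroup P₀]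
  [AddCommGroup M] [AddCommGroup Q] [Module R P₁] [Module R P₀] [Module R M] [Module R Q]

/-- If maps `P₁ → M` extend along a projective presentation of `M`, then maps from the kernel of
any projective cover-like map `Q → M` to quotients of `M` extend to `Q`. -/
theorem exists_extension_of_presentation [Module.Projective R P₁] [Module.Projective R P₀]
    [Module.Projective R Q] (f : P₁ →ₗ[R] P₀) (g : P₀ →ₗ[R] M) (hg : Function.Surjective g)
    (hfg : LinearMap.range f = LinearMap.ker g)
    (hext : ∀ h : P₁ →ₗ[R] M, ∃ h' : P₀ →ₗ[R] M, h = h'.comp f)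
    (q : Q →ₗ[R] M) (hq : Function.Surjective q) (S : Submodule R M)
    (θ : LinearMap.ker q →ₗ[R] M ⧸ S) :
    ∃ h' : Q →ₗ[R] M, ∀ x : LinearMap.ker q, S.mkQ (h' x) = θ x := by
  obtain ⟨ψ, hψ⟩ := Module.projective_lifting_property q g hq
  obtain ⟨p, hp⟩ := Module.projective_lifting_property g q hg
  have hψ' : ∀ x, q (ψ x) = g x := fun x => LinearMap.congr_fun hψ x
  have hp' : ∀ x, g (p x) = q x := fun x => LinearMap.congr_fun hp x
  have hgf : ∀ x, g (f x) = 0 := fun x => by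
    have : f x ∈ LinearMap.ker g := hfg ▸ LinearMap.mem_range_self f x
    exact this
  let a : P₁ →ₗ[R] LinearMap.ker q := (ψ.comp f).codRestrict _ fun x => by
    simp [hψ', hgf]
  obtain ⟨k, hk⟩ := Module.projective_lifting_property S.mkQ (θ.comp a) S.mkQ_surjective
  obtain ⟨k', rfl⟩ := hext k
  let b : Q →ₗ[R] LinearMap.ker q := (ψ.comp p - LinearMap.id).codRestrict _ fun x => by
    simp [hψ', hp']
  obtain ⟨l, hl⟩ := Module.projective_lifting_property S.mkQ (θ.comp b) S.mkQ_surjective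
  refine ⟨k'.comp p - l, fun x => ?_⟩
  have hx : p x ∈ LinearMap.range f := by rw [hfg]; simp [hp']
  obtain ⟨t, ht⟩ := hx
  have h1 : S.mkQ (k' (f t)) = θ (a t) := LinearMap.congr_fun hk t
  have h2 : S.mkQ (l x) = θ (b x) := LinearMap.congr_fun hl x
  have h3 : a t - b x = x := by
    ext
    simp [a, b, ht]
  rw [LinearMap.sub_apply, LinearMap.comp_apply, map_sub, ← ht, h1, h2, ← map_sub, h3]

end Extension

namespace Pointed

variable {K R : Type} [Field K] [Ring R] [Algebra K R] (D : Pointed K R)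

section Minimal

variable {M : Type} [AddCommGroup M] [Module R M]

theorem exists_homogeneous_family [Module.Finite R M] : ∃ (n : ℕ) (v : Fin n → Fin 2)
    (m : Fin n → M), (∀ k, D.e (v k) • m k = m k) ∧ Submodule.span R (Set.range m) = ⊤ := by
  obtain ⟨n, s, hs⟩ := Module.Finite.exists_fin (R := R) (M := M)
  refine ⟨n * 2, fun k => (finProdFinEquiv.symm k).2,
    fun k => D.e (finProdFinEquiv.symm k).2 • s (finProdFinEquiv.symm k).1,
    fun k => D.ee_smul _ _, ?_⟩
  rw [eq_top_iff, ← hs, Submodule.span_le]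
  rintro _ ⟨k, rfl⟩
  rw [← D.e_decomp (s k)]
  refine Submodule.add_mem _ (Submodule.subset_span ⟨finProdFinEquiv (k, 0), ?_⟩)
    (Submodule.subset_span ⟨finProdFinEquiv (k, 1), ?_⟩) <;> simp

/-- Minimal homogeneous generating families. -/
theorem exists_minimal_family [Module.Finite R M] : ∃ (n : ℕ) (v : Fin n → Fin 2)
    (m : Fin n → M), (∀ k, D.e (v k) • m k = m k) ∧ Submodule.span R (Set.range m) = ⊤ ∧
      ∀ y : Fin n → R, ∑ k, y k • m k = 0 → ∀ k, y k * D.e (v k) ∈ D.J := by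
  classical
  have hex := D.exists_homogeneous_family (M := M)
  obtain ⟨v, m, hv, hm⟩ := Nat.find_spec hex
  refine ⟨_, v, m, hv, hm, fun y hy k => ?_⟩
  by_contra hk
  obtain ⟨n, hn⟩ : ∃ n, Nat.find hex = n + 1 :=
    Nat.exists_eq_succ_of_ne_zero (Nat.ne_zero_of_lt k.2)
  refine Nat.find_min hex (m := n) (by omega) ?_
  generalize Nat.find hex = N at *
  subst hn
  refine ⟨v ∘ k.succAbove, m ∘ k.succAbove, fun _ => hv _, D.nakayama_sup _ ?_⟩
  set C := Submodule.span R (Set.range (m ∘ k.succAbove)) with hC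
  have hother : ∀ l, m (k.succAbove l) ∈ C := fun l => Submodule.subset_span ⟨l, rfl⟩
  set c := D.top (y k * D.e (v k)) (v k) with hc
  have h1 : y k * D.e (v k) - algebraMap K R c * D.e (v k) ∈ D.J :=
    D.corner_sub_mem (by rw [mul_assoc, D.idem])
  have hc0 : c ≠ 0 := fun h0 => hk (by rw [h0] at h1; simpa using h1)
  rw [Fin.sum_univ_succAbove _ k] at hy
  have h2 : m k ∈ C ⊔ D.J • (⊤ : Submodule R M) := by
    have h3 : algebraMap K R c • m k = (- ∑ l, y (k.succAbove l) • m (k.succAbove l)) +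
        -((y k * D.e (v k) - algebraMap K R c * D.e (v k)) • m k) := by
      rw [sub_smul, mul_smul, mul_smul, hv, ← eq_neg_of_add_eq_zero_left hy]
      abel
    have h4 : algebraMap K R c • m k ∈ C ⊔ D.J • (⊤ : Submodule R M) := by
      rw [h3]
      exact Submodule.add_mem_sup
        (neg_mem (Submodule.sum_mem _ fun l _ => Submodule.smul_mem _ _ (hother l)))
        (neg_mem (Submodule.smul_mem_smul h1 trivial))
    have h5 := Submodule.smul_mem _ (algebraMap K R c⁻¹) h4
    rwa [← mul_smul, ← map_mul, inv_mul_cancel₀ hc0, map_one, one_smul] at h5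
  rw [← hm, Submodule.span_le]
  rintro _ ⟨l, rfl⟩
  by_cases hl : l = k
  · rw [hl]; rw [hm]; exact h2
  · obtain ⟨l', rfl⟩ := Fin.exists_succAbove_eq hl
    exact Submodule.mem_sup_left (hother l')

/-- Minimal homogeneous presentations. -/
theorem exists_minimal_pres [Module.Finite R M] : ∃ (n p : ℕ) (v : Fin n → Fin 2)
    (u : Fin p → Fin 2) (m : Fin n → M) (F : Matrix (Fin p) (Fin n) R), D.Pres v u m F ∧
      (∀ r k, F r k ∈ D.J) ∧ ∀ b : Fin p → R, (∀ k, ∑ r, b r * F r k = 0) →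
        ∀ r, b r * D.e (u r) ∈ D.J := by
  obtain ⟨n, v, m, hv, hm, hmin⟩ := D.exists_minimal_family (M := M)
  let S : Submodule R (Fin n → R) :=
    { carrier := {y | (∀ k, y k * D.e (v k) = y k) ∧ ∑ k, y k • m k = 0}
      add_mem' := fun {x y} hx hy => ⟨fun k => by simp [add_mul, hx.1, hy.1], by
        simp [add_smul, Finset.sum_add_distrib, hx.2, hy.2]⟩
      zero_mem' := by simp
      smul_mem' := fun c y hy => ⟨fun k => by simp [mul_assoc, hy.1], by
        simp [mul_smul, ← Finset.smul_sum, hy.2]⟩ }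
  have := D.isNoetherian
  obtain ⟨p, u, F, hu, hF, hFmin⟩ := D.exists_minimal_family (M := S)
  have hs : ∀ (b : Fin p → R) k, ((∑ r, b r • F r : S) : Fin n → R) k =
      ∑ r, b r * (F r : Fin n → R) k := fun b k => by
    simp [Finset.sum_apply]
  refine ⟨n, p, v, u, m, Matrix.of fun r => (F r : Fin n → R), ⟨?_, ?_, hv, hm, ?_, ?_⟩, ?_, ?_⟩
  · intro r k
    exact congrFun (congrArg Subtype.val (hu r)) k
  · intro r k
    exact (F r).2.1 k
  · ext r
    exact (F r).2.2
  · intro y hy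
    have hy' : (fun k => y k * D.e (v k)) ∈ S :=
      ⟨fun k => by rw [mul_assoc, D.idem], by simpa [mul_smul, hv] using hy⟩
    obtain ⟨b, hb⟩ := exists_sum_of_span hF ⟨_, hy'⟩
    refine ⟨b, fun k => ?_⟩
    have := hs b k
    rw [hb] at this
    exact this
  · intro r k
    rw [Matrix.of_apply, ← (F r).2.1 k]
    exact hmin _ (F r).2.2 k
  · intro b hb
    refine hFmin b (Subtype.ext (funext fun k => ?_))
    rw [hs]
    exact hb k

end Minimal

section TauRigid

variable {D}
variable {κ ι M : Type} [Fintype κ] [Fintype ι] [AddCommGroup M] [Module R M]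
variable {v : κ → Fin 2} {u : ι → Fin 2} {m : κ → M} {F : Matrix ι κ R}

theorem Pres.crit_of_tauRigid (h : D.Pres v u m F)
    (hmin : ∀ b : ι → R, (∀ k, ∑ r, b r * F r k = 0) → ∀ r, b r * D.e (u r) ∈ D.J)
    (hM : IsTauRigidCat R (ModuleCat.of R M)) : D.Crit u F M := by
  classical
  intro n hn
  obtain ⟨-, P₁, P₀, f, g, -, _, -, _, hg, hfg, hext⟩ := hM
  let L : (ι → R) →ₗ[R] (κ → R) := Fintype.linearCombination R fun r k => F r k
  let H : (ι → R) →ₗ[R] M := Fintype.linearCombination R n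
  let q : (κ → R) →ₗ[R] M := Fintype.linearCombination R m
  have hL : ∀ b k, L b k = ∑ r, b r * F r k := fun b k => by
    simp [L, Fintype.linearCombination_apply, Finset.sum_apply]
  let E : (κ → R) →ₗ[R] (κ → R) :=
    { toFun := fun y k => y k * D.e (v k)
      map_add' := fun x y => by ext k; simp [add_mul]
      map_smul' := fun c y => by ext k; simp [mul_assoc] }
  have hE : ∀ x : LinearMap.ker q, E x ∈ LinearMap.range L := fun x => by
    obtain ⟨b, hb⟩ := h.exact x x.2
    refine ⟨b, ?_⟩
    ext k
    rw [hL]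
    exact (hb k).symm
  let S : Submodule R M := (LinearMap.ker L).map H
  let θ₀ : LinearMap.range L →ₗ[R] M ⧸ S :=
    ((LinearMap.ker L).liftQ (S.mkQ.comp H) fun x hx => by
      rw [LinearMap.mem_ker, LinearMap.comp_apply, Submodule.mkQ_apply,
        Submodule.Quotient.mk_eq_zero]
      exact ⟨x, hx, rfl⟩).comp L.quotKerEquivRange.symm.toLinearMap
  have hθ₀ : ∀ b, θ₀ ⟨L b, LinearMap.mem_range_self L b⟩ = S.mkQ (H b) := fun b => by
    have : L.quotKerEquivRange.symm ⟨L b, LinearMap.mem_range_self L b⟩ =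
        Submodule.Quotient.mk b := by
      rw [LinearEquiv.symm_apply_eq]
      rfl
    simp only [θ₀, LinearMap.comp_apply, LinearEquiv.coe_coe, this]
    rfl
  have hq : Function.Surjective q := fun x => by
    obtain ⟨y, hy⟩ := exists_sum_of_span h.span x
    exact ⟨y, by simpa [q, Fintype.linearCombination_apply] using hy⟩
  obtain ⟨h', hh'⟩ := exists_extension_of_presentation f g hg hfg hext q hq S
    (θ₀.comp ((E.comp (LinearMap.ker q).subtype).codRestrict _ hE))
  have hrow : ∀ r, n r - act F (fun k => h' (Pi.single k 1)) r ∈ S := by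
    intro r
    have hFr : (fun k => F r k) ∈ LinearMap.ker q := by
      rw [LinearMap.mem_ker]
      exact (Fintype.linearCombination_apply R m _).trans (congrFun h.rel r)
    have h1 := hh' ⟨_, hFr⟩
    have h2 : E (fun k => F r k) = L (Pi.single r 1) := by
      ext k
      rw [hL]
      simp only [E, LinearMap.coe_mk, AddHom.coe_mk, h.right]
      rw [Finset.sum_eq_single r] <;> simp +contextual
    have h3 : (⟨E (fun k => F r k), hE ⟨_, hFr⟩⟩ : LinearMap.range L) =
      ⟨L (Pi.single r 1), LinearMap.mem_range_self L _⟩ := Subtype.ext h2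
    rw [LinearMap.comp_apply] at h1
    have h4 := h1.trans ((congrArg θ₀ h3).trans (hθ₀ _))
    have h5 : H (Pi.single r 1) = n r := by
      simp [H]
    have h6 : h' (fun k => F r k) = act F (fun k => h' (Pi.single k 1)) r := by
      rw [act_apply]
      conv_lhs => rw [pi_eq_sum_univ (fun k => F r k)]
      rw [map_sum]
      refine Finset.sum_congr rfl fun k _ => ?_
      rw [map_smul]
      congr 2
      ext l
      simp [Pi.single_apply, eq_comm]
    rw [h5, h6] at h4
    exact (Submodule.Quotient.eq S).1 h4.symm
  set n' : ι → M := fun r => n r - act F (fun k => h' (Pi.single k 1)) r with hn'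
  have hne : ∀ r, D.e (u r) • n' r = n' r := fun r => by
    simp only [hn', smul_sub, hn, act_apply, Finset.smul_sum, ← mul_smul, h.left]
  have hS : S = ⊥ := by
    apply D.nakayama
    rintro _ ⟨b, hb, rfl⟩
    have hb' : ∀ k, ∑ r, b r * F r k = 0 := fun k => by
      rw [← hL]
      exact congrFun hb k
    have : H b = ∑ r, (b r * D.e (u r)) • n' r := by
      simp only [mul_smul, hne]
      simp only [hn', smul_sub, Finset.sum_sub_distrib, act_apply, Finset.smul_sum]
      rw [Finset.sum_comm (f := fun r k => b r • F r k • h' (Pi.single k 1))]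
      simp only [← mul_smul, ← Finset.sum_smul, hb', zero_smul, Finset.sum_const_zero, sub_zero]
      simp [H, Fintype.linearCombination_apply]
    rw [this]
    exact Submodule.sum_mem _ fun r _ => Submodule.smul_mem_smul (hmin b hb' r) (hrow r)
  refine ⟨fun k => h' (Pi.single k 1), ?_⟩
  ext r
  have := hrow r
  rw [hS, Submodule.mem_bot, sub_eq_zero] at this
  exact this.symm

theorem Pres.presilting (h : D.Pres v u m F) (hc : D.Crit u F M) (H : Matrix ι κ R)
    (hl : ∀ r k, D.e (u r) * H r k = H r k) (hr : ∀ r k, H r k * D.e (v k) = H r k) :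
    ∃ (A : Matrix κ κ R) (B : Matrix ι ι R), (∀ k l, D.e (v k) * A k l = A k l) ∧
      (∀ k l, A k l * D.e (v l) = A k l) ∧ (∀ r s, D.e (u r) * B r s = B r s) ∧
      (∀ r s, B r s * D.e (u s) = B r s) ∧ H = F * A + B * F := by
  obtain ⟨h', hh'⟩ := hc (act H m) fun r => by
    simp only [act_apply, Finset.smul_sum, ← mul_smul, hl]
  choose A hA using fun k => exists_sum_of_span h.span (h' k)
  let A' : Matrix κ κ R := Matrix.of fun k l => D.e (v k) * A k l * D.e (v l)
  have hFA : act F (act A' m) = act H m := by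
    rw [← hh']
    ext r
    refine Finset.sum_congr rfl fun k _ => ?_
    rw [← h.right, mul_smul, mul_smul (F r k)]
    congr 1
    simp only [A', act_apply, Matrix.of_apply, mul_smul, h.gen]
    rw [← Finset.smul_sum, hA, D.ee_smul]
  have hz : ∀ r, ∑ k, (H - F * A') r k • m k = 0 := fun r => by
    have h1 := congrFun hFA r
    rw [← act_mul] at h1
    simp only [act_apply] at h1
    simp only [Matrix.sub_apply, sub_smul, Finset.sum_sub_distrib, h1, sub_self]
  choose B hB using fun r => h.exact _ (hz r)
  let B' : Matrix ι ι R := Matrix.of fun r s => D.e (u r) * B r s * D.e (u s)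
  refine ⟨A', B', fun k l => ?_, fun k l => ?_, fun r s => ?_, fun r s => ?_, ?_⟩
  · simp only [A', Matrix.of_apply, ← mul_assoc, D.idem]
  · simp only [A', Matrix.of_apply, mul_assoc, D.idem]
  · simp only [B', Matrix.of_apply, ← mul_assoc, D.idem]
  · simp only [B', Matrix.of_apply, mul_assoc, D.idem]
  · rw [← sub_eq_iff_eq_add']
    ext r k
    have hl' : D.e (u r) * (H - F * A') r k = (H - F * A') r k := by
      simp only [Matrix.sub_apply, Matrix.mul_apply, mul_sub, Finset.mul_sum, ← mul_assoc, hl,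
        h.left]
    have hr' : (H - F * A') r k * D.e (v k) = (H - F * A') r k := by
      simp only [Matrix.sub_apply, Matrix.mul_apply, sub_mul, Finset.sum_mul, mul_assoc, hr]
      simp only [A', Matrix.of_apply, mul_assoc, D.idem]
    rw [← hl', ← hr', hB, Matrix.mul_apply, Finset.mul_sum]
    refine Finset.sum_congr rfl fun s _ => ?_
    simp only [B', Matrix.of_apply, mul_assoc, h.left]

theorem ne_of_presilting [DecidableEq κ] [DecidableEq ι] (hF : ∀ r k, F r k ∈ D.J)
    (hp : ∀ H : Matrix ι κ R, (∀ r k, D.e (u r) * H r k = H r k) →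
      (∀ r k, H r k * D.e (v k) = H r k) →
      ∃ (A : Matrix κ κ R) (B : Matrix ι ι R), H = F * A + B * F) (r : ι) (k : κ) :
    u r ≠ v k := by
  intro hrk
  obtain ⟨A, B, hAB⟩ := hp (Matrix.single r k (D.e (u r)))
    (fun r' k' => by
      by_cases h : r' = r ∧ k' = k
      · obtain ⟨rfl, rfl⟩ := h; simp [D.idem]
      · rw [Matrix.single_apply_of_ne]; simp; tauto)
    (fun r' k' => by
      by_cases h : r' = r ∧ k' = k
      · obtain ⟨rfl, rfl⟩ := h; simp [hrk, D.idem]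
      · rw [Matrix.single_apply_of_ne]; simp; tauto)
  have h1 := congrFun (congrFun hAB r) k
  rw [Matrix.single_apply_same] at h1
  have h2 : D.e (u r) ∈ D.J := by
    rw [h1, Matrix.add_apply, Matrix.mul_apply, Matrix.mul_apply]
    exact add_mem (sum_mem fun l _ => D.J_mul_mem (hF _ _) _)
      (sum_mem fun l _ => D.J.mul_mem_left _ (hF _ _))
  rw [mem_J] at h2
  have := D.top_e_apply (u r) (u r)
  rw [h2] at this
  simp at this

end TauRigid

/-- The matrix form of rigidity for presentations with generators at `j` and relations
at `i`. -/
def Presilting {κ ι : Type} [Fintype κ] [Fintype ι] (i j : Fin 2) (F : Matrix ι κ R) : Prop :=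
  ∀ H : Matrix ι κ R, (∀ r k, D.e i * H r k = H r k) → (∀ r k, H r k * D.e j = H r k) →
    ∃ (A : Matrix κ κ R) (B : Matrix ι ι R), (∀ k l, D.e j * A k l = A k l) ∧
      (∀ k l, A k l * D.e j = A k l) ∧ (∀ r s, D.e i * B r s = B r s) ∧
      (∀ r s, B r s * D.e i = B r s) ∧ H = F * A + B * F

/-- Shape of the minimal presentations of τ-rigid modules. -/
theorem tauRigid_cases {M : Type} [AddCommGroup M] [Module R M]
    (hM : IsTauRigidCat R (ModuleCat.of R M)) :
    (∃ (n : ℕ) (v : Fin n → Fin 2) (m : Fin n → M),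
      D.Pres v (fun x : Empty => x.elim) m (noRel R (Fin n))) ∨
    ∃ (i j : Fin 2) (n p : ℕ) (m : Fin n → M) (F : Matrix (Fin p) (Fin n) R), i ≠ j ∧
      D.Pres (fun _ => j) (fun _ => i) m F ∧ D.Presilting i j F := by
  have : Module.Finite R M := hM.1
  obtain ⟨n, p, v, u, m, F, h, hF, hmin⟩ := D.exists_minimal_pres (M := M)
  have hs := h.presilting (h.crit_of_tauRigid hmin hM)
  have hne := ne_of_presilting (D := D) (u := u) (v := v) hF fun H h1 h2 => by
    obtain ⟨A, B, -, -, -, -, h⟩ := hs H h1 h2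
    exact ⟨A, B, h⟩
  by_cases hp : IsEmpty (Fin p) ∨ IsEmpty (Fin n)
  · refine Or.inl ⟨n, v, m, ⟨fun r => r.elim, fun r => r.elim, h.gen, h.span,
      funext fun r => r.elim, fun y hy => ⟨fun r => r.elim, fun k => ?_⟩⟩⟩
    rcases hp with hp | hn
    · obtain ⟨b, hb⟩ := h.exact y hy
      rw [hb]; simp
    · exact hn.elim k
  · simp only [not_or, not_isEmpty_iff] at hp
    obtain ⟨⟨r₀⟩, ⟨k₀⟩⟩ := hp
    have hv : v = fun _ => v k₀ := by
      ext k
      have := hne r₀ k₀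
      have := hne r₀ k
      omega
    have hu : u = fun _ => u r₀ := by
      ext r
      have := hne r₀ k₀
      have := hne r k₀
      omega
    refine Or.inr ⟨u r₀, v k₀, n, p, m, F, hne _ _, hv ▸ hu ▸ h, ?_⟩
    intro H h1 h2
    have h3 := hs H (fun r k => by rw [hu]; exact h1 r k) (fun r k => by rw [hv]; exact h2 r k)
    rw [hu, hv] at h3
    exact h3

end Pointed

section NormalForms

variable {K : Type} [Field K]

/-- A surjective linear map is a projection in suitable coordinates. -/
theorem exists_splitting {V W : Type} [AddCommGroup V] [AddCommGroup W] [Module K V] [Module K W]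
    (f : V →ₗ[K] W) (hf : Function.Surjective f) :
    ∃ E : V ≃ₗ[K] W × LinearMap.ker f, (∀ x, (E x).1 = f x) ∧ ∀ x, E.symm (0, x) = x := by
  obtain ⟨p, hp⟩ := (LinearMap.ker f).subtype.exists_leftInverse_of_injective
    (Submodule.ker_subtype _)
  have hp' : ∀ x, p (x : LinearMap.ker f) = x := fun x => LinearMap.congr_fun hp x
  have hb : Function.Bijective (f.prod p) := by
    constructor
    · rw [← LinearMap.ker_eq_bot, LinearMap.ker_eq_bot']
      intro x hx
      obtain ⟨h1, h2⟩ := Prod.mk.inj hx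
      have h3 := hp' ⟨x, h1⟩
      rw [show p x = 0 from h2] at h3
      exact (congrArg Subtype.val h3).symm
    · rintro ⟨w, u⟩
      obtain ⟨x, rfl⟩ := hf w
      refine ⟨x + (u - p x : LinearMap.ker f), ?_⟩
      have : ∀ y : LinearMap.ker f, f y = 0 := fun y => y.2
      ext <;> simp [hp', this]
  refine ⟨LinearEquiv.ofBijective _ hb, fun x => rfl, fun x => ?_⟩
  rw [LinearEquiv.symm_apply_eq]
  have : f x = 0 := x.2
  ext <;> simp [hp', this]

/-- Coordinates on a finite dimensional space. -/
theorem exists_coordinates (V : Type) [AddCommGroup V] [Module K V] [FiniteDimensional K V] :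
    ∃ n : ℕ, Nonempty (V ≃ₗ[K] (Fin n → K)) :=
  ⟨_, ⟨(Module.finBasis K V).equivFun⟩⟩

variable {ρ κ : Type} [Fintype ρ] [Fintype κ] [DecidableEq ρ] [DecidableEq κ]

/-- A matrix with independent rows can be brought to the form `[1 0]` by column operations. -/
theorem exists_normal_form_of_independent (F : Matrix ρ κ K)
    (hF : Function.Surjective F.mulVec) :
    ∃ (n : ℕ) (Q : Matrix κ (ρ ⊕ Fin n) K) (Q' : Matrix (ρ ⊕ Fin n) κ K),
      Q * Q' = 1 ∧ Q' * Q = 1 ∧ F * Q = Matrix.fromCols 1 0 := by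
  obtain ⟨E, hE, -⟩ := exists_splitting F.mulVecLin hF
  obtain ⟨n, ⟨c⟩⟩ := exists_coordinates (K := K) (LinearMap.ker F.mulVecLin)
  let Φ : (κ → K) ≃ₗ[K] (ρ ⊕ Fin n → K) :=
    (E.trans (LinearEquiv.prodCongr (LinearEquiv.refl K _) c)).trans
      (LinearEquiv.sumArrowLequivProdArrow ρ (Fin n) K K).symm
  have hΦ : ∀ x r, Φ x (Sum.inl r) = F.mulVec x r := fun x r => by
    simp [Φ, hE]
  refine ⟨n, LinearMap.toMatrix' Φ.symm.toLinearMap, LinearMap.toMatrix' Φ.toLinearMap, ?_, ?_, ?_⟩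
  · rw [← LinearMap.toMatrix'_comp]; simp
  · rw [← LinearMap.toMatrix'_comp]; simp
  · apply Matrix.toLin'.injective
    ext1 x
    ext
    rw [Matrix.toLin'_mul, Matrix.toLin'_toMatrix']
    simp only [LinearMap.comp_apply, LinearMap.single_apply, Matrix.toLin'_apply,
      LinearEquiv.coe_coe]
    rw [← hΦ, LinearEquiv.apply_symm_apply]
    rcases x with x | x <;> simp [Pi.single_apply, Matrix.one_apply]

/-- Simultaneous normal form of two matrices, the first surjective and the second injective on
the kernel of the first. -/
theorem exists_normal_form_of_injOn (F G : Matrix ρ κ K) (hF : Function.Surjective F.mulVec)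
    (hG : ∀ w, F.mulVec w = 0 → G.mulVec w = 0 → w = 0) :
    ∃ (t s : ℕ) (P : Matrix (Fin t ⊕ Fin s) ρ K) (P' : Matrix ρ (Fin t ⊕ Fin s) K)
      (Q : Matrix κ (Fin t ⊕ (Fin t ⊕ Fin s)) K) (Q' : Matrix (Fin t ⊕ (Fin t ⊕ Fin s)) κ K)
      (C : Matrix (Fin t ⊕ Fin s) (Fin t ⊕ Fin s) K),
      P * P' = 1 ∧ P' * P = 1 ∧ Q * Q' = 1 ∧ Q' * Q = 1 ∧
      P * F * Q = Matrix.fromCols 0 1 ∧ P * G * Q = Matrix.fromCols (Matrix.fromRows 1 0) C := by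
  obtain ⟨E, hE, hE'⟩ := exists_splitting F.mulVecLin hF
  obtain ⟨t, ⟨c⟩⟩ := exists_coordinates (K := K) (LinearMap.ker F.mulVecLin)
  let g : (Fin t → K) →ₗ[K] (ρ → K) :=
    G.mulVecLin.comp ((LinearMap.ker F.mulVecLin).subtype.comp c.symm.toLinearMap)
  have hg : Function.Injective g := by
    rw [← LinearMap.ker_eq_bot, LinearMap.ker_eq_bot']
    intro x hx
    have h2 := hG (c.symm x) (c.symm x).2 hx
    simpa using h2
  obtain ⟨p, hp⟩ := g.exists_leftInverse_of_injective (LinearMap.ker_eq_bot.2 hg)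
  have hp' : ∀ x, p (g x) = x := fun x => LinearMap.congr_fun hp x
  obtain ⟨s, ⟨c₂⟩⟩ := exists_coordinates (K := K) (LinearMap.ker p)
  let q : (ρ → K) →ₗ[K] LinearMap.ker p :=
    (LinearMap.id - g.comp p).codRestrict _ fun x => by simp [hp']
  have hb : Function.Bijective (p.prod (c₂.toLinearMap.comp q)) := by
    constructor
    · rw [← LinearMap.ker_eq_bot, LinearMap.ker_eq_bot']
      intro x hx
      obtain ⟨h1, h2⟩ := Prod.mk.inj hx
      have h3 : q x = 0 := c₂.injective (by rw [map_zero]; exact h2)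
      have h4 := congrArg Subtype.val h3
      have h5 : x - g (p x) = 0 := h4
      rw [show p x = 0 from h1, map_zero, sub_zero] at h5
      exact h5
    · rintro ⟨x, y⟩
      refine ⟨g x + (c₂.symm y : LinearMap.ker p), ?_⟩
      have h0 : p (c₂.symm y : LinearMap.ker p) = 0 := (c₂.symm y).2
      have h1 : q (g x + (c₂.symm y : LinearMap.ker p)) = c₂.symm y := by
        ext1
        change (g x + (c₂.symm y : LinearMap.ker p)) -
          g (p (g x + (c₂.symm y : LinearMap.ker p))) = _
        rw [map_add, h0, hp', add_zero, add_sub_cancel_left]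
      have h2 : p (g x + (c₂.symm y : LinearMap.ker p)) = x := by
        rw [map_add, h0, hp', add_zero]
      exact Prod.ext h2 (by
        change c₂ (q _) = y
        rw [h1, LinearEquiv.apply_symm_apply])
  let Ψ : (ρ → K) ≃ₗ[K] (Fin t ⊕ Fin s → K) := (LinearEquiv.ofBijective _ hb).trans
    (LinearEquiv.sumArrowLequivProdArrow (Fin t) (Fin s) K K).symm
  have hΨ : ∀ x, Ψ (g x) = Sum.elim x 0 := fun x => by
    have h1 : q (g x) = 0 := by
      ext1
      change g x - g (p (g x)) = 0
      rw [hp', sub_self]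
    ext (r | r)
    · simp [Ψ, hp']
    · simp [Ψ, h1]
  let Φ : (κ → K) ≃ₗ[K] (Fin t ⊕ (Fin t ⊕ Fin s) → K) :=
    ((E.trans (LinearEquiv.prodCongr Ψ c)).trans (LinearEquiv.prodComm K _ _)).trans
      (LinearEquiv.sumArrowLequivProdArrow (Fin t) (Fin t ⊕ Fin s) K K).symm
  have hΦ : ∀ x r, Φ x (Sum.inr r) = Ψ (F.mulVec x) r := fun x r => by
    simp [Φ, hE]
  have hΦ' : ∀ x, Φ.symm (Sum.elim x 0) = c.symm x := fun x => by
    rw [LinearEquiv.symm_apply_eq]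
    have h1 : E (c.symm x : LinearMap.ker F.mulVecLin) = (0, c.symm x) :=
      ((E.symm_apply_eq).1 (hE' _)).symm
    ext (r | r) <;> simp [Φ, h1]
  have h1 : ∀ A : Matrix ρ κ K, Matrix.toLin' (LinearMap.toMatrix' Ψ.toLinearMap * A *
      LinearMap.toMatrix' Φ.symm.toLinearMap) =
      Ψ.toLinearMap.comp (A.mulVecLin.comp Φ.symm.toLinearMap) := fun A => by
    rw [Matrix.mul_assoc, Matrix.toLin'_mul, Matrix.toLin'_mul, Matrix.toLin'_toMatrix',
      Matrix.toLin'_toMatrix']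
    rfl
  refine ⟨t, s, LinearMap.toMatrix' Ψ.toLinearMap, LinearMap.toMatrix' Ψ.symm.toLinearMap,
    LinearMap.toMatrix' Φ.symm.toLinearMap, LinearMap.toMatrix' Φ.toLinearMap,
    (LinearMap.toMatrix' Ψ.toLinearMap * G * LinearMap.toMatrix' Φ.symm.toLinearMap).submatrix
      id Sum.inr, ?_, ?_, ?_, ?_, ?_, ?_⟩
  · rw [← LinearMap.toMatrix'_comp]; simp
  · rw [← LinearMap.toMatrix'_comp]; simp
  · rw [← LinearMap.toMatrix'_comp]; simp
  · rw [← LinearMap.toMatrix'_comp]; simp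
  · apply Matrix.toLin'.injective
    rw [h1]
    ext1 x
    ext r
    simp only [LinearMap.comp_apply, LinearMap.single_apply, Matrix.toLin'_apply,
      LinearEquiv.coe_coe, Matrix.mulVecLin_apply]
    rw [← hΦ, LinearEquiv.apply_symm_apply]
    rcases x with x | x <;> simp [Pi.single_apply, Matrix.one_apply, eq_comm]
  · ext r (x | x)
    · have h2 := LinearMap.congr_fun (h1 G) (Pi.single (Sum.inl x) 1)
      rw [Matrix.toLin'_apply, Matrix.mulVec_single_one] at h2
      have h3 := congrFun h2 r
      rw [Matrix.col_apply] at h3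
      rw [h3]
      have h4 : (Pi.single (Sum.inl x) 1 : Fin t ⊕ (Fin t ⊕ Fin s) → K) =
          Sum.elim (Pi.single x 1) 0 := by
        ext (y | y) <;> simp [Pi.single_apply]
      simp only [LinearMap.comp_apply, LinearEquiv.coe_coe]
      rw [h4, hΦ']
      change Ψ (g (Pi.single x 1)) r = _
      rw [hΨ]
      rcases r with r | r <;> simp [Pi.single_apply, Matrix.one_apply]
    · rfl

end NormalForms

section Separation

variable {K : Type} [Field K] {ρ κ : Type} [Fintype ρ] [Fintype κ]

/-- A proper subspace is contained in a hyperplane. -/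
theorem exists_dotProduct_of_notMem (S : Submodule K (ρ → K)) {x : ρ → K} (hx : x ∉ S) :
    ∃ v : ρ → K, v ⬝ᵥ x ≠ 0 ∧ ∀ y ∈ S, v ⬝ᵥ y = 0 := by
  classical
  obtain ⟨f, hf, hS⟩ := Submodule.exists_le_ker_of_notMem hx
  have : ∀ y, (fun r => f (Pi.single r 1)) ⬝ᵥ y = f y := fun y => by
    conv_rhs => rw [pi_eq_sum_univ' y]
    simp [dotProduct, mul_comm]
  exact ⟨fun r => f (Pi.single r 1), by rw [this]; exact hf, fun y hy => by
    rw [this]; exact hS hy⟩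

theorem mulVec_surjective_of_vecMul (F : Matrix ρ κ K) (h : ∀ v, Matrix.vecMul v F = 0 → v = 0) :
    Function.Surjective F.mulVec := by
  intro x
  by_contra hx
  obtain ⟨v, h1, h2⟩ := exists_dotProduct_of_notMem (LinearMap.range F.mulVecLin) (x := x)
    (by rintro ⟨y, hy⟩; exact hx ⟨y, hy⟩)
  refine h1 ?_
  rw [h v, zero_dotProduct]
  classical
  ext k
  have := h2 _ ⟨Pi.single k 1, rfl⟩
  rw [Matrix.mulVecLin_apply, Matrix.dotProduct_mulVec] at this
  simpa using this

theorem exists_left_inverse (F : Matrix ρ κ K) [DecidableEq κ] (h : ∀ w, F.mulVec w = 0 → w = 0) :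
    ∃ S : Matrix κ ρ K, S * F = 1 := by
  have hs := mulVec_surjective_of_vecMul F.transpose fun v hv => h v (by
    rwa [Matrix.vecMul_transpose] at hv)
  choose g hg using hs
  refine ⟨Matrix.of fun k => g (Pi.single k 1), ?_⟩
  ext k l
  have := congrFun (hg (Pi.single k 1)) l
  rw [Matrix.mulVec_transpose] at this
  rw [Matrix.one_apply]
  refine Eq.trans ?_ (this.trans ?_)
  · rfl
  · simp [Pi.single_apply, eq_comm]

/-- Two-sided rigidity of a matrix forces it to be injective on one side. -/
theorem injective_or_of_rigid (F : Matrix ρ κ K)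
    (h : ∀ G : Matrix ρ κ K, ∃ (A : Matrix κ κ K) (B : Matrix ρ ρ K), G = F * A + B * F) :
    (∀ v, Matrix.vecMul v F = 0 → v = 0) ∨ ∀ w, F.mulVec w = 0 → w = 0 := by
  classical
  by_contra! hc
  obtain ⟨⟨v, hv, hv0⟩, w, hw, hw0⟩ := hc
  obtain ⟨r, hr⟩ := Function.ne_iff.1 hv0
  obtain ⟨k, hk⟩ := Function.ne_iff.1 hw0
  obtain ⟨A, B, hG⟩ := h (Matrix.single r k 1)
  have h1 : v ⬝ᵥ (Matrix.single r k (1 : K)).mulVec w = 0 := by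
    rw [hG, Matrix.add_mulVec, dotProduct_add, ← Matrix.mulVec_mulVec, ← Matrix.mulVec_mulVec, hw,
      Matrix.mulVec_zero, dotProduct_zero, Matrix.dotProduct_mulVec, hv, zero_dotProduct, add_zero]
  rw [Matrix.single_mulVec] at h1
  simp [dotProduct, Function.update_apply] at h1
  rcases h1 with h1 | h1
  · exact hr h1
  · exact hk h1

/-- The second order version of `injective_or_of_rigid`. -/
theorem injective_or_of_rigid_pair (F F₁ : Matrix ρ κ K)
    (h : ∀ G : Matrix ρ κ K, ∃ (A : Matrix κ κ K) (B B' : Matrix ρ ρ K),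
      0 = F * A + B * F ∧ G = F₁ * A + B * F₁ + B' * F) :
    (∀ w, F.mulVec w = 0 → F₁.mulVec w = 0 → w = 0) ∨
      ∀ v, (∀ w, F.mulVec w = 0 → v ⬝ᵥ F₁.mulVec w = 0) → v = 0 := by
  classical
  by_contra! hc
  obtain ⟨⟨w, hw, hw1, hw0⟩, v, hv, hv0⟩ := hc
  have hv1 : ∃ v₁, Matrix.vecMul v F₁ = Matrix.vecMul v₁ F := by
    by_contra hx
    obtain ⟨y, h1, h2⟩ := exists_dotProduct_of_notMem (LinearMap.range F.vecMulLinear)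
      (x := Matrix.vecMul v F₁) (by rintro ⟨y, hy⟩; exact hx ⟨y, hy.symm⟩)
    refine h1 ?_
    rw [dotProduct_comm, ← Matrix.dotProduct_mulVec]
    refine hv y ?_
    ext r
    have := h2 _ ⟨Pi.single r 1, rfl⟩
    rw [Matrix.vecMulLinear_apply, dotProduct_comm, ← Matrix.dotProduct_mulVec] at this
    simpa using this
  obtain ⟨v₁, hv1⟩ := hv1
  obtain ⟨r, hr⟩ := Function.ne_iff.1 hv0
  obtain ⟨k, hk⟩ := Function.ne_iff.1 hw0
  obtain ⟨A, B, B', h0, hG⟩ := h (Matrix.single r k 1)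
  have h1 : v ⬝ᵥ (Matrix.single r k (1 : K)).mulVec w = 0 := by
    have h2 : F.mulVec (A.mulVec w) = 0 := by
      have := congrArg (fun X => Matrix.mulVec X w) h0
      simpa [Matrix.add_mulVec, ← Matrix.mulVec_mulVec, hw] using this.symm
    rw [hG, Matrix.add_mulVec, Matrix.add_mulVec, ← Matrix.mulVec_mulVec, ← Matrix.mulVec_mulVec,
      ← Matrix.mulVec_mulVec, hw, hw1, Matrix.mulVec_zero, Matrix.mulVec_zero, add_zero, add_zero,
      Matrix.dotProduct_mulVec, hv1, ← Matrix.dotProduct_mulVec, h2, dotProduct_zero]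
  rw [Matrix.single_mulVec] at h1
  simp [dotProduct, Function.update_apply] at h1
  rcases h1 with h1 | h1
  · exact hr h1
  · exact hk h1

end Separation

section kmat
variable {K R : Type} [Field K] [Ring R] [Algebra K R] {ρ κ lam : Type}

/-- The multiple of a constant matrix by a ring element. -/
def kmat (G : Matrix ρ κ K) (x : R) : Matrix ρ κ R := Matrix.of fun r k => G r k • x

@[simp] theorem kmat_apply (G : Matrix ρ κ K) (x : R) (r : ρ) (k : κ) :
    kmat G x r k = G r k • x := rfl

theorem kmat_mul [Fintype κ] (G : Matrix ρ κ K) (H : Matrix κ lam K) (x y : R) :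
    kmat G x * kmat H y = kmat (G * H) (x * y) := by
  ext r k
  simp only [Matrix.mul_apply, kmat_apply, Finset.sum_smul, smul_mul_smul_comm]

theorem kmat_add (G H : Matrix ρ κ K) (x : R) : kmat (G + H) x = kmat G x + kmat H x := by
  ext; simp [add_smul]

theorem kmat_one [DecidableEq κ] : kmat (1 : Matrix κ κ K) (1 : R) = 1 := by
  ext a b; by_cases h : a = b <;> simp [h, Matrix.one_apply]

end kmat

section central
variable {R : Type} [Ring R] {ρ κ lam : Type} [Fintype κ]

theorem mul_central_smul (z : Subring.center R) (A : Matrix ρ κ R) (B : Matrix κ lam R) :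
    A * z • B = z • (A * B) := by
  ext r k
  simp only [Matrix.mul_apply, Matrix.smul_apply, Finset.smul_sum]
  refine Finset.sum_congr rfl fun l _ => ?_
  rw [Algebra.mul_smul_comm]

theorem central_smul_mul (z : Subring.center R) (A : Matrix ρ κ R) (B : Matrix κ lam R) :
    (z • A) * B = z • (A * B) := by
  ext r k
  simp only [Matrix.mul_apply, Matrix.smul_apply, Finset.smul_sum]
  refine Finset.sum_congr rfl fun l _ => ?_
  rw [Algebra.smul_mul_assoc]

end central

namespace Pointed
variable {K R : Type} [Field K] [Ring R] [Algebra K R] {D : Pointed K R}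
variable {κ ι M : Type} [Fintype κ] [Fintype ι] [AddCommGroup M] [Module R M]
  [DecidableEq κ] [DecidableEq ι]
variable {i j : Fin 2} {m : κ → M} {F : Matrix ι κ R}

theorem commute_scalar_iff {e : R} {U : Matrix κ κ R} :
    Commute (Matrix.scalar κ e) U ↔ ∀ a b, e * U a b = U a b * e := by
  constructor
  · intro h a b
    have := congrFun (congrFun h.eq a) b
    simpa using this
  · intro h
    ext a b
    simp [h]

theorem Pres.units (h : D.Pres (fun _ => j) (fun _ => i) m F) (U : (Matrix ι ι R)ˣ)
    (V : (Matrix κ κ R)ˣ) (hU : ∀ a b, D.e i * U.1 a b = U.1 a b * D.e i)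
    (hV : ∀ a b, D.e j * V.1 a b = V.1 a b * D.e j) :
    ∃ m' : κ → M, D.Pres (fun _ => j) (fun _ => i) m' (U.1 * F * V.1) :=
  ⟨_, h.baseChange (V⁻¹).1 V.1 U.1 (U⁻¹).1
    (commute_scalar_iff.1 ((commute_scalar_iff.2 hV).units_inv_right)) hV hU
    V.mul_inv V.inv_mul U.inv_mul⟩

theorem Pres.constChange {κ' ι' : Type} [Fintype κ'] [Fintype ι'] [DecidableEq κ']
    (h : D.Pres (fun _ => j) (fun _ => i) m F)
    (P : Matrix ι' ι K) (P' : Matrix ι ι' K) (Q : Matrix κ κ' K) (Q' : Matrix κ' κ K)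
    (hP : P' * P = 1) (hQ : Q * Q' = 1) (hQ' : Q' * Q = 1) :
    ∃ m' : κ' → M, D.Pres (fun _ => j) (fun _ => i) m'
      (kmat P (1 : R) * F * kmat Q (1 : R)) :=
  ⟨_, h.baseChange (kmat Q' 1) (kmat Q 1) (kmat P 1) (kmat P' 1)
    (by simp) (by simp) (by simp)
    (by rw [kmat_mul, hQ, mul_one, kmat_one]) (by rw [kmat_mul, hQ', mul_one, kmat_one])
    (by rw [kmat_mul, hP, mul_one, kmat_one])⟩

/-- A relation matrix which is presilting modulo a nilpotent central element can be lifted. -/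
theorem Pres.hensel (h : D.Pres (fun _ => j) (fun _ => i) m F) {z : Subring.center R}
    (hz : IsNilpotent z) {F' : Matrix ι κ R} (hF' : D.Presilting i j F')
    (hl : ∀ r k, D.e i * F' r k = F' r k) (hr : ∀ r k, F' r k * D.e j = F' r k)
    (H : Matrix ι κ R) (hF : F = F' + z • H) :
    ∃ m' : κ → M, D.Pres (fun _ => j) (fun _ => i) m' F' := by
  have key : ∀ n : ℕ, ∃ (m' : κ → M) (H : Matrix ι κ R),
      D.Pres (fun _ => j) (fun _ => i) m' (F' + z ^ (n + 1) • H) := by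
    intro n
    induction n with
    | zero => exact ⟨m, H, by rw [zero_add, pow_one, ← hF]; exact h⟩
    | succ n ih =>
      obtain ⟨m', H, h'⟩ := ih
      let H' : Matrix ι κ R := Matrix.of fun r k => D.e i * H r k * D.e j
      have hH : z ^ (n + 1) • H = z ^ (n + 1) • H' := by
        ext r k
        have h1 := h'.left r k
        have h2 := h'.right r k
        simp only [Matrix.add_apply, Matrix.smul_apply, mul_add, add_mul, hl, hr,
          add_right_inj] at h1 h2 ⊢
        change _ = z ^ (n + 1) • (D.e i * H r k * D.e j)
        rw [← Algebra.smul_mul_assoc, ← Algebra.mul_smul_comm, h1, h2]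
      obtain ⟨A, B, hA1, hA2, hB1, hB2, hAB⟩ := hF' H'
        (fun r k => by simp only [H', Matrix.of_apply, ← mul_assoc, D.idem])
        (fun r k => by simp only [H', Matrix.of_apply, mul_assoc, D.idem])
      have nilp : IsNilpotent (z ^ (n + 1)) := hz.pow_of_pos (by omega)
      have nA : IsNilpotent (z ^ (n + 1) • A) := by
        obtain ⟨N, hN⟩ := nilp
        refine ⟨N, ?_⟩
        rw [smul_pow, hN, zero_smul]
      have nB : IsNilpotent (z ^ (n + 1) • B) := by
        obtain ⟨N, hN⟩ := nilp
        refine ⟨N, ?_⟩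
        rw [smul_pow, hN, zero_smul]
      obtain ⟨V, hV⟩ := nA.isUnit_one_sub
      obtain ⟨U, hU⟩ := nB.isUnit_one_sub
      rw [hH] at h'
      obtain ⟨m'', h''⟩ := h'.units U V
        (by
          rw [hU]
          refine commute_scalar_iff.1 ((Commute.one_right _).sub_right
            (commute_scalar_iff.2 fun a b => ?_))
          rw [Matrix.smul_apply, Algebra.mul_smul_comm, Algebra.smul_mul_assoc, hB1, hB2])
        (by
          rw [hV]
          refine commute_scalar_iff.1 ((Commute.one_right _).sub_right
            (commute_scalar_iff.2 fun a b => ?_))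
          rw [Matrix.smul_apply, Algebra.mul_smul_comm, Algebra.smul_mul_assoc, hA1, hA2])
      refine ⟨m'', z ^ n • (B * F' * A - B * H' - H' * A + z ^ (n + 1) • (B * H' * A)), ?_⟩
      convert h'' using 1
      rw [hU, hV]
      simp only [Matrix.add_mul, Matrix.mul_add, Matrix.sub_mul,
        Matrix.mul_sub, central_smul_mul, mul_central_smul, Matrix.one_mul, Matrix.mul_one,
        smul_add, smul_sub, smul_smul, ← pow_add]
      rw [show z ^ (n + 1) • H' = z ^ (n + 1) • (F' * A) + z ^ (n + 1) • (B * F') by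
        rw [hAB, smul_add]]
      rw [show n + 1 + 1 + n = n + 1 + (n + 1) by ring,
        show n + 1 + 1 + (n + (n + 1)) = n + 1 + (n + 1 + (n + 1)) by ring]
      abel
  obtain ⟨N, hN⟩ := hz
  obtain ⟨m', H', h'⟩ := key N
  refine ⟨m', ?_⟩
  rwa [pow_succ, hN, zero_mul, zero_smul, add_zero] at h'

end Pointed

namespace Pointed
variable {K R : Type} [Field K] [Ring R] [Algebra K R] {D : Pointed K R}

section classify
variable {n : ℕ} {a b : Fin n → ℕ} {N : ∀ p, Matrix (Fin (a p)) (Fin (b p)) R} {i j : Fin 2}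
  {κ ι M : Type} [Fintype κ] [Fintype ι] [AddCommGroup M] [Module R M]
  [DecidableEq κ] [DecidableEq ι] {m : κ → M} {F : Matrix ι κ R}

theorem exists_equiv_family (hl : ∀ p r k, D.e i * N p r k = N p r k)
    (hr : ∀ p r k, N p r k * D.e j = N p r k)
    {ξ : Type} [Fintype ξ] [DecidableEq ξ] (c : ξ → Fin n)
    (hc : ∀ x y, D.Crit (fun _ => i) (N (c x)) (D.PMod (fun _ => j) (N (c y))))
    (ε : (Σ x, Fin (b (c x))) ≃ κ) (η : (Σ x, Fin (a (c x))) ≃ ι)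
    (h : D.Pres (fun _ => j) (fun _ => i) m F) {z : Subring.center R} (hz : IsNilpotent z)
    (H : Matrix ι κ R)
    (hF : F.submatrix η ε = Matrix.blockDiagonal' (fun x => N (c x)) + z • H.submatrix η ε) :
    Nonempty (M ≃ₗ[R] ∀ x, D.PMod (fun _ => j) (N (c x))) := by
  have h1 := h.reindex ε η
  have h2 := Pres.pi (fun x => D.pmod_pres (fun _ => j) (fun _ => i) (N (c x)) (hl _) (hr _))
  have h3 := h2.presilting (Crit.pi hc)
  obtain ⟨m', h4⟩ := Pres.hensel (i := i) (j := j) h1 hz h3 h2.left h2.right _ hF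
  obtain ⟨f, -⟩ := h4.iso h2 h2.rel h4.rel
  exact ⟨f⟩

/-- Regrouping the index set of a product of two powers. -/
def sigmaEquiv (b : Fin n → ℕ) (τ σ : Type) (p q : Fin n) :
    (Σ x : τ ⊕ σ, Fin (b (Sum.elim (fun _ => p) (fun _ => q) x))) ≃
      (τ × Fin (b p)) ⊕ (σ × Fin (b q)) :=
  (Equiv.sumSigmaDistrib _).trans
    (Equiv.sumCongr (Equiv.sigmaEquivProd τ (Fin (b p))) (Equiv.sigmaEquivProd σ (Fin (b q))))

theorem exists_equiv_two (hl : ∀ p r k, D.e i * N p r k = N p r k)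
    (hr : ∀ p r k, N p r k * D.e j = N p r k)
    {τ σ : Type} [Fintype τ] [DecidableEq τ] [Fintype σ] [DecidableEq σ] (p q : Fin n)
    (hpp : D.Crit (fun _ => i) (N p) (D.PMod (fun _ => j) (N p)))
    (hpq : D.Crit (fun _ => i) (N p) (D.PMod (fun _ => j) (N q)))
    (hqp : D.Crit (fun _ => i) (N q) (D.PMod (fun _ => j) (N p)))
    (hqq : D.Crit (fun _ => i) (N q) (D.PMod (fun _ => j) (N q)))
    (ε : (τ × Fin (b p)) ⊕ (σ × Fin (b q)) ≃ κ) (η : (τ × Fin (a p)) ⊕ (σ × Fin (a q)) ≃ ι)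
    (h : D.Pres (fun _ => j) (fun _ => i) m F) {z : Subring.center R} (hz : IsNilpotent z)
    (F' H : Matrix ι κ R) (hF : F = F' + z • H)
    (h11 : ∀ t r t' k, F' (η (.inl (t, r))) (ε (.inl (t', k))) = if t = t' then N p r k else 0)
    (h12 : ∀ t r t' k, F' (η (.inl (t, r))) (ε (.inr (t', k))) = 0)
    (h21 : ∀ t r t' k, F' (η (.inr (t, r))) (ε (.inl (t', k))) = 0)
    (h22 : ∀ t r t' k, F' (η (.inr (t, r))) (ε (.inr (t', k))) = if t = t' then N q r k else 0) :
    Nonempty (M ≃ₗ[R] ∀ x : τ ⊕ σ,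
      D.PMod (fun _ => j) (N (Sum.elim (fun _ => p) (fun _ => q) x))) := by
  refine exists_equiv_family hl hr (Sum.elim (fun _ => p) (fun _ => q)) ?_
    ((sigmaEquiv b τ σ p q).trans ε) ((sigmaEquiv a τ σ p q).trans η) h hz H ?_
  · rintro (x | x) (y | y)
    exacts [hpp, hpq, hqp, hqq]
  · rw [hF]
    ext ⟨x, r⟩ ⟨y, k⟩
    simp only [Matrix.submatrix_apply, Matrix.add_apply, Matrix.smul_apply, add_left_inj]
    rcases x with x | x <;> rcases y with y | y
    · refine (h11 x r y k).trans ?_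
      by_cases hxy : x = y
      · subst hxy; simp
      · rw [if_neg hxy, Matrix.blockDiagonal'_apply_ne]; simpa using hxy
    · refine (h12 x r y k).trans ?_
      rw [Matrix.blockDiagonal'_apply_ne]; simp
    · refine (h21 x r y k).trans ?_
      rw [Matrix.blockDiagonal'_apply_ne]; simp
    · refine (h22 x r y k).trans ?_
      by_cases hxy : x = y
      · subst hxy; simp
      · rw [if_neg hxy, Matrix.blockDiagonal'_apply_ne]; simpa using hxy

end classify

section EndLocal
variable {κ ι M : Type} [Fintype κ] [Fintype ι] [DecidableEq κ] [AddCommGroup M] [Module R M]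
  {m : κ → M} {F : Matrix ι κ R} {i j : Fin 2}

theorem sub_smul_mem {M : Type} [AddCommGroup M] [Module R M] {j : Fin 2} {a : R} {x : M}
    (hx : D.e j • x = x) :
    a • x - algebraMap K R (D.top a j) • x ∈ D.J • (⊤ : Submodule R M) := by
  have h := D.corner_sub_mem (i := j) (r := a * D.e j) (by rw [mul_assoc, D.idem])
  have h2 := Submodule.smul_mem_smul h (Submodule.mem_top (x := x))
  convert h2 using 1
  rw [sub_smul, mul_smul, mul_smul, hx, map_mul]
  simp [D.top_e]

theorem isUnit_of_top (hs : Submodule.span R (Set.range m) = ⊤) (hg : ∀ k, D.e j • m k = m k)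
    (φ : Module.End R M) (A : Matrix κ κ R) (hA : ∀ k, φ (m k) = ∑ l, A k l • m l)
    (hu : IsUnit (Matrix.of fun k l => D.top (A k l) j)) : IsUnit φ := by
  obtain ⟨Q, hQ⟩ := hu.exists_left_inv
  have hsurj : Function.Surjective φ := by
    rw [← LinearMap.range_eq_top, eq_top_iff,
      ← D.nakayama_span m (fun k => φ (∑ l, algebraMap K R (Q k l) • m l)) hs ?_,
      Submodule.span_le]
    · rintro _ ⟨k, rfl⟩
      exact ⟨_, rfl⟩
    intro k
    have h1 : m k =
        ∑ l, algebraMap K R (Q k l) • ∑ l', algebraMap K R (D.top (A l l') j) • m l' := by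
      have := congrFun (congrFun hQ k)
      simp only [Finset.smul_sum, ← mul_smul, ← map_mul]
      rw [Finset.sum_comm]
      simp only [← Finset.sum_smul, ← map_sum]
      simp only [Matrix.mul_apply, Matrix.of_apply] at this
      simp [this, Matrix.one_apply]
    have h2 : φ (∑ l, algebraMap K R (Q k l) • m l) =
        ∑ l, algebraMap K R (Q k l) • ∑ l', A l l' • m l' := by
      simp only [map_sum, map_smul, hA]
    rw [h2]
    nth_rewrite 1 [h1]
    rw [← Finset.sum_sub_distrib]
    refine Submodule.sum_mem _ fun l _ => ?_
    rw [← smul_sub, ← Finset.sum_sub_distrib]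
    refine Submodule.smul_mem _ _ (Submodule.sum_mem _ fun l' _ => ?_)
    rw [← neg_sub]
    exact Submodule.neg_mem _ (sub_smul_mem (hg l'))
  have := D.isNoetherian
  have : Module.Finite R M := ⟨hs ▸ Submodule.fg_span (Set.finite_range m)⟩
  rw [Module.End.isUnit_iff]
  exact ⟨IsNoetherian.injective_of_surjective_endomorphism φ hsurj, hsurj⟩

theorem Pres.gen_ne_zero (hij : i ≠ j) (h : D.Pres (fun _ => j) (fun _ => i) m F) (k : κ) :
    m k ≠ 0 := by
  intro h0
  obtain ⟨b, hb⟩ := h.exact (Pi.single k 1) (by simp [Pi.single_apply, h0])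
  have h1 := hb k
  rw [Pi.single_eq_same, one_mul] at h1
  have h2 : D.e j ∈ D.J := by
    rw [h1]
    exact Submodule.sum_mem _ fun r _ => D.J.mul_mem_left _
      (D.mem_J_of_ne hij (h.left r k) (h.right r k))
  rw [mem_J] at h2
  have := congrFun h2 j
  simp [D.top_e] at this

theorem Pres.isLocalRing (hij : i ≠ j) (h : D.Pres (fun _ => j) (fun _ => i) m F) [Nonempty κ]
    (hA : ∀ A : Matrix κ κ R, (∀ k l, D.e j * A k l = A k l) → (∀ k l, A k l * D.e j = A k l) →
      act F (act A m) = 0 → ∃ c : K,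
        (c ≠ 0 → IsUnit (Matrix.of fun k l => D.top (A k l) j)) ∧
        (c ≠ 1 → IsUnit (1 - Matrix.of fun k l => D.top (A k l) j))) :
    IsLocalRing (Module.End R M) := by
  have : Nontrivial M := ⟨m (Classical.arbitrary κ), 0, h.gen_ne_zero hij _⟩
  refine IsLocalRing.of_isUnit_or_isUnit_one_sub_self fun φ => ?_
  choose A hA' using fun k => exists_sum_of_span h.span (φ (m k))
  let A' : Matrix κ κ R := Matrix.of fun k l => D.e j * A k l * D.e j
  have hA2 : ∀ k, φ (m k) = ∑ l, A' k l • m l := by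
    intro k
    have h1 : D.e j • φ (m k) = φ (m k) := by rw [← map_smul, h.gen]
    rw [← h1, ← hA', Finset.smul_sum]
    refine Finset.sum_congr rfl fun l _ => ?_
    simp only [A', Matrix.of_apply, mul_smul, h.gen]
  obtain ⟨c, hc, hc'⟩ := hA A' (fun k l => by simp [A', ← mul_assoc, D.idem])
    (fun k l => by simp [A', mul_assoc, D.idem]) (by
      have h1 : act A' m = fun k => φ (m k) := by
        ext k; rw [hA2, act_apply]
      ext r
      rw [h1, ← map_act, h.rel, Pi.zero_apply, map_zero])
  by_cases h0 : c = 0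
  · right
    refine isUnit_of_top h.span h.gen (1 - φ) (1 - A') ?_ ?_
    · intro k
      simp only [LinearMap.sub_apply, Module.End.one_apply, Matrix.sub_apply, sub_smul,
        Finset.sum_sub_distrib, ← hA2, sub_left_inj]
      simp [Matrix.one_apply]
    · convert hc' (by rw [h0]; exact zero_ne_one) using 1
      ext k l
      by_cases hkl : k = l <;> simp [Matrix.one_apply, hkl]
  · left
    exact isUnit_of_top h.span h.gen φ A' hA2 (hc h0)

end EndLocal

end Pointed

namespace Pointed
variable {K R : Type} [Field K] [Ring R] [Algebra K R]

/-- A chain of presented modules, generated at vertex `j` with relations at vertex `i`, through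
which all τ-rigid modules of that shape can be described. -/
structure SideData (D : Pointed K R) (i j : Fin 2) (n : ℕ) where
  ne : i ≠ j
  a : Fin n → ℕ
  b : Fin n → ℕ
  N : ∀ p, Matrix (Fin (a p)) (Fin (b p)) R
  left : ∀ p r k, D.e i * N p r k = N p r k
  right : ∀ p r k, N p r k * D.e j = N p r k
  crit : ∀ p q : Fin n, (p : ℕ) ≤ q + 1 → (q : ℕ) ≤ p + 1 →
    D.Crit (fun _ => i) (N p) (D.PMod (fun _ => j) (N q))
  isLocal : ∀ p, IsLocalRing (Module.End R (D.PMod (fun _ => j) (N p)))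
  fac : ∀ p q, p ≤ q → ∃ (k : ℕ) (f : (Fin k → D.PMod (fun _ => j) (N q)) →ₗ[R]
    D.PMod (fun _ => j) (N p)), Function.Surjective f
  notFac : ∀ p q, p < q → ∀ (k : ℕ) (f : (Fin k → D.PMod (fun _ => j) (N p)) →ₗ[R]
    D.PMod (fun _ => j) (N q)), ¬ Function.Surjective f
  zero : ∀ p : Fin n, (p : ℕ) = 0 → ∀ x : D.PMod (fun _ => j) (N p), D.e i • x = 0
  nonzero : ∀ p : Fin n, (p : ℕ) ≠ 0 → ∃ x : D.PMod (fun _ => j) (N p), D.e i • x ≠ 0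
  last : ∀ p : Fin n, (p : ℕ) + 1 = n → a p = 0 ∧ b p = 1
  classify : ∀ {κ ι M : Type} [Fintype κ] [Fintype ι] [AddCommGroup M] [Module R M]
    [DecidableEq κ] [DecidableEq ι] (m : κ → M) (F : Matrix ι κ R),
    D.Pres (fun _ => j) (fun _ => i) m F → D.Presilting i j F →
    ∃ (ξ : Type) (_ : Fintype ξ) (_ : DecidableEq ξ) (c : ξ → Fin n) (s : ℕ),
      (∀ x, (c x : ℕ) = s ∨ (c x : ℕ) = s + 1) ∧
      Nonempty (M ≃ₗ[R] ∀ x, D.PMod (fun _ => j) (N (c x)))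

/-- Coordinates on the bimodule `e i R e j` modulo a nilpotent central element. -/
structure Side (D : Pointed K R) (i j : Fin 2) where
  ne : i ≠ j
  z : Subring.center R
  nil : IsNilpotent z
  mu : R
  mu' : R
  mu_left : D.e i * mu = mu
  mu_right : mu * D.e j = mu
  mu'_left : D.e i * mu' = mu'
  mu'_right : mu' * D.e j = mu'
  c0 : R →ₗ[K] K
  c1 : R →ₗ[K] K
  mem : ∀ x, D.e i * x = x → x * D.e j = x → ∃ y, x = c0 x • mu + c1 x • mu' + z • y
  c0_left : ∀ b x, D.e i * b = b → b * D.e i = b → D.e i * x = x → x * D.e j = x →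
    c0 (b * x) = D.top b i * c0 x
  c0_right : ∀ x a, D.e j * a = a → a * D.e j = a → D.e i * x = x → x * D.e j = x →
    c0 (x * a) = c0 x * D.top a j
  c0_mu : c0 mu = 1
  c0_mu' : c0 mu' = 0
  c1_mu : c1 mu = 0
  c0_z : ∀ x, c0 (z • x) = 0
  c1_z : ∀ x, c1 (z • x) = 0

/-- The submodule generated by the products of homogeneous ring elements with generators. -/
def cspan {κ M : Type} [AddCommGroup M] [Module R M] (D : Pointed K R)
    (i j : Fin 2) (m : κ → M) : Submodule R M :=
  Submodule.span R {x | ∃ r k, D.e i * r = r ∧ r * D.e j = r ∧ x = r • m k}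

namespace Side
variable {D : Pointed K R} {i j : Fin 2} (S : D.Side i j)
include S

theorem mem_homog (x : R) (h1 : D.e i * x = x) (h2 : x * D.e j = x) :
    ∃ y, D.e i * y = y ∧ y * D.e j = y ∧ x = S.c0 x • S.mu + S.c1 x • S.mu' + S.z • y := by
  obtain ⟨y, hy⟩ := S.mem x h1 h2
  refine ⟨D.e i * y * D.e j, by simp only [← mul_assoc, D.idem], by simp only [mul_assoc, D.idem],
    ?_⟩
  have h3 : x = D.e i * x * D.e j := by rw [h1, h2]
  rw [hy] at h3
  rw [← hy] at h3
  nth_rewrite 1 [h3]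
  nth_rewrite 1 [hy]
  simp only [mul_add, add_mul, mul_smul_comm, smul_mul_assoc, S.mu_left, S.mu_right, S.mu'_left,
    S.mu'_right]

/-- The image of a scalar in the centre. -/
def _root_.TwoPoint.toCenter (R : Type) [Ring R] [Algebra K R] (c : K) : Subring.center R :=
  ⟨algebraMap K R c, Subring.mem_center_iff.2 fun r => (Algebra.commutes c r).symm⟩

omit S in
theorem _root_.TwoPoint.toCenter_smul (c : K) (r : R) : toCenter R c • r = c • r := by
  rw [Algebra.smul_def c r]; rfl

theorem exists_coeff (x : R) (h1 : D.e i * x = x) (h2 : x * D.e j = x) :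
    ∃ p q : Subring.center R, x = p • S.mu + q • S.mu' := by
  have key : ∀ n : ℕ, ∃ (p q : Subring.center R) (y : R), D.e i * y = y ∧ y * D.e j = y ∧
      x = p • S.mu + q • S.mu' + S.z ^ n • y := by
    intro n
    induction n with
    | zero => exact ⟨0, 0, x, h1, h2, by simp⟩
    | succ n ih =>
      obtain ⟨p, q, y, hy1, hy2, hx⟩ := ih
      obtain ⟨y', h1', h2', hy⟩ := S.mem_homog y hy1 hy2
      refine ⟨p + S.z ^ n * toCenter R (S.c0 y), q + S.z ^ n * toCenter R (S.c1 y), y', h1', h2',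
        ?_⟩
      rw [hx]
      nth_rewrite 1 [hy]
      simp only [add_smul, smul_add, mul_smul, toCenter_smul, pow_succ]
      abel
  obtain ⟨n, hn⟩ := S.nil
  obtain ⟨p, q, y, -, -, hx⟩ := key n
  exact ⟨p, q, by rw [hx, hn, zero_smul, add_zero]⟩

section pres
variable {κ ι M : Type} [Fintype κ] [Fintype ι] [AddCommGroup M] [Module R M]
  [DecidableEq κ] [DecidableEq ι] {m : κ → M} {F : Matrix ι κ R}

/-- Homogeneous elements at vertex `i` in a module generated at vertex `j`. -/
theorem exists_coeff_sum (hs : Submodule.span R (Set.range m) = ⊤) (hg : ∀ k, D.e j • m k = m k)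
    (x : M) (hx : D.e i • x = x) : ∃ p q : κ → Subring.center R,
      x = ∑ k, (p k • S.mu + q k • S.mu') • m k := by
  obtain ⟨y, rfl⟩ := exists_sum_of_span hs x
  choose p q hpq using fun k => S.exists_coeff (D.e i * y k * D.e j)
    (by simp only [← mul_assoc, D.idem]) (by simp only [mul_assoc, D.idem])
  refine ⟨p, q, ?_⟩
  rw [← hx, Finset.smul_sum]
  refine Finset.sum_congr rfl fun k _ => ?_
  rw [← hpq, mul_smul, hg, mul_smul]

theorem exists_decomp (hl : ∀ r k, D.e i * F r k = F r k) (hr : ∀ r k, F r k * D.e j = F r k) :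
    ∃ H : Matrix ι κ R, (∀ r k, D.e i * H r k = H r k) ∧ (∀ r k, H r k * D.e j = H r k) ∧
      F = kmat (F.map S.c0) S.mu + kmat (F.map S.c1) S.mu' + S.z • H := by
  choose H h1 h2 h3 using fun r k => S.mem_homog (F r k) (hl r k) (hr r k)
  refine ⟨Matrix.of H, h1, h2, ?_⟩
  ext r k
  exact h3 r k

theorem map_c0_mul (hl : ∀ r k, D.e i * F r k = F r k) (hr : ∀ r k, F r k * D.e j = F r k)
    {A : Matrix κ κ R} (h1 : ∀ k l, D.e j * A k l = A k l) (h2 : ∀ k l, A k l * D.e j = A k l) :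
    (F * A).map S.c0 = F.map S.c0 * A.map fun a => D.top a j := by
  ext r k
  simp only [Matrix.map_apply, Matrix.mul_apply, map_sum]
  exact Finset.sum_congr rfl fun l _ => S.c0_right _ _ (h1 _ _) (h2 _ _) (hl _ _) (hr _ _)

theorem map_mul_c0 (hl : ∀ r k, D.e i * F r k = F r k) (hr : ∀ r k, F r k * D.e j = F r k)
    {B : Matrix ι ι R} (h1 : ∀ k l, D.e i * B k l = B k l) (h2 : ∀ k l, B k l * D.e i = B k l) :
    (B * F).map S.c0 = (B.map fun a => D.top a i) * F.map S.c0 := by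
  ext r k
  simp only [Matrix.map_apply, Matrix.mul_apply, map_sum]
  exact Finset.sum_congr rfl fun l _ => S.c0_left _ _ (h1 _ _) (h2 _ _) (hl _ _) (hr _ _)

theorem rigid (hl : ∀ r k, D.e i * F r k = F r k) (hr : ∀ r k, F r k * D.e j = F r k)
    (hF : D.Presilting i j F) (G : Matrix ι κ K) :
    ∃ (A : Matrix κ κ K) (B : Matrix ι ι K), G = F.map S.c0 * A + B * F.map S.c0 := by
  obtain ⟨A, B, hA1, hA2, hB1, hB2, h⟩ := hF (kmat G S.mu) (by simp [S.mu_left])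
    (by simp [S.mu_right])
  refine ⟨A.map fun a => D.top a j, B.map fun a => D.top a i, ?_⟩
  rw [← S.map_c0_mul hl hr hA1 hA2, ← S.map_mul_c0 hl hr hB1 hB2,
    ← Matrix.map_add _ (map_add S.c0), ← h]
  ext r k
  simp [S.c0_mu]

/-- If the generators are killed by all elements of `e i R e j`, the module is a power of the
module presented by any relations killing vertex `i`. -/
theorem equiv_of_smul_mem {n : ℕ} {a b : Fin n → ℕ} {N : ∀ p, Matrix (Fin (a p)) (Fin (b p)) R}
    (hl : ∀ p r k, D.e i * N p r k = N p r k) (hr : ∀ p r k, N p r k * D.e j = N p r k)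
    (h : D.Pres (fun _ => j) (fun _ => i) m F) (p : Fin n) (ε : (Σ _ : κ, Fin (b p)) ≃ κ)
    (hp : ∀ x : D.PMod (fun _ => j) (N p), D.e i • x = 0)
    (h0 : ∀ k, S.mu • m k ∈ D.J • D.cspan i j m) (h1 : ∀ k, S.mu' • m k ∈ D.J • D.cspan i j m) :
    Nonempty (M ≃ₗ[R] ∀ _ : κ, D.PMod (fun _ => j) (N p)) := by
  have hC0 : D.cspan i j m = ⊥ := by
    apply D.nakayama
    nth_rewrite 1 [cspan]
    rw [Submodule.span_le]
    rintro _ ⟨r, k, hr1, hr2, rfl⟩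
    obtain ⟨s, t, rfl⟩ := S.exists_coeff r hr1 hr2
    rw [add_smul]
    refine Submodule.add_mem _ ?_ ?_
    · rw [Subring.smul_def, smul_eq_mul, mul_smul]
      exact Submodule.smul_mem _ _ (h0 k)
    · rw [Subring.smul_def, smul_eq_mul, mul_smul]
      exact Submodule.smul_mem _ _ (h1 k)
  have hX : ∀ r k, D.e i * r = r → r * D.e j = r → r • m k = 0 := by
    intro r k hr1 hr2
    have : r • m k ∈ D.cspan i j m := Submodule.subset_span ⟨r, k, hr1, hr2, rfl⟩
    rw [hC0] at this
    simpa using this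
  have h2 := h.reindex ε (Equiv.refl ι)
  have h3 := Pres.pi (ξ := κ) (fun _ => D.pmod_pres (fun _ => j) (fun _ => i) (N p) (hl p) (hr p))
  obtain ⟨f, -⟩ := h2.iso h3
    (by
      ext r x
      rw [act_apply, Finset.sum_apply, Pi.zero_apply, Pi.zero_apply]
      refine Finset.sum_eq_zero fun k _ => ?_
      have h4 := h.left r (ε k)
      rw [Matrix.submatrix_apply, Equiv.refl_apply, ← h4, mul_smul, Pi.smul_apply, hp])
    (by
      ext r
      rw [act_apply, Pi.zero_apply]
      exact Finset.sum_eq_zero fun k _ => hX _ _ (h3.left r k) (h3.right r k))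
  exact ⟨f⟩

end pres
end Side

end Pointed

namespace Pointed
variable {K R : Type} [Field K] [Ring R] [Algebra K R] {D : Pointed K R} {i j : Fin 2}

theorem crit_of_isEmpty {κ ι N : Type} [Fintype κ] [IsEmpty ι] [AddCommGroup N] [Module R N]
    (u : ι → Fin 2) (F : Matrix ι κ R) : D.Crit u F N :=
  fun _ _ => ⟨0, funext fun r => isEmptyElim r⟩

theorem crit_of_smul_eq_zero {κ ι N : Type} [Fintype κ] [AddCommGroup N] [Module R N]
    (hN : ∀ x : N, D.e i • x = 0) (F : Matrix ι κ R) : D.Crit (fun _ => i) F N := by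
  refine fun h hh => ⟨0, ?_⟩
  ext r
  rw [act_zero_right, ← hh r, hN, Pi.zero_apply]

theorem not_surjective_of_smul_eq_zero {M N : Type} [AddCommGroup M] [Module R M]
    [AddCommGroup N] [Module R N] (hM : ∀ x : M, D.e i • x = 0) (hN : ∃ x : N, D.e i • x ≠ 0)
    (k : ℕ) (f : (Fin k → M) →ₗ[R] N) : ¬ Function.Surjective f := by
  intro hf
  obtain ⟨x, hx⟩ := hN
  obtain ⟨y, rfl⟩ := hf x
  refine hx ?_
  rw [← map_smul]
  convert map_zero f
  ext l
  exact hM _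

theorem exists_surjective_of_span {ι : Type} [Fintype ι] [IsEmpty ι] {v : Fin 2} {u : ι → Fin 2}
    {P M : Type} [AddCommGroup P] [Module R P] {g : Fin 1 → P} {F : Matrix ι (Fin 1) R}
    [AddCommGroup M] [Module R M] (h : D.Pres (fun _ => v) u g F) {k : ℕ} {m : Fin k → M}
    (hs : Submodule.span R (Set.range m) = ⊤) (hg : ∀ l, D.e v • m l = m l) :
    ∃ (k : ℕ) (f : (Fin k → P) →ₗ[R] M), Function.Surjective f := by
  choose φ hφ using fun l => h.lift (N := M) (fun _ => m l) (fun _ => hg l)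
    (funext fun r => isEmptyElim r)
  refine ⟨k, ∑ l, (φ l).comp (LinearMap.proj l), fun x => ?_⟩
  obtain ⟨y, rfl⟩ := exists_sum_of_span hs x
  refine ⟨fun l => y l • g 0, ?_⟩
  simp [hφ]

theorem exists_surjective_self (M : Type) [AddCommGroup M] [Module R M] :
    ∃ (k : ℕ) (f : (Fin k → M) →ₗ[R] M), Function.Surjective f :=
  ⟨1, LinearMap.proj 0, fun x => ⟨fun _ => x, rfl⟩⟩

theorem exists_surjective_of_surjective {M N : Type} [AddCommGroup M] [Module R M]
    [AddCommGroup N] [Module R N] (f : M →ₗ[R] N) (hf : Function.Surjective f) :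
    ∃ (k : ℕ) (f : (Fin k → M) →ₗ[R] N), Function.Surjective f :=
  ⟨1, f.comp (LinearMap.proj 0), fun x => by
    obtain ⟨y, rfl⟩ := hf x
    exact ⟨fun _ => y, rfl⟩⟩

theorem Pres.isLocalRing_of_fin_one {ι M : Type} [Fintype ι] [AddCommGroup M] [Module R M]
    {m : Fin 1 → M} {F : Matrix ι (Fin 1) R} (hij : i ≠ j)
    (h : D.Pres (fun _ => j) (fun _ => i) m F) : IsLocalRing (Module.End R M) := by
  refine h.isLocalRing hij fun A _ _ _ => ⟨D.top (A 0 0) j, fun hc => ?_, fun hc => ?_⟩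
  · rw [Matrix.isUnit_iff_isUnit_det, Matrix.det_fin_one]
    simpa using hc
  · rw [Matrix.isUnit_iff_isUnit_det, Matrix.det_fin_one]
    simpa [sub_eq_zero] using hc.symm

namespace Side
variable (S : D.Side i j)
include S

theorem smul_eq_zero_of_gen {κ M : Type} [Fintype κ] [AddCommGroup M] [Module R M]
    [DecidableEq κ] {m : κ → M}
    (hs : Submodule.span R (Set.range m) = ⊤) (hg : ∀ k, D.e j • m k = m k)
    (h0 : ∀ k, S.mu • m k = 0) (h1 : ∀ k, S.mu' • m k = 0) (x : M) : D.e i • x = 0 := by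
  obtain ⟨p, q, hx⟩ := S.exists_coeff_sum hs hg (D.e i • x) (D.ee_smul i x)
  rw [hx]
  refine Finset.sum_eq_zero fun k _ => ?_
  rw [add_smul, Subring.smul_def, Subring.smul_def, smul_eq_mul, smul_eq_mul, mul_smul, mul_smul,
    h0, h1, smul_zero, smul_zero, add_zero]

theorem exists_smul_ne_zero_of_isEmpty {ι M : Type} [Fintype ι] [IsEmpty ι] [AddCommGroup M]
    [Module R M] {u : ι → Fin 2} {m : Fin 1 → M} {F : Matrix ι (Fin 1) R}
    (h : D.Pres (fun _ => j) u m F) : ∃ x : M, D.e i • x ≠ 0 := by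
  refine ⟨S.mu • m 0, ?_⟩
  rw [← mul_smul, S.mu_left]
  intro h0
  obtain ⟨b, hb⟩ := h.exact (fun _ => S.mu) (by simpa using h0)
  have h1 := hb 0
  have h2 := S.c0_mu
  rw [S.mu_right, Finset.univ_eq_empty, Finset.sum_empty] at h1
  rw [h1, map_zero] at h2
  exact zero_ne_one h2

theorem const_decomp {κ ι κ' ι' : Type} [Fintype κ] [Fintype ι] [DecidableEq κ] [DecidableEq ι]
    (P : Matrix ι' ι K) (Q : Matrix κ κ' K) (F F₁ : Matrix ι κ K) (H : Matrix ι κ R) :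
    kmat P (1 : R) * (kmat F S.mu + kmat F₁ S.mu' + S.z • H) * kmat Q (1 : R) =
      kmat (P * F * Q) S.mu + kmat (P * F₁ * Q) S.mu' +
        S.z • (kmat P (1 : R) * H * kmat Q (1 : R)) := by
  simp only [Matrix.mul_add, Matrix.add_mul, kmat_mul, one_mul, mul_one, mul_central_smul,
    central_smul_mul]

theorem z_mem_J : (S.z : R) ∈ D.J := by
  rw [mem_J]
  obtain ⟨n, hn⟩ := S.nil
  have : (D.top (S.z : R)) ^ n = 0 := by
    rw [← map_pow, ← Subring.coe_pow, hn]; simp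
  exact eq_zero_of_pow_eq_zero this

theorem sum_mem_of_decomp {κ ι ι' M : Type} [Fintype κ] [Fintype ι] [AddCommGroup M] [Module R M]
    {m : κ → M} {F H : Matrix ι κ R} (h : act F m = 0)
    (hH1 : ∀ r k, D.e i * H r k = H r k) (hH2 : ∀ r k, H r k * D.e j = H r k)
    (hF : F = kmat (F.map S.c0) S.mu + kmat (F.map S.c1) S.mu' + S.z • H) (T : Matrix ι' ι K)
    (l : ι') : ∑ k, ((T * F.map S.c0) l k • S.mu) • m k +
      ∑ k, ((T * F.map S.c1) l k • S.mu') • m k ∈ D.J • D.cspan i j m := by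
  have h1 : act (kmat T (1 : R) * F) m = 0 := by rw [act_mul, h, act_zero_right]
  rw [hF, Matrix.mul_add, Matrix.mul_add, act_add, act_add, kmat_mul, kmat_mul, one_mul, one_mul,
    mul_central_smul] at h1
  have h2 := congrFun h1 l
  rw [Pi.add_apply, Pi.zero_apply, add_eq_zero_iff_eq_neg] at h2
  refine Eq.subst (motive := fun x => x ∈ D.J • D.cspan i j m) h2.symm (Submodule.neg_mem _ ?_)
  rw [act_apply]
  refine Submodule.sum_mem _ fun k _ => ?_
  rw [Matrix.smul_apply, Subring.smul_def, smul_eq_mul, mul_smul]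
  refine Submodule.smul_mem_smul S.z_mem_J (Submodule.subset_span ⟨_, k, ?_, ?_, rfl⟩)
  · simp [Matrix.mul_apply, Finset.mul_sum, hH1]
  · simp [Matrix.mul_apply, Finset.sum_mul, hH2]

/-- The equivalence regrouping a power of a module with a single generator. -/
def _root_.TwoPoint.sigmaUnit (κ : Type) : (Σ _ : κ, Fin 1) ≃ κ :=
  (Equiv.sigmaEquivProd κ (Fin 1)).trans (Equiv.prodUnique κ (Fin 1))

section typeI

/-- Numbers of relations for a chain of length two. -/
def aI : Fin 2 → ℕ
  | 0 => 1
  | 1 => 0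

/-- The presentation matrices of a chain of length two. -/
def nI : ∀ p : Fin 2, Matrix (Fin (aI p)) (Fin 1) R
  | 0 => Matrix.of fun _ _ => S.mu
  | 1 => Matrix.of fun r _ => r.elim0

theorem nI_left : ∀ p r k, D.e i * S.nI p r k = S.nI p r k
  | 0, _, _ => S.mu_left
  | 1, r, _ => r.elim0

theorem nI_right : ∀ p r k, S.nI p r k * D.e j = S.nI p r k
  | 0, _, _ => S.mu_right
  | 1, r, _ => r.elim0

theorem nI_pres (p : Fin 2) : D.Pres (fun _ => j) (fun _ => i) (D.pgen (fun _ => j) (S.nI p))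
    (S.nI p) := D.pmod_pres _ _ _ (S.nI_left p) (S.nI_right p)

theorem nI_zero (h : S.mu' = 0) (x : D.PMod (fun _ => j) (S.nI 0)) : D.e i • x = 0 := by
  have hP := S.nI_pres 0
  refine S.smul_eq_zero_of_gen hP.span hP.gen (fun k => ?_) (fun k => by rw [h, zero_smul]) x
  have : ∑ l : Fin 1, S.mu • D.pgen (fun _ => j) (S.nI 0) l = 0 := congrFun hP.rel (0 : Fin 1)
  rw [Fin.sum_univ_one] at this
  rw [Subsingleton.elim k 0]
  exact this

theorem nI_crit (h : S.mu' = 0) : ∀ p q : Fin 2,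
    D.Crit (fun _ => i) (S.nI p) (D.PMod (fun _ => j) (S.nI q))
  | 1, _ => @crit_of_isEmpty _ _ _ _ _ _ _ _ _ _ Fin.isEmpty _ _ _ _
  | 0, 0 => crit_of_smul_eq_zero (S.nI_zero h) _
  | 0, 1 => by
    have hP := S.nI_pres 1
    intro x hx
    obtain ⟨p, q, hpq⟩ := S.exists_coeff_sum hP.span hP.gen (x (0 : Fin 1)) (hx _)
    refine ⟨fun _ => ∑ k, (p k : R) • D.pgen (fun _ => j) (S.nI 1) k, ?_⟩
    ext r
    rw [show r = (0 : Fin 1) from Subsingleton.elim (α := Fin 1) _ _, hpq]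
    change ∑ l : Fin 1, S.mu • (∑ k, (p k : R) • D.pgen (fun _ => j) (S.nI 1) k) = _
    rw [Fin.sum_univ_one, Finset.smul_sum]
    refine Finset.sum_congr rfl fun k _ => ?_
    rw [h, smul_zero, add_zero, ← mul_smul, Subring.smul_def, smul_eq_mul]
    rw [Subring.mem_center_iff.1 (p k).2]

theorem classifyI (h0 : S.mu' = 0) {κ ι M : Type} [Fintype κ] [Fintype ι] [AddCommGroup M]
    [Module R M] [DecidableEq κ] [DecidableEq ι] (m : κ → M) (F : Matrix ι κ R)
    (h : D.Pres (fun _ => j) (fun _ => i) m F) (hF : D.Presilting i j F) :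
    ∃ (ξ : Type) (_ : Fintype ξ) (_ : DecidableEq ξ) (c : ξ → Fin 2) (s : ℕ),
      (∀ x, (c x : ℕ) = s ∨ (c x : ℕ) = s + 1) ∧
      Nonempty (M ≃ₗ[R] ∀ x, D.PMod (fun _ => j) (S.nI (c x))) := by
  obtain ⟨H, hH1, hH2, hFH⟩ := S.exists_decomp h.left h.right
  rcases injective_or_of_rigid (F.map S.c0) (S.rigid h.left h.right hF) with hi | hi
  · obtain ⟨n, Q, Q', hQ1, hQ2, hQ3⟩ :=
      exists_normal_form_of_independent _ (mulVec_surjective_of_vecMul _ hi)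
    obtain ⟨m', h'⟩ := h.constChange (1 : Matrix ι ι K) 1 Q Q' (one_mul _) hQ1 hQ2
    rw [hFH, S.const_decomp, Matrix.one_mul, hQ3, h0] at h'
    have e0 : kmat ((1 : Matrix ι ι K) * F.map S.c1 * Q) (0 : R) = 0 := by ext; simp
    rw [e0, add_zero] at h'
    have e1 : ∀ t t', kmat (Matrix.fromCols (1 : Matrix ι ι K) (0 : Matrix ι (Fin n) K)) S.mu t
        (Sum.inl t') = if t = t' then S.mu else 0 := fun t t' => by simp [Matrix.one_apply]
    have e2 : ∀ t t', kmat (Matrix.fromCols (1 : Matrix ι ι K) (0 : Matrix ι (Fin n) K)) S.mu t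
        (Sum.inr t') = 0 := fun t t' => by simp
    refine ⟨ι ⊕ Fin n, inferInstance, inferInstance, Sum.elim (fun _ => 0) (fun _ => 1), 0,
      by rintro (x | x) <;> simp, ?_⟩
    exact exists_equiv_two (b := fun _ => 1) (a := aI) S.nI_left S.nI_right (0 : Fin 2) 1
      (S.nI_crit h0 0 0) (S.nI_crit h0 0 1) (S.nI_crit h0 1 0) (S.nI_crit h0 1 1)
      (Equiv.sumCongr (Equiv.prodUnique ι (Fin 1)) (Equiv.prodUnique (Fin n) (Fin 1)))
      ((@Equiv.sumEmpty _ (Fin n × Fin 0) _).trans (Equiv.prodUnique ι (Fin 1)))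
      h' S.nil _ _ rfl (fun t _ t' _ => e1 t t') (fun t _ t' _ => e2 t t')
      (fun _ r => r.elim0) (fun _ r => r.elim0)
  · obtain ⟨T, hT⟩ := exists_left_inverse (F.map S.c0) hi
    refine ⟨κ, inferInstance, inferInstance, fun _ => 0, 0, fun _ => .inl rfl, ?_⟩
    refine S.equiv_of_smul_mem (b := fun _ => 1) S.nI_left S.nI_right h 0 (sigmaUnit κ)
      (S.nI_zero h0) (fun k => ?_) (fun k => by rw [h0, zero_smul]; exact zero_mem _)
    have h1 := S.sum_mem_of_decomp h.rel hH1 hH2 hFH T k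
    simpa [h0, hT, Matrix.one_apply, Finset.sum_ite_eq] using h1

/-- The chain of length two. -/
def dataI (h0 : S.mu' = 0) : D.SideData i j 2 where
  ne := S.ne
  a := aI
  b := fun _ => 1
  N := S.nI
  left := S.nI_left
  right := S.nI_right
  crit p q _ _ := S.nI_crit h0 p q
  isLocal p := (S.nI_pres p).isLocalRing_of_fin_one S.ne
  fac := fun
    | 0, 0, _ => exists_surjective_self _
    | 1, 1, _ => exists_surjective_self _
    | 0, 1, _ => @exists_surjective_of_span K R _ _ _ D _ _ Fin.isEmpty _ _ _ _ _ _ _ _ _ _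
        (S.nI_pres 1) _ _ (S.nI_pres 0).span (S.nI_pres 0).gen
  notFac := fun
    | 0, 0, h => absurd h (by decide)
    | 1, 0, h => absurd h (by decide)
    | 1, 1, h => absurd h (by decide)
    | 0, 1, _ => not_surjective_of_smul_eq_zero (S.nI_zero h0)
        (@exists_smul_ne_zero_of_isEmpty _ _ _ _ _ _ _ _ S _ _ _ Fin.isEmpty _ _ _ _ _
          (S.nI_pres 1))
  zero := fun
    | 0, _ => S.nI_zero h0
  nonzero := fun
    | 1, _ => @exists_smul_ne_zero_of_isEmpty _ _ _ _ _ _ _ _ S _ _ _ Fin.isEmpty _ _ _ _ _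
          (S.nI_pres 1)
  last := fun
    | 1, _ => ⟨rfl, rfl⟩
  classify := S.classifyI h0

end typeI

end Side

end Pointed

namespace Pointed
variable {K R : Type} [Field K] [Ring R] [Algebra K R] {D : Pointed K R} {i j : Fin 2}

/-- Constant elementary base change by a square-zero element. -/
def unip {κ : Type} [Fintype κ] [DecidableEq κ] {x : R} (hx : x * x = 0) (C : Matrix κ κ K) :
    (Matrix κ κ R)ˣ where
  val := 1 - kmat C x
  inv := 1 + kmat C x
  val_inv := by
    rw [mul_add, mul_one, sub_mul, one_mul, kmat_mul, hx]
    have : kmat (C * C) (0 : R) = 0 := by ext; simp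
    rw [this]; abel
  inv_val := by
    rw [mul_sub, mul_one, add_mul, one_mul, kmat_mul, hx]
    have : kmat (C * C) (0 : R) = 0 := by ext; simp
    rw [this]; abel

theorem unip_comm {κ : Type} [Fintype κ] [DecidableEq κ] {x : R} (hx : x * x = 0)
    (C : Matrix κ κ K) (h1 : D.e j * x = x) (h2 : x * D.e j = x) (a b : κ) :
    D.e j * (unip hx C).1 a b = (unip hx C).1 a b * D.e j := by
  by_cases hab : a = b <;> simp [unip, hab, mul_sub, sub_mul, h1, h2]

theorem exists_dotProduct_ker {κ ι : Type} [Fintype κ] [Fintype ι] [DecidableEq κ]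
    (F F₁ : Matrix κ ι K) (h : ∀ v, (∀ w, F.mulVec w = 0 → v ⬝ᵥ F₁.mulVec w = 0) → v = 0)
    (x : κ → K) : ∃ w, F.mulVec w = 0 ∧ F₁.mulVec w = x := by
  by_contra! hc
  obtain ⟨v, hv, hv'⟩ := exists_dotProduct_of_notMem
    ((LinearMap.ker F.mulVecLin).map F₁.mulVecLin) (x := x) (by
      rintro ⟨w, hw, rfl⟩
      exact hc w (by simpa using hw) rfl)
  refine hv ?_
  rw [h v fun w hw => hv' _ ⟨w, by simpa using hw, rfl⟩, zero_dotProduct]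

/-- Coordinates on `e i R e j` when the second basis element is `mu * al`. -/
structure SideII (D : Pointed K R) (i j : Fin 2) extends D.Side i j where
  al : R
  al_left : D.e j * al = al
  al_right : al * D.e j = al
  al_sq : al * al = 0
  mu'_eq : mu' = mu * al
  c1_mu' : c1 mu' = 1
  δ : R → K
  c1_left : ∀ b x, D.e i * b = b → b * D.e i = b → D.e i * x = x → x * D.e j = x →
    c1 (b * x) = D.top b i * c1 x
  c1_right : ∀ x a, D.e j * a = a → a * D.e j = a → D.e i * x = x → x * D.e j = x →
    c1 (x * a) = c1 x * D.top a j + c0 x * δ a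

namespace SideII
variable (S : D.SideII i j)
include S

theorem al_mem_J : S.al ∈ D.J := by
  rw [mem_J]
  exact eq_zero_of_pow_eq_zero (n := 2) (by rw [← map_pow, pow_two, S.al_sq, map_zero])

theorem mu'_mul_al : S.mu' * S.al = 0 := by rw [S.mu'_eq, mul_assoc, S.al_sq, mul_zero]

/-- Numbers of relations. -/
def aII : Fin 3 → ℕ
  | 0 => 2
  | 1 => 1
  | 2 => 0

/-- The presentation matrix with both basis elements as relations. -/
def pair : Matrix (Fin 2) (Fin 1) R := Matrix.of fun r _ => if r = 0 then S.mu else S.mu'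

/-- The presentation matrices. -/
def nII : ∀ p : Fin 3, Matrix (Fin (aII p)) (Fin 1) R
  | 0 => S.pair
  | 1 => Matrix.of fun _ _ => S.mu
  | 2 => Matrix.of fun r _ => r.elim0

theorem nII_left : ∀ p r k, D.e i * S.nII p r k = S.nII p r k
  | 0, (0 : Fin 2), _ => S.mu_left
  | 0, (1 : Fin 2), _ => S.mu'_left
  | 1, _, _ => S.mu_left
  | 2, r, _ => r.elim0

theorem nII_right : ∀ p r k, S.nII p r k * D.e j = S.nII p r k
  | 0, (0 : Fin 2), _ => S.mu_right
  | 0, (1 : Fin 2), _ => S.mu'_right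
  | 1, _, _ => S.mu_right
  | 2, r, _ => r.elim0

/-- The generator. -/
def gen (p : Fin 3) : D.PMod (fun _ => j) (S.nII p) := D.pgen (fun _ => j) (S.nII p) 0

theorem nII_pres (p : Fin 3) : D.Pres (fun _ => j) (fun _ => i) (fun _ => S.gen p) (S.nII p) := by
  have h := D.pmod_pres (fun _ => j) (fun _ => i) (S.nII p) (S.nII_left p) (S.nII_right p)
  have : (fun _ => S.gen p) = D.pgen (fun _ => j) (S.nII p) := by
    ext k; rw [Subsingleton.elim k 0]; rfl
  rw [this]; exact h

theorem mu_gen_zero : S.mu • S.gen 0 = 0 := by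
  have : ∑ l : Fin 1, S.mu • S.gen 0 = 0 := 
    congrFun (S.nII_pres 0).rel (0 : Fin 2)
  rwa [Fin.sum_univ_one] at this

theorem mu'_gen_zero : S.mu' • S.gen 0 = 0 := by
  have : ∑ l : Fin 1, S.mu' • S.gen 0 = 0 := congrFun (S.nII_pres 0).rel (1 : Fin 2)
  rwa [Fin.sum_univ_one] at this

theorem mu_gen_one : S.mu • S.gen 1 = 0 := by
  have : ∑ l : Fin 1, S.mu • S.gen 1 = 0 := congrFun (S.nII_pres 1).rel (0 : Fin 1)
  rwa [Fin.sum_univ_one] at this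

theorem nII_zero (x : D.PMod (fun _ => j) (S.nII 0)) : D.e i • x = 0 :=
  S.smul_eq_zero_of_gen (S.nII_pres 0).span (S.nII_pres 0).gen (fun _ => S.mu_gen_zero)
    (fun _ => S.mu'_gen_zero) x

theorem exists_coeff_gen (p : Fin 3) (x : D.PMod (fun _ => j) (S.nII p)) (hx : D.e i • x = x) :
    ∃ a b : Subring.center R, x = ((a : R) * S.mu + (b : R) * S.mu') • S.gen p := by
  obtain ⟨a, b, h⟩ := S.exists_coeff_sum (S.nII_pres p).span (S.nII_pres p).gen x hx
  rw [Fin.sum_univ_one] at h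
  exact ⟨a 0, b 0, h⟩

theorem mu_mul_center (a b : Subring.center R) :
    S.mu * ((a : R) + (b : R) * S.al) = (a : R) * S.mu + (b : R) * S.mu' := by
  rw [mul_add, Subring.mem_center_iff.1 a.2, ← mul_assoc, Subring.mem_center_iff.1 b.2, mul_assoc,
    S.mu'_eq]

theorem nII_crit_one (q : Fin 3) :
    D.Crit (fun _ => i) (S.nII 1) (D.PMod (fun _ => j) (S.nII q)) := by
  intro x hx
  obtain ⟨a, b, h⟩ := S.exists_coeff_gen q (x (0 : Fin 1)) (hx _)
  refine ⟨fun _ => ((a : R) + (b : R) * S.al) • S.gen q, ?_⟩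
  ext r
  rw [show r = (0 : Fin 1) from Subsingleton.elim (α := Fin 1) _ _, h]
  change ∑ l : Fin 1, S.mu • ((a : R) + (b : R) * S.al) • S.gen q = _
  rw [Fin.sum_univ_one, ← mul_smul, S.mu_mul_center]

theorem nII_crit : ∀ p q : Fin 3, (p : ℕ) ≤ q + 1 → (q : ℕ) ≤ p + 1 →
    D.Crit (fun _ => i) (S.nII p) (D.PMod (fun _ => j) (S.nII q))
  | 2, _, _, _ => @crit_of_isEmpty _ _ _ _ _ _ _ _ _ _ Fin.isEmpty _ _ _ _
  | 0, 0, _, _ => crit_of_smul_eq_zero S.nII_zero _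
  | 1, q, _, _ => S.nII_crit_one q
  | 0, 2, _, h => absurd h (by decide)
  | 0, 1, _, _ => by
    intro x hx
    obtain ⟨a, b, h⟩ := S.exists_coeff_gen 1 (x (0 : Fin 2)) (hx _)
    obtain ⟨a', b', h'⟩ := S.exists_coeff_gen 1 (x (1 : Fin 2)) (hx _)
    refine ⟨fun _ => ((b' : R) + (b : R) * S.al) • S.gen 1, ?_⟩
    have h0 : ∑ l : Fin 1, S.mu • ((b' : R) + (b : R) * S.al) • S.gen 1 = x (0 : Fin 2) := by
      rw [Fin.sum_univ_one, ← mul_smul, S.mu_mul_center, h, add_smul, add_smul, mul_smul,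
        mul_smul (a : R), S.mu_gen_one, smul_zero, smul_zero]
    have h1 : ∑ l : Fin 1, S.mu' • ((b' : R) + (b : R) * S.al) • S.gen 1 = x (1 : Fin 2) := by
      rw [Fin.sum_univ_one, ← mul_smul, mul_add, Subring.mem_center_iff.1 b'.2, ← mul_assoc,
        Subring.mem_center_iff.1 b.2, mul_assoc, S.mu'_mul_al, mul_zero, add_zero, h', add_smul,
        mul_smul (a' : R), S.mu_gen_one, smul_zero, zero_add]
    ext r
    match r with
    | (0 : Fin 2) => exact h0
    | (1 : Fin 2) => exact h1

theorem nII_nonzero : ∀ p : Fin 3, (p : ℕ) ≠ 0 →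
    ∃ x : D.PMod (fun _ => j) (S.nII p), D.e i • x ≠ 0
  | 0, h => absurd rfl h
  | 2, _ => @Side.exists_smul_ne_zero_of_isEmpty _ _ _ _ _ _ _ _ S.toSide _ _ _ Fin.isEmpty
      _ _ _ _ _ (S.nII_pres 2)
  | 1, _ => by
    refine ⟨S.mu' • S.gen 1, ?_⟩
    rw [← mul_smul, S.mu'_left]
    intro h0
    obtain ⟨b, hb⟩ := (S.nII_pres 1).exact (fun _ => S.mu') (by rw [Fin.sum_univ_one]; exact h0)
    have h1 : S.mu' * D.e j = ∑ r : Fin 1, b r * S.mu := hb 0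
    rw [Fin.sum_univ_one, S.mu'_right] at h1
    have h2 : S.mu' = (D.e i * b (0 : Fin 1) * D.e i) * S.mu := by
      rw [mul_assoc, S.mu_left, mul_assoc, ← h1, S.mu'_left]
    have h3 := S.c1_mu'
    rw [h2, S.c1_left _ _ (by simp only [← mul_assoc, D.idem]) (by simp only [mul_assoc, D.idem])
      S.mu_left S.mu_right, S.c1_mu, mul_zero] at h3
    exact zero_ne_one h3

theorem nII_notFac_one_two (k : ℕ) (f : (Fin k → D.PMod (fun _ => j) (S.nII 1)) →ₗ[R]
    D.PMod (fun _ => j) (S.nII 2)) : ¬ Function.Surjective f := by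
  classical
  intro hf
  have key : ∀ l : Fin k, f (Pi.single l (S.gen 1)) ∈
      D.J • (⊤ : Submodule R (D.PMod (fun _ => j) (S.nII 2))) := by
    intro l
    obtain ⟨y, hy⟩ := exists_sum_of_span (S.nII_pres 2).span (f (Pi.single l (S.gen 1)))
    rw [Fin.sum_univ_one] at hy
    have hy' : (D.e j * y 0 * D.e j) • S.gen 2 = f (Pi.single l (S.gen 1)) := by
      rw [mul_smul, mul_smul, (S.nII_pres 2).gen 0, hy, ← map_smul, ← Pi.single_smul,
        (S.nII_pres 1).gen 0]
    have h0 : (S.mu * (D.e j * y 0 * D.e j)) • S.gen 2 = 0 := by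
      rw [mul_smul, hy', ← map_smul, ← Pi.single_smul, S.mu_gen_one, Pi.single_zero, map_zero]
    obtain ⟨b, hb⟩ := (S.nII_pres 2).exact (fun _ => S.mu * (D.e j * y 0 * D.e j))
      (by rw [Fin.sum_univ_one]; exact h0)
    have h1 : S.mu * (D.e j * y 0 * D.e j) * D.e j = 0 := (hb 0).trans
      (Fin.sum_univ_zero _)
    have h2 : S.mu * (D.e j * y 0 * D.e j) = 0 := by
      rw [← h1]; simp only [mul_assoc, D.idem]
    have h3 := S.c0_right S.mu (D.e j * y 0 * D.e j) (by simp only [← mul_assoc, D.idem])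
      (by simp only [mul_assoc, D.idem]) S.mu_left S.mu_right
    rw [h2, map_zero, S.c0_mu, one_mul] at h3
    rw [← hy']
    refine Submodule.smul_mem_smul ?_ Submodule.mem_top
    have h4 := D.corner_sub_mem (i := j) (r := D.e j * y 0 * D.e j)
      (by simp only [mul_assoc, D.idem])
    rwa [← h3, map_zero, zero_mul, sub_zero] at h4
  have htop : (⊤ : Submodule R (D.PMod (fun _ => j) (S.nII 2))) = ⊥ := by
    apply D.nakayama
    intro x _
    obtain ⟨y, rfl⟩ := hf x
    have hy : y = ∑ l, Pi.single l (y l) := by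
      ext l; simp
    rw [hy, map_sum]
    refine Submodule.sum_mem _ fun l _ => ?_
    obtain ⟨c, hc⟩ := exists_sum_of_span (S.nII_pres 1).span (y l)
    rw [Fin.sum_univ_one] at hc
    rw [← hc, Pi.single_smul, map_smul]
    exact Submodule.smul_mem _ _ (key l)
  have : S.gen 2 ∈ (⊤ : Submodule R (D.PMod (fun _ => j) (S.nII 2))) := Submodule.mem_top
  rw [htop] at this
  exact (S.nII_pres 2).gen_ne_zero S.ne 0 (by simpa using this)

theorem nII_fac : ∀ p q : Fin 3, p ≤ q → ∃ (k : ℕ)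
    (f : (Fin k → D.PMod (fun _ => j) (S.nII q)) →ₗ[R] D.PMod (fun _ => j) (S.nII p)),
      Function.Surjective f
  | p, 2, _ => @exists_surjective_of_span K R _ _ _ D _ _ Fin.isEmpty _ _ _ _ _ _ _ _ _ _
        (S.nII_pres 2) _ _ (S.nII_pres p).span (S.nII_pres p).gen
  | 0, 0, _ => exists_surjective_self _
  | 1, 1, _ => exists_surjective_self _
  | 1, 0, h => absurd h (by decide)
  | 2, 0, h => absurd h (by decide)
  | 2, 1, h => absurd h (by decide)
  | 0, 1, _ => by
    have h : act (S.nII 1) (fun _ => S.gen 0) = 0 := by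
      ext r
      change ∑ l : Fin 1, S.mu • S.gen 0 = _
      rw [Fin.sum_univ_one, S.mu_gen_zero, Pi.zero_apply]
    obtain ⟨φ, hφ⟩ := (S.nII_pres 1).lift (fun _ => S.gen 0) (S.nII_pres 0).gen h
    refine exists_surjective_of_surjective φ fun x => ?_
    obtain ⟨y, rfl⟩ := exists_sum_of_span (S.nII_pres 0).span x
    exact ⟨∑ k, y k • S.gen 1, by simp [hφ 0]⟩

theorem nII_notFac : ∀ p q : Fin 3, p < q → ∀ (k : ℕ)
    (f : (Fin k → D.PMod (fun _ => j) (S.nII p)) →ₗ[R] D.PMod (fun _ => j) (S.nII q)),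
      ¬ Function.Surjective f
  | 0, 0, h => absurd h (by decide)
  | 0, 1, _ => not_surjective_of_smul_eq_zero S.nII_zero (S.nII_nonzero 1 (by decide))
  | 0, 2, _ => not_surjective_of_smul_eq_zero S.nII_zero (S.nII_nonzero 2 (by decide))
  | 1, 0, h => absurd h (by decide)
  | 1, 1, h => absurd h (by decide)
  | 1, 2, _ => S.nII_notFac_one_two
  | 2, 0, h => absurd h (by decide)
  | 2, 1, h => absurd h (by decide)
  | 2, 2, h => absurd h (by decide)

end SideII

end Pointed

namespace Pointed
variable {K R : Type} [Field K] [Ring R] [Algebra K R] {D : Pointed K R} {i j : Fin 2}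

namespace SideII
variable (S : D.SideII i j)
include S

section classify
variable {κ ι M : Type} [Fintype κ] [Fintype ι] [AddCommGroup M] [Module R M]
  [DecidableEq κ] [DecidableEq ι] {m : κ → M} {F : Matrix ι κ R}

theorem rigid_pair (hl : ∀ r k, D.e i * F r k = F r k) (hr : ∀ r k, F r k * D.e j = F r k)
    (hF : D.Presilting i j F) (G : Matrix ι κ K) :
    ∃ (A A' : Matrix κ κ K) (B : Matrix ι ι K), 0 = F.map S.c0 * A + B * F.map S.c0 ∧
      G = F.map S.c1 * A + F.map S.c0 * A' + B * F.map S.c1 := by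
  obtain ⟨A, B, hA1, hA2, hB1, hB2, h⟩ := hF (kmat G S.mu') (by simp [S.mu'_left])
    (by simp [S.mu'_right])
  refine ⟨A.map fun a => D.top a j, A.map S.δ, B.map fun a => D.top a i, ?_, ?_⟩
  · rw [← S.map_c0_mul hl hr hA1 hA2, ← S.map_mul_c0 hl hr hB1 hB2,
      ← Matrix.map_add _ (map_add S.c0), ← h]
    ext r k
    simp [S.c0_mu']
  · have h1 : (F * A).map S.c1 = F.map S.c1 * (A.map fun a => D.top a j) +
        F.map S.c0 * A.map S.δ := by
      ext r k
      simp only [Matrix.map_apply, Matrix.mul_apply, Matrix.add_apply, map_sum,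
        ← Finset.sum_add_distrib]
      exact Finset.sum_congr rfl fun l _ => S.c1_right _ _ (hA1 _ _) (hA2 _ _) (hl _ _) (hr _ _)
    have h2 : (B * F).map S.c1 = (B.map fun a => D.top a i) * F.map S.c1 := by
      ext r k
      simp only [Matrix.map_apply, Matrix.mul_apply, map_sum]
      exact Finset.sum_congr rfl fun l _ => S.c1_left _ _ (hB1 _ _) (hB2 _ _) (hl _ _) (hr _ _)
    rw [← h1, ← h2, ← Matrix.map_add _ (map_add S.c1), ← h]
    ext r k
    simp [S.c1_mu']

theorem kmat_mul_unip {ι κ : Type} [Fintype κ] [DecidableEq κ] (G G' C : Matrix ι κ K)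
    (C' : Matrix κ κ K) (H : Matrix ι κ R) (hC : G * C' = C) :
    (kmat G S.mu + kmat (G' + C) S.mu' + S.z • H) * (unip S.al_sq C').1 =
      kmat G S.mu + kmat G' S.mu' + S.z • (H * (unip S.al_sq C').1) := by
  rw [Matrix.add_mul, Matrix.add_mul, central_smul_mul]
  congr 1
  simp only [unip, Matrix.mul_sub, Matrix.mul_one, kmat_mul, S.mu'_mul_al, ← S.mu'_eq, hC]
  have : kmat ((G' + C) * C') (0 : R) = 0 := by ext; simp
  rw [this, kmat_add]; abel

theorem classify (h : D.Pres (fun _ => j) (fun _ => i) m F) (hF : D.Presilting i j F) :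
    ∃ (ξ : Type) (_ : Fintype ξ) (_ : DecidableEq ξ) (c : ξ → Fin 3) (s : ℕ),
      (∀ x, (c x : ℕ) = s ∨ (c x : ℕ) = s + 1) ∧
      Nonempty (M ≃ₗ[R] ∀ x, D.PMod (fun _ => j) (S.nII (c x))) := by
  obtain ⟨H, hH1, hH2, hFH⟩ := S.exists_decomp h.left h.right
  have hcomm := fun {κ : Type} [Fintype κ] [DecidableEq κ] (C : Matrix κ κ K) =>
    unip_comm S.al_sq C S.al_left S.al_right
  rcases injective_or_of_rigid (F.map S.c0) (S.rigid h.left h.right hF) with hi | hi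
  · obtain ⟨n, Q, Q', hQ1, hQ2, hQ3⟩ :=
      exists_normal_form_of_independent _ (mulVec_surjective_of_vecMul _ hi)
    obtain ⟨m', h'⟩ := h.constChange (1 : Matrix ι ι K) 1 Q Q' (one_mul _) hQ1 hQ2
    rw [hFH, S.const_decomp, Matrix.one_mul, hQ3, Matrix.one_mul] at h'
    obtain ⟨m'', h''⟩ := h'.units 1
      (unip S.al_sq (Matrix.fromRows (F.map S.c1 * Q) (0 : Matrix (Fin n) (ι ⊕ Fin n) K)))
      (fun a b => by by_cases hab : a = b <;> simp [hab]) (hcomm _)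
    rw [Units.val_one, Matrix.one_mul, ← zero_add (F.map S.c1 * Q),
      S.kmat_mul_unip _ _ _ _ _ (by rw [Matrix.fromCols_mul_fromRows]; simp)] at h''
    have e0 : kmat (0 : Matrix ι (ι ⊕ Fin n) K) S.mu' = 0 := by ext; simp
    rw [e0, add_zero] at h''
    have e1 : ∀ t t', kmat (Matrix.fromCols (1 : Matrix ι ι K) (0 : Matrix ι (Fin n) K)) S.mu t
        (Sum.inl t') = if t = t' then S.mu else 0 := fun t t' => by simp [Matrix.one_apply]
    have e2 : ∀ t t', kmat (Matrix.fromCols (1 : Matrix ι ι K) (0 : Matrix ι (Fin n) K)) S.mu t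
        (Sum.inr t') = 0 := fun t t' => by simp
    refine ⟨ι ⊕ Fin n, inferInstance, inferInstance, Sum.elim (fun _ => 1) (fun _ => 2), 1,
      by rintro (x | x) <;> simp, ?_⟩
    exact exists_equiv_two (b := fun _ => 1) (a := aII) S.nII_left S.nII_right (1 : Fin 3) 2
      (S.nII_crit 1 1 (by decide) (by decide)) (S.nII_crit 1 2 (by decide) (by decide))
      (S.nII_crit 2 1 (by decide) (by decide)) (S.nII_crit 2 2 (by decide) (by decide))
      (Equiv.sumCongr (Equiv.prodUnique ι (Fin 1)) (Equiv.prodUnique (Fin n) (Fin 1)))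
      ((@Equiv.sumEmpty _ (Fin n × Fin 0) _).trans (Equiv.prodUnique ι (Fin 1)))
      h'' S.nil _ _ rfl (fun t _ t' _ => e1 t t') (fun t _ t' _ => e2 t t')
      (fun _ r => r.elim0) (fun _ r => r.elim0)
  have hi' : ∀ v, Matrix.vecMul v (F.map S.c0).transpose = 0 → v = 0 := fun v hv =>
    hi v (by rwa [Matrix.vecMul_transpose] at hv)
  rcases injective_or_of_rigid_pair (F.map S.c0).transpose (F.map S.c1).transpose (by
    intro G
    obtain ⟨A, A', B, h1, h2⟩ := S.rigid_pair h.left h.right hF G.transpose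
    refine ⟨B.transpose, A.transpose, A'.transpose, ?_, ?_⟩
    · rw [← Matrix.transpose_mul, ← Matrix.transpose_mul, ← Matrix.transpose_add, add_comm, ← h1,
        Matrix.transpose_zero]
    · rw [← Matrix.transpose_mul, ← Matrix.transpose_mul, ← Matrix.transpose_mul,
        ← Matrix.transpose_add, ← Matrix.transpose_add, ← Matrix.transpose_transpose G, h2]
      congr 1; abel) with hp | hp
  · obtain ⟨t, s, P, P', Q, Q', C, hP, hP', hQ, hQ', e0, e1⟩ :=
      exists_normal_form_of_injOn _ _ (mulVec_surjective_of_vecMul _ hi') hp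
    obtain ⟨m', h'⟩ := h.constChange Q.transpose Q'.transpose P.transpose P'.transpose
      (by rw [← Matrix.transpose_mul, hQ, Matrix.transpose_one])
      (by rw [← Matrix.transpose_mul, hP', Matrix.transpose_one])
      (by rw [← Matrix.transpose_mul, hP, Matrix.transpose_one])
    have e0' : Q.transpose * F.map S.c0 * P.transpose = Matrix.fromRows 0 1 := by
      rw [← Matrix.transpose_transpose (F.map S.c0), ← Matrix.transpose_mul,
        ← Matrix.transpose_mul, ← Matrix.mul_assoc, e0, Matrix.transpose_fromCols]
      simp
    have e1' : Q.transpose * F.map S.c1 * P.transpose =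
        Matrix.fromRows (Matrix.fromCols 1 0) 0 + Matrix.fromRows 0 C.transpose := by
      rw [← Matrix.transpose_transpose (F.map S.c1), ← Matrix.transpose_mul,
        ← Matrix.transpose_mul, ← Matrix.mul_assoc, e1, Matrix.transpose_fromCols,
        Matrix.transpose_fromRows]
      ext (a | a) b <;> simp
    rw [hFH, S.const_decomp, e0', e1'] at h'
    obtain ⟨m'', h''⟩ := h'.units 1 (unip S.al_sq C.transpose)
      (fun a b => by by_cases hab : a = b <;> simp [hab]) (hcomm _)
    rw [Units.val_one, Matrix.one_mul,
      S.kmat_mul_unip _ _ _ _ _ (by rw [Matrix.fromRows_mul]; simp)] at h''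
    let ε : (Fin t × Fin 1) ⊕ (Fin s × Fin 1) ≃ Fin t ⊕ Fin s :=
      Equiv.sumCongr (Equiv.prodUnique _ _) (Equiv.prodUnique _ _)
    let η : (Fin t × Fin 2) ⊕ (Fin s × Fin 1) ≃ Fin t ⊕ (Fin t ⊕ Fin s) :=
      { toFun := Sum.elim (fun x => if x.2 = 1 then .inl x.1 else .inr (.inl x.1))
          (fun x => .inr (.inr x.1))
        invFun := Sum.elim (fun x => .inl (x, 1)) (Sum.elim (fun x => .inl (x, 0))
          (fun x => .inr (x, 0)))
        left_inv := by
          rintro (⟨x, y⟩ | ⟨x, y⟩)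
          · fin_cases y <;> simp
          · simp [Subsingleton.elim y 0]
        right_inv := by rintro (x | x | x) <;> simp }
    let F' : Matrix (Fin t ⊕ (Fin t ⊕ Fin s)) (Fin t ⊕ Fin s) R :=
      kmat (Matrix.fromRows 0 1 : Matrix _ _ K) S.mu +
        kmat (Matrix.fromRows (Matrix.fromCols 1 0) 0 : Matrix _ _ K) S.mu'
    have h11 : ∀ (a : Fin t) (r : Fin 2) (a' : Fin t) (k : Fin 1),
        F' (η (.inl (a, r))) (ε (.inl (a', k))) = if a = a' then S.pair r k else 0 := by
      intro a r a' k
      fin_cases r <;> by_cases haa : a = a' <;> simp [F', η, ε, pair, haa]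
    have h12 : ∀ (a : Fin t) (r : Fin 2) (a' : Fin s) (k : Fin 1),
        F' (η (.inl (a, r))) (ε (.inr (a', k))) = 0 := by
      intro a r a' k
      fin_cases r <;> simp [F', η, ε]
    have h21 : ∀ (a : Fin s) (r : Fin 1) (a' : Fin t) (k : Fin 1),
        F' (η (.inr (a, r))) (ε (.inl (a', k))) = 0 := by
      intro a r a' k
      simp [F', η, ε]
    have h22 : ∀ (a : Fin s) (r : Fin 1) (a' : Fin s) (k : Fin 1),
        F' (η (.inr (a, r))) (ε (.inr (a', k))) = if a = a' then S.mu else 0 := by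
      intro a r a' k
      by_cases haa : a = a' <;> simp [F', η, ε, haa]
    refine ⟨Fin t ⊕ Fin s, inferInstance, inferInstance, Sum.elim (fun _ => 0) (fun _ => 1), 0,
      by rintro (x | x) <;> simp, ?_⟩
    exact exists_equiv_two (b := fun _ => 1) (a := aII) S.nII_left S.nII_right (0 : Fin 3) 1
      (S.nII_crit 0 0 (by decide) (by decide)) (S.nII_crit 0 1 (by decide) (by decide))
      (S.nII_crit 1 0 (by decide) (by decide)) (S.nII_crit 1 1 (by decide) (by decide))
      ε η h'' S.nil F' _ rfl h11 h12 h21 h22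
  · obtain ⟨T, hT⟩ := exists_left_inverse (F.map S.c0) hi
    have hmu' : ∀ k, S.mu' • m k ∈ D.J • D.cspan i j m := by
      intro k
      obtain ⟨w, hw0, hw1⟩ := exists_dotProduct_ker _ _ hp (Pi.single k (1 : K))
      have e0 : (Matrix.of fun _ : Fin 1 => w) * F.map S.c0 = 0 := by
        ext r l
        have := congrFun hw0 l
        rw [Matrix.mulVec_transpose] at this
        exact this
      have e1 : ∀ l, ((Matrix.of fun _ : Fin 1 => w) * F.map S.c1) 0 l =
          (Pi.single k 1 : κ → K) l := by
        intro l
        rw [← hw1, Matrix.mulVec_transpose]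
        rfl
      have h1 := S.sum_mem_of_decomp h.rel hH1 hH2 hFH (Matrix.of fun _ : Fin 1 => w) 0
      rw [e0] at h1
      simpa [e1, Pi.single_apply] using h1
    refine ⟨κ, inferInstance, inferInstance, fun _ => 0, 0, fun _ => .inl rfl, ?_⟩
    refine S.equiv_of_smul_mem (b := fun _ => 1) S.nII_left S.nII_right h 0 (sigmaUnit κ)
      S.nII_zero (fun k => ?_) hmu'
    have h1 := S.sum_mem_of_decomp h.rel hH1 hH2 hFH T k
    rw [hT] at h1
    have h2 : ∑ l, ((T * F.map S.c1) k l • S.mu') • m l ∈ D.J • D.cspan i j m := by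
      refine Submodule.sum_mem _ fun l _ => ?_
      rw [Algebra.smul_def, mul_smul]
      exact Submodule.smul_mem _ _ (hmu' l)
    have h3 := Submodule.sub_mem _ h1 h2
    rw [add_sub_cancel_right] at h3
    simpa [Matrix.one_apply] using h3

end classify

/-- The chain of length three. -/
def data : D.SideData i j 3 where
  ne := S.ne
  a := aII
  b := fun _ => 1
  N := S.nII
  left := S.nII_left
  right := S.nII_right
  crit := S.nII_crit
  isLocal p := (D.pmod_pres _ _ _ (S.nII_left p) (S.nII_right p)).isLocalRing_of_fin_one S.ne
  fac := S.nII_fac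
  notFac := S.nII_notFac
  zero := fun
    | 0, _ => S.nII_zero
  nonzero := S.nII_nonzero
  last := fun
    | 2, _ => ⟨rfl, rfl⟩
  classify _ _ := S.classify

end SideII

end Pointed

namespace Pointed
variable {K R : Type} [Field K] [Ring R] [Algebra K R] {D : Pointed K R} {i j : Fin 2}

/-- Coordinates on `e i R e j` when the second basis element is `al * mu`. -/
structure SideIII (D : Pointed K R) (i j : Fin 2) extends D.Side i j where
  al : R
  al_left : D.e i * al = al
  al_right : al * D.e i = al
  al_sq : al * al = 0
  mu'_eq : mu' = al * mu
  c1_mu' : c1 mu' = 1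
  δ : R → K
  c1_left : ∀ b x, D.e i * b = b → b * D.e i = b → D.e i * x = x → x * D.e j = x →
    c1 (b * x) = D.top b i * c1 x + δ b * c0 x
  c1_right : ∀ x a, D.e j * a = a → a * D.e j = a → D.e i * x = x → x * D.e j = x →
    c1 (x * a) = c1 x * D.top a j

namespace SideIII
variable (S : D.SideIII i j)
include S

theorem al_mem_J : S.al ∈ D.J := by
  rw [mem_J]
  exact eq_zero_of_pow_eq_zero (n := 2) (by rw [← map_pow, pow_two, S.al_sq, map_zero])

theorem al_mul_mu' : S.al * S.mu' = 0 := by rw [S.mu'_eq, ← mul_assoc, S.al_sq, zero_mul]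

/-- Numbers of relations. -/
def aIII : Fin 3 → ℕ
  | 0 => 1
  | 1 => 1
  | 2 => 0

/-- Numbers of generators. -/
def bIII : Fin 3 → ℕ
  | 0 => 1
  | 1 => 2
  | 2 => 1

/-- The presentation matrix with a single relation between two generators. -/
def pair : Matrix (Fin 1) (Fin 2) R := Matrix.of fun _ k => if k = 0 then S.mu else S.mu'

/-- The presentation matrices. -/
def nIII : ∀ p : Fin 3, Matrix (Fin (aIII p)) (Fin (bIII p)) R
  | 0 => Matrix.of fun _ _ => S.mu
  | 1 => S.pair
  | 2 => Matrix.of fun r _ => r.elim0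

theorem nIII_left : ∀ p r k, D.e i * S.nIII p r k = S.nIII p r k
  | 0, _, _ => S.mu_left
  | 1, _, (0 : Fin 2) => S.mu_left
  | 1, _, (1 : Fin 2) => S.mu'_left
  | 2, r, _ => r.elim0

theorem nIII_right : ∀ p r k, S.nIII p r k * D.e j = S.nIII p r k
  | 0, _, _ => S.mu_right
  | 1, _, (0 : Fin 2) => S.mu_right
  | 1, _, (1 : Fin 2) => S.mu'_right
  | 2, r, _ => r.elim0

/-- The first module of the chain. -/
abbrev L0 := D.PMod (fun _ => j) (S.nIII 0)
/-- The second module of the chain. -/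
abbrev L1 := D.PMod (fun _ => j) (S.nIII 1)
/-- The third module of the chain. -/
abbrev L2 := D.PMod (fun _ => j) (S.nIII 2)

/-- Generator of the first module. -/
def gen0 : Fin 1 → S.L0 := D.pgen (fun _ => j) (S.nIII 0)
/-- Generators of the second module. -/
def gen1 : Fin 2 → S.L1 := D.pgen (fun _ => j) (S.nIII 1)
/-- Generator of the third module. -/
def gen2 : Fin 1 → S.L2 := D.pgen (fun _ => j) (S.nIII 2)

theorem nIII_pres (p : Fin 3) : D.Pres (fun _ => j) (fun _ => i)
    (D.pgen (fun _ => j) (S.nIII p)) (S.nIII p) :=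
  D.pmod_pres (fun _ => j) (fun _ => i) (S.nIII p) (S.nIII_left p) (S.nIII_right p)

theorem pres0 : D.Pres (fun _ : Fin 1 => j) (fun _ : Fin 1 => i) S.gen0
    (Matrix.of fun _ _ => S.mu) := S.nIII_pres 0

theorem pres1 : D.Pres (fun _ : Fin 2 => j) (fun _ : Fin 1 => i) S.gen1 S.pair := S.nIII_pres 1

theorem pres2 : D.Pres (fun _ : Fin 1 => j) (fun _ : Fin 0 => i) S.gen2
    (Matrix.of fun r _ => r.elim0) := S.nIII_pres 2

theorem mu_gen0 (k : Fin 1) : S.mu • S.gen0 k = 0 := by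
  have : ∑ l : Fin 1, S.mu • S.gen0 l = 0 := congrFun S.pres0.rel 0
  rw [Fin.sum_univ_one] at this
  rwa [Subsingleton.elim k 0]

theorem mu'_gen0 (k : Fin 1) : S.mu' • S.gen0 k = 0 := by
  rw [S.mu'_eq, mul_smul, S.mu_gen0, smul_zero]

theorem rel_gen1 : S.mu • S.gen1 0 + S.mu' • S.gen1 1 = 0 := by
  have := congrFun S.pres1.rel 0
  rw [act_apply, Fin.sum_univ_two] at this
  exact this

theorem mu'_gen1 : S.mu' • S.gen1 0 = 0 := by
  have := congrArg (S.al • ·) S.rel_gen1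
  simpa only [smul_add, ← mul_smul, S.al_mul_mu', ← S.mu'_eq, zero_smul, add_zero, smul_zero]
    using this

theorem nIII_zero (x : S.L0) : D.e i • x = 0 :=
  S.smul_eq_zero_of_gen S.pres0.span S.pres0.gen S.mu_gen0 S.mu'_gen0 x

theorem nIII_crit_one (q : Fin 3) :
    D.Crit (fun _ => i) (S.nIII 1) (D.PMod (fun _ => j) (S.nIII q)) := by
  intro x hx
  obtain ⟨a, b, h⟩ := S.exists_coeff_sum (S.nIII_pres q).span (S.nIII_pres q).gen
    (x (0 : Fin 1)) (hx _)
  let y : Fin 2 → D.PMod (fun _ => j) (S.nIII q) := fun l => if l = 0 then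
    ∑ k, (a k : R) • D.pgen (fun _ => j) (S.nIII q) k else
    ∑ k, (b k : R) • D.pgen (fun _ => j) (S.nIII q) k
  have hy : act S.pair y 0 = x (0 : Fin 1) := by
    rw [act_apply, Fin.sum_univ_two, h]
    change S.mu • (∑ k, (a k : R) • D.pgen (fun _ => j) (S.nIII q) k) +
      S.mu' • (∑ k, (b k : R) • D.pgen (fun _ => j) (S.nIII q) k) = _
    rw [Finset.smul_sum, Finset.smul_sum, ← Finset.sum_add_distrib]
    refine Finset.sum_congr rfl fun k _ => ?_
    rw [← mul_smul, ← mul_smul, Subring.mem_center_iff.1 (a k).2,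
      Subring.mem_center_iff.1 (b k).2, ← add_smul]
    rfl
  refine ⟨y, ?_⟩
  ext r
  rw [show r = (0 : Fin 1) from Subsingleton.elim (α := Fin 1) _ _]
  exact hy

theorem nIII_crit_zero_one : D.Crit (fun _ => i) (S.nIII 0) S.L1 := by
  intro x hx
  obtain ⟨a, b, h⟩ := S.exists_coeff_sum S.pres1.span S.pres1.gen (x (0 : Fin 1)) (hx _)
  rw [Fin.sum_univ_two] at h
  have hy : S.mu • (((a 0 : R) - (b 1 : R)) • S.gen1 0 + (a 1 : R) • S.gen1 1) =
      x (0 : Fin 1) := by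
    have h2 : S.mu • S.gen1 0 = - S.mu' • S.gen1 1 := by
      rw [neg_smul]; exact eq_neg_of_add_eq_zero_left S.rel_gen1
    rw [h]
    simp only [Subring.smul_def, smul_eq_mul]
    rw [smul_add, ← mul_smul, ← mul_smul, mul_sub, Subring.mem_center_iff.1 (a 0).2,
      Subring.mem_center_iff.1 (b 1).2, Subring.mem_center_iff.1 (a 1).2]
    simp only [sub_smul, add_smul, mul_smul, S.mu'_gen1, h2, smul_zero, smul_neg, neg_smul]
    abel
  refine ⟨fun _ => ((a 0 : R) - (b 1 : R)) • S.gen1 0 + (a 1 : R) • S.gen1 1, ?_⟩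
  ext r
  rw [show r = (0 : Fin 1) from Subsingleton.elim (α := Fin 1) _ _]
  refine Eq.trans ?_ hy
  change ∑ l : Fin 1, S.mu • _ = _
  rw [Fin.sum_univ_one]

theorem nIII_crit : ∀ p q : Fin 3, (p : ℕ) ≤ q + 1 → (q : ℕ) ≤ p + 1 →
    D.Crit (fun _ => i) (S.nIII p) (D.PMod (fun _ => j) (S.nIII q))
  | 2, _, _, _ => @crit_of_isEmpty _ _ _ _ _ _ _ _ _ _ Fin.isEmpty _ _ _ _
  | 0, 0, _, _ => crit_of_smul_eq_zero S.nIII_zero _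
  | 1, q, _, _ => S.nIII_crit_one q
  | 0, 2, _, h => absurd h (by decide)
  | 0, 1, _, _ => S.nIII_crit_zero_one

theorem nIII_nonzero : ∀ p : Fin 3, (p : ℕ) ≠ 0 →
    ∃ x : D.PMod (fun _ => j) (S.nIII p), D.e i • x ≠ 0
  | 0, h => absurd rfl h
  | 2, _ => S.exists_smul_ne_zero_of_isEmpty S.pres2
  | 1, _ => by
    refine ⟨S.mu • S.gen1 1, ?_⟩
    rw [← mul_smul, S.mu_left]
    intro h0
    obtain ⟨b, hb⟩ := S.pres1.exact (fun k => if k = 1 then S.mu else 0)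
      (by rw [Fin.sum_univ_two]; simpa using h0)
    have h1 := hb 1
    rw [Fin.sum_univ_one, if_pos rfl, S.mu_right] at h1
    have h2 : S.mu = (D.e i * b 0 * D.e i) * S.mu' := by
      rw [mul_assoc, S.mu'_left, mul_assoc]
      have : b 0 * S.mu' = S.mu := h1.symm
      rw [this, S.mu_left]
    have h3 := S.c0_mu
    rw [h2, S.c0_left _ _ (by simp only [← mul_assoc, D.idem]) (by simp only [mul_assoc, D.idem])
      S.mu'_left S.mu'_right, S.c0_mu', mul_zero] at h3
    exact zero_ne_one h3

theorem isLocal_one : IsLocalRing (Module.End R S.L1) := by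
  refine S.pres1.isLocalRing S.ne fun A hA1 hA2 hA => ?_
  rw [← act_mul] at hA
  obtain ⟨b, hb⟩ := S.pres1.exact (fun k => (S.pair * A) 0 k) (by
    have := congrFun hA 0
    rwa [act_apply] at this)
  have e : ∀ k, (S.pair * A) 0 k = S.mu * A 0 k + S.mu' * A 1 k := by
    intro k
    rw [Matrix.mul_apply, Fin.sum_univ_two]
    rfl
  have h0 : S.mu * A 0 0 + S.mu' * A 1 0 = (D.e i * b 0 * D.e i) * S.mu := by
    have := congrArg (D.e i * ·) (hb 0)
    simp only [Fin.sum_univ_one, e] at this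
    rw [add_mul, mul_assoc, mul_assoc, hA2, hA2, mul_add, ← mul_assoc, ← mul_assoc, S.mu_left,
      S.mu'_left] at this
    rw [this, mul_assoc, mul_assoc, S.mu_left]
    rfl
  have h1 : S.mu * A 0 1 + S.mu' * A 1 1 = (D.e i * b 0 * D.e i) * S.mu' := by
    have := congrArg (D.e i * ·) (hb 1)
    simp only [Fin.sum_univ_one, e] at this
    rw [add_mul, mul_assoc, mul_assoc, hA2, hA2, mul_add, ← mul_assoc, ← mul_assoc, S.mu_left,
      S.mu'_left] at this
    rw [this, mul_assoc, mul_assoc, S.mu'_left]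
    rfl
  have hb1 : D.e i * (D.e i * b 0 * D.e i) = D.e i * b 0 * D.e i := by
    simp only [← mul_assoc, D.idem]
  have hb2 : (D.e i * b 0 * D.e i) * D.e i = D.e i * b 0 * D.e i := by
    simp only [mul_assoc, D.idem]
  generalize D.e i * b 0 * D.e i = b' at *
  have c00 := congrArg S.c0 h0
  have c01 := congrArg S.c0 h1
  have c11 := congrArg S.c1 h1
  rw [map_add, S.c0_right _ _ (hA1 _ _) (hA2 _ _) S.mu_left S.mu_right,
    S.c0_right _ _ (hA1 _ _) (hA2 _ _) S.mu'_left S.mu'_right] at c00 c01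
  rw [map_add, S.c1_right _ _ (hA1 _ _) (hA2 _ _) S.mu_left S.mu_right,
    S.c1_right _ _ (hA1 _ _) (hA2 _ _) S.mu'_left S.mu'_right,
    S.c1_left _ _ hb1 hb2 S.mu'_left S.mu'_right, S.c1_mu, S.c1_mu', S.c0_mu'] at c11
  rw [S.c0_left _ _ hb1 hb2 S.mu_left S.mu_right, S.c0_mu, S.c0_mu'] at c00
  rw [S.c0_left _ _ hb1 hb2 S.mu'_left S.mu'_right, S.c0_mu, S.c0_mu'] at c01
  simp only [one_mul, zero_mul, mul_one, mul_zero, add_zero, zero_add] at c00 c01 c11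
  refine ⟨D.top b' i, fun hc => ?_, fun hc => ?_⟩
  · rw [Matrix.isUnit_iff_isUnit_det, Matrix.det_fin_two]
    simpa [c00, c01, c11] using hc
  · rw [Matrix.isUnit_iff_isUnit_det, Matrix.det_fin_two]
    simpa [c00, c01, c11, sub_eq_zero] using hc.symm

theorem nIII_isLocal : ∀ p : Fin 3, IsLocalRing (Module.End R (D.PMod (fun _ => j) (S.nIII p)))
  | 0 => S.pres0.isLocalRing_of_fin_one S.ne
  | 1 => S.isLocal_one
  | 2 => S.pres2.isLocalRing_of_fin_one S.ne

theorem nIII_notFac_one_two (k : ℕ) (f : (Fin k → S.L1) →ₗ[R] S.L2) :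
    ¬ Function.Surjective f := by
  classical
  intro hf
  have key : ∀ (l : Fin k) (x : S.L1), f (Pi.single l x) ∈ D.J • (⊤ : Submodule R S.L2) := by
    intro l
    have hy : ∀ q : Fin 2, ∃ y : R, D.e j * y = y ∧ y * D.e j = y ∧
        y • S.gen2 0 = f (Pi.single l (S.gen1 q)) := by
      intro q
      obtain ⟨y, hy⟩ := exists_sum_of_span S.pres2.span (f (Pi.single l (S.gen1 q)))
      rw [Fin.sum_univ_one] at hy
      refine ⟨D.e j * y 0 * D.e j, by simp only [← mul_assoc, D.idem],
        by simp only [mul_assoc, D.idem], ?_⟩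
      rw [mul_smul, mul_smul, S.pres2.gen 0, hy, ← map_smul, ← Pi.single_smul, S.pres1.gen q]
    choose y hy1 hy2 hy3 using hy
    have h0 : (S.mu * y 0 + S.mu' * y 1) • S.gen2 0 = 0 := by
      rw [add_smul, mul_smul, mul_smul, hy3, hy3, ← map_smul, ← map_smul, ← Pi.single_smul,
        ← Pi.single_smul, ← map_add, ← Pi.single_add, S.rel_gen1, Pi.single_zero, map_zero]
    obtain ⟨b, hb⟩ := S.pres2.exact (fun _ => S.mu * y 0 + S.mu' * y 1)
      (by rw [Fin.sum_univ_one]; exact h0)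
    have h1 := hb 0
    rw [Fin.sum_univ_zero, add_mul, mul_assoc, mul_assoc, hy2, hy2] at h1
    have c0 := congrArg S.c0 h1
    have c1 := congrArg S.c1 h1
    rw [map_add, S.c0_right _ _ (hy1 _) (hy2 _) S.mu_left S.mu_right,
      S.c0_right _ _ (hy1 _) (hy2 _) S.mu'_left S.mu'_right, S.c0_mu, S.c0_mu', map_zero] at c0
    rw [map_add, S.c1_right _ _ (hy1 _) (hy2 _) S.mu_left S.mu_right,
      S.c1_right _ _ (hy1 _) (hy2 _) S.mu'_left S.mu'_right, S.c1_mu, S.c1_mu', map_zero] at c1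
    simp only [one_mul, zero_mul, add_zero, zero_add] at c0 c1
    have hJ : ∀ q, y q ∈ D.J := by
      intro q
      have h4 := D.corner_sub_mem (hy2 q)
      have h5 : D.top (y q) j = 0 := by fin_cases q; exacts [c0, c1]
      rwa [h5, map_zero, zero_mul, sub_zero] at h4
    intro x
    obtain ⟨c, rfl⟩ := exists_sum_of_span S.pres1.span x
    have : f (Pi.single l (∑ q, c q • S.gen1 q)) = ∑ q, c q • f (Pi.single l (S.gen1 q)) := by
      simp only [Fin.sum_univ_two, Pi.single_add, map_add, Pi.single_smul, map_smul]
    rw [this]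
    refine Submodule.sum_mem _ fun q _ => Submodule.smul_mem _ _ ?_
    rw [← hy3]
    exact Submodule.smul_mem_smul (hJ q) Submodule.mem_top
  have htop : (⊤ : Submodule R S.L2) = ⊥ := by
    apply D.nakayama
    intro x _
    obtain ⟨y, rfl⟩ := hf x
    have hy : y = ∑ l, Pi.single l (y l) := by
      ext l; simp
    rw [hy, map_sum]
    exact Submodule.sum_mem _ fun l _ => key l _
  have : S.gen2 0 ∈ (⊤ : Submodule R S.L2) := Submodule.mem_top
  rw [htop] at this
  exact S.pres2.gen_ne_zero S.ne 0 (by simpa using this)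

theorem nIII_fac : ∀ p q : Fin 3, p ≤ q → ∃ (k : ℕ)
    (f : (Fin k → D.PMod (fun _ => j) (S.nIII q)) →ₗ[R] D.PMod (fun _ => j) (S.nIII p)),
      Function.Surjective f
  | p, 2, _ => exists_surjective_of_span S.pres2 (S.nIII_pres p).span (S.nIII_pres p).gen
  | 0, 0, _ => exists_surjective_self _
  | 1, 1, _ => exists_surjective_self _
  | 1, 0, h => absurd h (by decide)
  | 2, 0, h => absurd h (by decide)
  | 2, 1, h => absurd h (by decide)
  | 0, 1, _ => by
    have h : act S.pair (fun _ => S.gen0 0) = 0 := by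
      ext r
      rw [act_apply, Fin.sum_univ_two]
      change S.mu • S.gen0 0 + S.mu' • S.gen0 0 = 0
      rw [S.mu_gen0, S.mu'_gen0, add_zero]
    obtain ⟨φ, hφ⟩ := S.pres1.lift (fun _ => S.gen0 0) (fun _ => S.pres0.gen 0) h
    refine exists_surjective_of_surjective φ fun x => ?_
    obtain ⟨y, rfl⟩ := exists_sum_of_span S.pres0.span x
    exact ⟨y 0 • S.gen1 0, by rw [map_smul, hφ, Fin.sum_univ_one]⟩

theorem nIII_notFac : ∀ p q : Fin 3, p < q → ∀ (k : ℕ)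
    (f : (Fin k → D.PMod (fun _ => j) (S.nIII p)) →ₗ[R] D.PMod (fun _ => j) (S.nIII q)),
      ¬ Function.Surjective f
  | 0, 0, h => absurd h (by decide)
  | 0, 1, _ => not_surjective_of_smul_eq_zero S.nIII_zero (S.nIII_nonzero 1 (by decide))
  | 0, 2, _ => not_surjective_of_smul_eq_zero S.nIII_zero (S.nIII_nonzero 2 (by decide))
  | 1, 0, h => absurd h (by decide)
  | 1, 1, h => absurd h (by decide)
  | 1, 2, _ => S.nIII_notFac_one_two
  | 2, 0, h => absurd h (by decide)
  | 2, 1, h => absurd h (by decide)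
  | 2, 2, h => absurd h (by decide)

section classify
variable {κ ι M : Type} [Fintype κ] [Fintype ι] [AddCommGroup M] [Module R M]
  [DecidableEq κ] [DecidableEq ι] {m : κ → M} {F : Matrix ι κ R}

theorem rigid_pair (hl : ∀ r k, D.e i * F r k = F r k) (hr : ∀ r k, F r k * D.e j = F r k)
    (hF : D.Presilting i j F) (G : Matrix ι κ K) :
    ∃ (A : Matrix κ κ K) (B B' : Matrix ι ι K), 0 = F.map S.c0 * A + B * F.map S.c0 ∧
      G = F.map S.c1 * A + B * F.map S.c1 + B' * F.map S.c0 := by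
  obtain ⟨A, B, hA1, hA2, hB1, hB2, h⟩ := hF (kmat G S.mu') (by simp [S.mu'_left])
    (by simp [S.mu'_right])
  refine ⟨A.map fun a => D.top a j, B.map fun a => D.top a i, B.map S.δ, ?_, ?_⟩
  · rw [← S.map_c0_mul hl hr hA1 hA2, ← S.map_mul_c0 hl hr hB1 hB2,
      ← Matrix.map_add _ (map_add S.c0), ← h]
    ext r k
    simp [S.c0_mu']
  · have h1 : (F * A).map S.c1 = F.map S.c1 * (A.map fun a => D.top a j) := by
      ext r k
      simp only [Matrix.map_apply, Matrix.mul_apply, map_sum]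
      exact Finset.sum_congr rfl fun l _ => S.c1_right _ _ (hA1 _ _) (hA2 _ _) (hl _ _) (hr _ _)
    have h2 : (B * F).map S.c1 = (B.map fun a => D.top a i) * F.map S.c1 +
        B.map S.δ * F.map S.c0 := by
      ext r k
      simp only [Matrix.map_apply, Matrix.mul_apply, Matrix.add_apply, map_sum,
        ← Finset.sum_add_distrib]
      exact Finset.sum_congr rfl fun l _ => S.c1_left _ _ (hB1 _ _) (hB2 _ _) (hl _ _) (hr _ _)
    rw [add_assoc, ← h1, ← h2, ← Matrix.map_add _ (map_add S.c1), ← h]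
    ext r k
    simp [S.c1_mu']

theorem unip_mul_kmat {ι κ : Type} [Fintype ι] [DecidableEq ι] (G G' C : Matrix ι κ K)
    (C' : Matrix ι ι K) (H : Matrix ι κ R) (hC : C' * G = C) :
    (unip S.al_sq C').1 * (kmat G S.mu + kmat (G' + C) S.mu' + S.z • H) =
      kmat G S.mu + kmat G' S.mu' + S.z • ((unip S.al_sq C').1 * H) := by
  rw [Matrix.mul_add, Matrix.mul_add, mul_central_smul]
  congr 1
  simp only [unip, Matrix.sub_mul, Matrix.one_mul, kmat_mul, S.al_mul_mu', ← S.mu'_eq, hC]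
  have : kmat (C' * (G' + C)) (0 : R) = 0 := by ext; simp
  rw [this, kmat_add]; abel

theorem classify (h : D.Pres (fun _ => j) (fun _ => i) m F) (hF : D.Presilting i j F) :
    ∃ (ξ : Type) (_ : Fintype ξ) (_ : DecidableEq ξ) (c : ξ → Fin 3) (s : ℕ),
      (∀ x, (c x : ℕ) = s ∨ (c x : ℕ) = s + 1) ∧
      Nonempty (M ≃ₗ[R] ∀ x, D.PMod (fun _ => j) (S.nIII (c x))) := by
  obtain ⟨H, hH1, hH2, hFH⟩ := S.exists_decomp h.left h.right
  rcases (injective_or_of_rigid (F.map S.c0) (S.rigid h.left h.right hF)).symm with hi | hi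
  · obtain ⟨T, hT⟩ := exists_left_inverse (F.map S.c0) hi
    have hmu' : ∀ k, S.mu' • m k ∈ D.J • D.cspan i j m := by
      intro k
      rw [S.mu'_eq, mul_smul]
      exact Submodule.smul_mem_smul S.al_mem_J
        (Submodule.subset_span ⟨_, k, S.mu_left, S.mu_right, rfl⟩)
    refine ⟨κ, inferInstance, inferInstance, fun _ => 0, 0, fun _ => .inl rfl, ?_⟩
    refine S.equiv_of_smul_mem S.nIII_left S.nIII_right h 0 (sigmaUnit κ)
      S.nIII_zero (fun k => ?_) hmu'
    have h1 := S.sum_mem_of_decomp h.rel hH1 hH2 hFH T k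
    rw [hT] at h1
    have h2 : ∑ l, ((T * F.map S.c1) k l • S.mu') • m l ∈ D.J • D.cspan i j m := by
      refine Submodule.sum_mem _ fun l _ => ?_
      rw [Algebra.smul_def, mul_smul]
      exact Submodule.smul_mem _ _ (hmu' l)
    have h3 := Submodule.sub_mem _ h1 h2
    rw [add_sub_cancel_right] at h3
    simpa [Matrix.one_apply] using h3
  rcases injective_or_of_rigid_pair (F.map S.c0) (F.map S.c1)
    (S.rigid_pair h.left h.right hF) with hp | hp
  · obtain ⟨t, s, P, P', Q, Q', C, hP, hP', hQ, hQ', e0, e1⟩ :=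
      exists_normal_form_of_injOn _ _ (mulVec_surjective_of_vecMul _ hi) hp
    obtain ⟨m', h'⟩ := h.constChange P P' Q Q' hP' hQ hQ'
    have e1' : P * F.map S.c1 * Q =
        Matrix.fromCols (Matrix.fromRows 1 0) 0 + Matrix.fromCols 0 C := by
      rw [e1]
      ext a (b | b) <;> simp
    rw [hFH, S.const_decomp, e0, e1'] at h'
    obtain ⟨m'', h''⟩ := h'.units (unip S.al_sq C) 1
      (unip_comm S.al_sq C S.al_left S.al_right)
      (fun a b => by by_cases hab : a = b <;> simp [hab])
    rw [Units.val_one, Matrix.mul_one,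
      S.unip_mul_kmat _ _ _ _ _ (by rw [Matrix.mul_fromCols]; simp)] at h''
    let η : (Fin t × Fin 1) ⊕ (Fin s × Fin 1) ≃ Fin t ⊕ Fin s :=
      Equiv.sumCongr (Equiv.prodUnique _ _) (Equiv.prodUnique _ _)
    let ε : (Fin t × Fin 2) ⊕ (Fin s × Fin 1) ≃ Fin t ⊕ (Fin t ⊕ Fin s) :=
      { toFun := Sum.elim (fun x => if x.2 = 1 then .inl x.1 else .inr (.inl x.1))
          (fun x => .inr (.inr x.1))
        invFun := Sum.elim (fun x => .inl (x, 1)) (Sum.elim (fun x => .inl (x, 0))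
          (fun x => .inr (x, 0)))
        left_inv := by
          rintro (⟨x, y⟩ | ⟨x, y⟩)
          · fin_cases y <;> simp
          · simp [Subsingleton.elim y 0]
        right_inv := by rintro (x | x | x) <;> simp }
    let F' : Matrix (Fin t ⊕ Fin s) (Fin t ⊕ (Fin t ⊕ Fin s)) R :=
      kmat (Matrix.fromCols 0 1 : Matrix _ _ K) S.mu +
        kmat (Matrix.fromCols (Matrix.fromRows 1 0) 0 : Matrix _ _ K) S.mu'
    have h11 : ∀ (a : Fin t) (r : Fin 1) (a' : Fin t) (k : Fin 2),
        F' (η (.inl (a, r))) (ε (.inl (a', k))) = if a = a' then S.pair r k else 0 := by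
      intro a r a' k
      fin_cases k <;> by_cases haa : a = a' <;> simp [F', η, ε, pair, haa]
    have h12 : ∀ (a : Fin t) (r : Fin 1) (a' : Fin s) (k : Fin 1),
        F' (η (.inl (a, r))) (ε (.inr (a', k))) = 0 := by
      intro a r a' k
      simp [F', η, ε]
    have h21 : ∀ (a : Fin s) (r : Fin 1) (a' : Fin t) (k : Fin 2),
        F' (η (.inr (a, r))) (ε (.inl (a', k))) = 0 := by
      intro a r a' k
      fin_cases k <;> simp [F', η, ε]
    have h22 : ∀ (a : Fin s) (r : Fin 1) (a' : Fin s) (k : Fin 1),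
        F' (η (.inr (a, r))) (ε (.inr (a', k))) = if a = a' then S.mu else 0 := by
      intro a r a' k
      by_cases haa : a = a' <;> simp [F', η, ε, haa]
    refine ⟨Fin t ⊕ Fin s, inferInstance, inferInstance, Sum.elim (fun _ => 1) (fun _ => 0), 0,
      by rintro (x | x) <;> simp, ?_⟩
    exact exists_equiv_two S.nIII_left S.nIII_right (1 : Fin 3) 0
      (S.nIII_crit 1 1 (by decide) (by decide)) (S.nIII_crit 1 0 (by decide) (by decide))
      (S.nIII_crit 0 1 (by decide) (by decide)) (S.nIII_crit 0 0 (by decide) (by decide))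
      ε η h'' S.nil F' _ rfl h11 h12 h21 h22
  · have hi2 : ∀ v, Matrix.vecMul v (Matrix.fromRows (F.map S.c0) (F.map S.c1)) = 0 → v = 0 := by
      intro v hv
      have h1 : Matrix.vecMul (v ∘ Sum.inl) (F.map S.c0) +
          Matrix.vecMul (v ∘ Sum.inr) (F.map S.c1) = 0 := by
        rw [← hv, ← Matrix.vecMul_fromRows]
      have h2 : v ∘ Sum.inr = 0 := by
        refine hp _ fun w hw => ?_
        have := congrArg (· ⬝ᵥ w) h1
        simpa [add_dotProduct, ← Matrix.dotProduct_mulVec, hw] using this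
      rw [h2, Matrix.zero_vecMul, add_zero] at h1
      have h3 := hi _ h1
      ext (a | a)
      exacts [congrFun h3 a, congrFun h2 a]
    obtain ⟨n, Q, Q', hQ1, hQ2, hQ3⟩ :=
      exists_normal_form_of_independent _ (mulVec_surjective_of_vecMul _ hi2)
    obtain ⟨m', h'⟩ := h.constChange (1 : Matrix ι ι K) 1 Q Q' (one_mul _) hQ1 hQ2
    rw [hFH, S.const_decomp, Matrix.one_mul, Matrix.one_mul] at h'
    rw [Matrix.fromRows_mul] at hQ3
    have q0 : ∀ a b, (F.map S.c0 * Q) a b = Matrix.fromCols (1 : Matrix (ι ⊕ ι) (ι ⊕ ι) K)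
        (0 : Matrix _ (Fin n) K) (Sum.inl a) b := fun a b => by rw [← hQ3]; simp
    have q1 : ∀ a b, (F.map S.c1 * Q) a b = Matrix.fromCols (1 : Matrix (ι ⊕ ι) (ι ⊕ ι) K)
        (0 : Matrix _ (Fin n) K) (Sum.inr a) b := fun a b => by rw [← hQ3]; simp
    let F' : Matrix ι ((ι ⊕ ι) ⊕ Fin n) R :=
      kmat (F.map S.c0 * Q) S.mu + kmat (F.map S.c1 * Q) S.mu'
    let η : (ι × Fin 1) ⊕ (Fin n × Fin 0) ≃ ι :=
      (@Equiv.sumEmpty _ (Fin n × Fin 0) _).trans (Equiv.prodUnique ι (Fin 1))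
    let ε : (ι × Fin 2) ⊕ (Fin n × Fin 1) ≃ (ι ⊕ ι) ⊕ Fin n :=
      Equiv.sumCongr
        { toFun := fun x => if x.2 = 0 then .inl x.1 else .inr x.1
          invFun := Sum.elim (fun x => (x, 0)) (fun x => (x, 1))
          left_inv := by
            rintro ⟨x, y⟩
            fin_cases y <;> simp
          right_inv := by rintro (x | x) <;> simp } (Equiv.prodUnique _ _)
    have h11 : ∀ (a : ι) (r : Fin 1) (a' : ι) (k : Fin 2),
        F' (η (.inl (a, r))) (ε (.inl (a', k))) = if a = a' then S.pair r k else 0 := by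
      intro a r a' k
      fin_cases k <;> by_cases haa : a = a' <;>
        simp [F', η, ε, pair, haa, q0, q1]
    have h12 : ∀ (a : ι) (r : Fin 1) (a' : Fin n) (k : Fin 1),
        F' (η (.inl (a, r))) (ε (.inr (a', k))) = 0 := by
      intro a r a' k
      simp [F', η, ε, q0, q1]
    refine ⟨ι ⊕ Fin n, inferInstance, inferInstance, Sum.elim (fun _ => 1) (fun _ => 2), 1,
      by rintro (x | x) <;> simp, ?_⟩
    exact exists_equiv_two S.nIII_left S.nIII_right (1 : Fin 3) 2
      (S.nIII_crit 1 1 (by decide) (by decide)) (S.nIII_crit 1 2 (by decide) (by decide))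
      (S.nIII_crit 2 1 (by decide) (by decide)) (S.nIII_crit 2 2 (by decide) (by decide))
      ε η h' S.nil F' _ rfl h11 h12 (fun _ r => r.elim0) (fun _ r => r.elim0)

end classify

/-- The chain of length three. -/
def data : D.SideData i j 3 where
  ne := S.ne
  a := aIII
  b := bIII
  N := S.nIII
  left := S.nIII_left
  right := S.nIII_right
  crit := S.nIII_crit
  isLocal := S.nIII_isLocal
  fac := S.nIII_fac
  notFac := S.nIII_notFac
  zero := fun
    | 0, _ => S.nIII_zero
  nonzero := S.nIII_nonzero
  last := fun
    | 2, _ => ⟨rfl, rfl⟩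
  classify _ _ := S.classify

end SideIII

end Pointed

section Generation

variable {R : Type} [Ring R]

/-- `M` generates `X`: `X` is a factor of a finite power of `M`. -/
def Gens (R M X : Type) [Ring R] [AddCommGroup M] [Module R M] [AddCommGroup X] [Module R X] :
    Prop := ∃ (k : ℕ) (f : (Fin k → M) →ₗ[R] X), Function.Surjective f

variable {L M X : Type} [AddCommGroup L] [Module R L] [AddCommGroup M] [Module R M]
  [AddCommGroup X] [Module R X]

theorem Gens.of_fintype {ι : Type} [Fintype ι] (f : (ι → M) →ₗ[R] X)
    (hf : Function.Surjective f) : Gens R M X :=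
  ⟨Fintype.card ι, f.comp (LinearEquiv.funCongrLeft R M (Fintype.equivFin ι)).toLinearMap,
    hf.comp (LinearEquiv.surjective _)⟩

theorem Gens.of_surjective (f : M →ₗ[R] X) (hf : Function.Surjective f) : Gens R M X :=
  Pointed.exists_surjective_of_surjective f hf

/-- The map between powers induced by a linear map. -/
def powMap (ι : Type) (f : M →ₗ[R] X) : (ι → M) →ₗ[R] (ι → X) :=
  LinearMap.pi fun i => f.comp (LinearMap.proj i)

theorem powMap_surjective (ι : Type) {f : M →ₗ[R] X} (hf : Function.Surjective f) :
    Function.Surjective (powMap ι f) := fun y => by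
  choose x hx using fun i => hf (y i)
  exact ⟨x, funext hx⟩

theorem Gens.trans (h : Gens R L M) (h' : Gens R M X) : Gens R L X := by
  obtain ⟨k, f, hf⟩ := h
  obtain ⟨l, g, hg⟩ := h'
  exact .of_fintype ((g.comp (powMap (Fin l) f)).comp
      (LinearEquiv.curry R L (Fin l) (Fin k)).toLinearMap)
    ((hg.comp (powMap_surjective _ hf)).comp (LinearEquiv.surjective _))

theorem Gens.pi {ξ : Type} [Fintype ξ] {G : ξ → Type} [∀ x, AddCommGroup (G x)]
    [∀ x, Module R (G x)] (h : ∀ x, Gens R M (G x)) : Gens R M (∀ x, G x) := by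
  choose k f hf using h
  refine .of_fintype (ι := Σ x, Fin (k x))
    (LinearMap.pi fun x => (f x).comp (LinearMap.pi fun y => LinearMap.proj ⟨x, y⟩)) fun y => ?_
  choose z hz using fun x => hf x (y x)
  exact ⟨fun p => z p.1 p.2, funext fun x => hz x⟩

theorem Gens.of_pi {ξ : Type} {G : ξ → Type} [∀ x, AddCommGroup (G x)]
    [∀ x, Module R (G x)] (h : Gens R M (∀ x, G x)) (x : ξ) : Gens R M (G x) :=
  h.trans (.of_surjective (LinearMap.proj x) (Function.surjective_eval x))

theorem Gens.proj {ξ : Type} {G : ξ → Type} [∀ x, AddCommGroup (G x)]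
    [∀ x, Module R (G x)] (x : ξ) : Gens R (∀ x, G x) (G x) :=
  .of_surjective (LinearMap.proj x) (Function.surjective_eval x)

theorem facLE_iff {Λ : Type} [Ring Λ] {M N : RMod Λ} : FacLE Λ M N ↔ Gens Λᵐᵒᵖ N M :=
  ⟨fun h => h M (Pointed.exists_surjective_self M), fun h _ hX => h.trans hX⟩

end Generation

namespace Pointed
variable {K R : Type} [Field K] [Ring R] [Algebra K R] (D : Pointed K R)
  {M N : Type} [AddCommGroup M] [Module R M] [AddCommGroup N] [Module R N]

/-- `M` is generated by elements at vertex `j`. -/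
def GenAt (j : Fin 2) (M : Type) [AddCommGroup M] [Module R M] : Prop :=
  Submodule.span R {x : M | D.e j • x = x} = ⊤

variable {D}

theorem Pres.genAt {κ ι : Type} [Fintype κ] [Fintype ι] {j : Fin 2} {u : ι → Fin 2} {m : κ → M}
    {F : Matrix ι κ R} (h : D.Pres (fun _ => j) u m F) : D.GenAt j M :=
  top_unique (h.span.ge.trans (Submodule.span_mono (by rintro _ ⟨k, rfl⟩; exact h.gen k)))

theorem GenAt.of_surjective {j : Fin 2} (h : D.GenAt j M) (f : M →ₗ[R] N)
    (hf : Function.Surjective f) : D.GenAt j N := by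
  have h1 : Submodule.map f ⊤ = ⊤ := by rw [Submodule.map_top, LinearMap.range_eq_top.2 hf]
  rw [GenAt, ← top_le_iff, ← h1, ← h, Submodule.map_span]
  refine Submodule.span_mono ?_
  rintro _ ⟨x, hx, rfl⟩
  change D.e j • f x = f x
  rw [← map_smul, hx]

theorem GenAt.pi {ξ : Type} [Fintype ξ] [DecidableEq ξ] {G : ξ → Type} [∀ x, AddCommGroup (G x)]
    [∀ x, Module R (G x)] {j : Fin 2} (h : ∀ x, D.GenAt j (G x)) : D.GenAt j (∀ x, G x) := by
  rw [GenAt, ← top_le_iff]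
  intro y _
  rw [show y = ∑ x, LinearMap.single R G x (y x) from (Finset.univ_sum_single y).symm]
  refine Submodule.sum_mem _ fun x _ => ?_
  have : y x ∈ Submodule.span R {x : G x | D.e j • x = x} := by rw [h]; trivial
  have h2 := Submodule.mem_map_of_mem (f := LinearMap.single R G x) this
  rw [Submodule.map_span] at h2
  refine Submodule.span_mono ?_ h2
  rintro _ ⟨z, hz, rfl⟩
  change D.e j • LinearMap.single R G x z = _
  rw [← map_smul, hz]

theorem GenAt.gens {j : Fin 2} (h : D.GenAt j M) (hg : Gens R M N) : D.GenAt j N := by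
  obtain ⟨k, f, hf⟩ := hg
  exact (GenAt.pi fun _ => h).of_surjective f hf

theorem GenAt.eq_zero {i j : Fin 2} (hij : i ≠ j) (hi : D.GenAt i M) (hj : D.GenAt j M) (x : M) :
    x = 0 := by
  have key : ∀ x : M, ∀ r, (D.e i * r) • x ∈ D.J • (⊤ : Submodule R M) := by
    intro x
    have : x ∈ Submodule.span R {x : M | D.e j • x = x} := by rw [hj]; trivial
    induction this using Submodule.span_induction with
    | mem x hx =>
      intro r
      rw [← hx, ← mul_smul]
      exact Submodule.smul_mem_smul (D.mem_J_of_ne hij (by rw [← mul_assoc, ← mul_assoc, D.idem])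
        (by rw [mul_assoc, D.idem])) trivial
    | zero => simp
    | add x y _ _ hx hy =>
      intro r
      rw [smul_add]
      exact Submodule.add_mem _ (hx r) (hy r)
    | smul a x _ hx =>
      intro r
      rw [← mul_smul, mul_assoc]
      exact hx _
  have h0 : (⊤ : Submodule R M) = ⊥ := by
    apply D.nakayama
    nth_rewrite 1 [← hi]
    rw [Submodule.span_le]
    intro x hx
    have hx' : D.e i • x = x := hx
    rw [← hx']
    simpa using key x 1
  have : x ∈ (⊤ : Submodule R M) := trivial
  rw [h0] at this
  simpa using this

/-- A module with no nonzero maps from some nonzero projective misses a vertex. -/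
theorem exists_smul_eq_zero (P : Type) [AddCommGroup P] [Module R P] [Module.Projective R P]
    [Nontrivial P] (h : ∀ f : P →ₗ[R] M, f = 0) : ∃ i, ∀ y : M, D.e i • y = 0 := by
  obtain ⟨s, hs⟩ := Module.projective_def'.1 ‹Module.Projective R P›
  have hz : ∀ (x p : P) (y : M), s x p • y = 0 := fun x p y =>
    LinearMap.congr_fun (h (((LinearMap.toSpanSingleton R M y).comp (Finsupp.lapply p)).comp s)) x
  have h1 : ∃ x p, s x p ∉ D.J := by
    by_contra! hJ
    have : (⊤ : Submodule R P) = ⊥ := by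
      apply D.nakayama
      intro x _
      have hx : Finsupp.linearCombination R id (s x) = x := LinearMap.congr_fun hs x
      rw [← hx, Finsupp.linearCombination_apply]
      exact Submodule.sum_mem _ fun p _ => Submodule.smul_mem_smul (hJ x p) trivial
    exact bot_ne_top this.symm
  obtain ⟨x, p, hr⟩ := h1
  set r := s x p
  rw [mem_J] at hr
  obtain ⟨i, hi⟩ := Function.ne_iff.1 hr
  refine ⟨i, fun y => ?_⟩
  have h2 := D.corner_sub_mem (i := i) (r := r * D.e i) (by rw [mul_assoc, D.idem])
  have h3 : D.top (r * D.e i) i = D.top r i := by simp [D.top_e]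
  rw [h3] at h2
  have h4 : Submodule.span R {D.e i • y} = ⊥ := by
    apply D.nakayama
    rw [Submodule.span_singleton_le_iff_mem]
    have h5 := Submodule.smul_mem_smul h2 (Submodule.mem_span_singleton_self (D.e i • y))
    rw [sub_smul, mul_smul, mul_smul, D.ee_smul, hz, zero_sub] at h5
    have h6 := Submodule.smul_mem _ (algebraMap K R (-(D.top r i)⁻¹)) h5
    rwa [smul_neg, ← mul_smul, ← map_mul, neg_mul, inv_mul_cancel₀ hi, map_neg, map_one,
      neg_smul, neg_neg, one_smul] at h6
  simpa using h4

end Pointed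

namespace Pointed
variable {K R : Type} [Field K] [Ring R] [Algebra K R] {D : Pointed K R} {n : ℕ}

/-- The members of the two chains of presented modules. -/
abbrev Chain (S : ∀ j, D.SideData (1 - j) j (n + 1)) (γ : Fin 2 × Fin (n + 1)) : Type :=
  D.PMod (fun _ => γ.1) ((S γ.1).N γ.2)

/-- The projective members. -/
def projs (n : ℕ) : Finset (Fin 2 × Fin (n + 1)) := Finset.univ.image fun x => (x, Fin.last n)

/-- The pairs of neighbours in a chain, and the minimal element of a chain. -/
def pairs (n : ℕ) (j : Fin 2) (p : Fin (n + 1)) : Finset (Fin 2 × Fin (n + 1)) :=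
  Finset.univ.filter fun γ => γ.1 = j ∧ (γ.2 = p ∨ (γ.2 : ℕ) + 1 = p)

/-- The sets of summands of the support τ-tilting modules. -/
def summands (n : ℕ) (x : WithTop (WithBot (Fin (n + 1) ⊕ Fin (n + 1)))) :
    Finset (Fin 2 × Fin (n + 1)) :=
  WithTop.recTopCoe (C := fun _ => Finset (Fin 2 × Fin (n + 1))) (projs n)
    (fun y => WithBot.recBotCoe (C := fun _ => Finset (Fin 2 × Fin (n + 1))) ∅
      (fun z => Sum.elim (pairs n 0) (pairs n 1) z) y) x

theorem mem_projs {γ : Fin 2 × Fin (n + 1)} : γ ∈ projs n ↔ γ.2 = Fin.last n := by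
  simp only [projs, Finset.mem_image, Finset.mem_univ, true_and]
  exact ⟨fun ⟨x, hx⟩ => hx ▸ rfl, fun h => ⟨γ.1, by rw [← h]⟩⟩

theorem card_projs : (projs n).card = 2 := by
  rw [projs, Finset.card_image_of_injective _ fun x y h => congrArg Prod.fst h]; rfl

theorem mem_pairs {γ : Fin 2 × Fin (n + 1)} {j : Fin 2} {p : Fin (n + 1)} :
    γ ∈ pairs n j p ↔ γ.1 = j ∧ (γ.2 = p ∨ (γ.2 : ℕ) + 1 = p) := by simp [pairs]

theorem pairs_zero (j : Fin 2) : pairs n j 0 = {(j, 0)} := by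
  ext ⟨a, b⟩
  simp [mem_pairs]

theorem pairs_succ (j : Fin 2) (p : Fin n) :
    pairs n j p.succ = {(j, p.succ), (j, p.castSucc)} := by
  ext ⟨a, b⟩
  simp only [mem_pairs, Finset.mem_insert, Finset.mem_singleton, Prod.mk.injEq, Fin.ext_iff,
    Fin.val_succ, Fin.val_castSucc]
  omega

theorem card_pairs_succ (j : Fin 2) (p : Fin n) : (pairs n j p.succ).card = 2 := by
  rw [pairs_succ, Finset.card_pair]
  simp [Fin.ext_iff]

section Fam
variable (S : ∀ j, D.SideData (1 - j) j (n + 1))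

theorem chain_pres (γ : Fin 2 × Fin (n + 1)) :
    D.Pres (fun _ => γ.1) (fun _ => 1 - γ.1) (D.pgen (fun _ => γ.1) ((S γ.1).N γ.2))
      ((S γ.1).N γ.2) :=
  D.pmod_pres _ _ _ ((S γ.1).left γ.2) ((S γ.1).right γ.2)

theorem chain_genAt (γ : Fin 2 × Fin (n + 1)) : D.GenAt γ.1 (Chain S γ) := (chain_pres S γ).genAt

instance chain_isLocal (γ : Fin 2 × Fin (n + 1)) : IsLocalRing (Module.End R (Chain S γ)) :=
  (S γ.1).isLocal γ.2

theorem chain_nontrivial (γ : Fin 2 × Fin (n + 1)) : Nontrivial (Chain S γ) :=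
  (isIndecModule_of_isLocalRing (R := R) (N := Chain S γ)).1

instance chain_finite (γ : Fin 2 × Fin (n + 1)) : Module.Finite R (Chain S γ) :=
  (chain_pres S γ).finite

theorem chain_not_both {γ : Fin 2 × Fin (n + 1)} {j : Fin 2} (hj : j ≠ γ.1)
    (h : D.GenAt j (Chain S γ)) : False := by
  have := chain_nontrivial S γ
  obtain ⟨x, hx⟩ := exists_ne (0 : Chain S γ)
  exact hx (h.eq_zero hj (chain_genAt S γ) x)

theorem chain_injective (γ γ' : Fin 2 × Fin (n + 1))
    (h : Nonempty (Chain S γ ≃ₗ[R] Chain S γ')) : γ = γ' := by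
  obtain ⟨f⟩ := h
  obtain ⟨j, p⟩ := γ
  obtain ⟨j', p'⟩ := γ'
  have hj : j = j' := by
    by_contra hne
    exact chain_not_both S hne ((chain_genAt S (j, p)).of_surjective f.toLinearMap f.surjective)
  subst hj
  congr 1
  rcases lt_trichotomy p p' with hp | hp | hp
  · obtain ⟨k, g, hg⟩ := exists_surjective_of_surjective f.toLinearMap f.surjective
    exact ((S j).notFac p p' hp k g hg).elim
  · exact hp
  · obtain ⟨k, g, hg⟩ := exists_surjective_of_surjective f.symm.toLinearMap f.symm.surjective
    exact ((S j).notFac p' p hp k g hg).elim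

theorem chain_gens (j : Fin 2) {p q : Fin (n + 1)} (h : p ≤ q) :
    Gens R (Chain S (j, q)) (Chain S (j, p)) := (S j).fac p q h

theorem isEmpty_rows (j : Fin 2) : IsEmpty (Fin ((S j).a (Fin.last n))) := by
  rw [((S j).last _ rfl).1]; infer_instance

/-- Projective modules are products of projective members of the family. -/
theorem exists_equiv_of_noRel {κ M : Type} [Fintype κ] [DecidableEq κ] [AddCommGroup M]
    [Module R M] {v : κ → Fin 2} {m : κ → M}
    (h : D.Pres v (fun x : Empty => x.elim) m (noRel R κ)) :
    Nonempty (M ≃ₗ[R] ∀ x, Chain S (v x, Fin.last n)) := by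
  have : ∀ x, Unique (Fin ((S (v x)).b (Fin.last n))) := fun x => by
    rw [((S (v x)).last _ rfl).2]; infer_instance
  have he : ∀ x, IsEmpty (Fin ((S (v x, Fin.last n).1).a (v x, Fin.last n).2)) :=
    fun x => isEmpty_rows S (v x)
  have h2 := h.reindex (Equiv.sigmaUnique κ fun x => Fin ((S (v x)).b (Fin.last n)))
    (Equiv.refl Empty)
  have h3 := Pres.pi (fun x => chain_pres S (v x, Fin.last n))
  obtain ⟨f, -⟩ := h2.iso h3 (funext fun r => r.elim) (funext fun r => ((he r.1).false r.2).elim)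
  exact ⟨f⟩

variable (D) in
theorem self_pres : D.Pres id (fun x : Empty => x.elim) D.e (noRel R (Fin 2)) where
  left r := r.elim
  right r := r.elim
  gen k := D.idem k
  span := by
    rw [Ideal.eq_top_iff_one, ← D.sum]
    exact Submodule.add_mem _ (Submodule.subset_span ⟨0, rfl⟩) (Submodule.subset_span ⟨1, rfl⟩)
  rel := funext fun r => r.elim
  exact y hy := by
    refine ⟨fun x => x.elim, fun k => ?_⟩
    have := congrArg (· * D.e k) hy
    simp only [smul_eq_mul, Finset.sum_mul, mul_assoc, zero_mul] at this
    rw [Finset.sum_eq_single k (fun l _ hl => by rw [D.orth _ _ hl, mul_zero])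
      (by simp), D.idem] at this
    rw [id, this]
    simp

theorem exists_self_equiv : Nonempty (R ≃ₗ[R] ∀ γ : projs n, Chain S γ) := by
  obtain ⟨f⟩ := exists_equiv_of_noRel S D.self_pres
  let w : Fin 2 ≃ projs n := Equiv.ofBijective (fun x => ⟨(x, Fin.last n), mem_projs.2 rfl⟩)
    ⟨fun x y h => congrArg (fun γ : projs n => γ.1.1) h, fun ⟨γ, h⟩ => ⟨γ.1, by
      rw [mem_projs] at h; exact Subtype.ext (Prod.ext rfl h.symm)⟩⟩
  exact ⟨f.trans (LinearEquiv.piCongrLeft R (fun γ : projs n => Chain S γ) w)⟩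

theorem chain_crit {γ γ' : Fin 2 × Fin (n + 1)}
    (h : γ.2 = Fin.last n ∨ γ.1 = γ'.1 ∧ (γ.2 : ℕ) ≤ γ'.2 + 1 ∧ (γ'.2 : ℕ) ≤ γ.2 + 1) :
    D.Crit (fun _ => 1 - γ.1) ((S γ.1).N γ.2) (Chain S γ') := by
  obtain ⟨j, p⟩ := γ
  obtain ⟨j', p'⟩ := γ'
  rcases h with h | ⟨h, h1, h2⟩
  · change p = Fin.last n at h
    subst h
    have := isEmpty_rows S j
    exact fun _ _ => ⟨0, funext fun r => isEmptyElim (α := Fin ((S j).a (Fin.last n))) r⟩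
  · change j = j' at h
    subst h
    exact (S j).crit p p' h1 h2

theorem hom_eq_zero {Q : Finset (Fin 2 × Fin (n + 1))} {M : Type} [AddCommGroup M] [Module R M]
    (h : ∀ γ ∈ Q, ∀ x : M, D.e γ.1 • x = 0) (f : (∀ γ : Q, Chain S γ) →ₗ[R] M) : f = 0 := by
  refine hom_ext_of_span (Pres.pi fun γ : Q => chain_pres S γ).span fun k => ?_
  rw [← (Pres.pi fun γ : Q => chain_pres S γ).gen k, map_smul, h _ k.1.2]
  rfl

end Fam
end Pointed

namespace Pointed
variable {K R : Type} [Field K] [Ring R] [Algebra K R] {D : Pointed K R} {n : ℕ}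
  (S : ∀ j, D.SideData (1 - j) j (n + 1))

theorem _root_.TwoPoint.eq_one_sub : ∀ {i j : Fin 2}, i ≠ j → i = 1 - j := by decide

theorem _root_.TwoPoint.one_sub_ne : ∀ j : Fin 2, 1 - j ≠ j := by decide

/-- The product of the members of the family in a finite set. -/
abbrev famProd (Q : Finset (Fin 2 × Fin (n + 1))) : Type := ∀ γ : Q, Chain S γ

include S in
theorem self_classCount : HasIndecClassCount R (ModuleCat.of R R) 2 := by
  obtain ⟨f⟩ := exists_self_equiv S
  have := (basic_and_count (chain_injective S) _ f).2
  rwa [card_projs] at this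

include S in
theorem self_classCount_eq {r : ℕ} (h : HasIndecClassCount R (ModuleCat.of R R) r) : r = 2 := by
  obtain ⟨f⟩ := exists_self_equiv S
  have := D.isArtinian
  have := D.isNoetherian
  rw [classCount_eq (chain_injective S) f h]
  refine Eq.trans (congrArg Finset.card ?_) (card_projs (n := n))
  ext γ
  simp

theorem famProd_supportTauTilting (Q P : Finset (Fin 2 × Fin (n + 1)))
    (hQ : ∀ γ ∈ Q, ∀ γ' ∈ Q, γ.2 = Fin.last n ∨
      γ.1 = γ'.1 ∧ (γ.2 : ℕ) ≤ γ'.2 + 1 ∧ (γ'.2 : ℕ) ≤ γ.2 + 1)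
    (hP : ∀ γ ∈ P, γ.2 = Fin.last n) (hPQ : ∀ γ ∈ P, ∀ γ' ∈ Q, ∀ x : Chain S γ', D.e γ.1 • x = 0)
    (hc : Q.card + P.card = 2) :
    IsSupportTauTiltingCat R (ModuleCat.of R (famProd S Q)) ∧
      IsBasicModuleCat R (ModuleCat.of R (famProd S Q)) := by
  have h1 := basic_and_count (chain_injective S) Q (LinearEquiv.refl R (famProd S Q))
  have h2 := basic_and_count (chain_injective S) P (LinearEquiv.refl R (famProd S P))
  have h3 := Pres.pi (fun γ : P => chain_pres S γ)
  have : IsEmpty (Σ γ : P, Fin ((S γ.1.1).a γ.1.2)) := ⟨fun ⟨⟨⟨j, p⟩, hp⟩, r⟩ => by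
    obtain rfl : p = Fin.last n := hP _ hp
    exact (isEmpty_rows S j).false r⟩
  refine ⟨⟨D.tauRigid_of_crit (Pres.pi fun γ : Q => chain_pres S γ)
    (Crit.pi fun γ γ' : Q => chain_crit S (hQ γ.1 γ.2 γ'.1 γ'.2)),
    ModuleCat.of R (famProd S P), _, _, _,
    h3.finite, h3.projective, ?_, h1.2, h2.2, self_classCount S, hc⟩, h1.1⟩
  exact hom_eq_zero S fun γ hγ x => funext fun γ' => hPQ γ hγ γ' γ'.2 (x γ')

theorem exists_label {M : Type} [AddCommGroup M] [Module R M]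
    (hM : IsTauRigidCat R (ModuleCat.of R M)) :
    ∃ (ξ : Type) (_ : Fintype ξ) (c : ξ → Fin 2 × Fin (n + 1)),
      ((∀ x, (c x).2 = Fin.last n) ∨
        ∃ j, ∃ s : ℕ, ∀ x, (c x).1 = j ∧ (((c x).2 : ℕ) = s ∨ ((c x).2 : ℕ) = s + 1)) ∧
      Nonempty (M ≃ₗ[R] ∀ x, Chain S (c x)) := by
  rcases D.tauRigid_cases hM with ⟨k, v, m, h⟩ | ⟨i, j, k, p, m, F, hij, h, hF⟩
  · exact ⟨Fin k, inferInstance, fun x => (v x, Fin.last n), .inl fun x => rfl,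
      exists_equiv_of_noRel S h⟩
  · obtain rfl := eq_one_sub hij
    obtain ⟨ξ, _, _, c, s, hs, f⟩ := (S j).classify m F h hF
    exact ⟨ξ, inferInstance, fun x => (j, c x), .inr ⟨j, s, fun x => ⟨rfl, hs x⟩⟩, f⟩

theorem exists_famProd_equiv {M : Type} [AddCommGroup M] [Module R M]
    (hM : IsSupportTauTiltingCat R (ModuleCat.of R M))
    (hb : IsBasicModuleCat R (ModuleCat.of R M)) :
    ∃ Q : Finset (Fin 2 × Fin (n + 1)), Nonempty (M ≃ₗ[R] famProd S Q) ∧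
      (Q = projs n ∨ Q = ∅ ∨ ∃ j p, Q = pairs n j p) := by
  classical
  obtain ⟨ht, P, p, q, r, hPf, hPp, hom, hp, hq, hr, hpq⟩ := hM
  obtain ⟨ξ, _, c, hc, ⟨f⟩⟩ := exists_label S ht
  have := D.isArtinian
  have := D.isNoetherian
  have : Module.Finite R M := ht.1
  obtain ⟨g⟩ := basic_equiv (chain_injective S) f hb
  refine ⟨_, ⟨g⟩, ?_⟩
  rw [self_classCount_eq S hr, classCount_eq (chain_injective S) f hp] at hpq
  set Q := Finset.univ.image c with hQ
  have hc' : (∀ γ ∈ Q, γ.2 = Fin.last n) ∨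
      ∃ j, ∃ s : ℕ, ∀ γ ∈ Q, γ.1 = j ∧ ((γ.2 : ℕ) = s ∨ (γ.2 : ℕ) = s + 1) := by
    simpa [hQ] using hc
  have h2 : Q.card = 0 ∨ Q.card = 1 ∨ Q.card = 2 := by omega
  rcases h2 with h2 | h2 | h2
  · exact .inr (.inl (Finset.card_eq_zero.1 h2))
  · right; right
    obtain ⟨⟨j, s⟩, hs⟩ := Finset.card_eq_one.1 h2
    obtain rfl : q = 1 := by omega
    have hPn : Nontrivial P := by
      obtain ⟨k, N, -, hN, d, hd, -⟩ := hq
      obtain ⟨a, -⟩ := hd 0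
      have := (hN a).1
      exact (Submodule.subtype_injective (N a)).nontrivial
    obtain ⟨i, hi⟩ := D.exists_smul_eq_zero P hom
    have hi' : ∀ x : Chain S (j, s), D.e i • x = 0 := by
      intro x
      have hmem : (j, s) ∈ Q := by rw [hs]; simp
      have h3 := congrArg g (hi (g.symm (Pi.single ⟨(j, s), hmem⟩ x)))
      rw [map_smul, LinearEquiv.apply_symm_apply, map_zero] at h3
      have := congrFun h3 ⟨(j, s), hmem⟩
      simpa using this
    have hij : i = 1 - j := by
      refine eq_one_sub ?_
      rintro rfl
      have := chain_nontrivial S (i, s)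
      have h4 : (⊤ : Submodule R (Chain S (i, s))) = ⊥ := by
        rw [← chain_genAt S (i, s), Submodule.span_eq_bot]
        intro x hx
        rw [← hi' x]
        exact hx.symm
      exact bot_ne_top h4.symm
    have hs0 : s = 0 := by
      by_contra hne
      obtain ⟨x, hx⟩ := (S j).nonzero s fun h => hne (Fin.ext h)
      rw [hij] at hi'
      exact hx (hi' x)
    exact ⟨j, 0, by rw [hs, hs0, pairs_zero]⟩
  · rcases hc' with hc' | ⟨j, s, hs⟩
    · left
      exact Finset.eq_of_subset_of_card_le (fun γ h => mem_projs.2 (hc' γ h))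
        (by rw [card_projs, h2])
    · right; right
      obtain ⟨⟨j₁, a⟩, ⟨j₂, b⟩, hab, hQab⟩ := Finset.card_eq_two.1 h2
      obtain ⟨h3, h3'⟩ := hs (j₁, a) (by simp [hQab])
      obtain ⟨h4, h4'⟩ := hs (j₂, b) (by simp [hQab])
      simp only at h3 h3' h4 h4'
      subst h3 h4
      have hab' : (a : ℕ) ≠ b := fun h => hab (by rw [Fin.ext h])
      rcases lt_or_gt_of_ne hab' with h | h
      · refine ⟨j₂, b, hQab.trans ?_⟩
        ext ⟨x, y⟩
        simp only [mem_pairs, Finset.mem_insert, Finset.mem_singleton, Prod.mk.injEq, Fin.ext_iff]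
        omega
      · refine ⟨j₂, a, hQab.trans ?_⟩
        ext ⟨x, y⟩
        simp only [mem_pairs, Finset.mem_insert, Finset.mem_singleton, Prod.mk.injEq, Fin.ext_iff]
        omega

theorem projs_supportTauTilting :
    IsSupportTauTiltingCat R (ModuleCat.of R (famProd S (projs n))) ∧
      IsBasicModuleCat R (ModuleCat.of R (famProd S (projs n))) :=
  famProd_supportTauTilting S _ ∅ (fun γ h _ _ => .inl (mem_projs.1 h)) (by simp) (by simp)
    (by simp [card_projs])

theorem empty_supportTauTilting :
    IsSupportTauTiltingCat R (ModuleCat.of R (famProd S ∅)) ∧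
      IsBasicModuleCat R (ModuleCat.of R (famProd S ∅)) :=
  famProd_supportTauTilting S _ (projs n) (by simp) (fun _ => mem_projs.1) (by simp)
    (by simp [card_projs])

theorem pairs_supportTauTilting (j : Fin 2) (p : Fin (n + 1)) :
    IsSupportTauTiltingCat R (ModuleCat.of R (famProd S (pairs n j p))) ∧
      IsBasicModuleCat R (ModuleCat.of R (famProd S (pairs n j p))) := by
  have hQ : ∀ γ ∈ pairs n j p, ∀ γ' ∈ pairs n j p, γ.2 = Fin.last n ∨
      γ.1 = γ'.1 ∧ (γ.2 : ℕ) ≤ γ'.2 + 1 ∧ (γ'.2 : ℕ) ≤ γ.2 + 1 := by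
    intro γ h γ' h'
    rw [mem_pairs] at h h'
    right
    refine ⟨h.1.trans h'.1.symm, ?_⟩
    have h1 := h.2
    have h2 := h'.2
    rw [Fin.ext_iff] at h1 h2
    omega
  induction p using Fin.cases with
  | zero =>
    refine famProd_supportTauTilting S _ {(1 - j, Fin.last n)} hQ (by simp) ?_
      (by rw [pairs_zero]; rfl)
    intro γ hγ γ' hγ' x
    obtain rfl := Finset.mem_singleton.1 hγ
    rw [pairs_zero] at hγ'
    obtain rfl := Finset.mem_singleton.1 hγ'
    exact (S j).zero 0 rfl x
  | succ p =>
    exact famProd_supportTauTilting S _ ∅ hQ (by simp) (by simp) (by simp [card_pairs_succ])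

theorem famProd_genAt {Q : Finset (Fin 2 × Fin (n + 1))} {j : Fin 2} (h : ∀ γ ∈ Q, γ.1 = j) :
    D.GenAt j (famProd S Q) :=
  GenAt.pi fun γ => by
    obtain ⟨⟨j', p⟩, hγ⟩ := γ
    obtain rfl : j' = j := h _ hγ
    exact chain_genAt S (j', p)

theorem famProd_gens {Q Q' : Finset (Fin 2 × Fin (n + 1))}
    (h : ∀ γ ∈ Q, ∃ γ' ∈ Q', γ.1 = γ'.1 ∧ γ.2 ≤ γ'.2) : Gens R (famProd S Q') (famProd S Q) := by
  refine .pi fun γ => ?_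
  obtain ⟨⟨j, p⟩, hγ⟩ := γ
  obtain ⟨⟨j', p'⟩, hγ', rfl, hp⟩ := h _ hγ
  exact (Gens.proj (R := R) (G := fun γ : Q' => Chain S γ) ⟨(j, p'), hγ'⟩).trans (chain_gens S j hp)

theorem famProd_gens_pairs {j : Fin 2} {p q : Fin (n + 1)} :
    Gens R (famProd S (pairs n j q)) (famProd S (pairs n j p)) ↔ p ≤ q := by
  refine ⟨fun h => ?_, fun h => famProd_gens S fun γ hγ => ⟨(j, q), by simp [mem_pairs], ?_⟩⟩
  · by_contra! hqp
    have h1 : Gens R (Chain S (j, q)) (famProd S (pairs n j q)) := .pi fun γ => by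
      obtain ⟨⟨j', s⟩, hγ⟩ := γ
      obtain ⟨rfl, hs⟩ := mem_pairs.1 hγ
      refine chain_gens S _ ?_
      simp only [Fin.ext_iff, Fin.le_def] at hs ⊢
      omega
    obtain ⟨k, f, hf⟩ := h1.trans (h.of_pi ⟨(j, p), by simp [mem_pairs]⟩)
    exact (S j).notFac q p hqp k f hf
  · obtain ⟨h1, h2⟩ := mem_pairs.1 hγ
    refine ⟨h1, ?_⟩
    simp only [Fin.ext_iff, Fin.le_def] at h h2 ⊢
    omega

theorem not_famProd_gens {Q Q' : Finset (Fin 2 × Fin (n + 1))} {j : Fin 2}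
    (h' : ∀ γ ∈ Q', γ.1 = j) {γ : Fin 2 × Fin (n + 1)} (h : γ ∈ Q) (hj : j ≠ γ.1) :
    ¬ Gens R (famProd S Q') (famProd S Q) := fun hg =>
  chain_not_both S hj ((famProd_genAt S h').gens (hg.of_pi ⟨γ, h⟩))

theorem famProd_gens_summands (x y : WithTop (WithBot (Fin (n + 1) ⊕ Fin (n + 1)))) :
    x ≤ y ↔ Gens R (famProd S (summands n y)) (famProd S (summands n x)) := by
  have top : ∀ Q, Gens R (famProd S (projs n)) (famProd S Q) := fun Q =>
    famProd_gens S fun γ _ => ⟨(γ.1, Fin.last n), mem_projs.2 rfl, rfl, Fin.le_last _⟩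
  have bot : ∀ Q, Gens R (famProd S Q) (famProd S ∅) := fun Q => famProd_gens S (by simp)
  have pm : ∀ j p, (j, p) ∈ pairs n j p := fun j p => by simp [mem_pairs]
  have pj : ∀ j p, ∀ γ ∈ pairs n j p, γ.1 = j := fun j p γ h => (mem_pairs.1 h).1
  have nbot : ∀ Q, ∀ γ ∈ Q, ¬ Gens R (famProd S ∅) (famProd S Q) := fun Q γ h =>
    not_famProd_gens S (j := 1 - γ.1) (by simp) h (one_sub_ne γ.1)
  have ntop : ∀ j p, ¬ Gens R (famProd S (pairs n j p)) (famProd S (projs n)) := fun j p =>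
    not_famProd_gens S (pj j p) (γ := (1 - j, Fin.last n)) (mem_projs.2 rfl)
      (one_sub_ne j).symm
  have nside : ∀ j j' p q, j ≠ j' → ¬ Gens R (famProd S (pairs n j p)) (famProd S (pairs n j' q)) :=
    fun j j' p q h => not_famProd_gens S (pj j p) (pm j' q) h
  induction y using WithTop.recTopCoe with
  | top => exact iff_of_true le_top (top _)
  | coe y =>
    induction x using WithTop.recTopCoe with
    | top =>
      refine iff_of_false (by simp) ?_
      induction y using WithBot.recBotCoe with
      | bot => exact nbot _ (0, Fin.last n) (mem_projs.2 rfl)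
      | coe y =>
        cases y with
        | inl q => exact ntop 0 q
        | inr q => exact ntop 1 q
    | coe x =>
      rw [WithTop.coe_le_coe]
      induction x using WithBot.recBotCoe with
      | bot => exact iff_of_true bot_le (bot _)
      | coe x =>
        induction y using WithBot.recBotCoe with
        | bot =>
          refine iff_of_false (by simp) ?_
          cases x with
          | inl p => exact nbot _ _ (pm 0 p)
          | inr p => exact nbot _ _ (pm 1 p)
        | coe y =>
          rw [WithBot.coe_le_coe]
          cases x with
          | inl p =>
            cases y with
            | inl q => exact Sum.inl_le_inl_iff.trans (famProd_gens_pairs S).symm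
            | inr q => exact iff_of_false Sum.not_inl_le_inr (nside 1 0 q p (by decide))
          | inr p =>
            cases y with
            | inl q => exact iff_of_false Sum.not_inr_le_inl (nside 0 1 q p (by decide))
            | inr q => exact Sum.inr_le_inr_iff.trans (famProd_gens_pairs S).symm

end Pointed

/-- The data of support τ-tilting modules of an algebra with two chains of presented modules. -/
theorem tauTiltingData_of_sideData {K Λ : Type} [Field K] [Ring Λ] [Algebra K Λ]
    {D : Pointed K Λᵐᵒᵖ} {n : ℕ} (S : ∀ j, D.SideData (1 - j) j (n + 1)) :
    TauTiltingData Λ (2 * n + 4) (n + 1) (n + 1) := by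
  let T : WithTop (WithBot (Fin (n + 1) ⊕ Fin (n + 1))) → RMod Λ := fun x =>
    ModuleCat.of Λᵐᵒᵖ (Pointed.famProd S (Pointed.summands n x))
  have h1 : ∀ x, IsBasicSupportTauTilting Λ (T x) := by
    intro x
    induction x using WithTop.recTopCoe with
    | top => exact Pointed.projs_supportTauTilting S
    | coe x =>
      induction x using WithBot.recBotCoe with
      | bot => exact Pointed.empty_supportTauTilting S
      | coe x =>
        cases x with
        | inl p => exact Pointed.pairs_supportTauTilting S 0 p
        | inr p => exact Pointed.pairs_supportTauTilting S 1 p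
  have h4 : ∀ x y, x ≤ y ↔ FacLE Λ (T x) (T y) := fun x y =>
    (Pointed.famProd_gens_summands S x y).trans (facLE_iff (M := T x) (N := T y)).symm
  have h2 : ∀ x y, Nonempty (T x ≃ₗ[Λᵐᵒᵖ] T y) → x = y := fun x y ⟨f⟩ =>
    le_antisymm
      ((h4 x y).2 (facLE_iff.2 (.of_surjective f.symm.toLinearMap f.symm.surjective)))
      ((h4 y x).2 (facLE_iff.2 (.of_surjective f.toLinearMap f.surjective)))
  have h3 : ∀ M : RMod Λ, IsBasicSupportTauTilting Λ M → ∃ x, Nonempty (M ≃ₗ[Λᵐᵒᵖ] T x) := by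
    intro M hM
    obtain ⟨Q, hf, rfl | rfl | ⟨j, p, rfl⟩⟩ := Pointed.exists_famProd_equiv S hM.1 hM.2
    · exact ⟨⊤, hf⟩
    · exact ⟨WithTop.some ⊥, hf⟩
    · obtain rfl | rfl := Fin.exists_fin_two.1 ⟨j, rfl⟩
      · exact ⟨WithTop.some (WithBot.some (Sum.inl p)), hf⟩
      · exact ⟨WithTop.some (WithBot.some (Sum.inr p)), hf⟩
  have w : Fin (2 * n + 4) ≃ WithTop (WithBot (Fin (n + 1) ⊕ Fin (n + 1))) :=
    (Fintype.equivFinOfCardEq (by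
      change Fintype.card (Option (Option (Fin (n + 1) ⊕ Fin (n + 1)))) = _
      simp only [Fintype.card_option, Fintype.card_sum, Fintype.card_fin]
      ring)).symm
  have h5 : ∀ M : RMod Λ, IsBasicSupportTauTilting Λ M →
      ∃ i, Nonempty (M ≃ₗ[Λᵐᵒᵖ] T (w i)) := fun M hM => by
    obtain ⟨x, hx⟩ := h3 M hM
    exact ⟨w.symm x, by rwa [w.apply_symm_apply]⟩
  exact ⟨⟨_, fun i => T (w i), h5⟩, ⟨fun i => T (w i), fun i => h1 _,
    fun i j h => w.injective (h2 _ _ h), h5⟩, T, h1, h2, h3, h4⟩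

/-- An algebra generated by two orthogonal idempotents and a space of arrows, some power of which
is divisible by a nilpotent central element. -/
structure Arrowed (K Λ : Type) [Field K] [Ring Λ] [Algebra K Λ] where
  e : Fin 2 → Λ
  idem : ∀ i, e i * e i = e i
  orth : ∀ i j, i ≠ j → e i * e j = 0
  sum : e 0 + e 1 = 1
  T : Submodule K Λ
  fg : T.FG
  left : ∀ i, ∀ x ∈ T, e i * x ∈ T
  right : ∀ i, ∀ x ∈ T, x * e i ∈ T
  gen : Algebra.adjoin K (Set.range e ∪ T) = ⊤
  z : Subring.center Λ
  nil : IsNilpotent z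
  L : ℕ
  pow : ∀ x ∈ T ^ L, ∃ y, x = z * y
  top : Λ →ₐ[K] (Fin 2 → K)
  top_e : ∀ i, top (e i) = Pi.single i 1
  top_T : ∀ x ∈ T, top x = 0

namespace Arrowed
variable {K Λ : Type} [Field K] [Ring Λ] [Algebra K Λ] (A : Arrowed K Λ)

theorem z_comm (x : Λ) : x * A.z = A.z * x := Subring.mem_center_iff.1 A.z.2 x

/-- The span of the idempotents. -/
def diag : Submodule K Λ := Submodule.span K (Set.range A.e)

theorem one_mem_diag : (1 : Λ) ∈ A.diag := by
  rw [← A.sum]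
  exact Submodule.add_mem _ (Submodule.subset_span ⟨0, rfl⟩) (Submodule.subset_span ⟨1, rfl⟩)

theorem diag_mul : A.diag * A.T ≤ A.T := by
  rw [Submodule.mul_le]
  intro d hd x hx
  induction hd using Submodule.span_induction with
  | mem d hd => obtain ⟨i, rfl⟩ := hd; exact A.left i x hx
  | zero => simp
  | add a b _ _ ha hb => rw [add_mul]; exact Submodule.add_mem _ ha hb
  | smul c a _ ha => rw [smul_mul_assoc]; exact Submodule.smul_mem _ _ ha

theorem mul_diag : A.T * A.diag ≤ A.T := by
  rw [Submodule.mul_le]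
  intro x hx d hd
  induction hd using Submodule.span_induction with
  | mem d hd => obtain ⟨i, rfl⟩ := hd; exact A.right i x hx
  | zero => simp
  | add a b _ _ ha hb => rw [mul_add]; exact Submodule.add_mem _ ha hb
  | smul c a _ ha => rw [mul_smul_comm]; exact Submodule.smul_mem _ _ ha

theorem diag_mul_diag : A.diag * A.diag ≤ A.diag := by
  rw [diag, Submodule.span_mul_span, Submodule.span_le]
  rintro _ ⟨_, ⟨i, rfl⟩, _, ⟨j, rfl⟩, rfl⟩
  change A.e i * A.e j ∈ A.diag
  by_cases h : i = j
  · rw [← h, A.idem]; exact Submodule.subset_span ⟨i, rfl⟩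
  · rw [A.orth i j h]; exact Submodule.zero_mem _

theorem top_le : ⊤ ≤ A.diag ⊔ A.T * ⊤ := by
  have key : ∀ x : Λ, ∀ y ∈ A.diag ⊔ A.T * ⊤, x * y ∈ A.diag ⊔ A.T * ⊤ := by
    intro x
    have hx : x ∈ Algebra.adjoin K (Set.range A.e ∪ A.T) := by rw [A.gen]; trivial
    induction hx using Algebra.adjoin_induction with
    | mem x hx =>
      intro y hy
      obtain ⟨d, hd, t, ht, rfl⟩ := Submodule.mem_sup.1 hy
      rcases hx with ⟨i, rfl⟩ | hx
      · rw [mul_add]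
        have hi : A.e i ∈ A.diag := Submodule.subset_span ⟨i, rfl⟩
        refine Submodule.add_mem_sup (A.diag_mul_diag (Submodule.mul_mem_mul hi hd)) ?_
        have := Submodule.mul_mem_mul hi ht
        rw [← mul_assoc] at this
        exact mul_le_mul' A.diag_mul le_rfl this
      · exact Submodule.mem_sup_right (Submodule.mul_mem_mul hx trivial)
    | algebraMap c =>
      intro y hy
      rw [← Algebra.smul_def]
      exact Submodule.smul_mem _ _ hy
    | add a b _ _ ha hb => intro y hy; rw [add_mul]; exact Submodule.add_mem _ (ha y hy) (hb y hy)
    | mul a b _ _ ha hb => intro y hy; rw [mul_assoc]; exact ha _ (hb y hy)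
  intro x _
  simpa using key x 1 (Submodule.mem_sup_left A.one_mem_diag)

theorem top_mul_le : ⊤ * A.T ≤ A.T * ⊤ := by
  refine (mul_le_mul' A.top_le le_rfl).trans ?_
  rw [Submodule.sup_mul]
  refine sup_le (A.diag_mul.trans fun x hx => ?_) ?_
  · simpa using Submodule.mul_mem_mul hx (Submodule.mem_top (x := (1 : Λ)))
  · rw [mul_assoc]
    exact mul_le_mul' le_rfl le_top

theorem mul_pow_le (k : ℕ) : A.T * ⊤ * (A.T ^ k * ⊤) ≤ A.T ^ (k + 1) * ⊤ := by
  have h : ∀ k : ℕ, (⊤ : Submodule K Λ) * A.T ^ k ≤ A.T ^ k * ⊤ := by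
    intro k
    induction k with
    | zero => simp
    | succ k ih =>
      calc (⊤ : Submodule K Λ) * A.T ^ (k + 1) = ⊤ * A.T ^ k * A.T := by rw [pow_succ, mul_assoc]
        _ ≤ A.T ^ k * ⊤ * A.T := mul_le_mul' ih le_rfl
        _ = A.T ^ k * (⊤ * A.T) := mul_assoc _ _ _
        _ ≤ A.T ^ k * (A.T * ⊤) := mul_le_mul' le_rfl A.top_mul_le
        _ = A.T ^ (k + 1) * ⊤ := by rw [pow_succ, mul_assoc]
  calc A.T * ⊤ * (A.T ^ k * ⊤) = A.T * (⊤ * A.T ^ k) * ⊤ := by simp only [mul_assoc]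
    _ ≤ A.T * (A.T ^ k * ⊤) * ⊤ := mul_le_mul' (mul_le_mul' le_rfl (h k)) le_rfl
    _ = A.T ^ (k + 1) * (⊤ * ⊤) := by rw [pow_succ']; simp only [mul_assoc]
    _ ≤ A.T ^ (k + 1) * ⊤ := mul_le_mul' le_rfl le_top

theorem pow_mul_diag (k : ℕ) : A.T ^ (k + 1) * A.diag ≤ A.T ^ (k + 1) := by
  rw [pow_succ, mul_assoc]
  exact mul_le_mul' le_rfl A.mul_diag

/-- The multiples of the central element. -/
def zIdeal : Submodule K Λ := LinearMap.range (LinearMap.mulLeft K (A.z : Λ))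

theorem mem_zIdeal {x : Λ} : x ∈ A.zIdeal ↔ ∃ y, x = A.z * y :=
  ⟨fun ⟨y, h⟩ => ⟨y, h.symm⟩, fun ⟨y, h⟩ => ⟨y, h.symm⟩⟩

/-- To exhaust the algebra modulo the central element it is enough to contain the idempotents and
the powers of the space of arrows. -/
theorem eq_top_of_le {V : Submodule K Λ} (h0 : A.diag ≤ V) (hz : A.zIdeal ≤ V)
    (hT : ∀ k, 0 < k → k < A.L → A.T ^ k ≤ V) : V = ⊤ := by
  have key : ∀ k ≤ A.L, ⊤ ≤ V ⊔ A.T ^ k * ⊤ := by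
    intro k
    induction k with
    | zero => intro _ x _; exact Submodule.mem_sup_right (by simp)
    | succ k ih =>
      intro hk
      refine (ih (by omega)).trans (sup_le le_sup_left ?_)
      refine (mul_le_mul' le_rfl A.top_le).trans ?_
      rw [Submodule.mul_sup, ← mul_assoc, ← pow_succ]
      refine sup_le_sup ?_ le_rfl
      cases k with
      | zero => simpa using h0
      | succ k => exact (A.pow_mul_diag k).trans (hT _ (by omega) (by omega))
  refine top_unique ((key _ le_rfl).trans (sup_le le_rfl (le_trans ?_ hz)))
  rw [Submodule.mul_le]
  intro x hx y _
  obtain ⟨w, rfl⟩ := A.pow x hx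
  exact A.mem_zIdeal.2 ⟨w * y, mul_assoc _ _ _⟩

theorem exists_fg (N : ℕ) : ∃ V : Submodule K Λ, V.FG ∧
    ∀ x, ∃ v ∈ V, ∃ y, x = v + (A.z : Λ) ^ N * y := by
  have hd : A.diag.FG := Submodule.fg_span (Set.finite_range _)
  let V₀ := A.diag ⊔ (Finset.range A.L).sup fun k => A.T ^ k
  have hV₀ : V₀.FG := hd.sup (Submodule.fg_finset_sup _ _ fun k _ => A.fg.pow k)
  have hV : ∀ x, ∃ v ∈ V₀, ∃ y, x = v + A.z * y := by
    intro x
    have : x ∈ V₀ ⊔ A.zIdeal := by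
      rw [A.eq_top_of_le (V := V₀ ⊔ A.zIdeal) (le_sup_left.trans le_sup_left) le_sup_right
        fun k _ hk => (Finset.le_sup (f := fun k => A.T ^ k) (Finset.mem_range.2 hk)).trans
          (le_sup_right.trans le_sup_left)]
      trivial
    obtain ⟨v, hv, w, ⟨y, rfl⟩, rfl⟩ := Submodule.mem_sup.1 this
    exact ⟨v, hv, y, rfl⟩
  induction N with
  | zero => exact ⟨⊥, Submodule.fg_bot, fun x => ⟨0, by simp, x, by simp⟩⟩
  | succ N ih =>
    obtain ⟨V, hVf, h⟩ := ih
    refine ⟨V ⊔ V₀.map (LinearMap.mulLeft K ((A.z : Λ) ^ N)), hVf.sup (hV₀.map _), fun x => ?_⟩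
    obtain ⟨v, hv, y, rfl⟩ := h x
    obtain ⟨w, hw, y', rfl⟩ := hV y
    refine ⟨v + A.z ^ N * w, Submodule.add_mem_sup hv ⟨w, hw, rfl⟩, y', ?_⟩
    rw [mul_add, pow_succ, mul_assoc, add_assoc]

include A in
theorem finite : Module.Finite K Λ := by
  obtain ⟨N, hN⟩ := A.nil
  obtain ⟨V, hV, h⟩ := A.exists_fg N
  have hN' : (A.z : Λ) ^ N = 0 := by exact_mod_cast congrArg Subtype.val hN
  rw [Module.finite_def]
  convert hV
  refine (top_unique fun x _ => ?_).symm
  obtain ⟨v, hv, y, rfl⟩ := h x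
  rwa [hN', zero_mul, add_zero]

theorem mem_of_top_eq_zero {x : Λ} (h : A.top x = 0) : x ∈ A.T * ⊤ := by
  obtain ⟨d, hd, t, ht, rfl⟩ := Submodule.mem_sup.1 (A.top_le (Submodule.mem_top (x := x)))
  have h0 : A.top t = 0 := by
    clear h
    induction ht using Submodule.mul_induction_on' with
    | mem_mul_mem a ha b _ => rw [map_mul, A.top_T a ha, zero_mul]
    | add a _ b _ ha hb => rw [map_add, ha, hb, add_zero]
  obtain ⟨c, rfl⟩ := (Submodule.mem_span_range_iff_exists_fun K).1 hd
  have hc : c = 0 := by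
    rw [map_add, h0, add_zero, map_sum] at h
    simp only [map_smul, A.top_e] at h
    rw [← h]
    ext i
    simp [Finset.sum_apply, Pi.single_apply]
  simpa [hc] using ht

theorem mem_pow_mul (N : ℕ) {x : Λ} (hx : x ∈ A.T ^ (A.L * N) * ⊤) :
    ∃ y, x = (A.z : Λ) ^ N * y := by
  induction N generalizing x with
  | zero => exact ⟨x, by simp⟩
  | succ N ih =>
    rw [Nat.mul_succ, pow_add, mul_assoc] at hx
    induction hx using Submodule.mul_induction_on' with
    | add a _ b _ ha hb =>
      obtain ⟨y, rfl⟩ := ha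
      obtain ⟨w, rfl⟩ := hb
      exact ⟨y + w, (mul_add _ _ _).symm⟩
    | mem_mul_mem a ha b hb =>
      obtain ⟨y, rfl⟩ := ih (x := a) (by
        simpa using Submodule.mul_mem_mul ha (Submodule.mem_top (x := (1 : Λ))))
      have : ∃ w, b = A.z * w := by
        clear ha
        induction hb using Submodule.mul_induction_on' with
        | add a _ b _ ha hb =>
          obtain ⟨y, rfl⟩ := ha
          obtain ⟨w, rfl⟩ := hb
          exact ⟨y + w, (mul_add _ _ _).symm⟩
        | mem_mul_mem a ha b hb =>
          obtain ⟨w, rfl⟩ := A.pow a ha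
          exact ⟨w * b, mul_assoc _ _ _⟩
      obtain ⟨w, rfl⟩ := this
      refine ⟨y * w, ?_⟩
      rw [← mul_assoc, mul_assoc _ y, A.z_comm, pow_succ]
      simp only [mul_assoc]

theorem mem_of_mem_pow {I : Ideal Λᵐᵒᵖ} (k : ℕ)
    (hI : ∀ y ∈ I, A.top y.unop = 0) (x : Λᵐᵒᵖ) (hx : x ∈ I ^ k) :
    x.unop ∈ A.T ^ k * ⊤ := by
  induction k generalizing x with
  | zero => simp
  | succ k ih =>
    rw [Submodule.pow_succ] at hx
    induction hx using Submodule.smul_induction_on' with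
    | smul r hr s hs =>
      rw [smul_eq_mul, MulOpposite.unop_mul]
      exact A.mul_pow_le k (Submodule.mul_mem_mul (A.mem_of_top_eq_zero (hI s hs)) (ih r hr))
    | add a _ b _ ha hb => exact Submodule.add_mem _ ha hb

/-- The opposite of an algebra presented by arrows is pointed. -/
def pointed : Pointed K Λᵐᵒᵖ where
  e i := MulOpposite.op (A.e i)
  idem i := by rw [← MulOpposite.op_mul, A.idem]
  orth i j h := by rw [← MulOpposite.op_mul, A.orth j i h.symm, MulOpposite.op_zero]
  sum := by rw [← MulOpposite.op_add, A.sum, MulOpposite.op_one]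
  top := AlgHom.fromOpposite A.top fun x y => mul_comm _ _
  top_e i := A.top_e i
  fin := by
    have := A.finite
    exact Module.Finite.equiv (MulOpposite.opLinearEquiv K)
  nil := by
    obtain ⟨N, hN⟩ := A.nil
    have hN' : (A.z : Λ) ^ N = 0 := by exact_mod_cast congrArg Subtype.val hN
    refine ⟨A.L * N, (Submodule.eq_bot_iff _).2 fun x hx => ?_⟩
    have := A.mem_pow_mul _ (A.mem_of_mem_pow _ (fun y hy => hy) x hx)
    obtain ⟨y, hy⟩ := this
    rw [hN', zero_mul] at hy
    exact MulOpposite.unop_injective hy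

end Arrowed

/-- An algebra generated by two orthogonal idempotents and elements running along the arrows of
a quiver with two vertices. -/
structure Quiv (K Λ : Type) {σ : Type} [Field K] [Ring Λ] [Algebra K Λ] (s t : σ → Fin 2) where
  e : Fin 2 → Λ
  a : σ → Λ
  idem : ∀ i, e i * e i = e i
  orth : ∀ i j, i ≠ j → e i * e j = 0
  sum : e 0 + e 1 = 1
  src : ∀ k, e (s k) * a k = a k
  tgt : ∀ k, a k * e (t k) = a k
  gen : Algebra.adjoin K (Set.range e ∪ Set.range a) = ⊤

section Bound
variable {K σ : Type} [Field K] {s t : σ → Fin 2}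
  {rels : Set (FreeAlgebra K (TPGen σ) × FreeAlgebra K (TPGen σ))}

/-- The projection from the free algebra. -/
def boundMk : FreeAlgebra K (TPGen σ) →ₐ[K] BoundQuiverAlgebra K σ s t rels :=
  RingQuot.mkAlgHom K (QuivRel K σ s t rels)

theorem boundMk_eq {x y : FreeAlgebra K (TPGen σ)} (h : QuivRel K σ s t rels x y) :
    (boundMk x : BoundQuiverAlgebra K σ s t rels) = boundMk y :=
  RingQuot.mkAlgHom_rel K h

theorem boundMk_rel {x y : FreeAlgebra K (TPGen σ)} (h : (x, y) ∈ rels) :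
    (boundMk x : BoundQuiverAlgebra K σ s t rels) = boundMk y :=
  boundMk_eq (.rel _ h)

/-- The bound quiver algebra is generated by its vertices and arrows. -/
def boundQuiv (K : Type) [Field K] {σ : Type} (s t : σ → Fin 2)
    (rels : Set (FreeAlgebra K (TPGen σ) × FreeAlgebra K (TPGen σ))) :
    Quiv K (BoundQuiverAlgebra K σ s t rels) s t where
  e i := boundMk (vtx K i)
  a k := boundMk (arr K k)
  idem i := by rw [← map_mul]; exact boundMk_eq (.idem i)
  orth i j h := by rw [← map_mul, boundMk_eq (.orth i j h), map_zero]
  sum := by rw [← map_add, boundMk_eq .vsum, map_one]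
  src k := by rw [← map_mul]; exact boundMk_eq (.src k)
  tgt k := by rw [← map_mul]; exact boundMk_eq (.tgt k)
  gen := by
    have h : Set.range (fun i => (boundMk (vtx K i) : BoundQuiverAlgebra K σ s t rels)) ∪
        Set.range (fun k => (boundMk (arr K k) : BoundQuiverAlgebra K σ s t rels)) =
        boundMk '' Set.range (FreeAlgebra.ι K) := by
      ext x
      constructor
      · rintro (⟨i, rfl⟩ | ⟨k, rfl⟩)
        · exact ⟨_, ⟨.v i, rfl⟩, rfl⟩
        · exact ⟨_, ⟨.ar k, rfl⟩, rfl⟩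
      · rintro ⟨_, ⟨i | k, rfl⟩, rfl⟩
        · exact Or.inl ⟨i, rfl⟩
        · exact Or.inr ⟨k, rfl⟩
    rw [h, ← AlgHom.map_adjoin, FreeAlgebra.adjoin_range_ι, Algebra.map_top, AlgHom.range_eq_top]
    exact RingQuot.mkAlgHom_surjective K _

variable {C : Type} [CommRing C] [Algebra K C]

/-- The matrices assigned to the generators by weights on the arrows. -/
def weight (s t : σ → Fin 2) (c : σ → C) : TPGen σ → Matrix (Fin 2) (Fin 2) C
  | .v i => Matrix.single i i 1
  | .ar k => Matrix.single (s k) (t k) (c k)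

/-- The representation of the free algebra given by weights on the arrows. -/
def freeRep (K : Type) [Field K] [Algebra K C] (s t : σ → Fin 2) (c : σ → C) :
    FreeAlgebra K (TPGen σ) →ₐ[K] Matrix (Fin 2) (Fin 2) C :=
  FreeAlgebra.lift K (weight s t c)

@[simp] theorem freeRep_vtx (c : σ → C) (i : Fin 2) :
    freeRep K s t c (vtx K i) = Matrix.single i i 1 := by
  simp [freeRep, vtx, weight]

@[simp] theorem freeRep_arr (c : σ → C) (k : σ) :
    freeRep K s t c (arr K k) = Matrix.single (s k) (t k) (c k) := by
  simp [freeRep, arr, weight]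

/-- A matrix representation of `Λ` with prescribed weights on the arrows. -/
structure Quiv.Rep {Λ : Type} [Ring Λ] [Algebra K Λ] (Q : Quiv K Λ s t) (c : σ → C) where
  ρ : Λ →ₐ[K] Matrix (Fin 2) (Fin 2) C
  map_e : ∀ i, ρ (Q.e i) = Matrix.single i i 1
  map_a : ∀ k, ρ (Q.a k) = Matrix.single (s k) (t k) (c k)

/-- The representation of a bound quiver algebra given by weights compatible with the
relations. -/
def boundRep (c : σ → C) (h : ∀ p ∈ rels, freeRep K s t c p.1 = freeRep K s t c p.2) :
    (boundQuiv K s t rels).Rep c :=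
  have hr : ∀ ⦃x y⦄, QuivRel K σ s t rels x y → freeRep K s t c x = freeRep K s t c y := by
    intro x y hxy
    cases hxy with
    | idem i => simp
    | orth i j hij => simp [hij]
    | vsum =>
      simp only [map_add, freeRep_vtx, map_one]
      ext i j
      fin_cases i <;> fin_cases j <;> simp [Matrix.single]
    | src k => simp
    | tgt k => simp
    | rel p hp => exact h p hp
  { ρ := RingQuot.liftAlgHom K ⟨freeRep K s t c, hr⟩
    map_e := fun i => (RingQuot.liftAlgHom_mkAlgHom_apply K _ hr _).trans (freeRep_vtx c i)
    map_a := fun k => (RingQuot.liftAlgHom_mkAlgHom_apply K _ hr _).trans (freeRep_arr c k) }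

end Bound

namespace Quiv
variable {K Λ σ : Type} [Field K] [Ring Λ] [Algebra K Λ] {s t : σ → Fin 2} (Q : Quiv K Λ s t)
  {C : Type} [CommRing C] [Algebra K C]

theorem hom_ext {B : Type} [Semiring B] [Algebra K B] {f g : Λ →ₐ[K] B}
    (he : ∀ i, f (Q.e i) = g (Q.e i)) (ha : ∀ k, f (Q.a k) = g (Q.a k)) : f = g := by
  refine AlgHom.ext_of_adjoin_eq_top Q.gen ?_
  rintro _ (⟨i, rfl⟩ | ⟨k, rfl⟩)
  · exact he i
  · exact ha k

theorem mul_entry {i j : Fin 2} (hij : i ≠ j) (M N : Matrix (Fin 2) (Fin 2) C) (p q : Fin 2) :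
    (M * N) p q = M p j * N j q + M p i * N i q := by
  rw [Matrix.mul_apply, Fin.sum_univ_two]
  match i, j, hij with
  | 0, 1, _ => exact add_comm _ _
  | 1, 0, _ => rfl
  | 0, 0, h => exact absurd rfl h
  | 1, 1, h => exact absurd rfl h

/-- Two characters and a derivation with respect to them, as given by a triangular
representation of weight `c` from the vertex `j` to the vertex `i`. -/
structure Tri (i j : Fin 2) (c : σ → C) where
  ne : i ≠ j
  φ : Λ →ₐ[K] C
  ψ : Λ →ₐ[K] C
  d : Λ →ₗ[K] C
  d_mul : ∀ x y, d (x * y) = φ x * d y + d x * ψ y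
  φ_e : ∀ k, φ (Q.e k) = if k = j then 1 else 0
  ψ_e : ∀ k, ψ (Q.e k) = if k = i then 1 else 0
  d_e : ∀ k, d (Q.e k) = 0
  φ_a : ∀ k, φ (Q.a k) = if s k = j ∧ t k = j then c k else 0
  ψ_a : ∀ k, ψ (Q.a k) = if s k = i ∧ t k = i then c k else 0
  d_a : ∀ k, d (Q.a k) = if s k = j ∧ t k = i then c k else 0

variable {Q}

theorem Rep.lower {c : σ → C} (r : Q.Rep c) {i j : Fin 2} (hij : i ≠ j)
    (hc : ∀ k, s k = i → t k = j → c k = 0) (x : Λ) : r.ρ x i j = 0 := by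
  have hx : x ∈ Algebra.adjoin K (Set.range Q.e ∪ Set.range Q.a) := by rw [Q.gen]; trivial
  induction hx using Algebra.adjoin_induction with
  | mem x hx =>
    rcases hx with ⟨k, rfl⟩ | ⟨k, rfl⟩
    · rw [r.map_e, Matrix.single_apply]
      exact if_neg fun h => hij (h.1.symm.trans h.2)
    · rw [r.map_a, Matrix.single_apply]
      split_ifs with h
      · exact hc k h.1 h.2
      · rfl
  | algebraMap b =>
    rw [AlgHom.commutes, Matrix.algebraMap_matrix_apply, if_neg hij]
  | add a b _ _ ha hb => rw [map_add, Matrix.add_apply, ha, hb, add_zero]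
  | mul a b _ _ ha hb => rw [map_mul, mul_entry hij, ha, hb, zero_mul, mul_zero, add_zero]

/-- The data extracted from a triangular representation. -/
def Rep.tri {c : σ → C} (r : Q.Rep c) {i j : Fin 2} (hij : i ≠ j)
    (hc : ∀ k, s k = i → t k = j → c k = 0) : Q.Tri i j c where
  ne := hij
  φ := AlgHom.ofLinearMap
    ((Matrix.entryLinearMap K C j j).comp r.ρ.toLinearMap)
    (by simp)
    (fun x y => by
      change r.ρ (x * y) j j = r.ρ x j j * r.ρ y j j
      rw [map_mul, mul_entry hij, r.lower hij hc y, mul_zero, add_zero])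
  ψ := AlgHom.ofLinearMap
    ((Matrix.entryLinearMap K C i i).comp r.ρ.toLinearMap)
    (by simp)
    (fun x y => by
      change r.ρ (x * y) i i = r.ρ x i i * r.ρ y i i
      rw [map_mul, mul_entry hij, r.lower hij hc x, zero_mul, zero_add])
  d := (Matrix.entryLinearMap K C j i).comp r.ρ.toLinearMap
  d_mul x y := by
    change r.ρ (x * y) j i = r.ρ x j j * r.ρ y j i + r.ρ x j i * r.ρ y i i
    rw [map_mul, mul_entry hij]
  φ_e k := by
    change r.ρ (Q.e k) j j = _
    rw [r.map_e, Matrix.single_apply]; simp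
  ψ_e k := by
    change r.ρ (Q.e k) i i = _
    rw [r.map_e, Matrix.single_apply]; simp
  d_e k := by
    change r.ρ (Q.e k) j i = _
    rw [r.map_e, Matrix.single_apply]
    exact if_neg fun h => hij (h.2.symm.trans h.1)
  φ_a k := by
    change r.ρ (Q.a k) j j = _
    rw [r.map_a, Matrix.single_apply]
  ψ_a k := by
    change r.ρ (Q.a k) i i = _
    rw [r.map_a, Matrix.single_apply]
  d_a k := by
    change r.ρ (Q.a k) j i = _
    rw [r.map_a, Matrix.single_apply]

/-- The augmentation killing the arrows. -/
def Rep.top (r : Q.Rep (fun _ : σ => (0 : K))) : Λ →ₐ[K] (Fin 2 → K) :=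
  AlgHom.pi (R := K) (A := fun _ : Fin 2 => K) fun i =>
    (r.tri (i := 1 - i) (j := i) (by revert i; decide) fun _ _ _ => rfl).φ

theorem Rep.top_e (r : Q.Rep (fun _ : σ => (0 : K))) (i : Fin 2) :
    r.top (Q.e i) = Pi.single i 1 := by
  ext k
  refine ((r.tri (i := 1 - k) (j := k) (by revert k; decide) fun _ _ _ => rfl).φ_e i).trans ?_
  rw [Pi.single_apply]
  exact if_congr eq_comm rfl rfl

theorem Rep.top_a (r : Q.Rep (fun _ : σ => (0 : K))) (k : σ) : r.top (Q.a k) = 0 := by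
  ext l
  exact ((r.tri (i := 1 - l) (j := l) (by revert l; decide) fun _ _ _ => rfl).φ_a k).trans
    (by simp)

/-- Arrow data for a quiver algebra. -/
def arrowed (Q : Quiv K Λ s t) [Finite σ] (r : Q.Rep (fun _ : σ => (0 : K)))
    (z : Subring.center Λ) (nil : IsNilpotent z) (L : ℕ)
    (pow : ∀ x ∈ Submodule.span K (Set.range Q.a) ^ L, ∃ y, x = z * y) : Arrowed K Λ where
  e := Q.e
  idem := Q.idem
  orth := Q.orth
  sum := Q.sum
  T := Submodule.span K (Set.range Q.a)
  fg := Submodule.fg_span (Set.finite_range _)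
  left i x hx := by
    induction hx using Submodule.span_induction with
    | mem x hx =>
      obtain ⟨k, rfl⟩ := hx
      by_cases h : i = s k
      · rw [h, Q.src]; exact Submodule.subset_span ⟨k, rfl⟩
      · rw [← Q.src, ← mul_assoc, Q.orth i _ h, zero_mul]; exact Submodule.zero_mem _
    | zero => simp
    | add a b _ _ ha hb => rw [mul_add]; exact Submodule.add_mem _ ha hb
    | smul c a _ ha => rw [mul_smul_comm]; exact Submodule.smul_mem _ _ ha
  right i x hx := by
    induction hx using Submodule.span_induction with
    | mem x hx =>
      obtain ⟨k, rfl⟩ := hx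
      by_cases h : t k = i
      · rw [← h, Q.tgt]; exact Submodule.subset_span ⟨k, rfl⟩
      · rw [← Q.tgt, mul_assoc, Q.orth _ i h, mul_zero]; exact Submodule.zero_mem _
    | zero => simp
    | add a b _ _ ha hb => rw [add_mul]; exact Submodule.add_mem _ ha hb
    | smul c a _ ha => rw [smul_mul_assoc]; exact Submodule.smul_mem _ _ ha
  gen := by
    refine top_unique (Q.gen.symm.le.trans (Algebra.adjoin_mono ?_))
    exact Set.union_subset_union le_rfl Submodule.subset_span
  z := z
  nil := nil
  L := L
  pow := pow
  top := r.top
  top_e := r.top_e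
  top_T x hx := by
    induction hx using Submodule.span_induction with
    | mem x hx => obtain ⟨k, rfl⟩ := hx; exact r.top_a k
    | zero => simp
    | add a b _ _ ha hb => rw [map_add, ha, hb, add_zero]
    | smul c a _ ha => rw [map_smul, ha, smul_zero]

/-- An element commuting with the generators is central. -/
theorem mem_center (Q : Quiv K Λ s t) {z : Λ} (he : ∀ i, Q.e i * z = z * Q.e i)
    (ha : ∀ k, Q.a k * z = z * Q.a k) : z ∈ Subring.center Λ := by
  rw [Subring.mem_center_iff]
  intro x
  have hx : x ∈ Algebra.adjoin K (Set.range Q.e ∪ Set.range Q.a) := by rw [Q.gen]; trivial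
  induction hx using Algebra.adjoin_induction with
  | mem x hx =>
    rcases hx with ⟨k, rfl⟩ | ⟨k, rfl⟩
    · exact he k
    · exact ha k
  | algebraMap b => exact Algebra.commutes b z
  | add a b _ _ ha hb => rw [mul_add, add_mul, ha, hb]
  | mul a b _ _ ha hb => rw [mul_assoc, hb, ← mul_assoc, ha, mul_assoc]

end Quiv
open scoped DualNumber

namespace Quiv
variable {K Λ σ : Type} [Field K] [Ring Λ] [Algebra K Λ] {s t : σ → Fin 2}

/-- Paths `m, m'` from `j` to `i` generating all such paths modulo a central element, with a
derivation detecting them. -/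
structure Detect (Q : Quiv K Λ s t) (r : Q.Rep (fun _ : σ => (0 : K))) (z : Subring.center Λ)
    (i j : Fin 2) where
  c : σ → K[ε]
  tri : Q.Tri i j c
  fst_c : ∀ k, s k = t k → (c k).fst = 0
  φ_z : tri.φ z = 0
  m : Λ
  m' : Λ
  m_left : Q.e j * m = m
  m_right : m * Q.e i = m
  m'_left : Q.e j * m' = m'
  m'_right : m' * Q.e i = m'
  d_m : tri.d m = 1
  d_m' : m' = 0 ∨ tri.d m' = DualNumber.eps
  mem : ∀ x, Q.e j * x = x → x * Q.e i = x → ∃ p q : K, ∃ y, x = p • m + q • m' + z * y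

namespace Tri
variable {Q : Quiv K Λ s t} {i j : Fin 2} {C : Type} [CommRing C] [Algebra K C] {c : σ → C}
  (T : Q.Tri i j c)

theorem d_left {b : Λ} (h : b * Q.e j = b) : T.d b = 0 := by
  rw [← h, T.d_mul, T.d_e, T.ψ_e, if_neg T.ne.symm]
  simp

theorem d_right {b : Λ} (h : Q.e i * b = b) : T.d b = 0 := by
  rw [← h, T.d_mul, T.d_e, T.φ_e, if_neg T.ne]
  simp

theorem d_center {z : Λ} (hz : z ∈ Subring.center Λ) : T.d z = 0 := by
  have h1 : T.d (z * Q.e i) = T.d z := by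
    rw [T.d_mul, T.d_e, T.ψ_e, if_pos rfl]; simp
  rw [← h1, ← (Subring.mem_center_iff.1 hz) (Q.e i), T.d_mul, T.d_e, T.φ_e, if_neg T.ne]
  simp

end Tri

namespace Detect
variable {Q : Quiv K Λ s t} {r : Q.Rep (fun _ : σ => (0 : K))} {z : Subring.center Λ}
  {i j : Fin 2} (S : Q.Detect r z i j)

theorem fst_φ (x : Λ) : (S.tri.φ x).fst = r.top x j := by
  have : (TrivSqZeroExt.fstHom K K K).comp S.tri.φ =
      (Pi.evalAlgHom K (fun _ : Fin 2 => K) j).comp r.top := by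
    refine Q.hom_ext (fun k => ?_) fun k => ?_
    · simp only [AlgHom.comp_apply, r.top_e, S.tri.φ_e]
      by_cases h : k = j
      · simp [h]
      · simp [h, Ne.symm h]
    · simp only [AlgHom.comp_apply, r.top_a, S.tri.φ_a, map_zero]
      split_ifs with h
      · exact S.fst_c k (h.1.trans h.2.symm)
      · exact map_zero _
  exact DFunLike.congr_fun this x

theorem fst_ψ (x : Λ) : (S.tri.ψ x).fst = r.top x i := by
  have : (TrivSqZeroExt.fstHom K K K).comp S.tri.ψ =
      (Pi.evalAlgHom K (fun _ : Fin 2 => K) i).comp r.top := by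
    refine Q.hom_ext (fun k => ?_) fun k => ?_
    · simp only [AlgHom.comp_apply, r.top_e, S.tri.ψ_e]
      by_cases h : k = i
      · simp [h]
      · simp [h, Ne.symm h]
    · simp only [AlgHom.comp_apply, r.top_a, S.tri.ψ_a, map_zero]
      split_ifs with h
      · exact S.fst_c k (h.1.trans h.2.symm)
      · exact map_zero _
  exact DFunLike.congr_fun this x

theorem snd_φ (hc : ∀ k, s k = j → t k = j → c S k = 0) (x : Λ) : (S.tri.φ x).snd = 0 := by
  have : S.tri.φ = (Algebra.ofId K K[ε]).comp
      ((Pi.evalAlgHom K (fun _ : Fin 2 => K) j).comp r.top) := by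
    refine Q.hom_ext (fun k => ?_) fun k => ?_
    · simp only [AlgHom.comp_apply, r.top_e, S.tri.φ_e]
      by_cases h : k = j
      · simp [h]
      · simp [h, Ne.symm h]
    · simp only [AlgHom.comp_apply, r.top_a, S.tri.φ_a, map_zero]
      split_ifs with h
      · exact hc k h.1 h.2
      · rfl
  rw [this]
  rfl

theorem snd_ψ (hc : ∀ k, s k = i → t k = i → c S k = 0) (x : Λ) : (S.tri.ψ x).snd = 0 := by
  have : S.tri.ψ = (Algebra.ofId K K[ε]).comp
      ((Pi.evalAlgHom K (fun _ : Fin 2 => K) i).comp r.top) := by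
    refine Q.hom_ext (fun k => ?_) fun k => ?_
    · simp only [AlgHom.comp_apply, r.top_e, S.tri.ψ_e]
      by_cases h : k = i
      · simp [h]
      · simp [h, Ne.symm h]
    · simp only [AlgHom.comp_apply, r.top_a, S.tri.ψ_a, map_zero]
      split_ifs with h
      · exact hc k h.1 h.2
      · rfl
  rw [this]
  rfl

theorem d_z (x : Λ) : S.tri.d (z * x) = 0 := by
  rw [S.tri.d_mul, S.φ_z, S.tri.d_center z.2, zero_mul, zero_mul, add_zero]

/-- The central element as an element of the opposite algebra. -/
def opCenter (z : Subring.center Λ) : Subring.center Λᵐᵒᵖ :=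
  ⟨MulOpposite.op z, Subring.mem_center_iff.2 fun g => MulOpposite.unop_injective
    ((Subring.mem_center_iff.1 z.2 g.unop).symm)⟩

theorem opCenter_smul (z : Subring.center Λ) (y : Λᵐᵒᵖ) :
    opCenter z • y = MulOpposite.op (z * y.unop) := by
  rw [Subring.smul_def, smul_eq_mul]
  exact MulOpposite.unop_injective (Subring.mem_center_iff.1 z.2 y.unop)

theorem opCenter_nil {z : Subring.center Λ} (h : IsNilpotent z) : IsNilpotent (opCenter z) := by
  obtain ⟨N, hN⟩ := h
  refine ⟨N, Subtype.ext ?_⟩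
  have : (z : Λ) ^ N = 0 := by exact_mod_cast congrArg Subtype.val hN
  change (MulOpposite.op (z : Λ)) ^ N = 0
  rw [← MulOpposite.op_pow, this, MulOpposite.op_zero]

variable [Finite σ] {nil : IsNilpotent z} {L : ℕ}
  {pow : ∀ x ∈ Submodule.span K (Set.range Q.a) ^ L, ∃ y, x = z * y}

/-- The side of the opposite algebra. -/
def side (nil : IsNilpotent z) (L : ℕ)
    (pow : ∀ x ∈ Submodule.span K (Set.range Q.a) ^ L, ∃ y, x = z * y) :
    (Q.arrowed r z nil L pow).pointed.Side i j where
  ne := S.tri.ne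
  z := opCenter z
  nil := opCenter_nil nil
  mu := MulOpposite.op S.m
  mu' := MulOpposite.op S.m'
  mu_left := congrArg MulOpposite.op S.m_right
  mu_right := congrArg MulOpposite.op S.m_left
  mu'_left := congrArg MulOpposite.op S.m'_right
  mu'_right := congrArg MulOpposite.op S.m'_left
  c0 := ((TrivSqZeroExt.fstHom K K K).toLinearMap.comp S.tri.d).comp
    (MulOpposite.opLinearEquiv K).symm.toLinearMap
  c1 := ((TrivSqZeroExt.sndHom K K).comp S.tri.d).comp
    (MulOpposite.opLinearEquiv K).symm.toLinearMap
  mem x h1 h2 := by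
    obtain ⟨p, q, y, hy⟩ := S.mem x.unop (congrArg MulOpposite.unop h2)
      (congrArg MulOpposite.unop h1)
    have hd : S.tri.d x.unop = p • 1 + q • S.tri.d S.m' := by
      rw [hy, map_add, map_add, S.d_z, map_smul, map_smul, S.d_m, add_zero]
    refine ⟨MulOpposite.op y, ?_⟩
    rw [opCenter_smul]
    refine MulOpposite.unop_injective (hy.trans ?_)
    change _ = (S.tri.d x.unop).fst • S.m + (S.tri.d x.unop).snd • S.m' + z * y
    rw [hd]
    rcases S.d_m' with h | h
    · simp [h]
    · simp [h]
  c0_left b x h1 h2 h3 h4 := by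
    change (S.tri.d (x.unop * b.unop)).fst = r.top b.unop i * (S.tri.d x.unop).fst
    rw [S.tri.d_mul, S.tri.d_right (congrArg MulOpposite.unop h2), mul_zero, zero_add,
      TrivSqZeroExt.fst_mul, S.fst_ψ, mul_comm]
  c0_right x a h1 h2 h3 h4 := by
    change (S.tri.d (a.unop * x.unop)).fst = (S.tri.d x.unop).fst * r.top a.unop j
    rw [S.tri.d_mul, S.tri.d_left (congrArg MulOpposite.unop h1), zero_mul, add_zero,
      TrivSqZeroExt.fst_mul, S.fst_φ, mul_comm]
  c0_mu := by
    change (S.tri.d S.m).fst = 1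
    rw [S.d_m]; rfl
  c0_mu' := by
    change (S.tri.d S.m').fst = 0
    rcases S.d_m' with h | h <;> simp [h]
  c1_mu := by
    change (S.tri.d S.m).snd = 0
    rw [S.d_m]; rfl
  c0_z x := by
    rw [opCenter_smul]
    change (S.tri.d (z * x.unop)).fst = 0
    rw [S.d_z]; rfl
  c1_z x := by
    rw [opCenter_smul]
    change (S.tri.d (z * x.unop)).snd = 0
    rw [S.d_z]; rfl

/-- The side data when one path suffices. -/
def dataI (h : S.m' = 0) : (Q.arrowed r z nil L pow).pointed.SideData i j 2 :=
  Pointed.Side.dataI (S.side nil L pow) (congrArg MulOpposite.op h)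

/-- The side data when the second path starts with a loop of square zero. -/
def dataII (hc : ∀ k, s k = i → t k = i → c S k = 0) (al : Λ) (hl : Q.e j * al = al)
    (hr : al * Q.e j = al) (hs : al * al = 0) (hm : S.m' = al * S.m)
    (hd : S.tri.d S.m' = DualNumber.eps) :
    (Q.arrowed r z nil L pow).pointed.SideData i j 3 :=
  Pointed.SideII.data
    { S.side nil L pow with
      al := MulOpposite.op al
      al_left := congrArg MulOpposite.op hr
      al_right := congrArg MulOpposite.op hl
      al_sq := congrArg MulOpposite.op hs
      mu'_eq := congrArg MulOpposite.op hm
      c1_mu' := by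
        change (S.tri.d S.m').snd = 1
        rw [hd]; rfl
      δ := fun a => (S.tri.φ a.unop).snd
      c1_left := fun b x h1 h2 h3 h4 => by
        change (S.tri.d (x.unop * b.unop)).snd = r.top b.unop i * (S.tri.d x.unop).snd
        rw [S.tri.d_mul, S.tri.d_right (congrArg MulOpposite.unop h2), mul_zero, zero_add,
          DualNumber.snd_mul, S.fst_ψ, S.snd_ψ hc]
        ring
      c1_right := fun x a h1 h2 h3 h4 => by
        change (S.tri.d (a.unop * x.unop)).snd = (S.tri.d x.unop).snd * r.top a.unop j +
          (S.tri.d x.unop).fst * (S.tri.φ a.unop).snd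
        rw [S.tri.d_mul, S.tri.d_left (congrArg MulOpposite.unop h1), zero_mul, add_zero,
          DualNumber.snd_mul, S.fst_φ]
        ring }

/-- The side data when the second path ends with a loop of square zero. -/
def dataIII (hc : ∀ k, s k = j → t k = j → c S k = 0) (al : Λ) (hl : Q.e i * al = al)
    (hr : al * Q.e i = al) (hs : al * al = 0) (hm : S.m' = S.m * al)
    (hd : S.tri.d S.m' = DualNumber.eps) :
    (Q.arrowed r z nil L pow).pointed.SideData i j 3 :=
  Pointed.SideIII.data
    { S.side nil L pow with
      al := MulOpposite.op al
      al_left := congrArg MulOpposite.op hr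
      al_right := congrArg MulOpposite.op hl
      al_sq := congrArg MulOpposite.op hs
      mu'_eq := congrArg MulOpposite.op hm
      c1_mu' := by
        change (S.tri.d S.m').snd = 1
        rw [hd]; rfl
      δ := fun a => (S.tri.ψ a.unop).snd
      c1_left := fun b x h1 h2 h3 h4 => by
        change (S.tri.d (x.unop * b.unop)).snd = r.top b.unop i * (S.tri.d x.unop).snd +
          (S.tri.ψ b.unop).snd * (S.tri.d x.unop).fst
        rw [S.tri.d_mul, S.tri.d_right (congrArg MulOpposite.unop h2), mul_zero, zero_add,
          DualNumber.snd_mul, S.fst_ψ]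
        ring
      c1_right := fun x a h1 h2 h3 h4 => by
        change (S.tri.d (a.unop * x.unop)).snd = (S.tri.d x.unop).snd * r.top a.unop j
        rw [S.tri.d_mul, S.tri.d_left (congrArg MulOpposite.unop h1), zero_mul, add_zero,
          DualNumber.snd_mul, S.fst_φ, S.snd_φ hc]
        ring }

end Detect
end Quiv

namespace Quiv
variable {K Λ σ : Type} [Field K] [Ring Λ] [Algebra K Λ] {s t : σ → Fin 2} (Q : Quiv K Λ s t)

theorem a_mul_a {k l : σ} (h : t k ≠ s l) : Q.a k * Q.a l = 0 := by
  rw [← Q.tgt k, ← Q.src l, mul_assoc, ← mul_assoc (Q.e _), Q.orth _ _ h, zero_mul, mul_zero]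

theorem a_mul_a_mul {k l : σ} (h : t k ≠ s l) (x : Λ) : Q.a k * (Q.a l * x) = 0 := by
  rw [← mul_assoc, Q.a_mul_a h, zero_mul]

theorem e_mul_a {i : Fin 2} {k : σ} (h : i = s k) : Q.e i * Q.a k = Q.a k := by
  rw [h, Q.src]

theorem e_mul_a_mul {i : Fin 2} {k : σ} (h : i = s k) (x : Λ) :
    Q.e i * (Q.a k * x) = Q.a k * x := by
  rw [← mul_assoc, Q.e_mul_a h]

theorem e_mul_a_zero {i : Fin 2} {k : σ} (h : i ≠ s k) : Q.e i * Q.a k = 0 := by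
  rw [← Q.src, ← mul_assoc, Q.orth _ _ h, zero_mul]

theorem e_mul_a_mul_zero {i : Fin 2} {k : σ} (h : i ≠ s k) (x : Λ) :
    Q.e i * (Q.a k * x) = 0 := by
  rw [← mul_assoc, Q.e_mul_a_zero h, zero_mul]

theorem a_mul_e {i : Fin 2} {k : σ} (h : t k = i) : Q.a k * Q.e i = Q.a k := by
  rw [← h, Q.tgt]

theorem a_mul_e_zero {i : Fin 2} {k : σ} (h : t k ≠ i) : Q.a k * Q.e i = 0 := by
  rw [← Q.tgt, mul_assoc, Q.orth _ _ h, mul_zero]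

theorem mul_assoc_zero {a b : Λ} (h : a * b = 0) (x : Λ) : a * (b * x) = 0 := by
  rw [← mul_assoc, h, zero_mul]

/-- The span of a set modulo the multiples of an element. -/
def modSpan (K : Type) [Field K] [Algebra K Λ] (z : Λ) (S : Set Λ) : Submodule K Λ :=
  Submodule.span K S ⊔ LinearMap.range (LinearMap.mulLeft K z)

theorem mem_modSpan_of_mem {z : Λ} {S : Set Λ} {x : Λ} (h : x ∈ S) : x ∈ modSpan K z S :=
  Submodule.mem_sup_left (Submodule.subset_span h)

theorem mul_mem_modSpan (z : Λ) (S : Set Λ) (y : Λ) : z * y ∈ modSpan K z S :=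
  Submodule.mem_sup_right ⟨y, rfl⟩

theorem modSpan_le {z : Λ} {S : Set Λ} {V : Submodule K Λ} (h : ∀ x ∈ S, x ∈ V)
    (hz : ∀ y, z * y ∈ V) : modSpan K z S ≤ V := by
  refine sup_le (Submodule.span_le.2 h) ?_
  rintro _ ⟨y, rfl⟩
  exact hz y

theorem mem_modSpan_empty {z x : Λ} (h : x ∈ modSpan K z ∅) : ∃ y, x = z * y := by
  rw [modSpan, Submodule.span_empty, bot_sup_eq] at h
  obtain ⟨y, rfl⟩ := h
  exact ⟨y, rfl⟩

/-- Sets of words of each length spanning all words modulo a central element. -/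
structure Levels (z : Subring.center Λ) (L : ℕ) where
  S : ℕ → Set Λ
  pos : 0 < L
  one : ∀ l, Q.a l ∈ modSpan K (z : Λ) (S 1)
  step : ∀ k, 0 < k → k < L → ∀ x ∈ S k, ∀ l, x * Q.a l ∈ modSpan K (z : Λ) (S (k + 1))
  last : ∀ x ∈ S L, ∃ y, x = z * y

namespace Levels
variable {Q} {z : Subring.center Λ} {L : ℕ} (H : Q.Levels z L)

theorem pow_le (k : ℕ) (h0 : 0 < k) (hk : k ≤ L) :
    Submodule.span K (Set.range Q.a) ^ k ≤ modSpan K (z : Λ) (H.S k) := by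
  induction k, h0 using Nat.le_induction with
  | base =>
    rw [Nat.succ_eq_add_one, zero_add, pow_one, Submodule.span_le]
    rintro _ ⟨l, rfl⟩
    exact H.one l
  | succ k h0 ih =>
    rw [pow_succ]
    refine (mul_le_mul' (ih (by omega)) le_rfl).trans ?_
    rw [Submodule.mul_le]
    intro x hx y hy
    induction hy using Submodule.span_induction with
    | zero => simp
    | add a b _ _ ha hb => rw [mul_add]; exact Submodule.add_mem _ ha hb
    | smul c a _ ha => rw [mul_smul_comm]; exact Submodule.smul_mem _ _ ha
    | mem y hy =>
      obtain ⟨l, rfl⟩ := hy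
      have : modSpan K (z : Λ) (H.S k) ≤
          (modSpan K (z : Λ) (H.S (k + 1))).comap (LinearMap.mulRight K (Q.a l)) :=
        modSpan_le (fun x hx => H.step k h0 (by omega) x hx l) fun y => by
          rw [Submodule.mem_comap, LinearMap.mulRight_apply, mul_assoc]
          exact mul_mem_modSpan _ _ _
      exact this hx

include H in
theorem pow (x : Λ) (hx : x ∈ Submodule.span K (Set.range Q.a) ^ L) : ∃ y, x = z * y := by
  refine mem_modSpan_empty (K := K) (modSpan_le (fun x hx => ?_) (fun y => ?_)
    (H.pow_le L H.pos le_rfl hx))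
  · obtain ⟨y, rfl⟩ := H.last x hx
    exact mul_mem_modSpan _ _ _
  · exact mul_mem_modSpan _ _ _

include H in
theorem mem (r : Q.Rep (fun _ : σ => (0 : K))) [Finite σ] (nil : IsNilpotent z) {i j : Fin 2}
    (hij : i ≠ j) (S' : Set Λ)
    (hS : ∀ k, 0 < k → k < L → ∀ x ∈ H.S k, Q.e j * (x * Q.e i) ∈ modSpan K (z : Λ) S')
    (x : Λ) (h1 : Q.e j * x = x) (h2 : x * Q.e i = x) : x ∈ modSpan K (z : Λ) S' := by
  let A := Q.arrowed r z nil L H.pow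
  let V := (modSpan K (z : Λ) S').comap
    ((LinearMap.mulLeft K (Q.e j)).comp (LinearMap.mulRight K (Q.e i)))
  have hz : ∀ y : Λ, (z : Λ) * y ∈ V := fun y => by
    rw [Submodule.mem_comap]
    change Q.e j * ((z : Λ) * y * Q.e i) ∈ modSpan K (z : Λ) S'
    rw [mul_assoc, ← mul_assoc, Subring.mem_center_iff.1 z.2, mul_assoc]
    exact mul_mem_modSpan _ _ _
  have hV : V = ⊤ := by
    refine A.eq_top_of_le ?_ ?_ fun k h0 hk => ?_
    · refine Submodule.span_le.2 ?_
      rintro _ ⟨k, rfl⟩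
      change Q.e k ∈ V
      rw [Submodule.mem_comap]
      change Q.e j * (Q.e k * Q.e i) ∈ modSpan K (z : Λ) S'
      by_cases h : k = i
      · rw [h, Q.idem, Q.orth _ _ hij.symm]; exact Submodule.zero_mem _
      · rw [Q.orth _ _ h, mul_zero]; exact Submodule.zero_mem _
    · rintro _ ⟨y, rfl⟩
      exact hz y
    · exact (H.pow_le k h0 hk.le).trans (modSpan_le (hS k h0 hk) hz)
  have hx : x ∈ V := by rw [hV]; trivial
  rw [Submodule.mem_comap] at hx
  change Q.e j * (x * Q.e i) ∈ modSpan K (z : Λ) S' at hx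
  rwa [h2, h1] at hx

end Levels

theorem mem_modSpan_pair {z m m' x : Λ} (h : x ∈ modSpan K z {m, m'}) :
    ∃ p q : K, ∃ y, x = p • m + q • m' + z * y := by
  obtain ⟨v, hv, _, ⟨y, rfl⟩, rfl⟩ := Submodule.mem_sup.1 h
  obtain ⟨p, q, rfl⟩ := Submodule.mem_span_pair.1 hv
  exact ⟨p, q, y, rfl⟩

end Quiv

namespace Quiv
variable {K Λ : Type} [Field K] [Ring Λ] [Algebra K Λ] (Q : Quiv K Λ QE.s QE.t)

/-- A central element with `z ^ N = 0` is nilpotent in the centre. -/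
theorem isNilpotent_mk {z : Λ} (h : z ∈ Subring.center Λ) {N : ℕ} (hN : z ^ N = 0) :
    IsNilpotent (⟨z, h⟩ : Subring.center Λ) :=
  ⟨N, Subtype.ext hN⟩

section Straight
variable (h02 : Q.a 0 * Q.a 2 = 0) (h30 : Q.a 3 * Q.a 0 = 0) (h21 : Q.a 2 * Q.a 1 = 0)
  (h13 : Q.a 1 * Q.a 3 = 0)
include h02 h30 h21 h13

theorem straight_center : Q.a 2 * Q.a 3 + Q.a 3 * Q.a 2 ∈ Subring.center Λ := by
  refine Q.mem_center (fun i => ?_) fun k => ?_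
  · fin_cases i <;>
      simp (disch := decide) [mul_add, add_mul, mul_assoc, Q.e_mul_a_mul, Q.e_mul_a_mul_zero,
        Q.a_mul_e, Q.a_mul_e_zero]
  · fin_cases k <;>
      simp (disch := decide) [mul_add, add_mul, mul_assoc, Q.a_mul_a, Q.a_mul_a_mul, h30, h21,
        mul_assoc_zero h02, mul_assoc_zero h13]

/-- The words when the loops annihilate the other arrows. -/
def straightLevels {m n : ℕ} (hz : Q.a 2 * Q.a 3 + Q.a 3 * Q.a 2 ∈ Subring.center Λ)
    (hm : ∃ y, Q.a 0 ^ m = (Q.a 2 * Q.a 3 + Q.a 3 * Q.a 2) * y)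
    (hn : ∃ y, Q.a 1 ^ n = (Q.a 2 * Q.a 3 + Q.a 3 * Q.a 2) * y) :
    Q.Levels ⟨_, hz⟩ (m + n + 3) where
  S
    | 0 => ∅
    | 1 => Set.range Q.a
    | 2 => {Q.a 0 ^ 2, Q.a 1 ^ 2, Q.a 2 * Q.a 3, Q.a 3 * Q.a 2}
    | k + 3 => {Q.a 0 ^ (k + 3), Q.a 1 ^ (k + 3)}
  pos := by omega
  one l := mem_modSpan_of_mem ⟨l, rfl⟩
  step k h0 hk x hx l := by
    match k with
    | 0 => omega
    | 1 =>
      obtain ⟨p, rfl⟩ := hx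
      have hin : ∀ x ∈ ({Q.a 0 ^ 2, Q.a 1 ^ 2, Q.a 2 * Q.a 3, Q.a 3 * Q.a 2} : Set Λ),
        x ∈ modSpan K (Q.a 2 * Q.a 3 + Q.a 3 * Q.a 2) {Q.a 0 ^ 2, Q.a 1 ^ 2, Q.a 2 * Q.a 3,
          Q.a 3 * Q.a 2} := fun x hx => mem_modSpan_of_mem hx
      fin_cases p <;> fin_cases l <;>
        simp (disch := decide) [Q.a_mul_a, h02, h30, h21, h13] <;>
        exact hin _ (by simp [pow_two])
    | 2 =>
      have h1 : Q.a 2 * (Q.a 3 * Q.a 2) = (Q.a 2 * Q.a 3 + Q.a 3 * Q.a 2) * Q.a 2 := by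
        simp (disch := decide) [add_mul, mul_assoc, Q.a_mul_a]
      have h2 : Q.a 3 * (Q.a 2 * Q.a 3) = (Q.a 2 * Q.a 3 + Q.a 3 * Q.a 2) * Q.a 3 := by
        simp (disch := decide) [add_mul, mul_assoc, Q.a_mul_a]
      rcases hx with rfl | rfl | rfl | rfl <;> fin_cases l <;>
        simp (disch := decide) [Q.a_mul_a, h02, h30, h21, h13, mul_assoc, pow_two] <;> first
        | (rw [h1]; exact mul_mem_modSpan _ _ _)
        | (rw [h2]; exact mul_mem_modSpan _ _ _)
        | exact mem_modSpan_of_mem (by simp [pow_succ, mul_assoc])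
    | k + 3 =>
      rcases hx with rfl | rfl <;> fin_cases l <;>
        simp (disch := decide) [Q.a_mul_a, h02, h13, mul_assoc, pow_succ] <;>
        exact mem_modSpan_of_mem (by simp)
  last x hx := by
    rcases hx with rfl | rfl
    · obtain ⟨y, hy⟩ := hm
      exact ⟨y * Q.a 0 ^ (n + 3), by
        rw [add_assoc m, pow_add, hy, mul_assoc]⟩
    · obtain ⟨y, hy⟩ := hn
      exact ⟨y * Q.a 1 ^ (m + 3), by
        rw [add_comm m, add_assoc n, pow_add, hy, mul_assoc]⟩

/-- The data when the loops annihilate the other arrows. -/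
theorem tauTiltingData_of_straight (r : Q.Rep (fun _ => (0 : K)))
    (rμ : Q.Rep (![0, 0, 1, 0] : Fin 4 → K[ε])) (rν : Q.Rep (![0, 0, 0, 1] : Fin 4 → K[ε]))
    {m n N : ℕ} (hm : ∃ y, Q.a 0 ^ m = (Q.a 2 * Q.a 3 + Q.a 3 * Q.a 2) * y)
    (hn : ∃ y, Q.a 1 ^ n = (Q.a 2 * Q.a 3 + Q.a 3 * Q.a 2) * y)
    (hN : (Q.a 2 * Q.a 3 + Q.a 3 * Q.a 2) ^ N = 0) : TauTiltingData Λ 6 2 2 := by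
  have hz := Q.straight_center h02 h30 h21 h13
  let H := Q.straightLevels h02 h30 h21 h13 hz hm hn
  let nil := isNilpotent_mk hz hN
  let tμ : Q.Tri 1 0 (![0, 0, 1, 0] : Fin 4 → K[ε]) := rμ.tri (by decide) (by
    intro k; fin_cases k <;> simp [QE.s, QE.t])
  let tν : Q.Tri 0 1 (![0, 0, 0, 1] : Fin 4 → K[ε]) := rν.tri (by decide) (by
    intro k; fin_cases k <;> simp [QE.s, QE.t])
  let dμ : Q.Detect r ⟨_, hz⟩ 1 0 :=
    { c := ![0, 0, 1, 0]
      tri := tμ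
      fst_c := by intro k; fin_cases k <;> simp [QE.s, QE.t]
      φ_z := by simp [map_add, map_mul, tμ.φ_a, QE.s, QE.t]
      m := Q.a 2
      m' := 0
      m_left := Q.e_mul_a rfl
      m_right := Q.a_mul_e rfl
      m'_left := mul_zero _
      m'_right := zero_mul _
      d_m := (tμ.d_a 2).trans rfl
      d_m' := Or.inl rfl
      mem := fun x h1 h2 => mem_modSpan_pair (H.mem r nil (by decide) _ (by
        intro k h0 hk x hx
        match k with
        | 0 => omega
        | 1 =>
          obtain ⟨p, rfl⟩ := hx
          fin_cases p <;>
            simp (disch := decide) [Q.a_mul_e, Q.a_mul_e_zero, Q.e_mul_a, Q.e_mul_a_zero]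
          exact mem_modSpan_of_mem (by simp)
        | 2 =>
          rcases hx with rfl | rfl | rfl | rfl <;>
            simp (disch := decide) [Q.a_mul_e, Q.a_mul_e_zero,
              Q.e_mul_a_mul_zero, pow_two, mul_assoc]
        | k + 3 =>
          rcases hx with rfl | rfl
          · simp (disch := decide) [pow_succ, mul_assoc, Q.a_mul_e_zero]
          · simp (disch := decide) [pow_succ', mul_assoc, Q.e_mul_a_mul_zero]) x h1 h2) }
  let dν : Q.Detect r ⟨_, hz⟩ 0 1 :=
    { c := ![0, 0, 0, 1]
      tri := tν
      fst_c := by intro k; fin_cases k <;> simp [QE.s, QE.t]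
      φ_z := by simp [map_add, map_mul, tν.φ_a, QE.s, QE.t]
      m := Q.a 3
      m' := 0
      m_left := Q.e_mul_a rfl
      m_right := Q.a_mul_e rfl
      m'_left := mul_zero _
      m'_right := zero_mul _
      d_m := (tν.d_a 3).trans rfl
      d_m' := Or.inl rfl
      mem := fun x h1 h2 => mem_modSpan_pair (H.mem r nil (by decide) _ (by
        intro k h0 hk x hx
        match k with
        | 0 => omega
        | 1 =>
          obtain ⟨p, rfl⟩ := hx
          fin_cases p <;>
            simp (disch := decide) [Q.a_mul_e, Q.a_mul_e_zero, Q.e_mul_a, Q.e_mul_a_zero]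
          exact mem_modSpan_of_mem (by simp)
        | 2 =>
          rcases hx with rfl | rfl | rfl | rfl <;>
            simp (disch := decide) [Q.a_mul_e, Q.a_mul_e_zero,
              Q.e_mul_a_mul_zero, pow_two, mul_assoc]
        | k + 3 =>
          rcases hx with rfl | rfl
          · simp (disch := decide) [pow_succ', mul_assoc, Q.e_mul_a_mul_zero]
          · simp (disch := decide) [pow_succ, mul_assoc, Q.a_mul_e_zero]) x h1 h2) }
  exact tauTiltingData_of_sideData (n := 1) fun j => match j with
    | 0 => dμ.dataI (nil := nil) (pow := H.pow) rfl
    | 1 => dν.dataI (nil := nil) (pow := H.pow) rfl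

end Straight
end Quiv

namespace Quiv
variable {K Λ : Type} [Field K] [Ring Λ] [Algebra K Λ] (Q : Quiv K Λ QE.s QE.t)

/-- The sum of the rotations of the cycle through the first loop. -/
def foldedZ : Λ := Q.a 0 * (Q.a 2 * Q.a 3) + Q.a 2 * (Q.a 3 * Q.a 0) + Q.a 3 * (Q.a 0 * Q.a 2)

section Folded
variable (h00 : Q.a 0 * Q.a 0 = 0) (h32 : Q.a 3 * Q.a 2 = 0) (h21 : Q.a 2 * Q.a 1 = 0)
  (h13 : Q.a 1 * Q.a 3 = 0)
include h00 h32 h21 h13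

theorem folded_center : Q.foldedZ ∈ Subring.center Λ := by
  refine Q.mem_center (fun i => ?_) fun k => ?_
  · fin_cases i <;>
      simp (disch := decide) [foldedZ, mul_add, add_mul, mul_assoc, Q.e_mul_a_mul,
        Q.e_mul_a_mul_zero, Q.a_mul_e, Q.a_mul_e_zero]
  · fin_cases k <;>
      simp (disch := decide) [foldedZ, mul_add, add_mul, mul_assoc, Q.a_mul_a, Q.a_mul_a_mul, h00,
        h32, h21, mul_assoc_zero h00, mul_assoc_zero h32,
        mul_assoc_zero h13]

/-- The words when the first loop has square zero and the second one annihilates the other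
arrows. -/
def foldedLevels {n : ℕ} (hz : Q.foldedZ ∈ Subring.center Λ)
    (hn : ∃ y, Q.a 1 ^ n = Q.foldedZ * y) : Q.Levels ⟨_, hz⟩ (n + 4) where
  S
    | 0 => ∅
    | 1 => Set.range Q.a
    | 2 => {Q.a 1 ^ 2, Q.a 0 * Q.a 2, Q.a 2 * Q.a 3, Q.a 3 * Q.a 0}
    | 3 => {Q.a 1 ^ 3, Q.a 0 * (Q.a 2 * Q.a 3), Q.a 2 * (Q.a 3 * Q.a 0),
        Q.a 3 * (Q.a 0 * Q.a 2)}
    | k + 4 => {Q.a 1 ^ (k + 4)}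
  pos := by omega
  one l := mem_modSpan_of_mem ⟨l, rfl⟩
  step k h0 hk x hx l := by
    match k with
    | 0 => omega
    | 1 =>
      obtain ⟨p, rfl⟩ := hx
      fin_cases p <;> fin_cases l <;>
        simp (disch := decide) [Q.a_mul_a, h00, h32, h21, h13] <;>
        exact mem_modSpan_of_mem (by simp [pow_two])
    | 2 =>
      rcases hx with rfl | rfl | rfl | rfl <;> fin_cases l <;>
        simp (disch := decide) [Q.a_mul_a, h00, h32, h21, h13, mul_assoc, pow_two] <;>
        exact mem_modSpan_of_mem (by simp [pow_succ, mul_assoc])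
    | 3 =>
      have h1 : Q.a 0 * (Q.a 2 * (Q.a 3 * Q.a 0)) = Q.foldedZ * Q.a 0 := by
        simp (disch := decide) [foldedZ, add_mul, mul_assoc, Q.a_mul_a, h00]
      have h2 : Q.a 2 * (Q.a 3 * (Q.a 0 * Q.a 2)) = Q.foldedZ * Q.a 2 := by
        simp (disch := decide) [foldedZ, add_mul, mul_assoc, Q.a_mul_a, h32]
      have h3 : Q.a 3 * (Q.a 0 * (Q.a 2 * Q.a 3)) = Q.foldedZ * Q.a 3 := by
        simp (disch := decide) [foldedZ, add_mul, mul_assoc, Q.a_mul_a]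
      rcases hx with rfl | rfl | rfl | rfl <;> fin_cases l <;>
        simp (disch := decide) [Q.a_mul_a, h00, h32, h21, h13, mul_assoc, pow_succ] <;> first
        | (rw [h1]; exact mul_mem_modSpan _ _ _)
        | (rw [h2]; exact mul_mem_modSpan _ _ _)
        | (rw [h3]; exact mul_mem_modSpan _ _ _)
        | exact mem_modSpan_of_mem (by simp)
    | k + 4 =>
      rcases hx with rfl
      fin_cases l <;>
        simp (disch := decide) [Q.a_mul_a, h13, mul_assoc, pow_succ]
      exact mem_modSpan_of_mem (by simp)
  last x hx := by
    rcases hx with rfl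
    obtain ⟨y, hy⟩ := hn
    exact ⟨y * Q.a 1 ^ 4, by rw [pow_add, hy, mul_assoc]⟩

/-- The data when the first loop has square zero and the second one annihilates the other
arrows. -/
theorem tauTiltingData_of_folded (r : Q.Rep (fun _ => (0 : K)))
    (rμ : Q.Rep (![DualNumber.eps, 0, 1, 0] : Fin 4 → K[ε]))
    (rν : Q.Rep (![DualNumber.eps, 0, 0, 1] : Fin 4 → K[ε]))
    {n N : ℕ} (hn : ∃ y, Q.a 1 ^ n = Q.foldedZ * y)
    (hN : Q.foldedZ ^ N = 0) : TauTiltingData Λ 8 3 3 := by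
  have hz := Q.folded_center h00 h32 h21 h13
  let H := Q.foldedLevels h00 h32 h21 h13 hz hn
  let nil := isNilpotent_mk hz hN
  let tμ : Q.Tri 1 0 (![DualNumber.eps, 0, 1, 0] : Fin 4 → K[ε]) := rμ.tri (by decide) (by
    intro k; fin_cases k <;> simp [QE.s, QE.t])
  let tν : Q.Tri 0 1 (![DualNumber.eps, 0, 0, 1] : Fin 4 → K[ε]) := rν.tri (by decide) (by
    intro k; fin_cases k <;> simp [QE.s, QE.t])
  have hdμ : tμ.d (Q.a 0 * Q.a 2) = DualNumber.eps := by
    simp [tμ.d_mul, tμ.φ_a, tμ.d_a, QE.s, QE.t]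
  have hdν : tν.d (Q.a 3 * Q.a 0) = DualNumber.eps := by
    simp [tν.d_mul, tν.ψ_a, tν.d_a, QE.s, QE.t]
  let dμ : Q.Detect r ⟨_, hz⟩ 1 0 :=
    { c := ![DualNumber.eps, 0, 1, 0]
      tri := tμ
      fst_c := by intro k; fin_cases k <;> simp [QE.s, QE.t]
      φ_z := by simp [foldedZ, map_add, map_mul, tμ.φ_a, QE.s, QE.t]
      m := Q.a 2
      m' := Q.a 0 * Q.a 2
      m_left := Q.e_mul_a rfl
      m_right := Q.a_mul_e rfl
      m'_left := by simp (disch := decide) [Q.e_mul_a_mul]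
      m'_right := by simp (disch := decide) [mul_assoc, Q.a_mul_e]
      d_m := (tμ.d_a 2).trans rfl
      d_m' := Or.inr hdμ
      mem := fun x h1 h2 => mem_modSpan_pair (H.mem r nil (by decide) _ (by
        intro k h0 hk x hx
        match k with
        | 0 => omega
        | 1 =>
          obtain ⟨p, rfl⟩ := hx
          fin_cases p <;>
            simp (disch := decide) [Q.a_mul_e, Q.a_mul_e_zero, Q.e_mul_a, Q.e_mul_a_zero]
          exact mem_modSpan_of_mem (by simp)
        | 2 =>
          rcases hx with rfl | rfl | rfl | rfl <;>
            simp (disch := decide) [Q.a_mul_e, Q.a_mul_e_zero,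
              Q.e_mul_a_mul, Q.e_mul_a_mul_zero, pow_two, mul_assoc]
          exact mem_modSpan_of_mem (by simp)
        | 3 =>
          rcases hx with rfl | rfl | rfl | rfl <;>
            simp (disch := decide) [Q.a_mul_e, Q.a_mul_e_zero,
              Q.e_mul_a_mul_zero, pow_succ, mul_assoc]
        | k + 4 =>
          rcases hx with rfl
          simp (disch := decide) [pow_succ', mul_assoc, Q.e_mul_a_mul_zero]) x h1 h2) }
  let dν : Q.Detect r ⟨_, hz⟩ 0 1 :=
    { c := ![DualNumber.eps, 0, 0, 1]
      tri := tν
      fst_c := by intro k; fin_cases k <;> simp [QE.s, QE.t]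
      φ_z := by simp [foldedZ, map_add, map_mul, tν.φ_a, QE.s, QE.t]
      m := Q.a 3
      m' := Q.a 3 * Q.a 0
      m_left := Q.e_mul_a rfl
      m_right := Q.a_mul_e rfl
      m'_left := by simp (disch := decide) [Q.e_mul_a_mul]
      m'_right := by simp (disch := decide) [mul_assoc, Q.a_mul_e]
      d_m := (tν.d_a 3).trans rfl
      d_m' := Or.inr hdν
      mem := fun x h1 h2 => mem_modSpan_pair (H.mem r nil (by decide) _ (by
        intro k h0 hk x hx
        match k with
        | 0 => omega
        | 1 =>
          obtain ⟨p, rfl⟩ := hx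
          fin_cases p <;>
            simp (disch := decide) [Q.a_mul_e, Q.a_mul_e_zero, Q.e_mul_a, Q.e_mul_a_zero]
          exact mem_modSpan_of_mem (by simp)
        | 2 =>
          rcases hx with rfl | rfl | rfl | rfl <;>
            simp (disch := decide) [Q.a_mul_e, Q.a_mul_e_zero,
              Q.e_mul_a_mul, Q.e_mul_a_mul_zero, pow_two, mul_assoc]
          exact mem_modSpan_of_mem (by simp)
        | 3 =>
          rcases hx with rfl | rfl | rfl | rfl <;>
            simp (disch := decide) [Q.a_mul_e, Q.a_mul_e_zero,
              Q.e_mul_a_mul_zero, pow_succ, mul_assoc]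
        | k + 4 =>
          rcases hx with rfl
          simp (disch := decide) [pow_succ, mul_assoc, Q.a_mul_e_zero]) x h1 h2) }
  exact tauTiltingData_of_sideData (n := 2) fun j => match j with
    | 0 => dμ.dataII (nil := nil) (pow := H.pow)
        (by intro k; fin_cases k <;> simp [dμ, QE.s, QE.t]) (Q.a 0) (Q.e_mul_a rfl)
        (Q.a_mul_e rfl) h00 rfl hdμ
    | 1 => dν.dataIII (nil := nil) (pow := H.pow)
        (by intro k; fin_cases k <;> simp [dν, QE.s, QE.t]) (Q.a 0) (Q.e_mul_a rfl)
        (Q.a_mul_e rfl) h00 rfl hdν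

end Folded
end Quiv

theorem add_pow_of_mul_eq_zero {Λ : Type} [Ring Λ] {x y : Λ} (h1 : x * y = 0) (h2 : y * x = 0)
    {n : ℕ} (hn : n ≠ 0) : (x + y) ^ n = x ^ n + y ^ n := by
  obtain ⟨k, rfl⟩ := Nat.exists_eq_succ_of_ne_zero hn
  have hx : ∀ k, x ^ (k + 1) * y = 0 := fun k => by rw [pow_succ, mul_assoc, h1, mul_zero]
  have hy : ∀ k, y ^ (k + 1) * x = 0 := fun k => by rw [pow_succ, mul_assoc, h2, mul_zero]
  clear hn
  induction k with
  | zero => simp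
  | succ k ih =>
    rw [Nat.succ_eq_add_one] at ih ⊢
    rw [pow_succ, ih, add_mul, mul_add, mul_add, hx, hy, ← pow_succ, ← pow_succ, add_zero,
      zero_add]

theorem pow_mul_eq_zero {Λ : Type} [Ring Λ] {x y : Λ} {m : ℕ} (hm : m ≠ 0) (h : x * y = 0) :
    x ^ m * y = 0 := by
  obtain ⟨k, rfl⟩ := Nat.exists_eq_succ_of_ne_zero hm
  rw [Nat.succ_eq_add_one, pow_succ, mul_assoc, h, mul_zero]

namespace Quiv
variable {K Λ σ σ' : Type} [Field K] [Ring Λ] [Algebra K Λ] {s t : σ → Fin 2} {s' t' : σ' → Fin 2}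

/-- The quiver algebra with additional arrows sent to zero. -/
def extend (Q : Quiv K Λ s' t') (s t : σ → Fin 2) (g : σ → Option σ')
    (hs : ∀ k l, g k = some l → s k = s' l ∧ t k = t' l) (hg : ∀ l, ∃ k, g k = some l) :
    Quiv K Λ s t where
  e := Q.e
  a k := (g k).elim 0 Q.a
  idem := Q.idem
  orth := Q.orth
  sum := Q.sum
  src k := by
    cases h : g k with
    | none => exact mul_zero _
    | some l => rw [(hs k l h).1]; exact Q.src l
  tgt k := by
    cases h : g k with
    | none => exact zero_mul _
    | some l => rw [(hs k l h).2]; exact Q.tgt l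
  gen := by
    refine top_unique (Q.gen.symm.le.trans (Algebra.adjoin_mono ?_))
    refine Set.union_subset_union le_rfl ?_
    rintro _ ⟨l, rfl⟩
    obtain ⟨k, hk⟩ := hg l
    exact ⟨k, by simp [hk]⟩

/-- The representation of an extended quiver algebra. -/
def Rep.extend {C : Type} [CommRing C] [Algebra K C] {Q : Quiv K Λ s' t'} {c' : σ' → C}
    (r : Q.Rep c') {g : σ → Option σ'}
    {hs : ∀ k l, g k = some l → s k = s' l ∧ t k = t' l} {hg : ∀ l, ∃ k, g k = some l}
    {c : σ → C} (hc : ∀ k, c k = (g k).elim 0 c') : (Q.extend s t g hs hg).Rep c where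
  ρ := r.ρ
  map_e := r.map_e
  map_a k := by
    rw [hc]
    change r.ρ ((g k).elim 0 Q.a) = _
    cases h : g k with
    | none => simp
    | some l => rw [(hs k l h).1, (hs k l h).2]; exact r.map_a l

variable (Q : Quiv K Λ QE.s QE.t)

theorem straight_nil {n : ℕ} (h : (Q.a 2 * Q.a 3) ^ n * Q.a 2 = 0) :
    (Q.a 2 * Q.a 3 + Q.a 3 * Q.a 2) ^ (n + 1) = 0 := by
  rw [add_pow_of_mul_eq_zero (by simp (disch := decide) [mul_assoc, Q.a_mul_a_mul])
    (by simp (disch := decide) [mul_assoc, Q.a_mul_a_mul]) (Nat.succ_ne_zero n), pow_succ,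
    ← mul_assoc, h, zero_mul, zero_add]
  have : ∀ k, (Q.a 3 * Q.a 2) ^ (k + 1) = Q.a 3 * ((Q.a 2 * Q.a 3) ^ k * Q.a 2) := by
    intro k
    induction k with
    | zero => simp
    | succ k ih => rw [pow_succ, ih, pow_succ]; simp only [mul_assoc]
  rw [this, h, mul_zero]

theorem straight_left {n : ℕ} (hn : n ≠ 0) : (Q.a 2 * Q.a 3) ^ n =
    (Q.a 2 * Q.a 3 + Q.a 3 * Q.a 2) * (Q.e 0 * (Q.a 2 * Q.a 3) ^ (n - 1)) := by
  obtain ⟨k, rfl⟩ := Nat.exists_eq_succ_of_ne_zero hn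
  rw [Nat.succ_eq_add_one, Nat.add_sub_cancel, pow_succ', ← mul_assoc]
  congr 1
  simp (disch := decide) [add_mul, mul_assoc, Q.a_mul_e, Q.a_mul_e_zero]

theorem straight_right {n : ℕ} (hn : n ≠ 0) : (Q.a 3 * Q.a 2) ^ n =
    (Q.a 2 * Q.a 3 + Q.a 3 * Q.a 2) * (Q.e 1 * (Q.a 3 * Q.a 2) ^ (n - 1)) := by
  obtain ⟨k, rfl⟩ := Nat.exists_eq_succ_of_ne_zero hn
  rw [Nat.succ_eq_add_one, Nat.add_sub_cancel, pow_succ', ← mul_assoc]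
  congr 1
  simp (disch := decide) [add_mul, mul_assoc, Q.a_mul_e, Q.a_mul_e_zero]

theorem folded_right {n : ℕ} (hn : n ≠ 0) : (Q.a 3 * Q.a 0 * Q.a 2) ^ n =
    Q.foldedZ * (Q.e 1 * (Q.a 3 * Q.a 0 * Q.a 2) ^ (n - 1)) := by
  obtain ⟨k, rfl⟩ := Nat.exists_eq_succ_of_ne_zero hn
  rw [Nat.succ_eq_add_one, Nat.add_sub_cancel, pow_succ', ← mul_assoc]
  congr 1
  simp (disch := decide) [foldedZ, add_mul, mul_assoc, Q.a_mul_e, Q.a_mul_e_zero]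

theorem folded_nil (hz : Q.foldedZ ∈ Subring.center Λ) (h00 : Q.a 0 * Q.a 0 = 0)
    (h32 : Q.a 3 * Q.a 2 = 0) {n : ℕ} (hn : n ≠ 0)
    (h : (Q.a 0 * Q.a 2 * Q.a 3) ^ n = (Q.a 2 * Q.a 3 * Q.a 0) ^ n) :
    Q.foldedZ ^ (n + 1) = 0 := by
  have hp : Q.foldedZ ^ n = (Q.a 0 * Q.a 2 * Q.a 3) ^ n + (Q.a 2 * Q.a 3 * Q.a 0) ^ n +
      (Q.a 3 * Q.a 0 * Q.a 2) ^ n := by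
    rw [← add_pow_of_mul_eq_zero (x := Q.a 0 * Q.a 2 * Q.a 3)
        (by simp (disch := decide) [mul_assoc, mul_assoc_zero h32])
        (by simp (disch := decide) [mul_assoc, mul_assoc_zero h00]) hn,
      ← add_pow_of_mul_eq_zero
        (by simp (disch := decide) [add_mul, mul_assoc, Q.a_mul_a_mul])
        (by simp (disch := decide) [mul_add, mul_assoc, Q.a_mul_a_mul]) hn]
    simp [foldedZ, mul_assoc]
  have hl : ∀ x : Λ, Q.a 0 * x = 0 → Q.a 0 * x ^ n = 0 := fun x hx => by
    obtain ⟨k, rfl⟩ := Nat.exists_eq_succ_of_ne_zero hn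
    rw [Nat.succ_eq_add_one, pow_succ', ← mul_assoc, hx, zero_mul]
  have h0 : Q.a 0 * Q.foldedZ ^ n = 0 := by
    rw [hp, ← h, mul_add, mul_add, hl _ (by simp [mul_assoc, mul_assoc_zero h00]),
      hl _ (by simp (disch := decide) [mul_assoc, Q.a_mul_a_mul])]
    simp
  have hc : ∀ x, x * Q.foldedZ ^ n = Q.foldedZ ^ n * x :=
    fun x => ((Subring.mem_center_iff.1 (pow_mem hz n)) x)
  have h0' : ∀ x, Q.a 0 * (x * Q.foldedZ ^ n) = 0 := fun x => by
    rw [hc, ← mul_assoc, h0, zero_mul]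
  rw [pow_succ, ← hc]
  generalize Q.foldedZ ^ n = w at h0 h0' ⊢
  have h1 : ∀ x y, Q.a 0 * (x * (y * w)) = 0 := fun x y => by rw [← mul_assoc x, h0']
  rw [foldedZ]
  simp only [add_mul, mul_assoc, h0, h0', h1, mul_zero, add_zero]

end Quiv

section Algebras
variable (K : Type) [Field K]

theorem tauTiltingData_bisB1 (n : ℕ) (hn : 1 ≤ n) : TauTiltingData (BisB1 K n) 6 2 2 := by
  let Q' : Quiv K (BisB1 K n) QF.s QF.t := boundQuiv K QF.s QF.t _
  let Q : Quiv K (BisB1 K n) QE.s QE.t := Q'.extend QE.s QE.t ![none, none, some 0, some 1]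
    (by intro k l; fin_cases k <;> fin_cases l <;> simp [QE.s, QE.t, QF.s, QF.t])
    (by intro l; fin_cases l; exacts [⟨2, rfl⟩, ⟨3, rfl⟩])
  have h1 : (boundMk ((QF.mu K * QF.nu K) ^ n * QF.mu K) : BisB1 K n) = boundMk 0 :=
    boundMk_rel (by simp)
  simp only [map_mul, map_pow, map_zero] at h1
  have hn' : n ≠ 0 := by omega
  refine Q.tauTiltingData_of_straight (m := 1) (n := 1) (N := n + 1) (zero_mul _) (mul_zero _)
    (mul_zero _) (zero_mul _)
    ((boundRep (fun _ => 0) ?_).extend ?_)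
    ((boundRep ![1, 0] ?_).extend ?_) ((boundRep ![0, 1] ?_).extend ?_)
    ⟨0, ?_⟩ ⟨0, ?_⟩ (Q.straight_nil h1)
  · simp [QF.mu, QF.nu]
  · intro k; fin_cases k <;> rfl
  · simp [QF.mu, QF.nu, hn']
  · intro k; fin_cases k <;> rfl
  · simp [QF.mu, QF.nu, hn']
  · intro k; fin_cases k <;> rfl
  · rw [pow_one, mul_zero]; rfl
  · rw [pow_one, mul_zero]; rfl

theorem tauTiltingData_bisB4 (m n : ℕ) (hm : 2 ≤ m) (hn : 1 ≤ n) :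
    TauTiltingData (BisB4 K m n) 6 2 2 := by
  let Q' : Quiv K (BisB4 K m n) QD.s QD.t := boundQuiv K QD.s QD.t _
  let Q : Quiv K (BisB4 K m n) QE.s QE.t := Q'.extend QE.s QE.t ![some 0, none, some 1, some 2]
    (by intro k l; fin_cases k <;> fin_cases l <;> simp [QE.s, QE.t, QD.s, QD.t])
    (by intro l; fin_cases l; exacts [⟨0, rfl⟩, ⟨2, rfl⟩, ⟨3, rfl⟩])
  have h1 : (boundMk (QD.al K * QD.mu K) : BisB4 K m n) = boundMk 0 := boundMk_rel (by simp)
  have h2 : (boundMk (QD.nu K * QD.al K) : BisB4 K m n) = boundMk 0 := boundMk_rel (by simp)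
  have h3 : (boundMk (QD.al K ^ m) : BisB4 K m n) = boundMk ((QD.mu K * QD.nu K) ^ n) :=
    boundMk_rel (by simp)
  simp only [map_mul, map_pow, map_zero] at h1 h2 h3
  have hn' : n ≠ 0 := by omega
  have hm' : m ≠ 0 := by omega
  have h02 : Q.a 0 * Q.a 2 = 0 := h1
  have h30 : Q.a 3 * Q.a 0 = 0 := h2
  have hp : Q.a 0 ^ m = (Q.a 2 * Q.a 3) ^ n := h3
  refine Q.tauTiltingData_of_straight (m := m) (n := 1) (N := n + 1) h02 h30
    (mul_zero _) (zero_mul _)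
    ((boundRep (fun _ => 0) ?_).extend ?_)
    ((boundRep ![0, 1, 0] ?_).extend ?_) ((boundRep ![0, 0, 1] ?_).extend ?_)
    ⟨_, hp.trans (Q.straight_left hn')⟩ ⟨0, ?_⟩ (Q.straight_nil ?_)
  · simp [QD.al, QD.mu, QD.nu, hn', hm']
  · intro k; fin_cases k <;> rfl
  · simp [QD.al, QD.mu, QD.nu, hn', hm']
  · intro k; fin_cases k <;> rfl
  · simp [QD.al, QD.mu, QD.nu, hn', hm']
  · intro k; fin_cases k <;> rfl
  · rw [pow_one, mul_zero]; rfl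
  · rw [← hp]; exact pow_mul_eq_zero hm' h02

theorem tauTiltingData_bisB6 (m r n : ℕ) (hm : 2 ≤ m) (hr : 2 ≤ r) (hn : 1 ≤ n) :
    TauTiltingData (BisB6 K m r n) 6 2 2 := by
  let Q : Quiv K (BisB6 K m r n) QE.s QE.t := boundQuiv K QE.s QE.t _
  have h1 : (boundMk (QE.al K * QE.mu K) : BisB6 K m r n) = boundMk 0 := boundMk_rel (by simp)
  have h2 : (boundMk (QE.mu K * QE.be K) : BisB6 K m r n) = boundMk 0 := boundMk_rel (by simp)
  have h3 : (boundMk (QE.be K * QE.nu K) : BisB6 K m r n) = boundMk 0 := boundMk_rel (by simp)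
  have h4 : (boundMk (QE.nu K * QE.al K) : BisB6 K m r n) = boundMk 0 := boundMk_rel (by simp)
  have h5 : (boundMk (QE.al K ^ m) : BisB6 K m r n) = boundMk ((QE.mu K * QE.nu K) ^ n) :=
    boundMk_rel (by simp)
  have h6 : (boundMk (QE.be K ^ r) : BisB6 K m r n) = boundMk ((QE.nu K * QE.mu K) ^ n) :=
    boundMk_rel (by simp)
  simp only [map_mul, map_pow, map_zero] at h1 h2 h3 h4 h5 h6
  have hn' : n ≠ 0 := by omega
  have hm' : m ≠ 0 := by omega
  have hr' : r ≠ 0 := by omega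
  have h02 : Q.a 0 * Q.a 2 = 0 := h1
  have hp : Q.a 0 ^ m = (Q.a 2 * Q.a 3) ^ n := h5
  have hq : Q.a 1 ^ r = (Q.a 3 * Q.a 2) ^ n := h6
  refine Q.tauTiltingData_of_straight (m := m) (n := r) (N := n + 1) h02 h4 h2 h3
    (boundRep (fun _ => 0) ?_) (boundRep ![0, 0, 1, 0] ?_) (boundRep ![0, 0, 0, 1] ?_)
    ⟨_, hp.trans (Q.straight_left hn')⟩ ⟨_, hq.trans (Q.straight_right hn')⟩ (Q.straight_nil ?_)
  · simp [QE.al, QE.be, QE.mu, QE.nu, hn', hm', hr']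
  · simp [QE.al, QE.be, QE.mu, QE.nu, hn', hm', hr']
  · simp [QE.al, QE.be, QE.mu, QE.nu, hn', hm', hr']
  · rw [← hp]; exact pow_mul_eq_zero hm' h02

theorem tauTiltingData_bisB5 (n : ℕ) (hn : 1 ≤ n) : TauTiltingData (BisB5 K n) 8 3 3 := by
  let Q' : Quiv K (BisB5 K n) QD.s QD.t := boundQuiv K QD.s QD.t _
  let Q : Quiv K (BisB5 K n) QE.s QE.t := Q'.extend QE.s QE.t ![some 0, none, some 1, some 2]
    (by intro k l; fin_cases k <;> fin_cases l <;> simp [QE.s, QE.t, QD.s, QD.t])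
    (by intro l; fin_cases l; exacts [⟨0, rfl⟩, ⟨2, rfl⟩, ⟨3, rfl⟩])
  have h1 : (boundMk (QD.al K ^ 2) : BisB5 K n) = boundMk 0 := boundMk_rel (by simp)
  have h2 : (boundMk (QD.nu K * QD.mu K) : BisB5 K n) = boundMk 0 := boundMk_rel (by simp)
  have h3 : (boundMk ((QD.al K * QD.mu K * QD.nu K) ^ n) : BisB5 K n) =
      boundMk ((QD.mu K * QD.nu K * QD.al K) ^ n) := boundMk_rel (by simp)
  simp only [map_mul, map_pow, map_zero] at h1 h2 h3
  have hn' : n ≠ 0 := by omega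
  have h00 : Q.a 0 * Q.a 0 = 0 := (sq _).symm.trans h1
  have h32 : Q.a 3 * Q.a 2 = 0 := h2
  have h21 : Q.a 2 * Q.a 1 = 0 := mul_zero _
  have h13 : Q.a 1 * Q.a 3 = 0 := zero_mul _
  refine Q.tauTiltingData_of_folded (n := 1) (N := n + 1) h00 h32 h21 h13
    ((boundRep (fun _ => 0) ?_).extend ?_)
    ((boundRep ![DualNumber.eps, 1, 0] ?_).extend ?_)
    ((boundRep ![DualNumber.eps, 0, 1] ?_).extend ?_) ⟨0, ?_⟩
    (Q.folded_nil (Q.folded_center h00 h32 h21 h13) h00 h32 hn' h3)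
  · simp [QD.al, QD.mu, QD.nu, hn']
  · intro k; fin_cases k <;> rfl
  · simp [QD.al, QD.mu, QD.nu, hn', QD.s, QD.t, sq]
  · intro k; fin_cases k <;> rfl
  · simp [QD.al, QD.mu, QD.nu, hn', QD.s, QD.t, sq]
  · intro k; fin_cases k <;> rfl
  · rw [pow_one, mul_zero]; rfl

theorem tauTiltingData_bisB7 (m n : ℕ) (hm : 2 ≤ m) (hn : 1 ≤ n) :
    TauTiltingData (BisB7 K m n) 8 3 3 := by
  let Q : Quiv K (BisB7 K m n) QE.s QE.t := boundQuiv K QE.s QE.t _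
  have h1 : (boundMk (QE.al K ^ 2) : BisB7 K m n) = boundMk 0 := boundMk_rel (by simp)
  have h2 : (boundMk (QE.nu K * QE.mu K) : BisB7 K m n) = boundMk 0 := boundMk_rel (by simp)
  have h3 : (boundMk (QE.mu K * QE.be K) : BisB7 K m n) = boundMk 0 := boundMk_rel (by simp)
  have h4 : (boundMk (QE.be K * QE.nu K) : BisB7 K m n) = boundMk 0 := boundMk_rel (by simp)
  have h5 : (boundMk ((QE.al K * QE.mu K * QE.nu K) ^ n) : BisB7 K m n) =
      boundMk ((QE.mu K * QE.nu K * QE.al K) ^ n) := boundMk_rel (by simp)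
  have h6 : (boundMk (QE.be K ^ m) : BisB7 K m n) =
      boundMk ((QE.nu K * QE.al K * QE.mu K) ^ n) := boundMk_rel (by simp)
  simp only [map_mul, map_pow, map_zero] at h1 h2 h3 h4 h5 h6
  have hn' : n ≠ 0 := by omega
  have hm' : m ≠ 0 := by omega
  have h00 : Q.a 0 * Q.a 0 = 0 := (sq _).symm.trans h1
  have h32 : Q.a 3 * Q.a 2 = 0 := h2
  have hq : Q.a 1 ^ m = (Q.a 3 * Q.a 0 * Q.a 2) ^ n := h6
  refine Q.tauTiltingData_of_folded (n := m) (N := n + 1) h00 h32 h3 h4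
    (boundRep (fun _ => 0) ?_)
    (boundRep ![DualNumber.eps, 0, 1, 0] ?_)
    (boundRep ![DualNumber.eps, 0, 0, 1] ?_) ⟨_, hq.trans (Q.folded_right hn')⟩
    (Q.folded_nil (Q.folded_center h00 h32 h3 h4) h00 h32 hn' h5)
  · simp [QE.al, QE.be, QE.mu, QE.nu, hn', hm']
  · simp [QE.al, QE.be, QE.mu, QE.nu, hn', hm', QE.s, QE.t, sq]
  · simp [QE.al, QE.be, QE.mu, QE.nu, hn', hm', QE.s, QE.t, sq]

end Algebras
namespace Pointed
variable {K R : Type} [Field K] [Ring R] [Algebra K R] {D : Pointed K R}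

section Card
variable {κ κ' ι ι' M N : Type} [Fintype κ] [Fintype κ'] [Fintype ι] [Fintype ι']
  [AddCommGroup M] [Module R M] [AddCommGroup N] [Module R N]
  {j : Fin 2} {u : ι → Fin 2} {u' : ι' → Fin 2} {m : κ → M} {m' : κ' → N}
  {F : Matrix ι κ R} {F' : Matrix ι' κ' R}

theorem Pres.top_eq_zero (h : D.Pres (fun _ => j) u m F) (hu : ∀ r, u r ≠ j) (y : κ → R)
    (hy : ∑ k, y k • m k = 0) (k : κ) : D.top (y k) j = 0 := by
  obtain ⟨b, hb⟩ := h.exact y hy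
  have h2 : y k * D.e j ∈ D.J := by
    rw [hb k]
    exact Submodule.sum_mem _ fun r _ => D.J.mul_mem_left _
      (D.mem_J_of_ne (hu r) (h.left r k) (h.right r k))
  rw [mem_J, map_mul, D.top_e] at h2
  simpa using congrFun h2 j

theorem Pres.top_mul (h : D.Pres (fun _ => j) u m F) (hu : ∀ r, u r ≠ j) [DecidableEq κ]
    (A : Matrix κ κ' R) (B : Matrix κ' κ R) (hAB : act A (act B m) = m) :
    (Matrix.of fun k l => D.top (A k l) j) * (Matrix.of fun k l => D.top (B k l) j) = 1 := by
  ext k k'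
  have h2 := h.top_eq_zero hu ((A * B - 1 : Matrix κ κ R) k) (by
    have := congrFun hAB k
    rw [← act_mul] at this
    simp only [Matrix.sub_apply, sub_smul, Finset.sum_sub_distrib]
    rw [← act_apply, ← act_apply, this, act_one, sub_self]) k'
  rw [Matrix.sub_apply, Matrix.mul_apply, map_sub, map_sum, Pi.sub_apply, Finset.sum_apply,
    sub_eq_zero] at h2
  simp only [map_mul, Pi.mul_apply] at h2
  rw [Matrix.mul_apply]
  refine h2.trans ?_
  rw [Matrix.one_apply, Matrix.one_apply]
  split_ifs <;> simp

/-- The number of generators in a minimal presentation is an invariant. -/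
theorem Pres.card_eq (h : D.Pres (fun _ => j) u m F) (hu : ∀ r, u r ≠ j)
    (h' : D.Pres (fun _ => j) u' m' F') (hu' : ∀ r, u' r ≠ j) (f : M ≃ₗ[R] N) :
    Fintype.card κ = Fintype.card κ' := by
  classical
  choose A hA using fun k => exists_sum_of_span h'.span (f (m k))
  choose B hB using fun k => exists_sum_of_span h.span (f.symm (m' k))
  have hA' : act A m' = fun k => f (m k) := funext hA
  have hB' : act B m = fun k => f.symm (m' k) := funext hB
  have h1 := h.top_mul hu A B (by
    rw [hB']
    ext k
    have := congrArg f.symm (congrFun hA' k)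
    simpa [act, map_sum] using this)
  have h2 := h'.top_mul hu' B A (by
    rw [hA']
    ext k
    have := congrArg f (congrFun hB' k)
    simpa [act, map_sum] using this)
  have := (Matrix.toLin'OfInv h1 h2).finrank_eq
  simpa using this

end Card

section Self
variable (D)

/-- The indecomposable projective modules. -/
abbrev Proj (j : Fin 2) : Type := D.PMod (fun _ : Unit => j) (noRel R Unit)

variable {D}

theorem proj_pres (j : Fin 2) (i : Fin 2) : D.Pres (fun _ => j) (fun _ => i)
    (D.pgen (fun _ : Unit => j) (noRel R Unit)) (noRel R Unit) :=
  D.pmod_pres _ _ _ (fun r => r.elim) (fun r => r.elim)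

theorem isUnit_of_unit_matrix (A : Matrix Unit Unit K) (h : A () () ≠ 0) : IsUnit A := by
  rw [Matrix.isUnit_iff_isUnit_det, Matrix.det_unique]
  exact isUnit_iff_ne_zero.2 h

instance proj_isLocal (j : Fin 2) : IsLocalRing (Module.End R (D.Proj j)) :=
  (proj_pres j (1 - j)).isLocalRing (by fin_cases j <;> simp) fun A _ _ _ =>
    ⟨D.top (A () ()) j, fun h => isUnit_of_unit_matrix _ h, fun h =>
      isUnit_of_unit_matrix _ (by simpa [sub_eq_zero] using h.symm)⟩

theorem proj_injective (j j' : Fin 2) (h : Nonempty (D.Proj j ≃ₗ[R] D.Proj j')) : j = j' := by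
  by_contra hne
  obtain ⟨f⟩ := h
  have := (isIndecModule_of_isLocalRing (R := R) (N := D.Proj j')).1
  obtain ⟨x, hx⟩ := exists_ne (0 : D.Proj j')
  exact hx (((proj_pres j j).genAt.of_surjective f.toLinearMap f.surjective).eq_zero hne
    (proj_pres j' j').genAt x)

theorem self_indecClassCount (D : Pointed K R) : HasIndecClassCount R (ModuleCat.of R R) 2 := by
  have h2 := D.self_pres.reindex (Equiv.sigmaUnique (Fin 2) fun _ => Unit) (Equiv.refl Empty)
  have h3 := Pres.pi (fun x : Fin 2 => D.proj_pres x x)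
  obtain ⟨f, -⟩ := h2.iso h3 (funext fun r => r.elim) (funext fun r => r.2.elim)
  exact (basic_and_count proj_injective Finset.univ
    (f.trans (LinearEquiv.piCongrLeft R (fun γ : (Finset.univ : Finset (Fin 2)) => D.Proj γ)
      (Equiv.subtypeUnivEquiv (by simp)).symm))).2

end Self

section Family
variable {i j : Fin 2} {N : ∀ n : ℕ, Matrix (Fin (n + 1)) (Fin n) R}

/-- The direct sum of two neighbours in a family of presented modules. -/
abbrev Neighbours (D : Pointed K R) (j : Fin 2) (N : ∀ n : ℕ, Matrix (Fin (n + 1)) (Fin n) R)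
    (n : ℕ) : Type := ∀ γ : Fin 2, D.PMod (fun _ => j) (N (n + γ))

theorem neighbours_supportTauTilting (hij : i ≠ j) {n : ℕ}
    (hl : ∀ n r k, D.e i * N n r k = N n r k) (hr : ∀ n r k, N n r k * D.e j = N n r k)
    (hloc : ∀ γ : Fin 2, IsLocalRing (Module.End R (D.PMod (fun _ => j) (N (n + γ)))))
    (hc : ∀ γ γ' : Fin 2,
      D.Crit (fun _ => i) (N (n + γ)) (D.PMod (fun _ => j) (N (n + γ')))) :
    IsSupportTauTiltingCat R (ModuleCat.of R (Neighbours D j N n)) ∧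
      IsBasicModuleCat R (ModuleCat.of R (Neighbours D j N n)) := by
  have hp : ∀ γ : Fin 2, D.Pres (fun _ => j) (fun _ => i) (D.pgen (fun _ => j) (N (n + γ)))
      (N (n + γ)) := fun γ => D.pmod_pres _ _ _ (hl _) (hr _)
  have hinj : ∀ γ γ' : Fin 2, Nonempty (D.PMod (fun _ => j) (N (n + γ)) ≃ₗ[R]
      D.PMod (fun _ => j) (N (n + γ'))) → γ = γ' := fun γ γ' ⟨f⟩ => by
    have := (hp γ).card_eq (fun _ => hij) (hp γ') (fun _ => hij) f
    simpa [Fin.ext_iff] using this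
  have h1 := basic_and_count hinj Finset.univ (LinearEquiv.piCongrLeft R
    (fun γ : (Finset.univ : Finset (Fin 2)) => D.PMod (fun _ => j) (N (n + (γ : Fin 2))))
      (Equiv.subtypeUnivEquiv (by simp)).symm : Neighbours D j N n ≃ₗ[R] _)
  have h2 := basic_and_count hinj ∅ (LinearEquiv.refl R (∀ γ : (∅ : Finset (Fin 2)),
    D.PMod (fun _ => j) (N (n + (γ : Fin 2)))))
  exact ⟨⟨D.tauRigid_of_crit (Pres.pi hp) (Crit.pi hc), ModuleCat.of R _, 2, 0, 2,
    inferInstance, Module.Projective.of_free, fun f => LinearMap.ext fun x => by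
      rw [Subsingleton.elim x 0, map_zero, map_zero], h1.2, h2.2, D.self_indecClassCount,
        rfl⟩, h1.1⟩

end Family
end Pointed

theorem not_isTauTiltingFinite_of_family {K Λ : Type} [Field K] [Ring Λ] [Algebra K Λ]
    (D : Pointed K Λᵐᵒᵖ) {i j : Fin 2} (hij : i ≠ j)
    (N : ∀ n : ℕ, Matrix (Fin (n + 1)) (Fin n) Λᵐᵒᵖ)
    (hl : ∀ n r k, D.e i * N n r k = N n r k) (hr : ∀ n r k, N n r k * D.e j = N n r k)
    (hloc : ∀ n, 1 ≤ n → IsLocalRing (Module.End Λᵐᵒᵖ (D.PMod (fun _ => j) (N n))))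
    (hc : ∀ n n', 2 ≤ n → n' ≤ n ∨ n' = n + 1 ∧ Even n →
      D.Crit (fun _ => i) (N n) (D.PMod (fun _ => j) (N n'))) : ¬ IsTauTiltingFinite Λ := by
  rintro ⟨s, L, hL⟩
  let T : ℕ → RMod Λ := fun t => ModuleCat.of Λᵐᵒᵖ (Pointed.Neighbours D j N (2 * t + 2))
  have hT : ∀ t, ∃ x, Nonempty (T t ≃ₗ[Λᵐᵒᵖ] L x) := fun t => by
    refine hL _ (Pointed.neighbours_supportTauTilting hij hl hr (fun γ => hloc _ (by omega))
      fun γ γ' => hc _ _ (by omega) ?_)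
    fin_cases γ <;> fin_cases γ' <;> simp [parity_simps]
  choose x f using hT
  refine not_injective_infinite_finite x fun t t' h => ?_
  obtain ⟨g⟩ := f t
  obtain ⟨g'⟩ := f t'
  rw [h] at g
  have hp : ∀ n, D.Pres (fun _ => j) (fun _ => i) (D.pgen (fun _ => j) (N n)) (N n) :=
    fun n => D.pmod_pres _ _ _ (hl _) (hr _)
  have := (Pointed.Pres.pi fun γ : Fin 2 => hp (2 * t + 2 + γ)).card_eq (fun _ => hij)
    (Pointed.Pres.pi fun γ : Fin 2 => hp (2 * t' + 2 + γ)) (fun _ => hij) (g.trans g'.symm)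
  simp only [Fintype.card_sigma, Fintype.card_fin, Fin.sum_univ_two] at this
  omega

/-- The extension of a finite tuple by zero. -/
def extendZero {M : Type} [Zero M] {n : ℕ} (v : Fin n → M) (k : ℕ) : M :=
  if h : k < n then v ⟨k, h⟩ else 0

theorem extendZero_val {M : Type} [Zero M] {n : ℕ} (v : Fin n → M) (k : Fin n) :
    extendZero v k = v k := dif_pos k.2

theorem extendZero_of_le {M : Type} [Zero M] {n : ℕ} (v : Fin n → M) {k : ℕ} (h : n ≤ k) :
    extendZero v k = 0 := dif_neg (by omega)

theorem extendZero_of_lt {M : Type} [Zero M] {n : ℕ} (v : Fin n → M) {k : ℕ} (h : k < n) :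
    extendZero v k = v ⟨k, h⟩ := dif_pos h

theorem sum_ite_smul_extendZero {R M : Type} [Ring R] [AddCommGroup M] [Module R M] {n : ℕ}
    (v : Fin n → M) (r : ℕ) (x : R) :
    ∑ k : Fin n, (if (k : ℕ) = r then x else 0) • v k = x • extendZero v r := by
  by_cases h : r < n
  · rw [extendZero_of_lt v h, Finset.sum_eq_single ⟨r, h⟩]
    · simp
    · intro b _ hb
      rw [if_neg (fun h' => hb (Fin.ext h')), zero_smul]
    · simp
  · rw [extendZero_of_le v (by omega), smul_zero]
    refine Finset.sum_eq_zero fun k _ => ?_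
    rw [if_neg (by omega), zero_smul]

theorem exists_sub_diagonal {A : Type} [AddCommGroup A] (h : ℕ → ℕ → A) (n : ℕ) :
    ∃ b : ℕ → ℕ → A, (∀ k, b 0 k = 0) ∧ (∀ k ≤ n, b (n + 1) k = 0) ∧
      ∀ r ≤ n, ∀ k, b r k - b (r + 1) (k + 1) = h r k := by
  refine ⟨fun r k => if r ≤ k then -∑ l ∈ Finset.range r, h (r - 1 - l) (k - 1 - l)
    else ∑ l ∈ Finset.range (n + 1 - r), h (r + l) (k + l), fun k => by simp,
    fun k hk => by simp; omega, fun r hr k => ?_⟩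
  beta_reduce
  by_cases hrk : r ≤ k
  · rw [if_pos hrk, if_pos (by omega), Finset.sum_range_succ']
    have : ∀ l, h (r + 1 - 1 - (l + 1)) (k + 1 - 1 - (l + 1)) = h (r - 1 - l) (k - 1 - l) :=
      fun l => by congr 1 <;> omega
    simp only [this]
    simp
  · rw [if_neg hrk, if_neg (by omega), show n + 1 - r = n + 1 - (r + 1) + 1 by omega,
      Finset.sum_range_succ']
    have : ∀ l, h (r + 1 + l) (k + 1 + l) = h (r + (l + 1)) (k + (l + 1)) :=
      fun l => by congr 1 <;> omega
    simp only [this]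
    simp

theorem eq_scalar_of_diagonal {A : Type} [Zero A] {n : ℕ} {a : ℕ → ℕ → A}
    (h0 : ∀ k, k + 1 < n → a 0 (k + 1) = 0)
    (hs : ∀ r k, r + 1 < n → k + 1 < n → a (r + 1) (k + 1) = a r k)
    (hl : ∀ k, k + 1 < n → a (n - 1) k = 0) {r k : ℕ} (hr : r < n) (hk : k < n) :
    a r k = if r = k then a 0 0 else 0 := by
  have key : ∀ t r k, r + t < n → k + t < n → a (r + t) (k + t) = a r k := by
    intro t
    induction t with
    | zero => simp
    | succ t ih =>
      intro r k hr hk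
      rw [← add_assoc, ← add_assoc, hs _ _ (by omega) (by omega), ih _ _ (by omega) (by omega)]
  split_ifs with h
  · subst h
    simpa using key r 0 0 (by omega) (by omega)
  · rcases Nat.lt_or_gt_of_ne h with h | h
    · have := key r 0 (k - r) (by omega) (by omega)
      rw [Nat.zero_add, Nat.sub_add_cancel h.le] at this
      rw [this, show k - r = k - r - 1 + 1 by omega, h0 _ (by omega)]
    · rw [← key (n - 1 - r) r k (by omega) (by omega), show r + (n - 1 - r) = n - 1 by omega,
        hl _ (by omega)]

namespace Pointed
variable {K R : Type} [Field K] [Ring R] [Algebra K R] {D : Pointed K R}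

theorem Pres.exists_sum_corner {κ ι M : Type} [Fintype κ] [Fintype ι] [AddCommGroup M]
    [Module R M] {i j : Fin 2} {m : κ → M} {F : Matrix ι κ R}
    (h : D.Pres (fun _ => j) (fun _ => i) m F) {w : M} (hw : D.e i • w = w) :
    ∃ s : κ → R, (∀ k, D.e i * s k = s k) ∧ (∀ k, s k * D.e j = s k) ∧ ∑ k, s k • m k = w := by
  obtain ⟨s, rfl⟩ := exists_sum_of_span h.span w
  refine ⟨fun k => D.e i * s k * D.e j, fun k => by rw [← mul_assoc, ← mul_assoc, D.idem],
    fun k => by rw [mul_assoc, D.idem], ?_⟩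
  rw [← hw, Finset.smul_sum]
  refine Finset.sum_congr rfl fun k _ => ?_
  rw [mul_smul, mul_smul, h.gen]

theorem Pres.exists_mul_eq {κ ι M : Type} [Fintype κ] [Fintype ι] [AddCommGroup M]
    [Module R M] {v : Fin 2} {u : ι → Fin 2} {m : κ → M} {F : Matrix ι κ R}
    (h : D.Pres (fun _ => v) u m F) {A : Matrix κ κ R} (hA : ∀ k l, A k l * D.e v = A k l)
    (hF : act F (act A m) = 0) : ∃ B : Matrix ι ι R, F * A = B * F := by
  have h1 : ∀ r, ∃ b : ι → R, ∀ k, (F * A) r k * D.e v = ∑ r', b r' * F r' k := fun r =>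
    h.exact _ (by
      have := congrFun hF r
      rwa [← act_mul] at this)
  choose B hB using h1
  refine ⟨Matrix.of B, ?_⟩
  ext r k
  rw [Matrix.mul_apply (M := Matrix.of B)]
  refine Eq.trans ?_ (hB r k)
  rw [Matrix.mul_apply, Finset.sum_mul]
  simp only [mul_assoc, hA]

/-- A pair of elements behaving like the arrows of the Kronecker quiver. -/
structure Kronecker (D : Pointed K R) (i j : Fin 2) (x y : R) : Prop where
  x_left : D.e i * x = x
  x_right : x * D.e j = x
  y_left : D.e i * y = y
  y_right : y * D.e j = y
  span : ∀ w, D.e i * w = w → w * D.e j = w →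
    ∃ (a b : K) (p q : R), w = a • x + b • y + p * x + q * y ∧ p * y = 0 ∧ q * x = 0
  dx : ∃ d : R →ₗ[K] K, (∀ b, d (b * x) = D.top b i) ∧ (∀ b, d (b * y) = 0) ∧
    (∀ a, d (x * a) = D.top a j) ∧ ∀ a, d (y * a) = 0
  dy : ∃ d : R →ₗ[K] K, (∀ b, d (b * x) = 0) ∧ (∀ b, d (b * y) = D.top b i) ∧
    (∀ a, d (x * a) = 0) ∧ ∀ a, d (y * a) = D.top a j

/-- The presentation matrices of the preinjective or preprojective Kronecker modules. -/
def kroneckerMatrix (x y : R) (n : ℕ) : Matrix (Fin (n + 1)) (Fin n) R :=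
  Matrix.of fun r k => (if (k : ℕ) = r then x else 0) + if (k : ℕ) + 1 = r then y else 0

section
variable {M : Type} [AddCommGroup M] [Module R M]

theorem act_kroneckerMatrix_zero (x y : R) {n : ℕ} (v : Fin n → M) (h : 0 < n + 1) :
    act (kroneckerMatrix x y n) v ⟨0, h⟩ = x • extendZero v 0 := by
  rw [act_apply, ← sum_ite_smul_extendZero]
  refine Finset.sum_congr rfl fun k _ => ?_
  rw [kroneckerMatrix, Matrix.of_apply, if_neg (Nat.succ_ne_zero _), add_zero]

theorem act_kroneckerMatrix_succ (x y : R) {n : ℕ} (v : Fin n → M) {r : ℕ} (h : r + 1 < n + 1) :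
    act (kroneckerMatrix x y n) v ⟨r + 1, h⟩ =
      x • extendZero v (r + 1) + y • extendZero v r := by
  rw [act_apply, ← sum_ite_smul_extendZero, ← sum_ite_smul_extendZero]
  simp [kroneckerMatrix, add_smul, Finset.sum_add_distrib]

namespace Kronecker
variable {i j : Fin 2} {x y : R} (H : D.Kronecker i j x y)
include H

theorem left (n : ℕ) (r k) : D.e i * kroneckerMatrix x y n r k = kroneckerMatrix x y n r k := by
  simp [kroneckerMatrix, mul_add, H.x_left, H.y_left]

theorem right (n : ℕ) (r k) : kroneckerMatrix x y n r k * D.e j = kroneckerMatrix x y n r k := by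
  simp [kroneckerMatrix, add_mul, H.x_right, H.y_right]

omit H in
theorem x_smul {n : ℕ} {m : Fin n → M} (h : act (kroneckerMatrix x y n) m = 0) :
    x • extendZero m 0 = 0 ∧ ∀ k, x • extendZero m (k + 1) = -(y • extendZero m k) := by
  refine ⟨by rw [← act_kroneckerMatrix_zero x y m (by omega), h, Pi.zero_apply], fun k => ?_⟩
  by_cases hk : k < n
  · rw [← add_eq_zero_iff_eq_neg, ← act_kroneckerMatrix_succ x y m (by omega), h, Pi.zero_apply]
  · rw [extendZero_of_le m (by omega), extendZero_of_le m (by omega), smul_zero, smul_zero,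
      neg_zero]

theorem exists_sum [Module K M] [IsScalarTower K R M] {n : ℕ} {m : Fin n → M}
    (hm : D.Pres (fun _ => j) (fun _ => i) m (kroneckerMatrix x y n)) {w : M}
    (hw : D.e i • w = w) :
    ∃ c : ℕ → K, w = ∑ k ∈ Finset.range n, c k • y • extendZero m k := by
  obtain ⟨hx0, hx⟩ := x_smul hm.rel
  have : w ∈ Submodule.span K (Set.range fun k : Fin n => y • m k) := by
    obtain ⟨s, hs, hs', rfl⟩ := hm.exists_sum_corner hw
    have hy : ∀ k, y • extendZero m k ∈ Submodule.span K (Set.range fun k : Fin n => y • m k) := by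
      intro k
      by_cases hk : k < n
      · rw [extendZero_of_lt m hk]
        exact Submodule.subset_span ⟨⟨k, hk⟩, rfl⟩
      · rw [extendZero_of_le m (by omega), smul_zero]
        exact zero_mem _
    refine Submodule.sum_mem _ fun k _ => ?_
    obtain ⟨a, b, p, q, h, hp, hq⟩ := H.span _ (hs k) (hs' k)
    have h1 : q • y • m k = 0 := by
      rw [← extendZero_val m k, ← neg_neg (y • _), ← hx, smul_neg, ← mul_smul, hq, zero_smul,
        neg_zero]
    have h2 : p • x • m k = 0 ∧
        x • m k ∈ Submodule.span K (Set.range fun k : Fin n => y • m k) := by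
      rw [← extendZero_val m k]
      rcases (k : ℕ) with _ | l
      · rw [hx0, smul_zero]
        exact ⟨rfl, zero_mem _⟩
      · rw [hx, smul_neg, ← mul_smul, hp, zero_smul, neg_zero]
        exact ⟨rfl, neg_mem (hy l)⟩
    rw [h, add_smul, add_smul, add_smul, mul_smul, mul_smul, h1, h2.1, add_zero, add_zero,
      smul_assoc, smul_assoc]
    refine add_mem (Submodule.smul_mem _ _ h2.2) (Submodule.smul_mem _ _ ?_)
    rw [← extendZero_val m k]
    exact hy _
  obtain ⟨c, rfl⟩ := (Submodule.mem_span_range_iff_exists_fun K).1 this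
  refine ⟨extendZero c, ?_⟩
  rw [Finset.sum_range]
  simp only [extendZero_val]

theorem crit [Module K M] [IsScalarTower K R M] {n n' : ℕ} (hn : n' ≤ n + 1) {m : Fin n' → M}
    (hm : D.Pres (fun _ => j) (fun _ => i) m (kroneckerMatrix x y n')) :
    D.Crit (fun _ => i) (kroneckerMatrix x y n) M := by
  have : SMulCommClass K R M := IsScalarTower.to_smulCommClass
  have : SMulCommClass R K M := SMulCommClass.symm _ _ _
  intro h hh
  obtain ⟨hx0, hx⟩ := x_smul hm.rel
  choose c hc using fun r => H.exists_sum hm (hh r)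
  obtain ⟨b, hb0, hbn, hb⟩ := exists_sub_diagonal (extendZero c) n
  let g : ℕ → M := fun r => ∑ k ∈ Finset.range n', b (r + 1) k • extendZero m k
  have hg : ∀ r ≤ n, extendZero (fun r : Fin n => g r) r = g r := by
    intro r hr
    rcases hr.lt_or_eq with hr | rfl
    · rw [extendZero_of_lt _ hr]
    · rw [extendZero_of_le _ le_rfl]
      refine (Finset.sum_eq_zero fun k hk => ?_).symm
      rw [hbn k (by rw [Finset.mem_range] at hk; omega), zero_smul]
  have hxg : ∀ r, x • g r = -∑ k ∈ Finset.range n', b (r + 1) (k + 1) • y • extendZero m k := by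
    intro r
    simp only [g, Finset.smul_sum, smul_comm x (_ : K)]
    cases n' with
    | zero => simp
    | succ l =>
      rw [Finset.sum_range_succ', hx0, smul_zero, add_zero, Finset.sum_range_succ,
        extendZero_of_lt m (Nat.lt_succ_self l)]
      have : y • m ⟨l, Nat.lt_succ_self l⟩ = 0 := by
        rw [← extendZero_of_lt m, ← neg_eq_zero, ← hx, extendZero_of_le m le_rfl, smul_zero]
      rw [this, smul_zero, add_zero, ← Finset.sum_neg_distrib]
      refine Finset.sum_congr rfl fun k _ => ?_
      rw [hx, smul_neg]
  have hcr : ∀ r : Fin (n + 1), h r = ∑ k ∈ Finset.range n',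
      (b r k - b (r + 1) (k + 1)) • y • extendZero m k := by
    intro r
    rw [hc r]
    refine Finset.sum_congr rfl fun k _ => ?_
    rw [hb r (by omega), extendZero_val]
  refine ⟨fun r => g r, funext fun ⟨r, hr⟩ => ?_⟩
  rw [hcr]
  cases r with
  | zero =>
    rw [act_kroneckerMatrix_zero, hg _ (by omega), hxg, ← Finset.sum_neg_distrib]
    simp [hb0]
  | succ r =>
    rw [act_kroneckerMatrix_succ, hg _ (by omega), hg _ (by omega), hxg]
    simp only [g, Finset.smul_sum, smul_comm y (_ : K), sub_smul, Finset.sum_sub_distrib]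
    abel

theorem isLocalRing (hij : i ≠ j) {n : ℕ} (hn : 1 ≤ n) {m : Fin n → M}
    (hm : D.Pres (fun _ => j) (fun _ => i) m (kroneckerMatrix x y n)) :
    IsLocalRing (Module.End R M) := by
  have : Nonempty (Fin n) := ⟨⟨0, hn⟩⟩
  refine hm.isLocalRing hij fun A _ hA hF => ?_
  obtain ⟨B, hB⟩ := hm.exists_mul_eq hA hF
  obtain ⟨d, d1, d2, d3, d4⟩ := H.dx
  obtain ⟨d', d1', d2', d3', d4'⟩ := H.dy
  let a : ℕ → ℕ → K := fun r k => D.top (extendZero (fun l => extendZero (A l) k) r) j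
  have ha : ∀ r k : Fin n, a r k = D.top (A r k) j := fun r k => by
    simp only [a, extendZero_val]
  have hak : ∀ (r : ℕ) (k : Fin n), D.top (extendZero (fun l => A l k) r) j = a r k := by
    intro r k
    simp only [a, extendZero_val]
  have hl : ∀ r k, (B * kroneckerMatrix x y n) r k = B r k.castSucc * x + B r k.succ * y := by
    intro r k
    have h1 : ∀ r' : Fin (n + 1), kroneckerMatrix x y n r' k =
        (if k.castSucc = r' then x else 0) + if k.succ = r' then y else 0 := fun r' => by
      simp [kroneckerMatrix, Fin.ext_iff]
    simp [Matrix.mul_apply, h1, mul_add, Finset.sum_add_distrib]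
  have h0 : ∀ k, x * extendZero (fun l => A l k) 0 = B 0 k.castSucc * x + B 0 k.succ * y :=
    fun k => by
      rw [← hl, ← hB]
      exact (act_kroneckerMatrix_zero x y (fun l => A l k) (by omega)).symm
  have h1 : ∀ (r : Fin n) k, x * extendZero (fun l => A l k) (r + 1) +
      y * extendZero (fun l => A l k) r = B r.succ k.castSucc * x + B r.succ k.succ * y :=
    fun r k => by
      rw [← hl, ← hB]
      exact (act_kroneckerMatrix_succ x y (fun l => A l k) (by omega)).symm
  have e0 : ∀ k : Fin n, a 0 k = D.top (B 0 k.castSucc) i := fun k => by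
    simpa [d1, d2, d3, hak] using congrArg d (h0 k)
  have e0' : ∀ k : Fin n, D.top (B 0 k.succ) i = 0 := fun k => by
    simpa [d1', d2', d3', hak] using (congrArg d' (h0 k)).symm
  have e1 : ∀ r k : Fin n, a (r + 1) k = D.top (B r.succ k.castSucc) i := fun r k => by
    simpa [d1, d2, d3, d4, hak] using congrArg d (h1 r k)
  have e1' : ∀ r k : Fin n, a r k = D.top (B r.succ k.succ) i := fun r k => by
    simpa [d1', d2', d3', d4', hak] using congrArg d' (h1 r k)
  have key : ∀ r k : Fin n, a r k = if (r : ℕ) = k then a 0 0 else 0 := fun r k => by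
    refine eq_scalar_of_diagonal (fun k hk => ?_) (fun r k hr hk => ?_) (fun k hk => ?_) r.2 k.2
    · exact (e0 ⟨k + 1, hk⟩).trans (e0' ⟨k, by omega⟩)
    · exact (e1 ⟨r, by omega⟩ ⟨k + 1, hk⟩).trans (e1' ⟨r, by omega⟩ ⟨k, by omega⟩).symm
    · refine (e1' ⟨n - 1, by omega⟩ ⟨k, by omega⟩).trans ?_
      refine (e1 ⟨n - 1, by omega⟩ ⟨k + 1, hk⟩).symm.trans ?_
      simp [a, extendZero_of_le _ (show n ≤ n - 1 + 1 by omega)]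
  have hM : (Matrix.of fun k l => D.top (A k l) j) = a 0 0 • (1 : Matrix (Fin n) (Fin n) K) := by
    ext r k
    rw [Matrix.of_apply, ← ha, key, Matrix.smul_apply, Matrix.one_apply]
    simp [Fin.ext_iff]
  refine ⟨a 0 0, fun hc => ?_, fun hc => ?_⟩
  · rw [hM]
    exact isUnit_one.smul (Units.mk0 _ hc)
  · rw [hM, show (1 : Matrix (Fin n) (Fin n) K) - a 0 0 • 1 = (1 - a 0 0) • 1 by
      rw [sub_smul, one_smul]]
    exact isUnit_one.smul (Units.mk0 _ (sub_ne_zero.2 hc.symm))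

end Kronecker
end
end Pointed

theorem Pointed.Kronecker.not_isTauTiltingFinite {K Λ : Type} [Field K] [Ring Λ] [Algebra K Λ]
    {D : Pointed K Λᵐᵒᵖ} {i j : Fin 2} (hij : i ≠ j) {x y : Λᵐᵒᵖ} (H : D.Kronecker i j x y) :
    ¬ IsTauTiltingFinite Λ := by
  have hp := fun n => D.pmod_pres (fun _ => j) (fun _ => i) (Pointed.kroneckerMatrix x y n)
    (H.left n) (H.right n)
  refine not_isTauTiltingFinite_of_family D hij (Pointed.kroneckerMatrix x y) H.left H.right
    (fun n hn => H.isLocalRing hij hn (hp n)) fun n n' _ h => H.crit (by omega) (hp n')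

/-- The solution of the recursion `T (r + 2) k = T r (k - 2) - h r (k - 2)`. -/
def twoStep {A : Type} [AddCommGroup A] (h : ℕ → ℕ → A) (p q : ℕ → A) : ℕ → ℕ → A
  | 0, k => p k
  | 1, k => q k
  | r + 2, k => twoStep h p q r (k - 2) - h r (k - 2)

theorem exists_sub_twoStep {A : Type} [AddCommGroup A] (h : ℕ → ℕ → A) (p q : ℕ → A)
    {n n' : ℕ} (hn : n' ≤ n ∨ n' = n + 1 ∧ Even n) :
    ∃ a : ℕ → ℕ → A, (∀ r k, n ≤ r → k < n' → a r k = 0) ∧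
      (∀ r k, r < n → a r k - a (r + 2) (k + 2) = h r k) ∧
      (a 0 0 - a 1 1 = p 0) ∧ (∀ k, a 0 (k + 1) = p (k + 1)) ∧ ∀ k, a 1 (k + 2) = - q k := by
  let h' : ℕ → ℕ → A := fun r k => if r < n then h r k else 0
  let b : ℕ → ℕ → A := fun r k => ∑ l ∈ Finset.range n, h' (r + 2 * l) (k + 2 * l)
  let t : ℕ → ℕ → A := twoStep h p fun k => if k = 1 then b 0 0 - p 0 else -q (k - 2)
  refine ⟨fun r k => if r < k ∨ r = k ∧ Odd r then t r k else b r k, fun r k hr hk => ?_,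
    fun r k hr => ?_, ?_, fun k => ?_, fun k => ?_⟩
  · beta_reduce
    rw [if_neg]
    · exact Finset.sum_eq_zero fun l _ => if_neg (by omega)
    · rintro (h1 | ⟨rfl, h1⟩)
      · omega
      · rcases hn with hn | ⟨rfl, hn⟩
        · omega
        · rw [show r = n by omega] at h1
          exact Nat.not_odd_iff_even.2 hn h1
  · beta_reduce
    by_cases hc : r < k ∨ r = k ∧ Odd r
    · rw [if_pos hc, if_pos (by
        rcases hc with hc | hc
        · exact Or.inl (by omega)
        · exact Or.inr ⟨by omega, by simpa [parity_simps] using hc.2⟩)]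
      simp [t, twoStep]
    · rw [if_neg hc, if_neg (by
        rintro (h1 | ⟨h1, h2⟩)
        · exact hc (Or.inl (by omega))
        · exact hc (Or.inr ⟨by omega, by simpa [parity_simps] using h2⟩))]
      have h1 : ∀ l, h' (r + 2 + 2 * l) (k + 2 + 2 * l) =
          h' (r + 2 * (l + 1)) (k + 2 * (l + 1)) := fun l => by congr 1 <;> ring
      simp only [b, h1]
      rw [← Finset.sum_sub_distrib, Finset.sum_range_sub' fun l => h' (r + 2 * l) (k + 2 * l)]
      simp only [h']
      rw [if_neg (show ¬ r + 2 * n < n by omega), sub_zero, if_pos (by omega)]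
      simp
  · simp [t, twoStep]
  · simp [t, twoStep]
  · simp [t, twoStep]

namespace Pointed
variable {K R : Type} [Field K] [Ring R] [Algebra K R] {D : Pointed K R}

/-- An arrow between two vertices with loops of square zero. -/
structure Looped (D : Pointed K R) (i j : Fin 2) (α β μ : R) : Prop where
  α_sq : α * α = 0
  α_right : α * D.e j = α
  β_left : D.e i * β = β
  β_sq : β * β = 0
  μ_left : D.e i * μ = μ
  μ_right : μ * D.e j = μ
  span : ∀ w, D.e i * w = w → w * D.e j = w → ∃ (a b d : K) (p q : R),
    w = a • μ + b • (μ * α) + d • (β * μ * α) + p * (β * μ) + q * (β * μ * α) ∧ q * μ = 0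
  d_one : ∃ d : R →ₗ[K] K, (∀ a, d (μ * a) = D.top a j) ∧ (∀ a, d (μ * α * a) = 0) ∧
    (∀ a, d (β * μ * α * a) = 0) ∧ (∀ b, d (b * μ) = D.top b i) ∧ (∀ b, d (b * (μ * α)) = 0) ∧
    ∀ b, d (b * (β * μ * α)) = 0
  d_left : ∃ d : R →ₗ[K] K, (∀ a, d (μ * α * a) = D.top a j) ∧
    (∀ a, d (β * μ * α * a) = 0) ∧ (∀ b, d (b * μ) = 0) ∧ (∀ b, d (b * (μ * α)) = D.top b i) ∧
    ∀ b, d (b * (β * μ * α)) = 0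
  d_both : ∃ d : R →ₗ[K] K, (∀ a, d (μ * a) = 0) ∧ (∀ a, d (μ * α * a) = 0) ∧
    (∀ a, d (β * μ * α * a) = D.top a j) ∧ (∀ b, d (b * μ) = 0) ∧
    ∀ b, d (b * (β * μ * α)) = D.top b i

/-- The presentation matrices of a family of string modules for an arrow between two vertices
with loops of square zero. -/
def loopedMatrix (α β μ : R) (n : ℕ) : Matrix (Fin (n + 1)) (Fin n) R :=
  Matrix.of fun r k => if (r : ℕ) < n
    then (if (k : ℕ) = r then μ else 0) + if (k : ℕ) = r + 2 then β * μ * α else 0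
    else (if (k : ℕ) = 0 then μ * α else 0) + if (k : ℕ) = 1 then β * μ * α else 0

section
variable {M : Type} [AddCommGroup M] [Module R M]

theorem act_loopedMatrix (α β μ : R) {n : ℕ} (v : Fin n → M) {r : ℕ} (h : r < n) :
    act (loopedMatrix α β μ n) v ⟨r, h.trans n.lt_succ_self⟩ =
      μ • extendZero v r + (β * μ * α) • extendZero v (r + 2) := by
  rw [act_apply, ← sum_ite_smul_extendZero, ← sum_ite_smul_extendZero]
  simp [loopedMatrix, h, add_smul, Finset.sum_add_distrib]

theorem act_loopedMatrix_last (α β μ : R) {n : ℕ} (v : Fin n → M) :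
    act (loopedMatrix α β μ n) v (Fin.last n) =
      (μ * α) • extendZero v 0 + (β * μ * α) • extendZero v 1 := by
  rw [act_apply, ← sum_ite_smul_extendZero, ← sum_ite_smul_extendZero]
  simp [loopedMatrix, add_smul, Finset.sum_add_distrib]

namespace Looped
variable {i j : Fin 2} {α β μ : R} (H : D.Looped i j α β μ)
include H

theorem left (n : ℕ) (r k) : D.e i * loopedMatrix α β μ n r k = loopedMatrix α β μ n r k := by
  rw [loopedMatrix, Matrix.of_apply]
  split_ifs <;> simp [mul_add, ← mul_assoc, H.β_left, H.μ_left]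

theorem right (n : ℕ) (r k) : loopedMatrix α β μ n r k * D.e j = loopedMatrix α β μ n r k := by
  rw [loopedMatrix, Matrix.of_apply]
  split_ifs <;> simp [add_mul, mul_assoc, H.α_right, H.μ_right]

/-- The relations among the generators `μ • g k` and `(μ * α) • g k`. -/
theorem β_smul {n : ℕ} {m : Fin n → M} (h : act (loopedMatrix α β μ n) m = 0) :
    (∀ k, β • μ • extendZero m k = 0) ∧ β • (μ * α) • extendZero m 0 = 0 ∧
      β • (μ * α) • extendZero m 1 = -((μ * α) • extendZero m 0) ∧
      ∀ k, β • (μ * α) • extendZero m (k + 2) = -(μ • extendZero m k) := by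
  have h1 : β • (μ * α) • extendZero m 1 = -((μ * α) • extendZero m 0) := by
    rw [← add_eq_zero_iff_eq_neg', ← mul_smul β, ← mul_assoc, ← act_loopedMatrix_last, h,
      Pi.zero_apply]
  have h2 : ∀ k, β • (μ * α) • extendZero m (k + 2) = -(μ • extendZero m k) := by
    intro k
    by_cases hk : k < n
    · rw [← add_eq_zero_iff_eq_neg', ← mul_smul β, ← mul_assoc, ← act_loopedMatrix _ _ _ _ hk, h,
        Pi.zero_apply]
    · rw [extendZero_of_le m (by omega), extendZero_of_le m (by omega)]
      simp
  refine ⟨fun k => ?_, ?_, h1, h2⟩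
  · rw [← neg_neg (μ • _), ← h2, smul_neg, ← mul_smul, H.β_sq, zero_smul, neg_zero]
  · rw [← neg_neg ((μ * α) • _), ← h1, smul_neg, ← mul_smul, H.β_sq, zero_smul, neg_zero]

theorem exists_sum [Module K M] [IsScalarTower K R M] {n : ℕ} {m : Fin n → M}
    (hm : D.Pres (fun _ => j) (fun _ => i) m (loopedMatrix α β μ n)) {w : M}
    (hw : D.e i • w = w) :
    ∃ c c' : ℕ → K, w = ∑ k ∈ Finset.range n, c k • (μ * α) • extendZero m k +
      ∑ k ∈ Finset.range n, c' k • μ • extendZero m k := by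
  obtain ⟨hw0, hu0, hu1, hu2⟩ := H.β_smul hm.rel
  let S := Submodule.span K
    (Set.range (Sum.elim (fun k : Fin n => (μ * α) • m k) fun k => μ • m k))
  have hu : ∀ k, (μ * α) • extendZero m k ∈ S := by
    intro k
    by_cases hk : k < n
    · rw [extendZero_of_lt m hk]
      exact Submodule.subset_span ⟨Sum.inl ⟨k, hk⟩, rfl⟩
    · rw [extendZero_of_le m (by omega), smul_zero]
      exact zero_mem _
  have hμ : ∀ k, μ • extendZero m k ∈ S := by
    intro k
    by_cases hk : k < n
    · rw [extendZero_of_lt m hk]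
      exact Submodule.subset_span ⟨Sum.inr ⟨k, hk⟩, rfl⟩
    · rw [extendZero_of_le m (by omega), smul_zero]
      exact zero_mem _
  have : w ∈ S := by
    obtain ⟨s, hs, hs', rfl⟩ := hm.exists_sum_corner hw
    refine Submodule.sum_mem _ fun k _ => ?_
    obtain ⟨a, b, d, p, q, h, hq⟩ := H.span _ (hs k) (hs' k)
    have h1 : (β * μ * α) • m k ∈ S ∧ q • (β * μ * α) • m k = 0 := by
      rw [← extendZero_val m k, mul_assoc, mul_smul]
      rcases (k : ℕ) with _ | _ | l
      · rw [hu0, smul_zero]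
        exact ⟨zero_mem _, rfl⟩
      · rw [hu1, smul_neg, ← mul_smul, ← mul_assoc, hq, zero_mul, zero_smul, neg_zero]
        exact ⟨neg_mem (hu _), rfl⟩
      · rw [hu2, smul_neg, ← mul_smul, hq, zero_smul, neg_zero]
        exact ⟨neg_mem (hμ _), rfl⟩
    have h2 : (β * μ) • m k = 0 := by
      rw [← extendZero_val m k, mul_smul, hw0]
    rw [h, add_smul, add_smul, add_smul, add_smul, mul_smul p, mul_smul q, h1.2, h2, smul_zero,
      add_zero, add_zero, smul_assoc, smul_assoc, smul_assoc]
    refine add_mem (add_mem (Submodule.smul_mem _ _ ?_) (Submodule.smul_mem _ _ ?_))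
      (Submodule.smul_mem _ _ h1.1)
    · rw [← extendZero_val m k]
      exact hμ _
    · rw [← extendZero_val m k]
      exact hu _
  obtain ⟨c, rfl⟩ := (Submodule.mem_span_range_iff_exists_fun K).1 this
  refine ⟨extendZero fun k => c (Sum.inl k), extendZero fun k => c (Sum.inr k), ?_⟩
  rw [Finset.sum_range, Finset.sum_range, Fintype.sum_sum_type]
  simp only [extendZero_val, Sum.elim_inl, Sum.elim_inr]

theorem sum_β_smul [Module K M] [IsScalarTower K R M] {n : ℕ} {m : Fin n → M}
    (hm : act (loopedMatrix α β μ n) m = 0) (a : ℕ → K) :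
    ∑ k ∈ Finset.range n, a k • β • (μ * α) • extendZero m k =
      -(a 1 • (μ * α) • extendZero m 0 + ∑ k ∈ Finset.range n, a (k + 2) • μ • extendZero m k) := by
  obtain ⟨hw0, hu0, hu1, hu2⟩ := H.β_smul hm
  have h1 : ∀ k, n ≤ k → a k • β • (μ * α) • extendZero m k = 0 := fun k hk => by
    rw [extendZero_of_le m hk]
    simp
  calc _ = ∑ k ∈ Finset.range (n + 2), a k • β • (μ * α) • extendZero m k := by
        rw [Finset.sum_range_succ, Finset.sum_range_succ, h1 _ le_rfl, h1 _ (by omega), add_zero,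
          add_zero]
    _ = _ := by
        rw [Finset.sum_range_succ', Finset.sum_range_succ', hu0, hu1]
        simp only [hu2, smul_neg, Finset.sum_neg_distrib]
        simp only [smul_zero]
        abel

theorem crit [Module K M] [IsScalarTower K R M] {n n' : ℕ} (h2 : 2 ≤ n)
    (hn : n' ≤ n ∨ n' = n + 1 ∧ Even n) {m : Fin n' → M}
    (hm : D.Pres (fun _ => j) (fun _ => i) m (loopedMatrix α β μ n')) :
    D.Crit (fun _ => i) (loopedMatrix α β μ n) M := by
  have : SMulCommClass K R M := IsScalarTower.to_smulCommClass
  have : SMulCommClass R K M := SMulCommClass.symm _ _ _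
  intro h hh
  have hsum := H.sum_β_smul hm.rel
  choose c c' hc using fun r => H.exists_sum hm (hh r)
  obtain ⟨a, ha, hw, h00, h0, h1⟩ := exists_sub_twoStep (extendZero c') (c (Fin.last n))
    (c' (Fin.last n)) hn
  let v : Fin n → M := fun r => ∑ k ∈ Finset.range n', a r k • extendZero m k +
    (∑ k ∈ Finset.range n', c r.castSucc k • α • extendZero m k + a (r + 2) 1 • α • extendZero m 0)
  have hu : ∀ s (hs : s < n), (μ * α) • v ⟨s, hs⟩ =
      ∑ k ∈ Finset.range n', a s k • (μ * α) • extendZero m k := by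
    intro s hs
    simp only [v, smul_add, Finset.smul_sum, smul_comm (μ * α) (_ : K), ← mul_smul (μ * α) α,
      mul_assoc μ α α, H.α_sq, mul_zero, zero_smul, smul_zero, Finset.sum_const_zero, add_zero]
  have hβ : ∀ s, (β * μ * α) • extendZero v s =
      -(a s 1 • (μ * α) • extendZero m 0 +
        ∑ k ∈ Finset.range n', a s (k + 2) • μ • extendZero m k) := by
    intro s
    rw [← hsum, mul_assoc, mul_smul]
    by_cases hs : s < n
    · rw [extendZero_of_lt v hs, hu, Finset.smul_sum]
      simp only [smul_comm β (_ : K)]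
    · rw [extendZero_of_le v (by omega), smul_zero, smul_zero]
      refine (Finset.sum_eq_zero fun k hk => ?_).symm
      rw [ha s k (by omega) (Finset.mem_range.1 hk), zero_smul]
  refine ⟨v, funext fun r => ?_⟩
  rw [hc r]
  refine r.lastCases ?_ fun r => ?_
  · have h3 : ∑ k ∈ Finset.range n', a 0 k • (μ * α) • extendZero m k =
        ∑ k ∈ Finset.range n', c (Fin.last n) k • (μ * α) • extendZero m k +
          a 1 1 • (μ * α) • extendZero m 0 := by
      cases n' with
      | zero => simp [extendZero_of_le m (Nat.zero_le 0)]
      | succ l =>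
        rw [Finset.sum_range_succ', Finset.sum_range_succ', sub_eq_iff_eq_add.1 h00, add_smul]
        simp only [h0]
        abel
    rw [act_loopedMatrix_last, hβ, extendZero_of_lt v (show 0 < n by omega), hu, h3]
    simp only [h1, neg_smul, Finset.sum_neg_distrib]
    abel
  · have h3 : ∀ k, a r k = c' r.castSucc k + a (r + 2) (k + 2) := fun k => by
      rw [← sub_eq_iff_eq_add, hw _ _ r.2, extendZero_of_lt c' (by omega)]
      rfl
    refine (act_loopedMatrix α β μ v r.2).trans ?_
    rw [hβ, extendZero_val]
    simp only [v, smul_add, Finset.smul_sum, smul_comm μ (_ : K), ← mul_smul μ α, h3, add_smul,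
      Finset.sum_add_distrib]
    abel

theorem isLocalRing (hij : i ≠ j) {n : ℕ} (hn : 1 ≤ n) {m : Fin n → M}
    (hm : D.Pres (fun _ => j) (fun _ => i) m (loopedMatrix α β μ n)) :
    IsLocalRing (Module.End R M) := by
  have : Nonempty (Fin n) := ⟨⟨0, hn⟩⟩
  refine hm.isLocalRing hij fun A _ hA hF => ?_
  obtain ⟨B, hB⟩ := hm.exists_mul_eq hA hF
  obtain ⟨d, d1, d2, d3, d4, d5, d6⟩ := H.d_one
  obtain ⟨dl, dl2, dl3, dl4, dl5, dl6⟩ := H.d_left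
  obtain ⟨db, db1, db2, db3, db4, db6⟩ := H.d_both
  let a : ℕ → ℕ → K := fun r k => D.top (extendZero (fun l => extendZero (A l) k) r) j
  have ha : ∀ r k : Fin n, a r k = D.top (A r k) j := fun r k => by
    simp only [a, extendZero_val]
  have hak : ∀ (r : ℕ) (k : Fin n), D.top (extendZero (fun l => A l k) r) j = a r k := by
    intro r k
    simp only [a, extendZero_val]
  have hl : ∀ r k, (B * loopedMatrix α β μ n) r k = B r k.castSucc * μ +
      (∑ r' : Fin n, if (k : ℕ) = r' + 2 then B r r'.castSucc * (β * μ * α) else 0) +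
      ((if (k : ℕ) = 0 then B r (Fin.last n) * (μ * α) else 0) +
        if (k : ℕ) = 1 then B r (Fin.last n) * (β * μ * α) else 0) := by
    intro r k
    rw [Matrix.mul_apply, Fin.sum_univ_castSucc]
    simp [loopedMatrix, mul_add, Finset.sum_add_distrib, Fin.val_inj]
  have h0 : ∀ k, (μ * α) * extendZero (fun l => A l k) 0 +
      (β * μ * α) * extendZero (fun l => A l k) 1 = (B * loopedMatrix α β μ n) (Fin.last n) k :=
    fun k => by
      rw [← hB]
      exact (act_loopedMatrix_last α β μ (fun l => A l k)).symm
  have h1 : ∀ (r : Fin n) k, μ * extendZero (fun l => A l k) r +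
      (β * μ * α) * extendZero (fun l => A l k) (r + 2) =
        (B * loopedMatrix α β μ n) r.castSucc k :=
    fun r k => by
      rw [← hB]
      exact (act_loopedMatrix α β μ (fun l => A l k) r.2).symm
  simp only [hl] at h0 h1
  have e1 : ∀ r k : Fin n, a r k = D.top (B r.castSucc k.castSucc) i := fun r k => by
    simpa [d1, d3, d4, d5, d6, hak, apply_ite d] using congrArg d (h1 r k)
  have e1' : ∀ k : Fin n, D.top (B (Fin.last n) k.castSucc) i = 0 := fun k => by
    simpa [d2, d3, d4, d5, d6, hak, apply_ite d] using (congrArg d (h0 k)).symm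
  have el : ∀ k : Fin n, a 0 k = if (k : ℕ) = 0 then D.top (B (Fin.last n) (Fin.last n)) i else 0 :=
    fun k => by
      simpa [dl2, dl3, dl4, dl5, dl6, hak, apply_ite dl] using congrArg dl (h0 k)
  have eb : ∀ k (hk : k + 1 < n), a 1 (k + 1) =
      if k = 0 then D.top (B (Fin.last n) (Fin.last n)) i else 0 := fun k hk => by
    have := congrArg db (h0 ⟨k + 1, hk⟩)
    simp only [map_add, map_sum, apply_ite db, db2, db3, db4, db6, hak, map_zero] at this
    rw [Finset.sum_eq_zero] at this
    · simpa using this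
    · intro r _
      rw [e1', ite_self]
  have eb' : ∀ r k, r < n → k + 2 < n → a (r + 2) (k + 2) = a r k := fun r k hr hk => by
    have := congrArg db (h1 ⟨r, hr⟩ ⟨k + 2, hk⟩)
    simp only [map_add, map_sum, apply_ite db, db1, db3, db4, db6, hak, map_zero] at this
    rw [Finset.sum_eq_single ⟨k, by omega⟩ (by
      intro l _ hl
      rw [if_neg]
      simpa [Fin.ext_iff, eq_comm] using hl) (by simp)] at this
    refine Eq.trans ?_ (e1 ⟨r, hr⟩ ⟨k, by omega⟩).symm
    simpa using this
  set c := D.top (B (Fin.last n) (Fin.last n)) i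
  have key : ∀ r k, r ≤ k → k < n → a r k = if r = k then c else 0 := by
    intro r
    induction r using Nat.twoStepInduction with
    | zero => exact fun k _ hk => by simpa [eq_comm] using el ⟨k, hk⟩
    | one =>
      intro k hk hkn
      obtain ⟨l, rfl⟩ := Nat.exists_eq_add_of_le' hk
      simpa [eq_comm] using eb l hkn
    | more r ih _ =>
      intro k hk hkn
      obtain ⟨l, rfl⟩ := Nat.exists_eq_add_of_le' (show 2 ≤ k by omega)
      rw [eb' _ _ (by omega) hkn, ih _ (by omega) (by omega)]
      simp
  have unit : ∀ (X : Matrix (Fin n) (Fin n) K) (c : K), c ≠ 0 →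
      (∀ r k, r ≤ k → X r k = if r = k then c else 0) → IsUnit X := by
    intro X c hc hX
    rw [Matrix.isUnit_iff_isUnit_det, Matrix.det_of_isLowerTriangular X fun r k h =>
      (hX r k (le_of_lt h)).trans
        (if_neg (fun h1 => (ne_of_lt h) (congrArg OrderDual.toDual h1.symm)))]
    simp [hX, hc]
  refine ⟨c, fun hc => unit _ c hc fun r k h => ?_, fun hc =>
    unit _ (1 - c) (sub_ne_zero.2 hc.symm) fun r k h => ?_⟩
  · rw [Matrix.of_apply, ← ha, key _ _ h k.2]
    simp [Fin.ext_iff]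
  · rw [Matrix.sub_apply, Matrix.of_apply, ← ha, key _ _ h k.2, Matrix.one_apply]
    by_cases hr : r = k <;> simp [hr, Fin.val_inj]
end Looped
end
end Pointed

theorem Pointed.Looped.not_isTauTiltingFinite {K Λ : Type} [Field K] [Ring Λ] [Algebra K Λ]
    {D : Pointed K Λᵐᵒᵖ} {i j : Fin 2} (hij : i ≠ j) {α β μ : Λᵐᵒᵖ} (H : D.Looped i j α β μ) :
    ¬ IsTauTiltingFinite Λ := by
  have hp := fun n => D.pmod_pres (fun _ => j) (fun _ => i) (Pointed.loopedMatrix α β μ n)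
    (H.left n) (H.right n)
  refine not_isTauTiltingFinite_of_family D hij (Pointed.loopedMatrix α β μ) H.left H.right
    (fun n hn => H.isLocalRing hij hn (hp n)) fun n n' h h' => H.crit h h' (hp n')

namespace Quiv
variable {K Λ σ : Type} [Field K] [Ring Λ] [Algebra K Λ] {s t : σ → Fin 2}

/-- The word of given length following a successor function on the arrows. -/
def word (Q : Quiv K Λ s t) (next : σ → σ) : σ → ℕ → Λ
  | _, 0 => 1
  | k, n + 1 => Q.a k * word Q next (next k) n

theorem word_add_one (Q : Quiv K Λ s t) (next : σ → σ) (k : σ) (n : ℕ) :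
    Q.word next k (n + 1) = Q.a k * Q.word next (next k) n := rfl

theorem word_add_one' (Q : Quiv K Λ s t) (next : σ → σ) (k : σ) (n : ℕ) :
    Q.word next k (n + 1) = Q.word next k n * Q.a (next^[n] k) := by
  induction n generalizing k with
  | zero => exact (mul_one _).trans (one_mul _).symm
  | succ n ih => rw [word_add_one, ih, ← mul_assoc, ← word_add_one, Function.iterate_succ_apply]

/-- Every arrow can be continued in only one way, the words obtained in this way are periodic,
and the words of one period are nilpotent. -/
structure Cyclic (Q : Quiv K Λ s t) where
  next : σ → σ
  p : ℕ
  pos : 0 < p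
  per : ∀ k, next^[p] k = k
  comp : ∀ k, t k = s (next k)
  zero : ∀ k l, l ≠ next k → Q.a k * Q.a l = 0
  N : ℕ
  nil : ∀ k, Q.word next k p ^ N = 0

namespace Cyclic
variable {Q : Quiv K Λ s t} (C : Q.Cyclic)

theorem word_mul_a {n : ℕ} (hn : 0 < n) {k l : σ} (h : l ≠ C.next^[n] k) :
    Q.word C.next k n * Q.a l = 0 := by
  obtain ⟨n, rfl⟩ := Nat.exists_eq_succ_of_ne_zero hn.ne'
  rw [Function.iterate_succ_apply'] at h
  rw [Nat.succ_eq_add_one, word_add_one', mul_assoc, C.zero _ _ h, mul_zero]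

theorem a_mul_word {n : ℕ} (hn : 0 < n) {k l : σ} (h : k ≠ C.next l) :
    Q.a l * Q.word C.next k n = 0 := by
  obtain ⟨n, rfl⟩ := Nat.exists_eq_succ_of_ne_zero hn.ne'
  rw [Nat.succ_eq_add_one, word_add_one, ← mul_assoc, C.zero _ _ h, zero_mul]

theorem word_mul_word {k l : σ} (h : k ≠ l) :
    Q.word C.next k C.p * Q.word C.next l C.p = 0 := by
  obtain ⟨n, hn⟩ := Nat.exists_eq_succ_of_ne_zero C.pos.ne'
  conv_lhs => rw [hn, Nat.succ_eq_add_one, word_add_one _ _ l, ← Nat.succ_eq_add_one, ← hn]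
  rw [← mul_assoc, C.word_mul_a C.pos, zero_mul]
  rw [C.per]
  exact h.symm

theorem e_mul_word (i : Fin 2) (k : σ) :
    Q.e i * Q.word C.next k C.p = if s k = i then Q.word C.next k C.p else 0 := by
  obtain ⟨n, hn⟩ := Nat.exists_eq_succ_of_ne_zero C.pos.ne'
  rw [hn, Nat.succ_eq_add_one, word_add_one, ← mul_assoc]
  split_ifs with h
  · rw [Q.e_mul_a h.symm]
  · rw [Q.e_mul_a_zero (Ne.symm h), zero_mul]

theorem word_mul_e (i : Fin 2) (k : σ) :
    Q.word C.next k C.p * Q.e i = if s k = i then Q.word C.next k C.p else 0 := by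
  obtain ⟨n, hn⟩ := Nat.exists_eq_succ_of_ne_zero C.pos.ne'
  have hk : t (C.next^[n] k) = s k := by
    rw [C.comp, ← Function.iterate_succ_apply' C.next, ← hn, C.per]
  rw [hn, Nat.succ_eq_add_one, word_add_one', mul_assoc, ← hk]
  split_ifs with h
  · rw [Q.a_mul_e h]
  · rw [Q.a_mul_e_zero h, mul_zero]

variable [Fintype σ]

theorem a_mul_sum (l : σ) :
    Q.a l * ∑ k, Q.word C.next k C.p = Q.word C.next l (C.p + 1) := by
  rw [Finset.mul_sum, Finset.sum_eq_single (C.next l)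
    (fun k _ h => C.a_mul_word C.pos h) fun h => absurd (Finset.mem_univ _) h, word_add_one]

theorem sum_mul_a (l : σ) :
    (∑ k, Q.word C.next k C.p) * Q.a l = Q.word C.next l (C.p + 1) := by
  rw [Finset.sum_mul, Finset.sum_eq_single l
    (fun k _ h => C.word_mul_a C.pos (by rw [C.per]; exact h.symm))
    fun h => absurd (Finset.mem_univ _) h, word_add_one', C.per]

theorem sum_mem_center : ∑ k, Q.word C.next k C.p ∈ Subring.center Λ :=
  Q.mem_center (fun i => by simp only [Finset.mul_sum, Finset.sum_mul, C.e_mul_word, C.word_mul_e])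
    fun l => (C.a_mul_sum l).trans (C.sum_mul_a l).symm

/-- The sum of the words of one period, as a central element. -/
def z : Subring.center Λ := ⟨_, C.sum_mem_center⟩

theorem sum_pow (n : ℕ) :
    (∑ k, Q.word C.next k C.p) ^ (n + 1) = ∑ k, Q.word C.next k C.p ^ (n + 1) := by
  induction n with
  | zero => simp
  | succ n ih =>
    rw [pow_succ, ih, Finset.sum_mul_sum]
    refine Finset.sum_congr rfl fun k _ => ?_
    rw [Finset.sum_eq_single k (fun l _ h => ?_) fun h => absurd (Finset.mem_univ _) h, ← pow_succ]
    rw [pow_succ, mul_assoc, C.word_mul_word h.symm, mul_zero]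

theorem isNilpotent_z : IsNilpotent C.z :=
  isNilpotent_mk C.sum_mem_center (N := C.N + 1) (by
    rw [C.sum_pow]
    exact Finset.sum_eq_zero fun k _ => by rw [pow_succ, C.nil, zero_mul])

/-- The words of each length. -/
def levels : Q.Levels C.z (C.p + 1) where
  S k := Set.range fun l => Q.word C.next l k
  pos := Nat.succ_pos _
  one l := mem_modSpan_of_mem ⟨l, mul_one _⟩
  step k h0 _ x hx l := by
    obtain ⟨m, rfl⟩ := hx
    by_cases h : l = C.next^[k] m
    · exact mem_modSpan_of_mem ⟨m, by rw [h]; exact Q.word_add_one' C.next m k⟩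
    · rw [C.word_mul_a h0 h]
      exact Submodule.zero_mem _
  last x hx := by
    obtain ⟨l, rfl⟩ := hx
    exact ⟨Q.a l, (C.sum_mul_a l).symm⟩

variable (r : Q.Rep (fun _ : σ => (0 : K)))

/-- The arrow data given by the words. -/
def arrowed : Arrowed K Λ := Q.arrowed r C.z C.isNilpotent_z (C.p + 1) C.levels.pow

include C r in
/-- A subspace contains all products `u * (x * v)` if it does so for generators `x`. -/
theorem mul_mul_mem {V : Submodule K Λ} {u v : Λ} (he : ∀ i, u * (Q.e i * v) ∈ V)
    (ha : ∀ k x, u * (Q.a k * (x * v)) ∈ V) (x : Λ) : u * (x * v) ∈ V := by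
  let W := V.comap ((LinearMap.mulLeft K u).comp (LinearMap.mulRight K v))
  suffices h : (C.arrowed r).diag ⊔ (C.arrowed r).T * ⊤ ≤ W from
    h ((C.arrowed r).top_le (Submodule.mem_top (x := x)))
  refine sup_le (Submodule.span_le.2 ?_) (Submodule.mul_le.2 fun y hy w _ => ?_)
  · rintro _ ⟨i, rfl⟩
    exact he i
  · induction hy using Submodule.span_induction with
    | mem y hy =>
      obtain ⟨k, rfl⟩ := hy
      rw [Submodule.mem_comap]
      change u * (Q.a k * w * v) ∈ V
      rw [mul_assoc]
      exact ha k w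
    | zero => rw [zero_mul]; exact Submodule.zero_mem _
    | add a b _ _ ha hb => rw [add_mul]; exact Submodule.add_mem _ ha hb
    | smul c a _ ha => rw [smul_mul_assoc]; exact Submodule.smul_mem _ _ ha

end Cyclic

namespace Tri
variable {Q : Quiv K Λ s t} {i j : Fin 2} {c : σ → K} (T : Q.Tri i j c)
  (r : Q.Rep (fun _ : σ => (0 : K)))

theorem φ_eq_top (hc : ∀ k, s k = t k → c k = 0) (x : Λ) : T.φ x = r.top x j := by
  have : T.φ = (Pi.evalAlgHom K (fun _ : Fin 2 => K) j).comp r.top := by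
    refine Q.hom_ext (fun k => ?_) fun k => ?_
    · rw [AlgHom.comp_apply, r.top_e, T.φ_e]
      by_cases h : k = j
      · simp [h]
      · simp [h, Ne.symm h]
    · rw [AlgHom.comp_apply, r.top_a, T.φ_a, map_zero]
      exact ite_eq_right_iff.2 fun h => hc k (h.1.trans h.2.symm)
  exact DFunLike.congr_fun this x

theorem ψ_eq_top (hc : ∀ k, s k = t k → c k = 0) (x : Λ) : T.ψ x = r.top x i := by
  have : T.ψ = (Pi.evalAlgHom K (fun _ : Fin 2 => K) i).comp r.top := by
    refine Q.hom_ext (fun k => ?_) fun k => ?_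
    · rw [AlgHom.comp_apply, r.top_e, T.ψ_e]
      by_cases h : k = i
      · simp [h]
      · simp [h, Ne.symm h]
    · rw [AlgHom.comp_apply, r.top_a, T.ψ_a, map_zero]
      exact ite_eq_right_iff.2 fun h => hc k (h.1.trans h.2.symm)
  exact DFunLike.congr_fun this x

/-- The derivation as a functional on the opposite algebra. -/
def opD : Λᵐᵒᵖ →ₗ[K] K := T.d.comp (MulOpposite.opLinearEquiv K).symm.toLinearMap

end Tri

section Kronecker
variable {Q : Quiv K Λ QH.s QH.t} (C : Q.Cyclic) (r : Q.Rep (fun _ => (0 : K)))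
  (h03 : Q.a 0 * Q.a 3 = 0) (h12 : Q.a 1 * Q.a 2 = 0)
include C r h03 h12

theorem Cyclic.span_kronecker (x : Λ) : ∃ (a b : K) (p q : Λ),
    Q.e 0 * (x * Q.e 1) = a • Q.a 0 + b • Q.a 1 + Q.a 0 * p + Q.a 1 * q ∧
      Q.a 1 * p = 0 ∧ Q.a 0 * q = 0 := by
  let V : Submodule K Λ := Submodule.span K {Q.a 0, Q.a 1} ⊔
    ((LinearMap.ker (LinearMap.mulLeft K (Q.a 1))).map (LinearMap.mulLeft K (Q.a 0)) ⊔
    (LinearMap.ker (LinearMap.mulLeft K (Q.a 0))).map (LinearMap.mulLeft K (Q.a 1)))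
  have hV0 : Q.a 0 ∈ V := Submodule.mem_sup_left (Submodule.subset_span (by simp))
  have hV1 : Q.a 1 ∈ V := Submodule.mem_sup_left (Submodule.subset_span (by simp))
  have hVp : ∀ p, Q.a 1 * p = 0 → Q.a 0 * p ∈ V := fun p hp =>
    Submodule.mem_sup_right (Submodule.mem_sup_left ⟨p, hp, rfl⟩)
  have hVq : ∀ q, Q.a 0 * q = 0 → Q.a 1 * q ∈ V := fun q hq =>
    Submodule.mem_sup_right (Submodule.mem_sup_right ⟨q, hq, rfl⟩)
  have h : Q.e 0 * (x * Q.e 1) ∈ V := by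
    refine C.mul_mul_mem r (fun i => ?_) (fun k y => ?_) x
    · fin_cases i
      · simp [Q.orth 0 1 (by decide)]
      · simp [Q.idem, Q.orth 0 1 (by decide)]
    · fin_cases k <;> simp (disch := decide) [Q.e_mul_a_mul, Q.e_mul_a_mul_zero]
      · refine C.mul_mul_mem r (fun i => ?_) (fun k y => ?_) y
        · fin_cases i
          · simp [Q.orth 0 1 (by decide)]
          · simpa (disch := decide) [Q.idem, Q.a_mul_e] using hV0
        · fin_cases k <;> simp (disch := decide) [Q.a_mul_a_mul, mul_assoc_zero h03]
          exact hVp _ (mul_assoc_zero h12 _)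
      · refine C.mul_mul_mem r (fun i => ?_) (fun k y => ?_) y
        · fin_cases i
          · simp [Q.orth 0 1 (by decide)]
          · simpa (disch := decide) [Q.idem, Q.a_mul_e] using hV1
        · fin_cases k <;> simp (disch := decide) [Q.a_mul_a_mul, mul_assoc_zero h12]
          exact hVq _ (mul_assoc_zero h03 _)
  obtain ⟨v, hv, w, hw, hx⟩ := Submodule.mem_sup.1 h
  obtain ⟨_, ⟨p, hp, rfl⟩, _, ⟨q, hq, rfl⟩, rfl⟩ := Submodule.mem_sup.1 hw
  obtain ⟨a, b, rfl⟩ := Submodule.mem_span_pair.1 hv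
  exact ⟨a, b, p, q, hx.symm.trans (add_assoc _ _ _).symm, hp, hq⟩

/-- Two parallel arrows which do not factor through a common arrow. -/
theorem Cyclic.not_isTauTiltingFinite_of_kronecker (rx : Q.Rep (![1, 0, 0, 0] : Fin 4 → K))
    (ry : Q.Rep (![0, 1, 0, 0] : Fin 4 → K)) : ¬ IsTauTiltingFinite Λ := by
  let Tx : Q.Tri 1 0 _ := rx.tri (by decide) (by intro k; fin_cases k <;> simp [QH.s, QH.t])
  let Ty : Q.Tri 1 0 _ := ry.tri (by decide) (by intro k; fin_cases k <;> simp [QH.s, QH.t])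
  have φx := Tx.φ_eq_top r (by intro k; fin_cases k <;> simp [QH.s, QH.t])
  have ψx := Tx.ψ_eq_top r (by intro k; fin_cases k <;> simp [QH.s, QH.t])
  have φy := Ty.φ_eq_top r (by intro k; fin_cases k <;> simp [QH.s, QH.t])
  have ψy := Ty.ψ_eq_top r (by intro k; fin_cases k <;> simp [QH.s, QH.t])
  have hx0 : Tx.d (Q.a 0) = 1 := (Tx.d_a 0).trans rfl
  have hx1 : Tx.d (Q.a 1) = 0 := (Tx.d_a 1).trans rfl
  have hy0 : Ty.d (Q.a 0) = 0 := (Ty.d_a 0).trans rfl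
  have hy1 : Ty.d (Q.a 1) = 1 := (Ty.d_a 1).trans rfl
  refine Pointed.Kronecker.not_isTauTiltingFinite (D := (C.arrowed r).pointed) (i := 1) (j := 0)
    (x := MulOpposite.op (Q.a 0)) (y := MulOpposite.op (Q.a 1)) (by decide) ?_
  refine
    { x_left := congrArg MulOpposite.op (Q.a_mul_e rfl)
      x_right := congrArg MulOpposite.op (Q.e_mul_a rfl)
      y_left := congrArg MulOpposite.op (Q.a_mul_e rfl)
      y_right := congrArg MulOpposite.op (Q.e_mul_a rfl)
      span := fun w h1 h2 => ?_
      dx := ⟨Tx.opD, fun b => ?_, fun b => ?_, fun a => ?_, fun a => ?_⟩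
      dy := ⟨Ty.opD, fun b => ?_, fun b => ?_, fun a => ?_, fun a => ?_⟩ }
  · have h1' : w.unop * Q.e 1 = w.unop := congrArg MulOpposite.unop h1
    have h2' : Q.e 0 * w.unop = w.unop := congrArg MulOpposite.unop h2
    obtain ⟨a, b, p, q, h, hp, hq⟩ := C.span_kronecker r h03 h12 w.unop
    rw [h1', h2'] at h
    exact ⟨a, b, MulOpposite.op p, MulOpposite.op q, MulOpposite.unop_injective h,
      congrArg MulOpposite.op hp, congrArg MulOpposite.op hq⟩
  · change Tx.d (Q.a 0 * b.unop) = r.top b.unop 1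
    rw [Tx.d_mul, hx0, φx, r.top_a, ψx]; simp
  · change Tx.d (Q.a 1 * b.unop) = 0
    rw [Tx.d_mul, hx1, φx, r.top_a]; simp
  · change Tx.d (a.unop * Q.a 0) = r.top a.unop 0
    rw [Tx.d_mul, hx0, φx, ψx, r.top_a]; simp
  · change Tx.d (a.unop * Q.a 1) = 0
    rw [Tx.d_mul, hx1, ψx, r.top_a]; simp
  · change Ty.d (Q.a 0 * b.unop) = 0
    rw [Ty.d_mul, hy0, φy, r.top_a]; simp
  · change Ty.d (Q.a 1 * b.unop) = r.top b.unop 1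
    rw [Ty.d_mul, hy1, φy, r.top_a, ψy]; simp
  · change Ty.d (a.unop * Q.a 0) = 0
    rw [Ty.d_mul, hy0, ψy, r.top_a]; simp
  · change Ty.d (a.unop * Q.a 1) = r.top a.unop 0
    rw [Ty.d_mul, hy1, φy, ψy, r.top_a]; simp

end Kronecker

section Looped
variable {Q : Quiv K Λ QE.s QE.t} (C : Q.Cyclic) (r : Q.Rep (fun _ => (0 : K)))
  (h00 : Q.a 0 * Q.a 0 = 0) (h11 : Q.a 1 * Q.a 1 = 0) (h23 : Q.a 2 * Q.a 3 = 0)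
include C r h00 h11 h23

theorem Cyclic.span_looped (x : Λ) : ∃ (a b d : K) (p q : Λ),
    Q.e 0 * (x * Q.e 1) = a • Q.a 2 + b • (Q.a 0 * Q.a 2) + d • (Q.a 0 * (Q.a 2 * Q.a 1)) +
      Q.a 2 * Q.a 1 * p + Q.a 0 * (Q.a 2 * Q.a 1) * q ∧ Q.a 2 * q = 0 := by
  let V : Submodule K Λ :=
    Submodule.span K {Q.a 2, Q.a 0 * Q.a 2, Q.a 0 * (Q.a 2 * Q.a 1)} ⊔
    (LinearMap.range (LinearMap.mulLeft K (Q.a 2 * Q.a 1)) ⊔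
    (LinearMap.ker (LinearMap.mulLeft K (Q.a 2))).map
      (LinearMap.mulLeft K (Q.a 0 * (Q.a 2 * Q.a 1))))
  have hV0 : ∀ v ∈ ({Q.a 2, Q.a 0 * Q.a 2, Q.a 0 * (Q.a 2 * Q.a 1)} : Set Λ), v ∈ V := fun v hv =>
    Submodule.mem_sup_left (Submodule.subset_span hv)
  have hVp : ∀ p, Q.a 2 * Q.a 1 * p ∈ V := fun p =>
    Submodule.mem_sup_right (Submodule.mem_sup_left ⟨p, rfl⟩)
  have hVq : ∀ q, Q.a 2 * q = 0 → Q.a 0 * (Q.a 2 * Q.a 1) * q ∈ V := fun q hq =>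
    Submodule.mem_sup_right (Submodule.mem_sup_right ⟨q, hq, rfl⟩)
  have h : Q.e 0 * (x * Q.e 1) ∈ V := by
    refine C.mul_mul_mem r (fun i => ?_) (fun k y => ?_) x
    · fin_cases i
      · simp [Q.orth 0 1 (by decide)]
      · simp [Q.idem, Q.orth 0 1 (by decide)]
    · fin_cases k <;> simp (disch := decide) [Q.e_mul_a_mul, Q.e_mul_a_mul_zero]
      · refine C.mul_mul_mem r (fun i => ?_) (fun k y => ?_) y
        · fin_cases i
          · simp [Q.orth 0 1 (by decide)]
          · simp (disch := decide) [Q.idem, Q.a_mul_e_zero]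
        · fin_cases k <;> simp (disch := decide) [Q.a_mul_a_mul, mul_assoc_zero h00]
          rw [← mul_assoc]
          refine C.mul_mul_mem r (fun i => ?_) (fun k y => ?_) y
          · fin_cases i
            · simp [Q.orth 0 1 (by decide)]
            · simpa (disch := decide) [Q.idem, Q.a_mul_e, mul_assoc] using hV0 _ (by simp)
          · fin_cases k <;>
              simp (disch := decide) [Q.a_mul_a_mul, mul_assoc_zero h23, mul_assoc]
            have h : Q.a 0 * (Q.a 2 * Q.a 1) * (y * Q.e 1) ∈ V := by
              refine C.mul_mul_mem r (fun i => ?_) (fun k y => ?_) y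
              · fin_cases i
                · simp [Q.orth 0 1 (by decide)]
                · simpa (disch := decide) [Q.idem, Q.a_mul_e, mul_assoc] using hV0 _ (by simp)
              · fin_cases k
                · simp (disch := decide) [Q.a_mul_a_mul, mul_assoc]
                · simp (disch := decide) [mul_assoc_zero h11, mul_assoc]
                · simp (disch := decide) [Q.a_mul_a_mul, mul_assoc]
                · exact hVq _ (mul_assoc_zero h23 _)
            simpa only [mul_assoc] using h
      · refine C.mul_mul_mem r (fun i => ?_) (fun k y => ?_) y
        · fin_cases i
          · simp [Q.orth 0 1 (by decide)]
          · simpa (disch := decide) [Q.idem, Q.a_mul_e] using hV0 _ (by simp)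
        · fin_cases k <;> simp (disch := decide) [Q.a_mul_a_mul, mul_assoc_zero h23]
          rw [← mul_assoc]
          exact hVp _
  obtain ⟨v, hv, w, hw, hx⟩ := Submodule.mem_sup.1 h
  obtain ⟨_, ⟨p, rfl⟩, _, ⟨q, hq, rfl⟩, rfl⟩ := Submodule.mem_sup.1 hw
  obtain ⟨a, b, d, rfl⟩ := Submodule.mem_span_triple.1 hv
  exact ⟨a, b, d, p, q, hx.symm.trans (add_assoc _ _ _).symm, hq⟩

end Looped
end Quiv

namespace Quiv
variable {K Λ : Type} [Field K] [Ring Λ] [Algebra K Λ] {Q : Quiv K Λ QE.s QE.t}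

/-- The weights of two independent square-zero loops joined by an arrow. -/
def loopWeight (K : Type) [Field K] : Fin 4 → K[ε][ε] :=
  ![TrivSqZeroExt.inl DualNumber.eps, DualNumber.eps, 1, 0]

namespace Tri
variable (T : Q.Tri 1 0 (loopWeight K)) (r : Q.Rep (fun _ : Fin 4 => (0 : K)))

theorem loop_φ_a (k : Fin 4) : T.φ (Q.a k) =
    if k = 0 then TrivSqZeroExt.inl DualNumber.eps else 0 := by
  rw [T.φ_a]
  fin_cases k <;> simp [QE.s, QE.t, loopWeight]

theorem loop_ψ_a (k : Fin 4) : T.ψ (Q.a k) = if k = 1 then DualNumber.eps else 0 := by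
  rw [T.ψ_a]
  fin_cases k <;> simp [QE.s, QE.t, loopWeight]

theorem loop_d_a (k : Fin 4) : T.d (Q.a k) = if k = 2 then 1 else 0 := by
  rw [T.d_a]
  fin_cases k <;> simp [QE.s, QE.t, loopWeight]

theorem loop_φ_fst_fst (x : Λ) : (T.φ x).fst.fst = r.top x 0 := by
  have : (TrivSqZeroExt.fstHom K K K).comp ((TrivSqZeroExt.fstHom K K[ε] K[ε]).comp T.φ) =
      (Pi.evalAlgHom K (fun _ : Fin 2 => K) 0).comp r.top := by
    refine Q.hom_ext (fun k => ?_) fun k => ?_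
    · simp only [AlgHom.comp_apply, r.top_e, T.φ_e]
      fin_cases k <;> simp
    · simp only [AlgHom.comp_apply, r.top_a, T.loop_φ_a]
      fin_cases k <;> simp
  exact DFunLike.congr_fun this x

theorem loop_ψ_fst_fst (x : Λ) : (T.ψ x).fst.fst = r.top x 1 := by
  have : (TrivSqZeroExt.fstHom K K K).comp ((TrivSqZeroExt.fstHom K K[ε] K[ε]).comp T.ψ) =
      (Pi.evalAlgHom K (fun _ : Fin 2 => K) 1).comp r.top := by
    refine Q.hom_ext (fun k => ?_) fun k => ?_
    · simp only [AlgHom.comp_apply, r.top_e, T.ψ_e]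
      fin_cases k <;> simp
    · simp only [AlgHom.comp_apply, r.top_a, T.loop_ψ_a]
      fin_cases k <;> simp
  exact DFunLike.congr_fun this x

theorem loop_φ_snd (x : Λ) : (T.φ x).snd = 0 := by
  have : T.φ = (TrivSqZeroExt.inlAlgHom K K[ε] K[ε]).comp
      ((TrivSqZeroExt.fstHom K K[ε] K[ε]).comp T.φ) := by
    refine Q.hom_ext (fun k => ?_) fun k => ?_
    · simp only [AlgHom.comp_apply, T.φ_e]
      fin_cases k <;> simp
    · simp only [AlgHom.comp_apply, T.loop_φ_a]
      fin_cases k <;> simp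
  rw [this]
  exact TrivSqZeroExt.snd_inl _ _

/-- The elements involving only the outer infinitesimal. -/
def outer (K : Type) [Field K] : Subalgebra K K[ε][ε] where
  carrier := {x | x.fst.snd = 0 ∧ x.snd.snd = 0}
  mul_mem' := fun {x y} hx hy => by
    constructor
    · rw [TrivSqZeroExt.fst_mul, DualNumber.snd_mul, hx.1, hy.1]; simp
    · rw [DualNumber.snd_mul, TrivSqZeroExt.snd_add, DualNumber.snd_mul, DualNumber.snd_mul,
        hx.1, hy.1, hx.2, hy.2]
      simp
  add_mem' := fun {x y} hx hy => by
    constructor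
    · rw [TrivSqZeroExt.fst_add, TrivSqZeroExt.snd_add, hx.1, hy.1, add_zero]
    · rw [TrivSqZeroExt.snd_add, TrivSqZeroExt.snd_add, hx.2, hy.2, add_zero]
  algebraMap_mem' _ := ⟨rfl, rfl⟩

theorem loop_ψ_mem (x : Λ) : T.ψ x ∈ outer K := by
  have h : (outer K).comap T.ψ = ⊤ := by
    rw [← top_le_iff, ← Q.gen]
    refine Algebra.adjoin_le ?_
    rintro _ (⟨k, rfl⟩ | ⟨k, rfl⟩)
    · change T.ψ (Q.e k) ∈ outer K
      rw [T.ψ_e]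
      split_ifs
      exacts [one_mem _, zero_mem _]
    · change T.ψ (Q.a k) ∈ outer K
      rw [T.loop_ψ_a]
      split_ifs
      exacts [⟨rfl, rfl⟩, zero_mem _]
  exact h.ge (Algebra.mem_top (x := x))

theorem loop_d_a0_mul (x : Λ) :
    T.d (Q.a 0 * x) = TrivSqZeroExt.inl DualNumber.eps * T.d x := by
  rw [T.d_mul, T.loop_φ_a, T.loop_d_a]; simp

theorem loop_d_a2_mul (x : Λ) : T.d (Q.a 2 * x) = T.ψ x := by
  rw [T.d_mul, T.loop_φ_a, T.loop_d_a]; simp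

/-- The coefficients of the derivation, as functionals on the opposite algebra. -/
def loopD (f : K[ε][ε] →ₗ[K] K) : Λᵐᵒᵖ →ₗ[K] K :=
  (f.comp T.d).comp (MulOpposite.opLinearEquiv K).symm.toLinearMap

end Tri

/-- An arrow between two vertices with square-zero loops. -/
theorem Cyclic.not_isTauTiltingFinite_of_looped (C : Q.Cyclic) (r : Q.Rep (fun _ => (0 : K)))
    (h00 : Q.a 0 * Q.a 0 = 0) (h11 : Q.a 1 * Q.a 1 = 0) (h23 : Q.a 2 * Q.a 3 = 0)
    (rl : Q.Rep (loopWeight K)) : ¬ IsTauTiltingFinite Λ := by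
  let T : Q.Tri 1 0 _ := rl.tri (by decide) (by
    intro k; fin_cases k <;> simp [QE.s, QE.t, loopWeight])
  have hφ := T.loop_φ_fst_fst r
  have hψ := T.loop_ψ_fst_fst r
  have hl : ∀ b, T.d (Q.a 2 * b) = T.ψ b := T.loop_d_a2_mul
  have hl0 : ∀ b, T.d (Q.a 0 * Q.a 2 * b) = TrivSqZeroExt.inl DualNumber.eps * T.ψ b := fun b => by
    rw [mul_assoc, T.loop_d_a0_mul, hl]
  have hl1 : ∀ b, T.d (Q.a 0 * (Q.a 2 * Q.a 1) * b) =
      TrivSqZeroExt.inl DualNumber.eps * (DualNumber.eps * T.ψ b) := fun b => by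
    rw [mul_assoc, mul_assoc, T.loop_d_a0_mul, hl, map_mul, T.loop_ψ_a]; rfl
  have hr : ∀ a, T.d (a * Q.a 2) = T.φ a := fun a => by
    rw [T.d_mul, T.loop_ψ_a, T.loop_d_a]; simp
  have hr0 : ∀ a, T.d (a * (Q.a 0 * Q.a 2)) =
      T.φ a * TrivSqZeroExt.inl DualNumber.eps := fun a => by
    rw [← mul_assoc, hr, map_mul, T.loop_φ_a]; rfl
  have hr1 : ∀ a, T.d (a * (Q.a 0 * (Q.a 2 * Q.a 1))) =
      T.φ a * TrivSqZeroExt.inl DualNumber.eps * DualNumber.eps := fun a => by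
    rw [← mul_assoc, ← mul_assoc, T.d_mul, T.loop_d_a, T.loop_ψ_a, hr]
    simp [T.loop_φ_a]
  have hs := T.loop_φ_snd
  have hm1 := fun b => (T.loop_ψ_mem b).1
  have hm2 := fun b => (T.loop_ψ_mem b).2
  refine Pointed.Looped.not_isTauTiltingFinite (D := (C.arrowed r).pointed) (i := 1) (j := 0)
    (α := MulOpposite.op (Q.a 0)) (β := MulOpposite.op (Q.a 1)) (μ := MulOpposite.op (Q.a 2))
    (by decide) ?_
  let f00 : K[ε][ε] →ₗ[K] K := (TrivSqZeroExt.fstHom K K K).toLinearMap.comp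
    (TrivSqZeroExt.fstHom K K[ε] K[ε]).toLinearMap
  let f01 : K[ε][ε] →ₗ[K] K := (TrivSqZeroExt.sndHom K K).comp
    (TrivSqZeroExt.fstHom K K[ε] K[ε]).toLinearMap
  let f11 : K[ε][ε] →ₗ[K] K := (TrivSqZeroExt.sndHom K K).comp
    ((TrivSqZeroExt.sndHom K[ε] K[ε]).restrictScalars K)
  refine
    { α_sq := congrArg MulOpposite.op h00
      α_right := congrArg MulOpposite.op (Q.e_mul_a rfl)
      β_left := congrArg MulOpposite.op (Q.a_mul_e rfl)
      β_sq := congrArg MulOpposite.op h11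
      μ_left := congrArg MulOpposite.op (Q.a_mul_e rfl)
      μ_right := congrArg MulOpposite.op (Q.e_mul_a rfl)
      span := fun w h1 h2 => ?_
      d_one := ⟨T.loopD f00, fun a => ?_, fun a => ?_, fun a => ?_, fun b => ?_, fun b => ?_,
        fun b => ?_⟩
      d_left := ⟨T.loopD f01, fun a => ?_, fun a => ?_, fun b => ?_, fun b => ?_, fun b => ?_⟩
      d_both := ⟨T.loopD f11, fun a => ?_, fun a => ?_, fun a => ?_, fun b => ?_, fun b => ?_⟩ }
  · have h1' : w.unop * Q.e 1 = w.unop := congrArg MulOpposite.unop h1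
    have h2' : Q.e 0 * w.unop = w.unop := congrArg MulOpposite.unop h2
    obtain ⟨a, b, d, p, q, h, hq⟩ := C.span_looped r h00 h11 h23 w.unop
    rw [h1', h2'] at h
    exact ⟨a, b, d, MulOpposite.op p, MulOpposite.op q, MulOpposite.unop_injective h,
      congrArg MulOpposite.op hq⟩
  · change (T.d (a.unop * Q.a 2)).fst.fst = r.top a.unop 0
    rw [hr, hφ]
  · change (T.d (a.unop * (Q.a 0 * Q.a 2))).fst.fst = 0
    rw [hr0]; simp
  · change (T.d (a.unop * (Q.a 0 * (Q.a 2 * Q.a 1)))).fst.fst = 0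
    rw [hr1]; simp
  · change (T.d (Q.a 2 * b.unop)).fst.fst = r.top b.unop 1
    rw [hl, hψ]
  · change (T.d (Q.a 0 * Q.a 2 * b.unop)).fst.fst = 0
    rw [hl0]; simp
  · change (T.d (Q.a 0 * (Q.a 2 * Q.a 1) * b.unop)).fst.fst = 0
    rw [hl1]; simp
  · change (T.d (a.unop * (Q.a 0 * Q.a 2))).fst.snd = r.top a.unop 0
    rw [hr0, ← hφ]; simp
  · change (T.d (a.unop * (Q.a 0 * (Q.a 2 * Q.a 1)))).fst.snd = 0
    rw [hr1]; simp
  · change (T.d (Q.a 2 * b.unop)).fst.snd = 0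
    rw [hl, hm1]
  · change (T.d (Q.a 0 * Q.a 2 * b.unop)).fst.snd = r.top b.unop 1
    rw [hl0, ← hψ]; simp
  · change (T.d (Q.a 0 * (Q.a 2 * Q.a 1) * b.unop)).fst.snd = 0
    rw [hl1]; simp
  · change (T.d (a.unop * Q.a 2)).snd.snd = 0
    rw [hr, hs]; rfl
  · change (T.d (a.unop * (Q.a 0 * Q.a 2))).snd.snd = 0
    rw [hr0]; simp [hs]
  · change (T.d (a.unop * (Q.a 0 * (Q.a 2 * Q.a 1)))).snd.snd = r.top a.unop 0
    rw [hr1, ← hφ]; simp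
  · change (T.d (Q.a 2 * b.unop)).snd.snd = 0
    rw [hl, hm2]
  · change (T.d (Q.a 0 * (Q.a 2 * Q.a 1) * b.unop)).snd.snd = r.top b.unop 1
    rw [hl1, ← hψ]; simp

end Quiv

theorem pow_eq_zero_of_pow_eq {R : Type} [Ring R] {x y : R} {m n : ℕ} (hm : m ≠ 0) (hn : n ≠ 0)
    (h : x ^ m = y ^ n) (hxy : x * y = 0) (hyx : y * x = 0) :
    x ^ (m + n + 1) = 0 ∧ y ^ (m + n + 1) = 0 := by
  constructor
  · rw [add_assoc, pow_add, h, add_comm n, pow_add, pow_one, ← mul_assoc,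
      pow_mul_eq_zero hn hyx, zero_mul]
  · rw [add_comm m, add_assoc, pow_add, ← h, add_comm m, pow_add, pow_one, ← mul_assoc,
      pow_mul_eq_zero hm hxy, zero_mul]

section Algebras
variable (K : Type) [Field K]

theorem not_isTauTiltingFinite_bisB2 (m n : ℕ) (hm : 1 ≤ m) (hn : 1 ≤ n) :
    ¬ IsTauTiltingFinite (BisB2 K m n) := by
  let Q : Quiv K (BisB2 K m n) QH.s QH.t := boundQuiv K QH.s QH.t _
  have h1 : (boundMk (QH.mu1 K * QH.nu2 K) : BisB2 K m n) = boundMk 0 := boundMk_rel (by simp)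
  have h2 : (boundMk (QH.nu2 K * QH.mu1 K) : BisB2 K m n) = boundMk 0 := boundMk_rel (by simp)
  have h3 : (boundMk (QH.mu2 K * QH.nu1 K) : BisB2 K m n) = boundMk 0 := boundMk_rel (by simp)
  have h4 : (boundMk (QH.nu1 K * QH.mu2 K) : BisB2 K m n) = boundMk 0 := boundMk_rel (by simp)
  have h5 : (boundMk ((QH.mu1 K * QH.nu1 K) ^ m) : BisB2 K m n) =
      boundMk ((QH.mu2 K * QH.nu2 K) ^ n) := boundMk_rel (by simp)
  have h6 : (boundMk ((QH.nu1 K * QH.mu1 K) ^ m) : BisB2 K m n) =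
      boundMk ((QH.nu2 K * QH.mu2 K) ^ n) := boundMk_rel (by simp)
  simp only [map_mul, map_pow, map_zero] at h1 h2 h3 h4 h5 h6
  have hm' : m ≠ 0 := by omega
  have hn' : n ≠ 0 := by omega
  have h03 : Q.a 0 * Q.a 3 = 0 := h1
  have h30 : Q.a 3 * Q.a 0 = 0 := h2
  have h12 : Q.a 1 * Q.a 2 = 0 := h3
  have h21 : Q.a 2 * Q.a 1 = 0 := h4
  have hp : (Q.a 0 * Q.a 2) ^ m = (Q.a 1 * Q.a 3) ^ n := h5
  have hq : (Q.a 2 * Q.a 0) ^ m = (Q.a 3 * Q.a 1) ^ n := h6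
  have h0 := pow_eq_zero_of_pow_eq hm' hn' hp
    (by simp only [mul_assoc, Quiv.mul_assoc_zero h21, mul_zero])
    (by simp only [mul_assoc, Quiv.mul_assoc_zero h30, mul_zero])
  have h1 := pow_eq_zero_of_pow_eq hm' hn' hq
    (by simp only [mul_assoc, Quiv.mul_assoc_zero h03, mul_zero])
    (by simp only [mul_assoc, Quiv.mul_assoc_zero h12, mul_zero])
  let C : Q.Cyclic :=
    { next := ![2, 3, 0, 1]
      p := 2
      pos := by decide
      per := by decide
      comp := by decide
      zero := fun k l h => by
        revert h
        fin_cases k <;> fin_cases l <;>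
          simp (disch := decide) [Q.a_mul_a, h03, h30, h12, h21]
      N := m + n + 1
      nil := fun k => by
        fin_cases k <;> simp [Quiv.word, h0, h1] }
  refine C.not_isTauTiltingFinite_of_kronecker (boundRep (fun _ => 0) ?_) h03 h12
    (boundRep ![1, 0, 0, 0] ?_) (boundRep ![0, 1, 0, 0] ?_) <;>
  simp [QH.mu1, QH.mu2, QH.nu1, QH.nu2, hm', hn']

theorem not_isTauTiltingFinite_bisB3 (n : ℕ) (hn : 1 ≤ n) :
    ¬ IsTauTiltingFinite (BisB3 K n) := by
  let Q : Quiv K (BisB3 K n) QH.s QH.t := boundQuiv K QH.s QH.t _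
  have h1 : (boundMk (QH.mu1 K * QH.nu2 K) : BisB3 K n) = boundMk 0 := boundMk_rel (by simp)
  have h2 : (boundMk (QH.nu1 K * QH.mu1 K) : BisB3 K n) = boundMk 0 := boundMk_rel (by simp)
  have h3 : (boundMk (QH.mu2 K * QH.nu1 K) : BisB3 K n) = boundMk 0 := boundMk_rel (by simp)
  have h4 : (boundMk (QH.nu2 K * QH.mu2 K) : BisB3 K n) = boundMk 0 := boundMk_rel (by simp)
  have h5 : (boundMk ((QH.mu1 K * QH.nu1 K * QH.mu2 K * QH.nu2 K) ^ n) : BisB3 K n) =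
      boundMk ((QH.mu2 K * QH.nu2 K * QH.mu1 K * QH.nu1 K) ^ n) := boundMk_rel (by simp)
  have h6 : (boundMk ((QH.nu1 K * QH.mu2 K * QH.nu2 K * QH.mu1 K) ^ n) : BisB3 K n) =
      boundMk ((QH.nu2 K * QH.mu1 K * QH.nu1 K * QH.mu2 K) ^ n) := boundMk_rel (by simp)
  simp only [map_mul, map_pow, map_zero, mul_assoc] at h1 h2 h3 h4 h5 h6
  have hn' : n ≠ 0 := by omega
  have h03 : Q.a 0 * Q.a 3 = 0 := h1
  have h20 : Q.a 2 * Q.a 0 = 0 := h2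
  have h12 : Q.a 1 * Q.a 2 = 0 := h3
  have h31 : Q.a 3 * Q.a 1 = 0 := h4
  have hp : (Q.a 0 * (Q.a 2 * (Q.a 1 * Q.a 3))) ^ n =
    (Q.a 1 * (Q.a 3 * (Q.a 0 * Q.a 2))) ^ n := h5
  have hq : (Q.a 2 * (Q.a 1 * (Q.a 3 * Q.a 0))) ^ n =
    (Q.a 3 * (Q.a 0 * (Q.a 2 * Q.a 1))) ^ n := h6
  have h0 := pow_eq_zero_of_pow_eq hn' hn' hp
    (by simp only [mul_assoc, Quiv.mul_assoc_zero h31, mul_zero])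
    (by simp only [mul_assoc, Quiv.mul_assoc_zero h20, mul_zero])
  have h1 := pow_eq_zero_of_pow_eq hn' hn' hq
    (by simp only [mul_assoc, Quiv.mul_assoc_zero h03, mul_zero])
    (by simp only [mul_assoc, Quiv.mul_assoc_zero h12, mul_zero])
  let C : Q.Cyclic :=
    { next := ![2, 3, 1, 0]
      p := 4
      pos := by decide
      per := by decide
      comp := by decide
      zero := fun k l h => by
        revert h
        fin_cases k <;> fin_cases l <;>
          simp (disch := decide) [Q.a_mul_a, h03, h20, h12, h31]
      N := n + n + 1
      nil := fun k => by fin_cases k <;> simp [Quiv.word, h0, h1] }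
  refine C.not_isTauTiltingFinite_of_kronecker (boundRep (fun _ => 0) ?_) h03 h12
    (boundRep ![1, 0, 0, 0] ?_) (boundRep ![0, 1, 0, 0] ?_) <;>
  simp [QH.mu1, QH.mu2, QH.nu1, QH.nu2, hn']

theorem not_isTauTiltingFinite_bisB8 (n : ℕ) (hn : 1 ≤ n) :
    ¬ IsTauTiltingFinite (BisB8 K n) := by
  let Q : Quiv K (BisB8 K n) QE.s QE.t := boundQuiv K QE.s QE.t _
  have h1 : (boundMk (QE.al K ^ 2) : BisB8 K n) = boundMk 0 := boundMk_rel (by simp)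
  have h2 : (boundMk (QE.be K ^ 2) : BisB8 K n) = boundMk 0 := boundMk_rel (by simp)
  have h3 : (boundMk (QE.mu K * QE.nu K) : BisB8 K n) = boundMk 0 := boundMk_rel (by simp)
  have h4 : (boundMk (QE.nu K * QE.mu K) : BisB8 K n) = boundMk 0 := boundMk_rel (by simp)
  have h5 : (boundMk ((QE.nu K * QE.al K * QE.mu K * QE.be K) ^ n) : BisB8 K n) =
      boundMk ((QE.be K * QE.nu K * QE.al K * QE.mu K) ^ n) := boundMk_rel (by simp)
  have h6 : (boundMk ((QE.al K * QE.mu K * QE.be K * QE.nu K) ^ n) : BisB8 K n) =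
      boundMk ((QE.mu K * QE.be K * QE.nu K * QE.al K) ^ n) := boundMk_rel (by simp)
  simp only [map_mul, map_pow, map_zero, mul_assoc] at h1 h2 h3 h4 h5 h6
  have hn' : n ≠ 0 := by omega
  have h00 : Q.a 0 * Q.a 0 = 0 := (sq _).symm.trans h1
  have h11 : Q.a 1 * Q.a 1 = 0 := (sq _).symm.trans h2
  have h23 : Q.a 2 * Q.a 3 = 0 := h3
  have h32 : Q.a 3 * Q.a 2 = 0 := h4
  have hp : (Q.a 3 * (Q.a 0 * (Q.a 2 * Q.a 1))) ^ n =
    (Q.a 1 * (Q.a 3 * (Q.a 0 * Q.a 2))) ^ n := h5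
  have hq : (Q.a 0 * (Q.a 2 * (Q.a 1 * Q.a 3))) ^ n =
    (Q.a 2 * (Q.a 1 * (Q.a 3 * Q.a 0))) ^ n := h6
  have h0 := pow_eq_zero_of_pow_eq hn' hn' hp
    (by simp only [mul_assoc, Quiv.mul_assoc_zero h11, mul_zero])
    (by simp only [mul_assoc, Quiv.mul_assoc_zero h23, mul_zero])
  have h1 := pow_eq_zero_of_pow_eq hn' hn' hq
    (by simp only [mul_assoc, Quiv.mul_assoc_zero h32, mul_zero])
    (by simp only [mul_assoc, Quiv.mul_assoc_zero h00, mul_zero])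
  let C : Q.Cyclic :=
    { next := ![2, 3, 1, 0]
      p := 4
      pos := by decide
      per := by decide
      comp := by decide
      zero := fun k l h => by
        revert h
        fin_cases k <;> fin_cases l <;>
          simp (disch := decide) [Q.a_mul_a, h00, h11, h23, h32]
      N := n + n + 1
      nil := fun k => by fin_cases k <;> simp [Quiv.word, h0, h1] }
  refine C.not_isTauTiltingFinite_of_looped (boundRep (fun _ => 0) ?_) h00 h11 h23
    (boundRep _ ?_)
  · simp [QE.al, QE.be, QE.mu, QE.nu, hn']
  · simp [QE.al, QE.be, QE.mu, QE.nu, hn', Quiv.loopWeight, QE.s, QE.t, sq]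
    rw [← TrivSqZeroExt.inl_mul, DualNumber.eps_mul_eps, TrivSqZeroExt.inl_zero, Matrix.single_zero]

end Algebras
end TwoPoint

namespace TwoPoint

/-- Theorem 5.2.  Among the two-point symmetric special biserial
algebras `B₁, …, B₈`: `B₁, B₄, B₅, B₆, B₇` are τ-tilting finite (for all admissible
parameters) with the indicated data, while `B₂, B₃, B₈` are τ-tilting infinite. -/
theorem biserial_tau_tilting (K : Type) [Field K] [IsAlgClosed K] :
    (∀ n : ℕ, 1 ≤ n → TauTiltingData (BisB1 K n) 6 2 2) ∧
    (∀ m n : ℕ, 2 ≤ m → 1 ≤ n → TauTiltingData (BisB4 K m n) 6 2 2) ∧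
    (∀ n : ℕ, 1 ≤ n → TauTiltingData (BisB5 K n) 8 3 3) ∧
    (∀ m r n : ℕ, 2 ≤ m → 2 ≤ r → 1 ≤ n → TauTiltingData (BisB6 K m r n) 6 2 2) ∧
    (∀ m n : ℕ, 2 ≤ m → 1 ≤ n → TauTiltingData (BisB7 K m n) 8 3 3) ∧
    (∀ m n : ℕ, 1 ≤ m → 1 ≤ n → ¬ IsTauTiltingFinite (BisB2 K m n)) ∧
    (∀ n : ℕ, 1 ≤ n → ¬ IsTauTiltingFinite (BisB3 K n)) ∧
    (∀ n : ℕ, 1 ≤ n → ¬ IsTauTiltingFinite (BisB8 K n)) := by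
  exact ⟨fun n hn => tauTiltingData_bisB1 K n hn, fun m n hm hn => tauTiltingData_bisB4 K m n hm hn,
    fun n hn => tauTiltingData_bisB5 K n hn,
    fun m r n hm hr hn => tauTiltingData_bisB6 K m r n hm hr hn,
    fun m n hm hn => tauTiltingData_bisB7 K m n hm hn,
    fun m n hm hn => not_isTauTiltingFinite_bisB2 K m n hm hn,
    fun n hn => not_isTauTiltingFinite_bisB3 K n hn,
    fun n hn => not_isTauTiltingFinite_bisB8 K n hn⟩

end TwoPoint
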